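/- Let a = (a_j)_{j≥0} and b = (b_j)_{j≥0} be strictly decreasing real sequences satisfying (Hyp 1), and assume in addition that the sequence (a_j) is Littlewood–Paley. Then for every triple of exponents with 1 < p₁, p₂ < ∞, 2 ≤ p₃ < ∞ and 1/p₁ + 1/p₂ + 1/p₃ = 1, there exists a finite constant C = C(p₁,p₂,a,b) such that ‖B_{m_{a,b}}(f,g)‖_{L^{p₃'}(ℝ)} ≤ C ‖f‖_{L^{p₁}(ℝ)} ‖g‖_{L^{p₂}(ℝ)} for all Schwartz functions f, g on ℝ. -/

import Mathlib

open MeasureTheory Set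
open scoped ENNReal NNReal

noncomputable section

/-- The character `e^{2π i t x}`. -/
def eChar (t x : ℝ) : ℂ := Complex.exp (2 * Real.pi * Complex.I * t * x)

/-- The Fourier transform `f̂(ξ) = ∫ f(x) e^{-2π i ξ x} dx`. -/
def fourierT (f : ℝ → ℂ) (ξ : ℝ) : ℂ := ∫ x : ℝ, f x * eChar (-ξ) x

/-- The bilinear multiplier operator `B_m` with symbol `m`. -/
def Bm (m : ℝ → ℝ → ℂ) (f g : ℝ → ℂ) (x : ℝ) : ℂ :=
  ∫ ξ : ℝ, ∫ η : ℝ, m ξ η * fourierT f ξ * fourierT g η * eChar (ξ + η) x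

/-- Complex-valued indicator function of a set of reals. -/
def indC (s : Set ℝ) (x : ℝ) : ℂ := s.indicator 1 x

/-- The set `-A - B = {-x-y : x ∈ A, y ∈ B}`. -/
def mink2 (A B : Set ℝ) : Set ℝ := Set.image2 (fun x y => -x - y) A B

/-- The paraproduct symbol `m_{a,b}(ξ,η) = Σ_{j≥1} 1_{[a_{j+1},a_j)}(ξ) 1_{[b_j,b_0)}(η)`. -/
def mab (a b : ℕ → ℝ) (ξ η : ℝ) : ℂ :=
  ∑' j : ℕ, indC (Ico (a (j + 2)) (a (j + 1))) ξ * indC (Ico (b (j + 1)) (b 0)) η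

/-- The interval `-[a_{j+1},a_j) - [b_j, b_0)` from the collection `I_{a,b}`. -/
def Iab (a b : ℕ → ℝ) (j : ℕ) : Set ℝ := mink2 (Ico (a (j + 1)) (a j)) (Ico (b j) (b 0))

/-- The interval `-[a_{j+1},a_j) - (b_∞, b_j)` from the collection `J_{a,b}`. -/
def Jab (a b : ℕ → ℝ) (binf : ℝ) (j : ℕ) : Set ℝ :=
  mink2 (Ico (a (j + 1)) (a j)) (Ioo binf (b j))

/-- The symbol `m̃_{u,v}(ξ,η) = Σ_{j≥1} 1_{(u_0,u_j]}(ξ) 1_{[v_j,v_{j+1})}(η)`. -/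
def muv (u v : ℕ → ℝ) (ξ η : ℝ) : ℂ :=
  ∑' j : ℕ, indC (Ioc (u 0) (u (j + 1))) ξ * indC (Ico (v (j + 1)) (v (j + 2))) η

/-- The interval `-(u_0,u_j] - [v_j, v_{j+1})`. -/
def Iuv (u v : ℕ → ℝ) (j : ℕ) : Set ℝ :=
  mink2 (Ioc (u 0) (u j)) (Ico (v j) (v (j + 1)))

/-- The frequency projection `(1_S f̂)^∨`. -/
def fproj (S : Set ℝ) (f : ℝ → ℂ) (x : ℝ) : ℂ := ∫ ξ in S, fourierT f ξ * eChar ξ x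

/-- The `L^p(ℓ²)` norm of the family of frequency projections onto the sets `T i`. -/
def sqNormLp {ι : Type*} (T : ι → Set ℝ) (f : ℝ → ℂ) (p : ℝ) : ℝ≥0∞ :=
  (∫⁻ x : ℝ, (∑' i, ((‖fproj (T i) f x‖₊ : ℝ≥0∞)) ^ 2) ^ (p / 2)) ^ (1 / p)

/-- The collection of connected components of a set `U ⊆ ℝ`. -/
def componentsOf (U : Set ℝ) : Set (Set ℝ) := {S | ∃ x ∈ U, S = connectedComponentIn U x}

/-- A closed Lebesgue-null set `E ⊆ ℝ` is Littlewood–Paley if for every `1 < p < ∞` the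
square function associated with the connected components of `ℝ \ E` is comparable with the
`L^p` norm (stated on the dense class of Schwartz functions). -/
def IsLPSet (E : Set ℝ) : Prop :=
  IsClosed E ∧ volume E = 0 ∧
    ∀ p : ℝ, 1 < p → ∃ c : ℝ, 0 < c ∧ ∃ C : ℝ, 0 < C ∧
      ∀ f : SchwartzMap ℝ ℂ,
        ENNReal.ofReal c * eLpNorm (⇑f) (ENNReal.ofReal p) volume ≤
            sqNormLp (fun ω : componentsOf Eᶜ => (ω : Set ℝ)) (⇑f) p ∧
          sqNormLp (fun ω : componentsOf Eᶜ => (ω : Set ℝ)) (⇑f) p ≤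
            ENNReal.ofReal C * eLpNorm (⇑f) (ENNReal.ofReal p) volume

/-- A strictly monotone real sequence is Littlewood–Paley if the closure of its range is a
Littlewood–Paley set. -/
def IsLPSeq (a : ℕ → ℝ) : Prop := IsLPSet (closure (Set.range a))

/-- A family of (pairwise disjoint) intervals is Littlewood–Paley if for every `1 < p < ∞`
the associated square function is bounded by the `L^p` norm. -/
def IsLPFamily {ι : Type*} (T : ι → Set ℝ) : Prop :=
  ∀ p : ℝ, 1 < p → ∃ C : ℝ, 0 < C ∧ ∀ f : SchwartzMap ℝ ℂ,
    sqNormLp T (⇑f) p ≤ ENNReal.ofReal C * eLpNorm (⇑f) (ENNReal.ofReal p) volume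

/-- Slope of the `j`-th segment of the piecewise linear curve with vertices `(a_j, b_j)`. -/
def pslope (a b : ℕ → ℝ) (j : ℕ) : ℝ := (b j - b (j + 1)) / (a j - a (j + 1))

/-- The epigraph of the piecewise linear curve with vertices `(a_j, b_j)`. -/
def polyEpi (a b : ℕ → ℝ) : Set (ℝ × ℝ) :=
  ⋃ j : ℕ, {p : ℝ × ℝ | a (j + 1) ≤ p.1 ∧ p.1 ≤ a j ∧
    b (j + 1) + pslope a b j * (p.1 - a (j + 1)) ≤ p.2}

end

/-- Complex-valued indicator function of a set in the plane, as a bilinear symbol. -/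
noncomputable def indC2 (S : Set (ℝ × ℝ)) (ξ η : ℝ) : ℂ := S.indicator 1 (ξ, η)

/-- Index of the dyadic interval of length `2 ^ (-k)` containing `x`. -/
noncomputable def ix (k : ℤ) (x : ℝ) : ℤ := ⌊x * (2 : ℝ) ^ k⌋

lemma ix_eq_iff {k : ℤ} {x : ℝ} {m : ℤ} :
    ix k x = m ↔ (m : ℝ) * (2 : ℝ) ^ (-k) ≤ x ∧ x < (m + 1) * (2 : ℝ) ^ (-k) := by
  have h : (0 : ℝ) < 2 ^ k := by positivity
  rw [ix, Int.floor_eq_iff, zpow_neg, ← div_eq_mul_inv, ← div_eq_mul_inv, div_le_iff₀ h,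
    lt_div_iff₀ h]

lemma ix_le (k : ℤ) (x : ℝ) : (ix k x : ℝ) * (2 : ℝ) ^ (-k) ≤ x := (ix_eq_iff.1 rfl).1

lemma lt_ix (k : ℤ) (x : ℝ) : x < (ix k x + 1) * (2 : ℝ) ^ (-k) := (ix_eq_iff.1 rfl).2

lemma measurable_ix (k : ℤ) : Measurable (ix k) :=
  Int.measurable_floor.comp (measurable_id.mul_const _)

lemma ix_mono (k : ℤ) {x y : ℝ} (h : x ≤ y) : ix k x ≤ ix k y :=
  Int.floor_le_floor (mul_le_mul_of_nonneg_right h (by positivity))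

lemma ix_coarse (k : ℤ) (d : ℕ) (x : ℝ) : ix (k - d) x = ix k x / 2 ^ d := by
  have h2 : (2 : ℝ) ^ (k - d : ℤ) = 2 ^ k / ((2 ^ d : ℕ) : ℝ) := by
    rw [zpow_sub₀ (by norm_num)]; simp
  rw [ix, ix, h2, ← mul_div_assoc, Int.floor_div_natCast]
  push_cast; rfl

lemma ix_coarse' {k k' : ℤ} (h : k' ≤ k) (x : ℝ) : ix k' x = ix k x / 2 ^ (k - k').toNat := by
  rw [← ix_coarse]
  congr 1
  omega

lemma ix_congr {k k' : ℤ} (h : k' ≤ k) {x y : ℝ} (hxy : ix k x = ix k y) :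
    ix k' x = ix k' y := by
  rw [ix_coarse' h, ix_coarse' h, hxy]

lemma int_div_sub_le {a b c : ℤ} (hc : 0 < c) (h : b ≤ a) : a / c - b / c ≤ a - b := by
  have h1 : a / c ≤ b / c + (a - b) := by
    have : a = b + (a - b) := by ring
    calc a / c ≤ (b + (a - b) * c) / c := by
          apply Int.ediv_le_ediv hc
          nlinarith
      _ = b / c + (a - b) := Int.add_mul_ediv_right _ _ (by omega)
  omega

lemma ix_sub_le {k k' : ℤ} (h : k' ≤ k) {x y : ℝ} (hxy : ix k x ≤ ix k y) :
    0 ≤ ix k' y - ix k' x ∧ ix k' y - ix k' x ≤ ix k y - ix k x := by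
  rw [ix_coarse' h, ix_coarse' h]
  have h2 : (0 : ℤ) < 2 ^ (k - k').toNat := by positivity
  exact ⟨by have := Int.ediv_le_ediv h2 hxy; omega, int_div_sub_le h2 hxy⟩

lemma ix_abs_sub_le {k k' : ℤ} (h : k' ≤ k) (x y : ℝ) :
    |ix k' y - ix k' x| ≤ |ix k y - ix k x| := by
  rcases le_total (ix k x) (ix k y) with hxy | hxy
  · have := ix_sub_le h hxy
    rw [abs_of_nonneg this.1, abs_of_nonneg (by omega)]; exact this.2
  · have := ix_sub_le h hxy
    rw [abs_sub_comm, abs_sub_comm (ix k y), abs_of_nonneg this.1, abs_of_nonneg (by omega)]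
    exact this.2

lemma abs_sub_lt_of_ix {k : ℤ} {x y : ℝ} : |x - y| < (|ix k x - ix k y| + 1 : ℤ) * (2 : ℝ) ^ (-k) := by
  have h1 := ix_le k x
  have h2 := lt_ix k x
  have h3 := ix_le k y
  have h4 := lt_ix k y
  have hp : (0 : ℝ) < 2 ^ (-k) := by positivity
  push_cast
  have h5 := le_abs_self ((ix k x : ℝ) - ix k y)
  have h6 := neg_abs_le ((ix k x : ℝ) - ix k y)
  rw [abs_lt]
  constructor <;> nlinarith

lemma ix_abs_sub_lt {k : ℤ} {x y : ℝ} : (|ix k x - ix k y| : ℝ) < |x - y| * (2 : ℝ) ^ k + 1 := by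
  have h1 := ix_le k x
  have h2 := lt_ix k x
  have h3 := ix_le k y
  have h4 := lt_ix k y
  have hp : (0 : ℝ) < 2 ^ k := by positivity
  rw [zpow_neg, ← div_eq_mul_inv] at *
  rw [div_le_iff₀ hp] at h1 h3
  rw [lt_div_iff₀ hp] at h2 h4
  have h5 := le_abs_self (x - y)
  have h6 := neg_abs_le (x - y)
  rw [abs_lt]
  constructor <;> nlinarith

/-! ### Weights -/

/-- The basic decaying weight `1 / (1 + |x|)`. -/
noncomputable def wt (x : ℝ) : ℝ := (1 + |x|)⁻¹

lemma wt_pos (x : ℝ) : 0 < wt x := by unfold wt; positivity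
lemma wt_nonneg (x : ℝ) : 0 ≤ wt x := (wt_pos x).le
lemma wt_le_one (x : ℝ) : wt x ≤ 1 := by
  unfold wt
  exact inv_le_one_of_one_le₀ (by linarith [abs_nonneg x])

lemma wt_neg (x : ℝ) : wt (-x) = wt x := by simp [wt]

lemma wt_abs_anti {x y : ℝ} (h : |x| ≤ |y|) : wt y ≤ wt x := by
  unfold wt
  gcongr

lemma wt_mul_le (x y : ℝ) : wt x * wt y ≤ wt (x + y) := by
  unfold wt
  rw [← mul_inv]
  have := abs_add_le x y
  gcongr
  nlinarith [abs_nonneg x, abs_nonneg y]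

lemma wt_pow_mul_le (N : ℕ) (x y : ℝ) : wt x ^ N * wt y ^ N ≤ wt (x + y) ^ N := by
  rw [← mul_pow]
  exact pow_le_pow_left₀ (mul_nonneg (wt_nonneg _) (wt_nonneg _)) (wt_mul_le x y) N

lemma wt_pow_anti {N M : ℕ} (h : M ≤ N) (x : ℝ) : wt x ^ N ≤ wt x ^ M :=
  pow_le_pow_of_le_one (wt_nonneg x) (wt_le_one x) h

lemma wt_le_inv {x r : ℝ} (hr : 0 < r) (h : r ≤ |x|) : wt x ≤ r⁻¹ := by
  unfold wt; gcongr; linarith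

/-- Perturbing the argument by at most `r` costs a factor `1 + r`. -/
lemma wt_le_mul_wt {x y r : ℝ} (h : |x - y| ≤ r) : wt x ≤ (1 + r) * wt y := by
  unfold wt
  have hr : 0 ≤ r := (abs_nonneg _).trans h
  rw [← div_eq_mul_inv, inv_eq_one_div, div_le_div_iff₀ (by positivity) (by positivity)]
  have : |y| ≤ |x| + |x - y| := by
    have := abs_sub_abs_le_abs_sub y x
    rw [abs_sub_comm y x] at this
    linarith
  nlinarith [abs_nonneg x]

lemma continuous_wt : Continuous wt := by
  unfold wt
  exact Continuous.inv₀ (by fun_prop) (fun x => by positivity)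

lemma wt_sq_le (x : ℝ) : wt x ^ 2 ≤ (1 + x ^ 2)⁻¹ := by
  unfold wt
  rw [inv_pow]
  gcongr
  nlinarith [abs_nonneg x, sq_abs x]

lemma integrable_wt_sq : Integrable fun x => wt x ^ 2 := by
  refine integrable_inv_one_add_sq.mono' (continuous_wt.pow 2).aestronglyMeasurable ?_
  filter_upwards with x
  rw [Real.norm_of_nonneg (by positivity)]
  exact wt_sq_le x

lemma integral_wt_sq_le : ∫ x, wt x ^ 2 ≤ 4 := by
  calc ∫ x, wt x ^ 2 ≤ ∫ x : ℝ, (1 + x ^ 2)⁻¹ :=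
        integral_mono integrable_wt_sq integrable_inv_one_add_sq wt_sq_le
    _ = Real.pi := integral_univ_inv_one_add_sq
    _ ≤ 4 := Real.pi_le_four

lemma integrable_wt_pow {N : ℕ} (hN : 2 ≤ N) {u : ℝ} (hu : 0 < u) (c : ℝ) :
    Integrable fun x => wt (u * (x - c)) ^ N := by
  have h2 : Integrable fun x => wt (u * (x - c)) ^ 2 :=
    (integrable_wt_sq.comp_mul_left' hu.ne').comp_sub_right c
  refine h2.mono' ((continuous_wt.comp (by fun_prop)).pow N).aestronglyMeasurable ?_
  filter_upwards with x
  rw [Real.norm_of_nonneg (pow_nonneg (wt_nonneg _) _)]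
  exact wt_pow_anti hN _

lemma integral_wt_pow_le {N : ℕ} (hN : 2 ≤ N) {u : ℝ} (hu : 0 < u) (c : ℝ) :
    ∫ x, wt (u * (x - c)) ^ N ≤ 4 / u := by
  calc ∫ x, wt (u * (x - c)) ^ N ≤ ∫ x, wt (u * (x - c)) ^ 2 :=
        integral_mono (integrable_wt_pow hN hu c) (integrable_wt_pow le_rfl hu c)
          (fun x => wt_pow_anti hN _)
    _ = u⁻¹ * ∫ x, wt x ^ 2 := by
        rw [integral_sub_right_eq_self (fun x => wt (u * x) ^ 2) c,
          Measure.integral_comp_mul_left (fun x => wt x ^ 2), abs_of_pos (by positivity),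
          smul_eq_mul]
    _ ≤ 4 / u := by
        rw [div_eq_inv_mul]
        gcongr
        exact integral_wt_sq_le

/-- The interval of the space grid at scale `k`, position `m`. -/
def dy (k m : ℤ) : Set ℝ := {y | ix (-k) y = m}

lemma dy_eq (k m : ℤ) : dy k m = Ico ((m : ℝ) * 2 ^ k) ((m + 1) * 2 ^ k) := by
  ext y
  simp only [dy, mem_ofPred_eq, ix_eq_iff, neg_neg, mem_Ico]

lemma measurableSet_dy (k m : ℤ) : MeasurableSet (dy k m) := by
  rw [dy_eq]; exact measurableSet_Ico

lemma volume_dy (k m : ℤ) : volume (dy k m) = ENNReal.ofReal (2 ^ k) := by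
  rw [dy_eq, Real.volume_Ico]; congr 1; ring

lemma volume_real_dy (k m : ℤ) : volume.real (dy k m) = 2 ^ k := by
  rw [measureReal_def, volume_dy, ENNReal.toReal_ofReal (by positivity)]

lemma disjoint_dy {k m m' : ℤ} (h : m ≠ m') : Disjoint (dy k m) (dy k m') := by
  rw [Set.disjoint_left]
  intro y hy hy'
  exact h (hy.symm.trans hy')

lemma abs_sub_le_of_mem_dy {k m : ℤ} {y : ℝ} (hy : y ∈ dy k m) : |y - m * 2 ^ k| ≤ 2 ^ k := by
  rw [dy_eq] at hy
  rw [abs_le]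
  have : (0 : ℝ) < 2 ^ k := by positivity
  constructor <;> nlinarith [hy.1, hy.2]

lemma setIntegral_const_real (s : Set ℝ) (c : ℝ) : ∫ _ in s, c = volume.real s * c := by
  simp

/-- Sums over pairwise disjoint sets are controlled by the integral. -/
lemma sum_le_integral {ι : Type*} (s : Finset ι) (J : ι → Set ℝ) (hJ : ∀ i ∈ s, MeasurableSet (J i))
    (hd : (s : Set ι).PairwiseDisjoint J) (g : ℝ → ℝ) (hg : Integrable g) (h0 : ∀ x, 0 ≤ g x)
    (c : ι → ℝ) (hc : ∀ i ∈ s, ∀ y ∈ J i, c i ≤ g y) (hv : ∀ i ∈ s, volume (J i) ≠ ⊤) :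
    ∑ i ∈ s, volume.real (J i) * c i ≤ ∫ x, g x := by
  calc ∑ i ∈ s, volume.real (J i) * c i = ∑ i ∈ s, ∫ _ in J i, c i := by
        simp_rw [setIntegral_const_real]
    _ ≤ ∑ i ∈ s, ∫ y in J i, g y := by
        refine Finset.sum_le_sum fun i hi => ?_
        exact setIntegral_mono_on (integrableOn_const (hv i hi)) hg.integrableOn (hJ i hi) (hc i hi)
    _ = ∫ y in ⋃ i ∈ s, J i, g y := by
        rw [integral_biUnion_finset s hJ hd (fun i _ => hg.integrableOn)]
    _ ≤ ∫ y, g y := setIntegral_le_integral hg (ae_of_all _ h0)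

lemma sum_wt_dy_le {N : ℕ} (hN : 2 ≤ N) (k : ℤ) (x : ℝ) (s : Finset ℤ) :
    ∑ m ∈ s, wt (2 ^ (-k) * (x - m * 2 ^ k)) ^ N ≤ 16 := by
  have hp : (0 : ℝ) < 2 ^ k := by positivity
  have hq : (0 : ℝ) < 2 ^ (-k) := by positivity
  have hpq : (2 : ℝ) ^ (-k) * 2 ^ k = 1 := by rw [← zpow_add₀ (by norm_num)]; simp
  have key := sum_le_integral s (dy k) (fun m _ => measurableSet_dy k m)
    (fun m _ m' _ h => disjoint_dy h) (fun y => 4 * wt (2 ^ (-k) * (y - x)) ^ 2)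
    ((integrable_wt_pow le_rfl hq x).const_mul 4) (fun y => by positivity)
    (fun m => wt (2 ^ (-k) * (x - m * 2 ^ k)) ^ 2) ?_ ?_
  · simp_rw [volume_real_dy, ← Finset.mul_sum] at key
    rw [integral_const_mul] at key
    have h2 := integral_wt_pow_le le_rfl hq x
    rw [zpow_neg] at h2
    simp only [div_inv_eq_mul] at h2
    have h3 : 2 ^ k * ∑ m ∈ s, wt (2 ^ (-k) * (x - m * 2 ^ k)) ^ 2 ≤ 2 ^ k * 16 := by
      rw [zpow_neg] at *
      linarith
    refine le_trans (Finset.sum_le_sum fun m _ => wt_pow_anti hN _) (le_of_mul_le_mul_left h3 hp)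
  · intro m _ y hy
    have h1 : wt (2 ^ (-k) * (x - m * 2 ^ k)) ≤ (1 + 1) * wt (2 ^ (-k) * (x - y)) := by
      apply wt_le_mul_wt
      have := abs_sub_le_of_mem_dy hy
      rw [← mul_sub, abs_mul, abs_of_pos hq, ← hpq]
      gcongr
      rwa [show x - m * 2 ^ k - (x - y) = y - m * 2 ^ k by ring]
    have h2 : wt (2 ^ (-k) * (x - y)) = wt (2 ^ (-k) * (y - x)) := by
      rw [← wt_neg, ← mul_neg, neg_sub]
    rw [h2] at h1
    calc wt (2 ^ (-k) * (x - m * 2 ^ k)) ^ 2 ≤ ((1 + 1) * wt (2 ^ (-k) * (y - x))) ^ 2 :=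
          pow_le_pow_left₀ (wt_nonneg _) h1 2
      _ = 4 * wt (2 ^ (-k) * (y - x)) ^ 2 := by ring
  · intro m _
    rw [volume_dy]; exact ENNReal.ofReal_ne_top

/-- A geometric sum over integers bounded above. -/
lemma sum_zpow_le (s : Finset ℤ) (j : ℤ) (h : ∀ k ∈ s, k ≤ j) : ∑ k ∈ s, (2 : ℝ) ^ k ≤ 2 * 2 ^ j := by
  have h1 : ∑ k ∈ s, (2 : ℝ) ^ k = ∑ d ∈ s.image (fun k => (j - k).toNat), 2 ^ j * (1 / 2 : ℝ) ^ d := by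
    rw [Finset.sum_image]
    · refine Finset.sum_congr rfl fun k hk => ?_
      have := h k hk
      have h3 : (1 / 2 : ℝ) ^ ((j - k).toNat) = (2 : ℝ) ^ (k - j) := by
        rw [one_div, inv_pow, ← zpow_natCast, ← zpow_neg]
        congr 1; omega
      rw [h3, ← zpow_add₀ (by norm_num)]
      congr 1; ring
    · intro k hk k' hk' hkk
      have := h k hk
      have := h k' hk'
      simp only at hkk
      omega
  rw [h1, ← Finset.mul_sum, mul_comm]
  gcongr
  calc _ ≤ ∑' d : ℕ, (1 / 2 : ℝ) ^ d :=
        Summable.sum_le_tsum _ (fun _ _ => by positivity) summable_geometric_two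
    _ = 2 := tsum_geometric_two

lemma sum_zpow_neg_le (s : Finset ℤ) (j : ℤ) (h : ∀ k ∈ s, j ≤ k) :
    ∑ k ∈ s, (2 : ℝ) ^ (-k) ≤ 2 * 2 ^ (-j) := by
  have := sum_zpow_le (s.image (fun k => -k)) (-j) (by
    intro k hk
    obtain ⟨k', hk', rfl⟩ := Finset.mem_image.1 hk
    have := h k' hk'; omega)
  rwa [Finset.sum_image (fun a _ b _ h => by simpa using h)] at this

section

/-! ### Characters and kernels -/

lemma eChar_eq (t x : ℝ) : eChar t x = Complex.exp ((2 * Real.pi * (t * x) : ℝ) * Complex.I) := by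
  unfold eChar; push_cast; ring_nf

@[simp] lemma norm_eChar (t x : ℝ) : ‖eChar t x‖ = 1 := by
  rw [eChar_eq, Complex.norm_exp_ofReal_mul_I]

lemma eChar_add_left (s t x : ℝ) : eChar (s + t) x = eChar s x * eChar t x := by
  simp only [eChar_eq, ← Complex.exp_add]; push_cast; ring_nf

lemma eChar_add_right (t x y : ℝ) : eChar t (x + y) = eChar t x * eChar t y := by
  simp only [eChar_eq, ← Complex.exp_add]; push_cast; ring_nf

@[simp] lemma eChar_zero_left (x : ℝ) : eChar 0 x = 1 := by simp [eChar]

@[simp] lemma eChar_zero_right (x : ℝ) : eChar x 0 = 1 := by simp [eChar]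

lemma eChar_neg_left (t x : ℝ) : eChar (-t) x = eChar t (-x) := by
  simp only [eChar_eq]; push_cast; ring_nf

lemma eChar_scale (c t x : ℝ) : eChar (c * t) x = eChar t (c * x) := by
  simp only [eChar_eq]; push_cast; ring_nf

lemma eChar_mul_neg (t x : ℝ) : eChar t x * eChar (-t) x = 1 := by
  rw [← eChar_add_left]; simp

lemma conj_eChar (t x : ℝ) : (starRingEnd ℂ) (eChar t x) = eChar t (-x) := by
  rw [eChar_eq, eChar_eq, ← Complex.exp_conj, map_mul, Complex.conj_ofReal, Complex.conj_I]
  push_cast; ring_nf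

lemma continuous_eChar : Continuous fun p : ℝ × ℝ => eChar p.1 p.2 := by
  unfold eChar; fun_prop

lemma continuous_eChar_right (t : ℝ) : Continuous (eChar t) :=
  continuous_eChar.comp (by fun_prop : Continuous fun x : ℝ => (t, x))

lemma continuous_eChar_left (x : ℝ) : Continuous fun t => eChar t x :=
  continuous_eChar.comp (by fun_prop : Continuous fun t : ℝ => (t, x))

lemma norm_eChar_sub_one_le (t x : ℝ) : ‖eChar t x - 1‖ ≤ 7 * |t| * |x| := by
  rw [eChar_eq, mul_comm _ Complex.I]
  refine (Real.norm_exp_I_mul_ofReal_sub_one_le).trans ?_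
  rw [Real.norm_eq_abs, abs_mul, abs_of_pos (by positivity : (0 : ℝ) < 2 * Real.pi), abs_mul]
  have := Real.pi_lt_d2
  nlinarith [mul_nonneg (abs_nonneg t) (abs_nonneg x)]

/-- Smooth compactly supported real symbols. -/
structure Symb (φ : ℝ → ℝ) : Prop where
  smooth : ContDiff ℝ (⊤ : ℕ∞) φ
  supp : HasCompactSupport φ

/-- The kernel (inverse Fourier transform) of a symbol. -/
noncomputable def ker (φ : ℝ → ℝ) (t : ℝ) : ℂ := ∫ ζ : ℝ, (φ ζ : ℂ) * eChar ζ t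

/-- A symbol viewed as a Schwartz function. -/
noncomputable def Symb.toS {φ : ℝ → ℝ} (h : Symb φ) : SchwartzMap ℝ ℂ :=
  HasCompactSupport.toSchwartzMap (f := fun x => (φ x : ℂ))
    (h.supp.comp_left (g := fun y : ℝ => (y : ℂ)) (by simp))
    (Complex.ofRealCLM.contDiff.comp h.smooth)

lemma Symb.toS_apply {φ : ℝ → ℝ} (h : Symb φ) (x : ℝ) : h.toS x = φ x := rfl

open scoped FourierTransform SchwartzMap Convolution

lemma fourierT_eq (f : ℝ → ℂ) : fourierT f = 𝓕 f := by
  ext ξ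
  rw [Real.fourier_real_eq_integral_exp_smul, fourierT]
  congr 1; ext x
  rw [eChar_eq, smul_eq_mul, mul_comm]
  congr 2; push_cast; ring

lemma fourierInv_eq_eChar (f : ℝ → ℂ) (t : ℝ) : 𝓕⁻ f t = ∫ ζ : ℝ, f ζ * eChar ζ t := by
  rw [Real.fourierInv_eq']
  congr 1; ext x
  rw [eChar_eq, smul_eq_mul, mul_comm]
  congr 2; simp; ring

/-- The kernel of a symbol as a Schwartz function. -/
noncomputable def Symb.invF {φ : ℝ → ℝ} (h : Symb φ) : 𝓢(ℝ, ℂ) := 𝓕⁻ h.toS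

lemma ker_eq {φ : ℝ → ℝ} (h : Symb φ) : ker φ = ⇑h.invF := by
  ext t
  rw [Symb.invF]
  rw [SchwartzMap.fourierInv_coe, fourierInv_eq_eChar]
  rfl

lemma continuous_ker {φ : ℝ → ℝ} (h : Symb φ) : Continuous (ker φ) := by
  rw [ker_eq h]; exact SchwartzMap.continuous _

lemma integrable_ker {φ : ℝ → ℝ} (h : Symb φ) : Integrable (ker φ) := by
  rw [ker_eq h]; exact SchwartzMap.integrable _

lemma schwartz_decay (g : 𝓢(ℝ, ℂ)) (N : ℕ) : ∃ C : ℝ, 0 < C ∧ ∀ t, ‖g t‖ ≤ C * wt t ^ N := by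
  have := g.one_add_le_sup_seminorm_apply (𝕜 := ℝ) (m := (N, 0)) (k := N) (n := 0) le_rfl le_rfl
  set B := 2 ^ (N, 0).1 * ((Finset.Iic (N, 0)).sup fun m => SchwartzMap.seminorm ℝ m.1 m.2) g
  have hB : 0 ≤ B := by positivity
  refine ⟨B + 1, by positivity, fun t => ?_⟩
  have h := this t
  rw [norm_iteratedFDeriv_zero] at h
  rw [wt, inv_pow, ← div_eq_mul_inv, le_div_iff₀ (by positivity), mul_comm]
  exact h.trans (by linarith)

lemma schwartz_deriv_decay (g : 𝓢(ℝ, ℂ)) (N : ℕ) :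
    ∃ C : ℝ, 0 < C ∧ ∀ t, ‖deriv g t‖ ≤ C * wt t ^ N :=
  schwartz_decay (SchwartzMap.derivCLM ℝ ℂ g) N

/-- A decay constant for the kernel of a symbol. -/
noncomputable def kC (φ : ℝ → ℝ) (N : ℕ) : ℝ :=
  Classical.epsilon fun C => 0 < C ∧ (∀ t, ‖ker φ t‖ ≤ C * wt t ^ N) ∧
    ∀ t t' : ℝ, |t - t'| ≤ 1 → ‖ker φ t - ker φ t'‖ ≤ C * |t - t'| * wt t' ^ N

lemma kC_spec {φ : ℝ → ℝ} (h : Symb φ) (N : ℕ) : 0 < kC φ N ∧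
    (∀ t, ‖ker φ t‖ ≤ kC φ N * wt t ^ N) ∧
    ∀ t t' : ℝ, |t - t'| ≤ 1 → ‖ker φ t - ker φ t'‖ ≤ kC φ N * |t - t'| * wt t' ^ N := by
  apply Classical.epsilon_spec (p := fun C => 0 < C ∧ (∀ t, ‖ker φ t‖ ≤ C * wt t ^ N) ∧
    ∀ t t' : ℝ, |t - t'| ≤ 1 → ‖ker φ t - ker φ t'‖ ≤ C * |t - t'| * wt t' ^ N)
  obtain ⟨C, hC, h1⟩ := schwartz_decay h.invF N
  obtain ⟨D, hD, h2⟩ := schwartz_deriv_decay h.invF N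
  rw [← ker_eq h] at h1 h2
  have hdiff : Differentiable ℝ (ker φ) := by rw [ker_eq h]; exact SchwartzMap.differentiable _
  refine ⟨C + D * 2 ^ N, by positivity, fun t => (h1 t).trans ?_, fun t t' htt => ?_⟩
  · have := pow_nonneg (wt_nonneg t) N
    gcongr
    have : 0 < D * 2 ^ N := by positivity
    linarith
  · have key := (convex_segment t' t).norm_image_sub_le_of_norm_deriv_le
      (f := ker φ) (C := D * 2 ^ N * wt t' ^ N) (fun x _ => hdiff x) (fun x hx => ?_)
      (left_mem_segment ℝ t' t) (right_mem_segment ℝ t' t)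
    · refine key.trans ?_
      rw [Real.norm_eq_abs]
      have := pow_nonneg (wt_nonneg t') N
      have : 0 ≤ |t - t'| * wt t' ^ N := by positivity
      nlinarith
    · refine (h2 x).trans ?_
      rw [mul_assoc, ← mul_pow]
      have hx' : |x - t'| ≤ 1 := by
        rw [segment_eq_uIcc] at hx
        exact (abs_sub_left_of_mem_uIcc hx).trans htt
      have := wt_le_mul_wt hx'
      norm_num at this
      have h0 := wt_nonneg x
      gcongr

lemma kC_pos {φ : ℝ → ℝ} (h : Symb φ) (N : ℕ) : 0 < kC φ N := (kC_spec h N).1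

lemma norm_ker_le {φ : ℝ → ℝ} (h : Symb φ) (N : ℕ) (t : ℝ) : ‖ker φ t‖ ≤ kC φ N * wt t ^ N :=
  (kC_spec h N).2.1 t

lemma norm_ker_sub_le {φ : ℝ → ℝ} (h : Symb φ) (N : ℕ) {t t' : ℝ} (htt : |t - t'| ≤ 1) :
    ‖ker φ t - ker φ t'‖ ≤ kC φ N * |t - t'| * wt t' ^ N :=
  (kC_spec h N).2.2 t t' htt

lemma conj_ker (φ : ℝ → ℝ) (t : ℝ) : (starRingEnd ℂ) (ker φ t) = ker φ (-t) := by
  unfold ker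
  rw [← integral_conj]
  simp_rw [map_mul, conj_eChar, Complex.conj_ofReal]

lemma Symb.mul {φ ψ : ℝ → ℝ} (h : Symb φ) (h' : Symb ψ) : Symb fun ζ => φ ζ * ψ ζ :=
  ⟨h.smooth.mul h'.smooth, h.supp.mul_right⟩

lemma Symb.sub {φ ψ : ℝ → ℝ} (h : Symb φ) (h' : Symb ψ) : Symb fun ζ => φ ζ - ψ ζ := by
  refine ⟨h.smooth.sub h'.smooth, ?_⟩
  simp_rw [sub_eq_add_neg]
  exact h.supp.add (h'.supp.comp_left (g := fun y : ℝ => -y) (by simp))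

/-- Composition of two convolution kernels. -/
lemma ker_conv {φ ψ : ℝ → ℝ} (h : Symb φ) (h' : Symb ψ) (x y : ℝ) :
    ∫ z, ker φ (x - z) * ker ψ (z - y) = ker (fun ζ => φ ζ * ψ ζ) (x - y) := by
  have h1 := SchwartzMap.convolution_apply (ContinuousLinearMap.mul ℂ ℂ) h'.invF h.invF
    (x - y)
  have h2 : SchwartzMap.convolution (ContinuousLinearMap.mul ℂ ℂ) h'.invF h.invF
      = (h.mul h').invF := by
    have : 𝓕 (SchwartzMap.convolution (ContinuousLinearMap.mul ℂ ℂ) h'.invF h.invF) =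
        (h.mul h').toS := by
      rw [SchwartzMap.fourier_convolution]
      ext ζ
      simp [Symb.toS_apply, mul_comm, Symb.invF]
    rw [Symb.invF.eq_def (h.mul h'), ← this]; simp
  rw [h2, ← ker_eq, ← ker_eq, ← ker_eq] at h1
  rw [h1, MeasureTheory.convolution]
  rw [← integral_add_right_eq_self (fun z => ker φ (x - z) * ker ψ (z - y)) y]
  congr 1; ext z
  simp only [ContinuousLinearMap.mul_apply']
  rw [mul_comm]
  congr 2 <;> ring

lemma Symb.scale {φ : ℝ → ℝ} (h : Symb φ) {c : ℝ} (hc : c ≠ 0) (d : ℝ) : Symb fun ζ => φ (c * ζ - d) := by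
  refine ⟨h.smooth.comp (by fun_prop), ?_⟩
  have := h.supp.comp_homeomorph ((Homeomorph.mulLeft₀ c hc).trans (Homeomorph.subRight d))
  exact this

/-- The kernel with symbol `φ` adapted to the tile of scale `k` and frequency index `n`. -/
noncomputable def tk (φ : ℝ → ℝ) (k n : ℤ) : ℝ → ℂ := ker fun ζ => φ (2 ^ k * ζ - n)

lemma Symb.tile {φ : ℝ → ℝ} (h : Symb φ) (k n : ℤ) : Symb fun ζ => φ (2 ^ k * ζ - n) :=
  h.scale (by positivity) _

lemma ker_scale (φ : ℝ → ℝ) {c : ℝ} (hc : 0 < c) (d t : ℝ) :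
    ker (fun ζ => φ (c * ζ - d)) t = (c⁻¹ : ℝ) * (eChar (d * c⁻¹) t * ker φ (c⁻¹ * t)) := by
  have h1 := Measure.integral_comp_mul_left (fun ζ => (φ (ζ - d) : ℂ) * eChar (c⁻¹ * ζ) t) c
  have h2 := integral_sub_right_eq_self (μ := volume)
    (fun ζ : ℝ => (φ ζ : ℂ) * eChar (c⁻¹ * (ζ + d)) t) d
  simp only [sub_add_cancel] at h2
  rw [h2, abs_of_pos (by positivity)] at h1
  simp only [inv_mul_cancel_left₀ hc.ne'] at h1
  rw [ker, h1, Complex.real_smul, ker, ← integral_const_mul (eChar (d * c⁻¹) t)]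
  congr 2; ext ζ
  rw [mul_add, eChar_add_left, eChar_scale, mul_comm d]; ring

lemma tk_eq (φ : ℝ → ℝ) (k n : ℤ) (t : ℝ) :
    tk φ k n t = (((2 : ℝ) ^ (-k) : ℝ) : ℂ) * (eChar (n * 2 ^ (-k)) t * ker φ (2 ^ (-k) * t)) := by
  rw [tk, ker_scale φ (by positivity), zpow_neg]

lemma norm_tk_le {φ : ℝ → ℝ} (h : Symb φ) (N : ℕ) (k n : ℤ) (t : ℝ) :
    ‖tk φ k n t‖ ≤ kC φ N * (2 ^ (-k) * wt (2 ^ (-k) * t) ^ N) := by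
  rw [tk_eq, norm_mul, norm_mul, norm_eChar, Complex.norm_real, one_mul,
    Real.norm_of_nonneg (by positivity)]
  have := norm_ker_le h N (2 ^ (-k) * t)
  calc _ ≤ 2 ^ (-k) * (kC φ N * wt (2 ^ (-k) * t) ^ N) := by gcongr
    _ = _ := by ring

end

section

open scoped FourierTransform SchwartzMap Convolution

/-! ### Convolution operators with kernels -/

/-- Convolution of `a` with the kernel of the symbol `φ`. -/
noncomputable def cv (φ : ℝ → ℝ) (a : ℝ → ℂ) (x : ℝ) : ℂ := ∫ y, ker φ (x - y) * a y

lemma cv_eq_convolution (φ : ℝ → ℝ) (a : ℝ → ℂ) :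
    cv φ a = a ⋆[ContinuousLinearMap.mul ℂ ℂ, volume] ker φ := by
  ext x
  rw [cv, MeasureTheory.convolution]
  congr 1; ext y
  simp [mul_comm]

lemma ker_bdd {φ : ℝ → ℝ} (h : Symb φ) (t : ℝ) : ‖ker φ t‖ ≤ kC φ 0 := by
  simpa using norm_ker_le h 0 t

lemma cv_integrand_integrable {φ : ℝ → ℝ} (h : Symb φ) {a : ℝ → ℂ} (ha : Integrable a) (x : ℝ) :
    Integrable fun y => ker φ (x - y) * a y :=
  ha.bdd_mul (((continuous_ker h).comp (by fun_prop)).aestronglyMeasurable)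
    (ae_of_all _ fun y => ker_bdd h (x - y))

lemma continuous_cv {φ : ℝ → ℝ} (h : Symb φ) {a : ℝ → ℂ} (ha : Integrable a) :
    Continuous (cv φ a) := by
  refine continuous_of_dominated (bound := fun y => kC φ 0 * ‖a y‖) ?_ ?_ (ha.norm.const_mul _) ?_
  · exact fun x => (cv_integrand_integrable h ha x).aestronglyMeasurable
  · intro x
    filter_upwards with y
    rw [norm_mul]
    exact mul_le_mul_of_nonneg_right (ker_bdd h _) (norm_nonneg _)
  · filter_upwards with y
    exact ((continuous_ker h).comp (by fun_prop)).mul continuous_const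

lemma integrable_cv {φ : ℝ → ℝ} (h : Symb φ) {a : ℝ → ℂ} (ha : Integrable a) :
    Integrable (cv φ a) := by
  rw [cv_eq_convolution]
  exact ha.integrable_convolution _ (integrable_ker h)

lemma norm_cv_le {φ : ℝ → ℝ} (h : Symb φ) {a : ℝ → ℂ} (ha : Integrable a) (x : ℝ) :
    ‖cv φ a x‖ ≤ kC φ 0 * ∫ y, ‖a y‖ := by
  rw [← integral_const_mul]
  refine norm_integral_le_of_norm_le (ha.norm.const_mul _) ?_
  filter_upwards with y
  rw [norm_mul]
  exact mul_le_mul_of_nonneg_right (ker_bdd h _) (norm_nonneg _)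

/-- The operator `cv φ` is self-adjoint. -/
lemma cv_adjoint {φ : ℝ → ℝ} (h : Symb φ) {a b : ℝ → ℂ} (ha : Integrable a) (hb : Integrable b) :
    ∫ x, cv φ a x * (starRingEnd ℂ) (b x) = ∫ x, a x * (starRingEnd ℂ) (cv φ b x) := by
  have hint : Integrable (fun p : ℝ × ℝ => ker φ (p.1 - p.2) * a p.2 * (starRingEnd ℂ) (b p.1))
      (volume.prod volume) := by
    have h1 : Integrable (fun p : ℝ × ℝ => (starRingEnd ℂ) (b p.1) * a p.2)
        (volume.prod volume) :=
      (Integrable.mul_prod (f := fun x => (starRingEnd ℂ) (b x))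
        (Complex.conjCLE.toContinuousLinearMap.integrable_comp hb) ha)
    have h2 := h1.bdd_mul (f := fun p : ℝ × ℝ => ker φ (p.1 - p.2)) (c := kC φ 0)
      (((continuous_ker h).comp (by fun_prop)).aestronglyMeasurable)
      (ae_of_all _ fun y => ker_bdd h _)
    refine h2.congr (ae_of_all _ fun p => ?_)
    simp only; ring
  calc ∫ x, cv φ a x * (starRingEnd ℂ) (b x)
      = ∫ x, ∫ y, ker φ (x - y) * a y * (starRingEnd ℂ) (b x) := by
        congr 1; ext x; rw [cv, integral_mul_const]
    _ = ∫ y, ∫ x, ker φ (x - y) * a y * (starRingEnd ℂ) (b x) := integral_integral_swap hint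
    _ = ∫ x, a x * (starRingEnd ℂ) (cv φ b x) := by
        congr 1; ext y
        rw [cv, ← integral_conj, ← integral_const_mul]
        congr 1; ext x
        rw [map_mul, conj_ker, neg_sub]; ring

lemma cv_cv {φ ψ : ℝ → ℝ} (h : Symb φ) (h' : Symb ψ) {a : ℝ → ℂ} (ha : Integrable a) :
    cv φ (cv ψ a) = cv (fun ζ => φ ζ * ψ ζ) a := by
  ext x
  have hint : Integrable (fun p : ℝ × ℝ => ker φ (x - p.1) * (ker ψ (p.1 - p.2) * a p.2))
      (volume.prod volume) := by
    have h1 : Integrable (fun p : ℝ × ℝ => ker φ (x - p.1) * a p.2) (volume.prod volume) :=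
      Integrable.mul_prod (f := fun z => ker φ (x - z)) ((integrable_ker h).comp_sub_left x) ha
    have h2 := h1.bdd_mul (f := fun p : ℝ × ℝ => ker ψ (p.1 - p.2)) (c := kC ψ 0)
      (((continuous_ker h').comp (by fun_prop)).aestronglyMeasurable)
      (ae_of_all _ fun y => ker_bdd h' _)
    refine h2.congr (ae_of_all _ fun p => ?_)
    simp only; ring
  calc cv φ (cv ψ a) x = ∫ z, ∫ y, ker φ (x - z) * (ker ψ (z - y) * a y) := by
        rw [cv]; congr 1; ext z; rw [cv, integral_const_mul]
    _ = ∫ y, ∫ z, ker φ (x - z) * (ker ψ (z - y) * a y) := integral_integral_swap hint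
    _ = ∫ y, ker (fun ζ => φ ζ * ψ ζ) (x - y) * a y := by
        congr 1; ext y
        rw [← ker_conv h h' x y, ← integral_mul_const]
        congr 1; ext z; ring
    _ = _ := rfl

lemma cv_zero (a : ℝ → ℂ) {φ : ℝ → ℝ} (h : ∀ ζ, φ ζ = 0) (x : ℝ) : cv φ a x = 0 := by
  simp [cv, ker, h]

lemma cv_add {φ : ℝ → ℝ} (h : Symb φ) {a b : ℝ → ℂ} (ha : Integrable a) (hb : Integrable b)
    (x : ℝ) : cv φ (fun y => a y + b y) x = cv φ a x + cv φ b x := by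
  simp only [cv, mul_add]
  exact integral_add (cv_integrand_integrable h ha x) (cv_integrand_integrable h hb x)

lemma cv_sum {φ : ℝ → ℝ} (h : Symb φ) {ι : Type*} (s : Finset ι) {a : ι → ℝ → ℂ}
    (ha : ∀ i ∈ s, Integrable (a i)) (x : ℝ) :
    cv φ (fun y => ∑ i ∈ s, a i y) x = ∑ i ∈ s, cv φ (a i) x := by
  simp only [cv, Finset.mul_sum]
  exact integral_finsetSum _ fun i hi => cv_integrand_integrable h (ha i hi) x

/-- Pairings of convolutions with kernels of disjoint frequency support vanish. -/
lemma cv_orthogonal {φ ψ : ℝ → ℝ} (h : Symb φ) (h' : Symb ψ) (hd : ∀ ζ, φ ζ * ψ ζ = 0)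
    {a b : ℝ → ℂ} (ha : Integrable a) (hb : Integrable b) :
    ∫ x, cv φ a x * (starRingEnd ℂ) (cv ψ b x) = 0 := by
  rw [cv_adjoint h ha (integrable_cv h' hb), cv_cv h h' hb]
  simp [cv_zero b hd]

/-- Bounded integrable functions. -/
structure BI (f : ℝ → ℂ) : Prop where
  int : Integrable f
  bdd : ∃ A, ∀ x, ‖f x‖ ≤ A

lemma BI.mul_int {f g : ℝ → ℂ} (hf : BI f) (hg : Integrable g) :
    Integrable fun x => g x * f x := by
  obtain ⟨A, hA⟩ := hf.bdd
  exact hg.mul_bdd hf.int.aestronglyMeasurable (ae_of_all _ hA)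

lemma BI.sq_int {f : ℝ → ℂ} (hf : BI f) : Integrable fun x => ‖f x‖ ^ 2 := by
  refine (hf.mul_int hf.int).norm.congr (ae_of_all _ fun x => ?_)
  simp [sq]

lemma BI.norm_mul_int {f g : ℝ → ℂ} (hf : BI f) (hg : BI g) :
    Integrable fun x => ‖g x‖ * ‖f x‖ := by
  refine (hf.mul_int hg.int).norm.congr (ae_of_all _ fun x => ?_)
  simp

lemma BI.conj {f : ℝ → ℂ} (hf : BI f) : BI fun x => (starRingEnd ℂ) (f x) :=
  ⟨Complex.conjCLE.toContinuousLinearMap.integrable_comp hf.int, by simpa using hf.bdd⟩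

lemma BI.add {f g : ℝ → ℂ} (hf : BI f) (hg : BI g) : BI fun x => f x + g x := by
  obtain ⟨A, hA⟩ := hf.bdd
  obtain ⟨B, hB⟩ := hg.bdd
  exact ⟨hf.int.add hg.int, A + B, fun x => (norm_add_le _ _).trans (add_le_add (hA x) (hB x))⟩

lemma BI.neg {f : ℝ → ℂ} (hf : BI f) : BI fun x => - f x :=
  ⟨hf.int.neg, by simpa using hf.bdd⟩

lemma BI.sub {f g : ℝ → ℂ} (hf : BI f) (hg : BI g) : BI fun x => f x - g x := by
  simpa [sub_eq_add_neg] using hf.add hg.neg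

lemma BI.sum {ι : Type*} (s : Finset ι) {a : ι → ℝ → ℂ} (ha : ∀ i ∈ s, BI (a i)) :
    BI fun x => ∑ i ∈ s, a i x := by
  classical
  induction s using Finset.induction_on with
  | empty => exact ⟨by simp, 0, by simp⟩
  | insert i s hi ih =>
    simp_rw [Finset.sum_insert hi]
    exact (ha i (Finset.mem_insert_self _ _)).add
      (ih fun j hj => ha j (Finset.mem_insert_of_mem hj))

lemma BI.indicator {f : ℝ → ℂ} (hf : BI f) {S : Set ℝ} (hS : MeasurableSet S) :
    BI (S.indicator f) := by
  obtain ⟨A, hA⟩ := hf.bdd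
  exact ⟨hf.int.indicator hS, A, fun x => (norm_indicator_le_norm_self f x).trans (hA x)⟩

lemma BI.cv {φ : ℝ → ℝ} (h : Symb φ) {a : ℝ → ℂ} (ha : Integrable a) : BI (cv φ a) :=
  ⟨integrable_cv h ha, _, norm_cv_le h ha⟩

lemma BI.mul_char {f : ℝ → ℂ} (hf : BI f) (t : ℝ) : BI fun x => f x * eChar t x := by
  obtain ⟨A, hA⟩ := hf.bdd
  refine ⟨hf.int.mul_bdd (c := 1) (continuous_eChar_right t).aestronglyMeasurable
    (ae_of_all _ (by simp)), A, by simpa using hA⟩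

/-- A quantitative duality inequality. -/
lemma norm_integral_conj_le {f g : ℝ → ℂ} (hf : BI f) (hg : BI g) {t : ℝ} (ht : 0 < t) :
    ‖∫ x, f x * (starRingEnd ℂ) (g x)‖ ≤ (t * ∫ x, ‖f x‖ ^ 2) + t⁻¹ / 4 * ∫ x, ‖g x‖ ^ 2 := by
  rw [← integral_const_mul, ← integral_const_mul,
    ← integral_add (hf.sq_int.const_mul _) (hg.sq_int.const_mul _)]
  refine norm_integral_le_of_norm_le ((hf.sq_int.const_mul _).add (hg.sq_int.const_mul _)) ?_
  filter_upwards with x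
  rw [norm_mul, RCLike.norm_conj]
  have h1 := sq_nonneg (t * ‖f x‖ - ‖g x‖ / 2)
  have h2 : t⁻¹ * (t * ‖f x‖ - ‖g x‖ / 2) ^ 2 = t * ‖f x‖ ^ 2 - ‖f x‖ * ‖g x‖ + t⁻¹ / 4 * ‖g x‖ ^ 2 := by
    field_simp; ring
  have h3 : 0 ≤ t⁻¹ * (t * ‖f x‖ - ‖g x‖ / 2) ^ 2 := by positivity
  linarith

/-- The square norm of a finite sum is at most the sum of the absolute pairings. -/
lemma integral_norm_sum_sq_le {ι : Type*} (s : Finset ι) {v : ι → ℝ → ℂ}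
    (hv : ∀ i ∈ s, BI (v i)) :
    ∫ x, ‖∑ i ∈ s, v i x‖ ^ 2 ≤ ∑ i ∈ s, ∑ j ∈ s, ‖∫ x, v i x * (starRingEnd ℂ) (v j x)‖ := by
  have h1 : ((∫ x, ‖∑ i ∈ s, v i x‖ ^ 2 : ℝ) : ℂ) =
      ∑ i ∈ s, ∑ j ∈ s, ∫ x, v i x * (starRingEnd ℂ) (v j x) := by
    rw [← integral_complex_ofReal]
    have : ∀ i ∈ s, ∀ j ∈ s, Integrable fun x => v i x * (starRingEnd ℂ) (v j x) :=
      fun i hi j hj => (hv j hj).conj.mul_int (hv i hi).int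
    have h2 : ∀ i ∈ s, ∑ j ∈ s, ∫ x, v i x * (starRingEnd ℂ) (v j x) =
        ∫ x, ∑ j ∈ s, v i x * (starRingEnd ℂ) (v j x) := fun i hi =>
      (integral_finsetSum _ (this i hi)).symm
    rw [Finset.sum_congr rfl h2, ← integral_finsetSum]
    · congr 1; ext x
      rw [← Complex.normSq_eq_norm_sq, ← Complex.mul_conj, map_sum, Finset.sum_mul_sum]
    · exact fun i hi => integrable_finsetSum _ (this i hi)
  have h0 : 0 ≤ ∫ x, ‖∑ i ∈ s, v i x‖ ^ 2 := integral_nonneg fun x => by positivity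
  calc ∫ x, ‖∑ i ∈ s, v i x‖ ^ 2 = ‖((∫ x, ‖∑ i ∈ s, v i x‖ ^ 2 : ℝ) : ℂ)‖ := by
        rw [Complex.norm_real, Real.norm_of_nonneg h0]
    _ ≤ _ := by
        rw [h1]
        refine (norm_sum_le _ _).trans (Finset.sum_le_sum fun i _ => norm_sum_le _ _)

end

/-! ### Tiles -/

/-- A tile `(k, m, n)`: the space interval is `dy k m`, of length `2 ^ k`, and the frequency
interval has length `2 ^ (-k)` and index `n`. -/
abbrev Tile := ℤ × ℤ × ℤ

namespace Tile
/-- scale -/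
abbrev k (s : Tile) : ℤ := s.1
/-- space index -/
abbrev m (s : Tile) : ℤ := s.2.1
/-- frequency index -/
abbrev n (s : Tile) : ℤ := s.2.2
/-- space interval -/
def I (s : Tile) : Set ℝ := dy s.k s.m
/-- left end point of the space interval -/
noncomputable def c (s : Tile) : ℝ := s.m * 2 ^ s.k
/-- a symbol adapted to a tile -/
noncomputable def sy (s : Tile) (φ : ℝ → ℝ) : ℝ → ℝ := fun ζ => φ (2 ^ s.k * ζ - s.n)

end Tile

lemma Symb.sy {φ : ℝ → ℝ} (h : Symb φ) (s : Tile) : Symb (s.sy φ) := h.tile s.k s.n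

lemma norm_ker_sy_le {φ : ℝ → ℝ} (h : Symb φ) (N : ℕ) (s : Tile) (t : ℝ) :
    ‖ker (s.sy φ) t‖ ≤ kC φ N * (2 ^ (-s.k) * wt (2 ^ (-s.k) * t) ^ N) :=
  norm_tk_le h N s.k s.n t

/-- A bump function equal to one on `[-9, -3]` and supported in `(-10, -2)`. -/
noncomputable def rhoBump : ContDiffBump (-6 : ℝ) := ⟨3, 4, by norm_num, by norm_num⟩

/-- The analyzing symbol. -/
noncomputable def rho (x : ℝ) : ℝ := rhoBump x

lemma symb_rho : Symb rho := ⟨rhoBump.contDiff, rhoBump.hasCompactSupport⟩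

lemma rho_eq_one {x : ℝ} (h1 : -9 ≤ x) (h2 : x ≤ -3) : rho x = 1 := by
  apply rhoBump.one_of_mem_closedBall
  rw [Metric.mem_closedBall, Real.dist_eq, abs_le]
  constructor <;> simp only [rhoBump] <;> linarith

lemma rho_ne_zero {x : ℝ} (h : rho x ≠ 0) : -10 < x ∧ x < -2 := by
  have : x ∈ Function.support rhoBump := h
  rw [rhoBump.support_eq, Metric.mem_ball, Real.dist_eq, abs_lt] at this
  simp only [rhoBump] at this
  constructor <;> linarith [this.1, this.2]

/-- The component of `f` analyzed at the frequency of the tile `s`. -/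
noncomputable def Fs (f : ℝ → ℂ) (s : Tile) : ℝ → ℂ := cv (s.sy rho) f

/-- The part of `Fs f s` on the space interval of `s`. -/
noncomputable def as (f : ℝ → ℂ) (s : Tile) : ℝ → ℂ := s.I.indicator (Fs f s)

noncomputable def vs (f : ℝ → ℂ) (s : Tile) : ℝ → ℂ := cv (s.sy rho) (as f s)

/-- The energy of a tile. -/
noncomputable def en (f : ℝ → ℂ) (s : Tile) : ℝ := ∫ x, ‖as f s x‖ ^ 2

lemma Tile.measurableSet_I (s : Tile) : MeasurableSet s.I := measurableSet_dy _ _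

lemma BI_Fs {f : ℝ → ℂ} (hf : BI f) (s : Tile) : BI (Fs f s) := BI.cv (symb_rho.sy s) hf.int

lemma BI_as {f : ℝ → ℂ} (hf : BI f) (s : Tile) : BI (as f s) :=
  (BI_Fs hf s).indicator s.measurableSet_I

lemma BI_vs {f : ℝ → ℂ} (hf : BI f) (s : Tile) : BI (vs f s) :=
  BI.cv (symb_rho.sy s) (BI_as hf s).int

lemma en_nonneg (f : ℝ → ℂ) (s : Tile) : 0 ≤ en f s := integral_nonneg fun x => by positivity

lemma integral_vs_conj {f : ℝ → ℂ} (hf : BI f) (s : Tile) :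
    ∫ x, vs f s x * (starRingEnd ℂ) (f x) = (en f s : ℂ) := by
  rw [vs, cv_adjoint (symb_rho.sy s) (BI_as hf s).int hf.int, en, ← integral_complex_ofReal]
  congr 1; ext x
  rw [← Complex.normSq_eq_norm_sq, ← Complex.mul_conj]
  by_cases hx : x ∈ s.I <;> simp [as, hx, Fs]

/-- The pairing of two tiles. -/
noncomputable def pr (f : ℝ → ℂ) (s s' : Tile) : ℝ :=
  ‖∫ x, vs f s x * (starRingEnd ℂ) (vs f s' x)‖

lemma pr_comm (f : ℝ → ℂ) (s s' : Tile) : pr f s s' = pr f s' s := by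
  rw [pr, pr, ← RCLike.norm_conj, ← integral_conj]
  congr 2; ext x; simp [mul_comm]

/-- `T T^*` argument. -/
lemma sum_en_le_of_pairs {f : ℝ → ℂ} (hf : BI f) (S : Finset Tile) {B : ℝ} (hB : 0 < B)
    (h : ∑ s ∈ S, ∑ s' ∈ S, pr f s s' ≤ B * ∑ s ∈ S, en f s) :
    ∑ s ∈ S, en f s ≤ B * ∫ x, ‖f x‖ ^ 2 := by
  have hV : BI fun x => ∑ s ∈ S, vs f s x := BI.sum S fun s _ => BI_vs hf s
  have h0 : 0 ≤ ∑ s ∈ S, en f s := Finset.sum_nonneg fun s _ => en_nonneg f s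
  have h1 : ∑ s ∈ S, en f s = ‖∫ x, (∑ s ∈ S, vs f s x) * (starRingEnd ℂ) (f x)‖ := by
    have : ∫ x, (∑ s ∈ S, vs f s x) * (starRingEnd ℂ) (f x) = ((∑ s ∈ S, en f s : ℝ) : ℂ) := by
      simp_rw [Finset.sum_mul]
      rw [integral_finsetSum _ fun s _ => hf.conj.mul_int (BI_vs hf s).int]
      push_cast
      exact Finset.sum_congr rfl fun s _ => integral_vs_conj hf s
    rw [this, Complex.norm_real, Real.norm_of_nonneg h0]
  have h2 := norm_integral_conj_le hV hf (t := (2 * B)⁻¹) (by positivity)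
  have h3 := integral_norm_sum_sq_le S fun s _ => BI_vs hf s
  rw [← h1] at h2
  have h4 : (2 * B)⁻¹ * ∫ x, ‖∑ s ∈ S, vs f s x‖ ^ 2 ≤ (2 * B)⁻¹ * (B * ∑ s ∈ S, en f s) := by
    gcongr
    exact h3.trans h
  have h5 : (2 * B)⁻¹ * (B * ∑ s ∈ S, en f s) = (∑ s ∈ S, en f s) / 2 := by field_simp
  have h6 : (2 * B)⁻¹⁻¹ / 4 = B / 2 := by field_simp; norm_num
  rw [h6] at h2
  linarith

lemma integral_as_sq_le {f : ℝ → ℂ} (hf : BI f) (s : Tile) :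
    (∫ x, ‖as f s x‖) ^ 2 ≤ 2 ^ s.k * en f s := by
  have hp : (0 : ℝ) < 2 ^ s.k := by positivity
  set A := ∫ x, ‖as f s x‖ with hA
  set l := A * (2 ^ s.k)⁻¹ with hl
  have h1 : ∫ x, (‖as f s x‖ ^ 2 - 2 * l * ‖as f s x‖ + s.I.indicator (fun _ => l ^ 2) x)
      = en f s - 2 * l * A + 2 ^ s.k * l ^ 2 := by
    rw [integral_add, integral_sub, integral_const_mul, integral_indicator s.measurableSet_I,
      setIntegral_const_real]
    · simp only [Tile.I, volume_real_dy]; rfl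
    · exact (BI_as hf s).sq_int
    · exact (BI_as hf s).int.norm.const_mul _
    · exact (BI_as hf s).sq_int.sub ((BI_as hf s).int.norm.const_mul _)
    · rw [integrable_indicator_iff s.measurableSet_I]
      refine integrableOn_const ?_
      rw [Tile.I, volume_dy]; exact ENNReal.ofReal_ne_top
  have h2 : 0 ≤ ∫ x, (‖as f s x‖ ^ 2 - 2 * l * ‖as f s x‖ + s.I.indicator (fun _ => l ^ 2) x) := by
    refine integral_nonneg fun x => ?_
    by_cases hx : x ∈ s.I
    · simp only [indicator_of_mem hx]
      have := sq_nonneg (‖as f s x‖ - l)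
      simp only [Pi.zero_apply]
      nlinarith
    · simp [hx, as]
  rw [h1] at h2
  have h3 : A = l * 2 ^ s.k := by rw [hl]; field_simp
  have h4 : A ^ 2 = 2 ^ s.k * (2 * l * A - 2 ^ s.k * l ^ 2) := by rw [h3]; ring
  rw [h4]
  gcongr
  linarith

/-- Pointwise bound for a convolution of a function living on the interval of the tile. -/
lemma norm_cv_sy_le {φ : ℝ → ℝ} (h : Symb φ) (N : ℕ) (s : Tile) {a : ℝ → ℂ} (ha : Integrable a)
    (h0 : ∀ y, y ∉ s.I → a y = 0) (x : ℝ) :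
    ‖cv (s.sy φ) a x‖ ≤
      2 ^ N * kC φ N * (∫ y, ‖a y‖) * (2 ^ (-s.k) * wt (2 ^ (-s.k) * (x - s.c)) ^ N) := by
  have hq : (0 : ℝ) < 2 ^ (-s.k) := by positivity
  have hk := kC_pos h N
  have : 2 ^ N * kC φ N * (∫ y, ‖a y‖) * (2 ^ (-s.k) * wt (2 ^ (-s.k) * (x - s.c)) ^ N) =
      ∫ y, 2 ^ N * kC φ N * (2 ^ (-s.k) * wt (2 ^ (-s.k) * (x - s.c)) ^ N) * ‖a y‖ := by
    rw [integral_const_mul]; ring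
  rw [this]
  refine norm_integral_le_of_norm_le (ha.norm.const_mul _) ?_
  filter_upwards with y
  rw [norm_mul]
  by_cases hy : y ∈ s.I
  · refine mul_le_mul_of_nonneg_right ((norm_ker_sy_le h N s _).trans ?_) (norm_nonneg _)
    have h1 : wt (2 ^ (-s.k) * (x - y)) ≤ (1 + 1) * wt (2 ^ (-s.k) * (x - s.c)) := by
      apply wt_le_mul_wt
      have h2 := abs_sub_le_of_mem_dy hy
      have hpq : (2 : ℝ) ^ (-s.k) * 2 ^ s.k = 1 := by rw [← zpow_add₀ (by norm_num)]; simp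
      rw [← mul_sub, abs_mul, abs_of_pos hq, ← hpq]
      gcongr
      rw [Tile.c, show x - y - (x - s.m * 2 ^ s.k) = -(y - s.m * 2 ^ s.k) by ring, abs_neg]
      exact h2
    have h3 := pow_le_pow_left₀ (wt_nonneg _) h1 N
    rw [mul_pow, one_add_one_eq_two] at h3
    calc _ ≤ kC φ N * (2 ^ (-s.k) * (2 ^ N * wt (2 ^ (-s.k) * (x - s.c)) ^ N)) := by gcongr
      _ = _ := by ring
  · simp [h0 y hy]

lemma as_of_notMem (f : ℝ → ℂ) (s : Tile) (y : ℝ) (hy : y ∉ s.I) : as f s y = 0 := by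
  simp [as, hy]

/-- The constant in pairing estimates. -/
noncomputable def prC (N : ℕ) : ℝ := 4 * (2 ^ (N + 2) * kC rho (N + 2)) ^ 2

lemma prC_pos (N : ℕ) : 0 < prC N := by
  have := kC_pos symb_rho (N + 2)
  unfold prC; positivity

lemma pr_le {f : ℝ → ℂ} (hf : BI f) (N : ℕ) {s s' : Tile} (hk : s'.k ≤ s.k) :
    pr f s s' ≤ prC N * (∫ y, ‖as f s y‖) * (∫ y, ‖as f s' y‖) *
      (2 ^ (-s.k) * wt (2 ^ (-s.k) * (s.c - s'.c)) ^ N) := by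
  have hq : (0 : ℝ) < 2 ^ (-s.k) := by positivity
  have hq' : (0 : ℝ) < 2 ^ (-s'.k) := by positivity
  have hqq : (2 : ℝ) ^ (-s.k) ≤ 2 ^ (-s'.k) := by
    apply zpow_le_zpow_right₀ (by norm_num); omega
  set D := 2 ^ (N + 2) * kC rho (N + 2) with hD
  have hDp : 0 < D := by
    have := kC_pos symb_rho (N + 2)
    positivity
  set A := ∫ y, ‖as f s y‖
  set A' := ∫ y, ‖as f s' y‖
  have hA : 0 ≤ A := integral_nonneg fun x => norm_nonneg _
  have hA' : 0 ≤ A' := integral_nonneg fun x => norm_nonneg _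
  set W := wt (2 ^ (-s.k) * (s.c - s'.c)) ^ N
  have hW : 0 ≤ W := pow_nonneg (wt_nonneg _) _
  have key : ∀ x, ‖vs f s x * (starRingEnd ℂ) (vs f s' x)‖ ≤
      D ^ 2 * A * A' * (2 ^ (-s.k) * W) * (2 ^ (-s'.k) * wt (2 ^ (-s'.k) * (x - s'.c)) ^ 2) := by
    intro x
    rw [norm_mul, RCLike.norm_conj]
    have h1 := norm_cv_sy_le symb_rho (N + 2) s (BI_as hf s).int (as_of_notMem f s) x
    have h2 := norm_cv_sy_le symb_rho (N + 2) s' (BI_as hf s').int (as_of_notMem f s') x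
    set p := wt (2 ^ (-s.k) * (x - s.c))
    set p' := wt (2 ^ (-s'.k) * (x - s'.c))
    have hp : 0 ≤ p := wt_nonneg _
    have hp' : 0 ≤ p' := wt_nonneg _
    have h3 : p ^ (N + 2) * p' ^ N ≤ W := by
      have h4 : p' ≤ wt (2 ^ (-s.k) * (x - s'.c)) := by
        apply wt_abs_anti
        rw [abs_mul, abs_mul, abs_of_pos hq, abs_of_pos hq']
        gcongr
      calc p ^ (N + 2) * p' ^ N ≤ p ^ N * wt (2 ^ (-s.k) * (x - s'.c)) ^ N := by
            have := wt_pow_anti (by omega : N ≤ N + 2) (2 ^ (-s.k) * (x - s.c))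
            gcongr
        _ = wt (-(2 ^ (-s.k) * (x - s.c))) ^ N * wt (2 ^ (-s.k) * (x - s'.c)) ^ N := by
            rw [wt_neg]
        _ ≤ W := by
            refine (wt_pow_mul_le N _ _).trans (le_of_eq ?_)
            simp only [W]; congr 2; ring
    calc _ ≤ (D * A * (2 ^ (-s.k) * p ^ (N + 2))) * (D * A' * (2 ^ (-s'.k) * p' ^ (N + 2))) := by
          apply mul_le_mul h1 h2 (norm_nonneg _); positivity
      _ = (D ^ 2 * A * A' * (2 ^ (-s.k) * (2 ^ (-s'.k) * p' ^ 2))) * (p ^ (N + 2) * p' ^ N) := by ring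
      _ ≤ (D ^ 2 * A * A' * (2 ^ (-s.k) * (2 ^ (-s'.k) * p' ^ 2))) * W := by gcongr
      _ = _ := by ring
  refine (norm_integral_le_of_norm_le
    (((integrable_wt_pow le_rfl hq' s'.c).const_mul _).const_mul _) (ae_of_all _ key)).trans ?_
  rw [integral_const_mul, integral_const_mul]
  have h5 : 2 ^ (-s'.k) * ∫ x, wt (2 ^ (-s'.k) * (x - s'.c)) ^ 2 ≤ 4 := by
    have := integral_wt_pow_le le_rfl hq' s'.c
    calc _ ≤ (2 : ℝ) ^ (-s'.k) * (4 / 2 ^ (-s'.k)) := by gcongr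
      _ = 4 := by field_simp
  calc _ ≤ D ^ 2 * A * A' * (2 ^ (-s.k) * W) * 4 := by gcongr
    _ = _ := by simp only [prC, ← hD]; ring

/-- Frequency disjointness of tiles. -/
def FD (s s' : Tile) : Prop := ∀ ζ, s.sy rho ζ * s'.sy rho ζ = 0

lemma pr_eq_zero {f : ℝ → ℂ} (hf : BI f) {s s' : Tile} (h : FD s s') : pr f s s' = 0 := by
  rw [pr, norm_eq_zero]
  exact cv_orthogonal (symb_rho.sy s) (symb_rho.sy s') h (BI_as hf s).int (BI_as hf s').int

lemma not_FD {s s' : Tile} (h : ¬ FD s s') : ∃ ζ : ℝ, (-10 < 2 ^ s.k * ζ - s.n ∧ 2 ^ s.k * ζ - s.n < -2)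
    ∧ (-10 < 2 ^ s'.k * ζ - s'.n ∧ 2 ^ s'.k * ζ - s'.n < -2) := by
  unfold FD at h
  push Not at h
  obtain ⟨ζ, hζ⟩ := h
  exact ⟨ζ, rho_ne_zero (left_ne_zero_of_mul hζ), rho_ne_zero (right_ne_zero_of_mul hζ)⟩

/-- Sums over tiles of a fixed scale with frequency indices in a fixed finite set. -/
lemma sum_tiles_le (S : Finset Tile) (k : ℤ) (A : Finset ℤ) (g : ℤ → ℝ) (hg : ∀ m, 0 ≤ g m) {B : ℝ}
    (hB : ∀ M : Finset ℤ, ∑ m ∈ M, g m ≤ B) (h : ∀ s ∈ S, s.k = k ∧ s.n ∈ A) :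
    ∑ s ∈ S, g s.m ≤ A.card * B := by
  have hsub : S ⊆ {k} ×ˢ ((S.image fun s => s.m) ×ˢ A) := by
    intro s hs
    simp only [Finset.mem_product, Finset.mem_singleton, Finset.mem_image]
    exact ⟨(h s hs).1, ⟨s, hs, rfl⟩, (h s hs).2⟩
  calc ∑ s ∈ S, g s.m ≤ ∑ s ∈ {k} ×ˢ ((S.image fun s => s.m) ×ˢ A), g s.2.1 :=
        Finset.sum_le_sum_of_subset_of_nonneg hsub fun s _ _ => hg _
    _ = ∑ n ∈ A, ∑ m ∈ S.image fun s => s.m, g m := by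
        rw [Finset.sum_product, Finset.sum_singleton, Finset.sum_product_right]
    _ ≤ ∑ n ∈ A, B := Finset.sum_le_sum fun n _ => hB _
    _ = A.card * B := by simp

/-- The same-scale part of the sum of pairings. -/
lemma sum_pr_same_scale {f : ℝ → ℂ} (hf : BI f) (S : Finset Tile) :
    ∑ s ∈ S, ∑ s' ∈ S with s'.k = s.k, pr f s s' ≤ 240 * prC 2 * ∑ s ∈ S, en f s := by
  set w : Tile → Tile → ℝ := fun s s' =>
    if s'.k = s.k ∧ s'.n ∈ Finset.Icc (s.n - 7) (s.n + 7) then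
      wt (2 ^ (-s.k) * (s.c - s'.m * 2 ^ s.k)) ^ 2 else 0 with hw
  have hw0 : ∀ s s', 0 ≤ w s s' := fun s s' => by
    simp only [hw]; split_ifs <;> positivity
  have hsymm : ∀ s s', w s s' = w s' s := by
    intro s s'
    simp only [hw, Finset.mem_Icc, Tile.c]
    by_cases h : s'.k = s.k
    · rw [h]
      congr 1
      · simp only [true_and, eq_iff_iff]; constructor <;> rintro ⟨h1, h2⟩ <;> constructor <;> omega
      · rw [← wt_neg]; congr 2; ring
    · rw [if_neg (fun h' => h h'.1), if_neg (fun h' => h h'.1.symm)]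
  have hsum : ∀ s, ∑ s' ∈ S, w s s' ≤ 240 := by
    intro s
    simp only [hw, ← Finset.sum_filter]
    refine (sum_tiles_le _ s.k (Finset.Icc (s.n - 7) (s.n + 7))
      (fun m => wt (2 ^ (-s.k) * (s.c - m * 2 ^ s.k)) ^ 2) (fun m => by positivity)
      (sum_wt_dy_le le_rfl s.k s.c) (fun s' hs' => (Finset.mem_filter.1 hs').2)).trans ?_
    rw [Int.card_Icc, show (s.n + 7 + 1 - (s.n - 7)) = (15 : ℕ) by push_cast; ring, Int.toNat_natCast]
    norm_num
  have hpt : ∀ s s', s'.k = s.k → pr f s s' ≤ prC 2 / 2 * (w s s' * (en f s + en f s')) := by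
    intro s s' hk
    by_cases hn : s'.n ∈ Finset.Icc (s.n - 7) (s.n + 7)
    · have h1 := pr_le hf 2 hk.le
      have h2 := integral_as_sq_le hf s
      have h3 := integral_as_sq_le hf s'
      rw [hk] at h3
      simp only [hw, hk, hn, true_and, if_true]
      have h4 : s'.c = s'.m * 2 ^ s.k := by rw [Tile.c, hk]
      rw [h4] at h1
      set A := ∫ y, ‖as f s y‖
      set A' := ∫ y, ‖as f s' y‖
      set W := wt (2 ^ (-s.k) * (s.c - s'.m * 2 ^ s.k)) ^ 2
      have hpq : (2 : ℝ) ^ (-s.k) * 2 ^ s.k = 1 := by rw [← zpow_add₀ (by norm_num)]; simp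
      have hq : (0 : ℝ) < 2 ^ (-s.k) := by positivity
      have h5 : 2 ^ (-s.k) * (A * A') ≤ (en f s + en f s') / 2 := by
        have : 2 * (A * A') ≤ 2 ^ s.k * (en f s + en f s') := by nlinarith [sq_nonneg (A - A')]
        calc 2 ^ (-s.k) * (A * A') ≤ 2 ^ (-s.k) * (2 ^ s.k * (en f s + en f s') / 2) := by
              gcongr; linarith
          _ = (en f s + en f s') / 2 := by rw [← mul_div_assoc, ← mul_assoc, hpq, one_mul]
      have hC := prC_pos 2
      calc _ ≤ prC 2 * A * A' * (2 ^ (-s.k) * W) := h1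
        _ = prC 2 * W * (2 ^ (-s.k) * (A * A')) := by ring
        _ ≤ prC 2 * W * ((en f s + en f s') / 2) := by gcongr
        _ = _ := by ring
    · rw [pr_eq_zero hf]
      · have := prC_pos 2
        have := hw0 s s'
        have := en_nonneg f s
        have := en_nonneg f s'
        positivity
      · by_contra hFD
        obtain ⟨ζ, ⟨h1, h2⟩, h3, h4⟩ := not_FD hFD
        rw [hk] at h3 h4
        apply hn
        have h5 : (s.n : ℝ) < s'.n + 8 := by linarith
        have h6 : (s'.n : ℝ) < s.n + 8 := by linarith
        norm_cast at h5 h6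
        rw [Finset.mem_Icc]; omega
  have hC := prC_pos 2
  calc ∑ s ∈ S, ∑ s' ∈ S with s'.k = s.k, pr f s s'
      ≤ ∑ s ∈ S, ∑ s' ∈ S, prC 2 / 2 * (w s s' * (en f s + en f s')) := by
        refine Finset.sum_le_sum fun s _ => ?_
        refine (Finset.sum_le_sum fun s' hs' => hpt s s' (Finset.mem_filter.1 hs').2).trans ?_
        refine Finset.sum_le_sum_of_subset_of_nonneg (Finset.filter_subset _ _) fun s' _ _ => ?_
        have := hw0 s s'
        have := en_nonneg f s
        have := en_nonneg f s'
        positivity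
    _ = prC 2 / 2 * (∑ s ∈ S, ∑ s' ∈ S, w s s' * en f s + ∑ s ∈ S, ∑ s' ∈ S, w s s' * en f s') := by
        simp_rw [← Finset.mul_sum, mul_add, Finset.sum_add_distrib, mul_add]
    _ = prC 2 * ∑ s ∈ S, (∑ s' ∈ S, w s s') * en f s := by
        rw [Finset.sum_comm (f := fun s s' => w s s' * en f s')]
        simp_rw [fun s s' => hsymm s' s, Finset.sum_mul]
        ring
    _ ≤ prC 2 * ∑ s ∈ S, 240 * en f s := by
        gcongr with s hs
        · exact en_nonneg f s
        · exact hsum s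
    _ = _ := by rw [← Finset.mul_sum]; ring

/-- Bessel inequality for collections in which distinct scales are frequency disjoint. -/
lemma bessel {f : ℝ → ℂ} (hf : BI f) (S : Finset Tile)
    (h : ∀ s ∈ S, ∀ s' ∈ S, s'.k ≠ s.k → FD s s') :
    ∑ s ∈ S, en f s ≤ 240 * prC 2 * ∫ x, ‖f x‖ ^ 2 := by
  apply sum_en_le_of_pairs hf S (by have := prC_pos 2; positivity)
  refine le_trans (le_of_eq ?_) (sum_pr_same_scale hf S)
  refine Finset.sum_congr rfl fun s hs => ?_
  rw [Finset.sum_filter]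
  refine Finset.sum_congr rfl fun s' hs' => ?_
  split_ifs with hk
  · rfl
  · exact pr_eq_zero hf (h s hs s' hs' hk)

/-! ### Tree tops, density and size -/

/-- A tree top: scale, space index, frequency. -/
abbrev TTop := ℤ × ℤ × ℝ

namespace TTop
/-- scale -/
abbrev K (t : TTop) : ℤ := t.1
/-- space index -/
abbrev M (t : TTop) : ℤ := t.2.1
/-- frequency -/
abbrev ξ (t : TTop) : ℝ := t.2.2
/-- top interval -/
def I (t : TTop) : Set ℝ := dy t.K t.M
end TTop

/-- The tile `s` lies in the tree with top `t`, with frequency offset between `a` and `b`. -/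
def UnderR (a b : ℤ) (s : Tile) (t : TTop) : Prop :=
  s.k ≤ t.K ∧ ix (-t.K) s.c = t.M ∧ a ≤ s.n - ix s.k t.ξ ∧ s.n - ix s.k t.ξ ≤ b

lemma UnderR.mono {a b a' b' : ℤ} {s : Tile} {t : TTop} (h : UnderR a b s t) (ha : a' ≤ a)
    (hb : b ≤ b') : UnderR a' b' s t := ⟨h.1, h.2.1, ha.trans h.2.2.1, h.2.2.2.trans hb⟩

/-- Collections covered by trees with tops of total length at most `B`. -/
def Cov (S : Finset Tile) (B : ℝ) : Prop :=
  ∃ 𝒯 : Finset TTop, (∀ s ∈ S, ∃ t ∈ 𝒯, UnderR 0 10 s t) ∧ ∑ t ∈ 𝒯, (2 : ℝ) ^ t.K ≤ B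

lemma sum_image_le_sum_of_nonneg {ι κ : Type*} [DecidableEq κ] (P : Finset ι) (t : ι → κ)
    (g : κ → ℝ) (hg : ∀ x, 0 ≤ g x) : ∑ x ∈ P.image t, g x ≤ ∑ i ∈ P, g (t i) := by
  classical
  rw [← Finset.sum_fiberwise_of_maps_to (s := P) (t := P.image t) (g := t)
    (fun i hi => Finset.mem_image_of_mem t hi)]
  refine Finset.sum_le_sum fun x hx => ?_
  obtain ⟨i, hi, rfl⟩ := Finset.mem_image.1 hx
  exact Finset.single_le_sum (f := fun j => g (t j)) (fun j _ => hg _)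
    (Finset.mem_filter.2 ⟨hi, rfl⟩)

/-- Size bound of a collection. -/
def SizeLe (f : ℝ → ℂ) (S : Finset Tile) (σ : ℝ) : Prop :=
  ∀ t : TTop, ∀ T ⊆ S, (∀ s ∈ T, UnderR 0 1 s t) → ∑ s ∈ T, en f s ≤ σ ^ 2 * 2 ^ t.K

/-- The part of `E` where `N` is near `η` and `x` is near `c`. -/
def dset (N : ℝ → ℝ) (E : Set ℝ) (c : ℝ) (k : ℤ) (η : ℝ) (j : ℕ) : Set ℝ :=
  {x | x ∈ E ∧ ix k (N x) = ix k η ∧ |x - c| ≤ 2 ^ (k + j)}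

/-- Density bound of a collection. -/
def DensLe (N : ℝ → ℝ) (E : Set ℝ) (S : Finset Tile) (δ : ℝ) : Prop :=
  ∀ s ∈ S, ∀ k, s.k ≤ k → ∀ η, 0 ≤ s.n - ix s.k η → s.n - ix s.k η ≤ 10 → ∀ j : ℕ,
    volume.real (dset N E s.c k η j) ≤ δ * 4 ^ j * 2 ^ k

lemma measurableSet_dset {N : ℝ → ℝ} (hN : Measurable N) {E : Set ℝ} (hE : MeasurableSet E)
    (c : ℝ) (k : ℤ) (η : ℝ) (j : ℕ) : MeasurableSet (dset N E c k η j) := by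
  refine hE.inter (((measurable_ix k).comp hN (measurableSet_singleton (ix k η))).inter ?_)
  have : Measurable fun x : ℝ => |x - c| := by fun_prop
  exact this measurableSet_Iic

/-- Density selection. -/
lemma density_cov {N : ℝ → ℝ} (hN : Measurable N) {E : Set ℝ} (hE : MeasurableSet E)
    (hEf : volume E ≠ ⊤) {S : Finset Tile} {δ : ℝ} (hδ : 0 < δ)
    (h : ∀ s ∈ S, ∃ k, s.k ≤ k ∧ ∃ η, 0 ≤ s.n - ix s.k η ∧ s.n - ix s.k η ≤ 10 ∧ ∃ j : ℕ,
      δ * 4 ^ j * 2 ^ k < volume.real (dset N E s.c k η j)) :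
    Cov S (16 * δ⁻¹ * volume.real E) := by
  classical
  choose! k hk η hη0 hη1 j hj using h
  set A : Tile → Set ℝ := fun s => dset N E s.c (k s) (η s) (j s) with hA
  have hAm : ∀ s, MeasurableSet (A s) := fun s => measurableSet_dset hN hE _ _ _ _
  have hAE : ∀ s, A s ⊆ E := fun s x hx => hx.1
  have hne : ∀ s ∈ S, (A s).Nonempty := by
    intro s hs
    by_contra hempty
    have := hj s hs
    rw [Set.not_nonempty_iff_eq_empty] at hempty
    simp only [hA] at hempty
    rw [hempty, measureReal_empty] at this
    have : 0 < δ * 4 ^ j s * 2 ^ k s := by positivity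
    linarith
  have hV : ∀ i : ℕ, ∃ u ⊆ {s : Tile | s ∈ S ∧ j s = i}, u.PairwiseDisjoint A ∧
      ∀ a ∈ {s : Tile | s ∈ S ∧ j s = i}, ∃ b ∈ u, (A a ∩ A b).Nonempty ∧
        (2 : ℝ) ^ k a ≤ 3 / 2 * 2 ^ k b := by
    intro i
    obtain ⟨R, hR⟩ := (S.image fun s => (2 : ℝ) ^ k s).bddAbove
    exact Vitali.exists_disjoint_subfamily_covering_enlargement A {s | s ∈ S ∧ j s = i}
      (fun s => (2 : ℝ) ^ k s) (3 / 2) (by norm_num) (fun s _ => by positivity) R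
      (fun s hs => hR (by
        simp only [Finset.coe_image, Set.mem_image, SetLike.mem_coe]
        exact ⟨s, hs.1, rfl⟩)) (fun s hs => hne s hs.1)
  choose u hu hud hcov using hV
  choose! q hq using fun s (hs : s ∈ S) => hcov (j s) s ⟨hs, rfl⟩
  have hkk : ∀ s ∈ S, k s ≤ k (q s) := by
    intro s hs
    by_contra hlt
    have h1 := (hq s hs).2.2
    have h2 : (2 : ℝ) ^ (k (q s) + 1) ≤ 2 ^ k s := zpow_le_zpow_right₀ (by norm_num) (by omega)
    rw [zpow_add_one₀ (by norm_num)] at h2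
    have : (0 : ℝ) < 2 ^ k (q s) := by positivity
    linarith
  have hqS : ∀ s ∈ S, q s ∈ S ∧ j (q s) = j s := fun s hs => hu _ (hq s hs).1
  -- tops attached to a selected tile
  set P : Tile → Finset TTop := fun p =>
    (Finset.Icc (ix (-k p) p.c - 2 ^ (j p + 1)) (ix (-k p) p.c + 2 ^ (j p + 1))).image
      fun M => (k p, M, η p) with hP
  have hPsum : ∀ p, ∑ t ∈ P p, (2 : ℝ) ^ t.K ≤ 8 * 2 ^ j p * 2 ^ k p := by
    intro p
    refine (sum_image_le_sum_of_nonneg _ _ (fun t : TTop => (2 : ℝ) ^ t.K)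
      (fun t => by positivity)).trans ?_
    simp only [TTop.K, Finset.sum_const, Int.card_Icc, nsmul_eq_mul]
    gcongr
    have : (ix (-k p) p.c + 2 ^ (j p + 1) + 1 - (ix (-k p) p.c - 2 ^ (j p + 1)))
        = ((2 * 2 ^ (j p + 1) + 1 : ℕ) : ℤ) := by push_cast; ring
    rw [this, Int.toNat_natCast]
    push_cast
    have : (1 : ℝ) ≤ 2 ^ j p := one_le_pow₀ (by norm_num)
    rw [pow_succ]; linarith
  refine ⟨S.image fun s => (k (q s), ix (-k (q s)) s.c, η (q s)),
    fun s hs => ⟨_, Finset.mem_image_of_mem _ hs, ?_⟩, ?_⟩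
  · obtain ⟨x, hx, hx'⟩ := (hq s hs).2.1
    refine ⟨(hk s hs).trans (hkk s hs), rfl, ?_⟩
    have h1 : ix (k s) (η (q s)) = ix (k s) (η s) := by
      rw [← hx.2.1]; exact (ix_congr (hkk s hs) hx'.2.1).symm
    have h2 := ix_congr (hk s hs) h1
    simp only [TTop.ξ]
    rw [h2]
    exact ⟨hη0 s hs, hη1 s hs⟩
  set U : Finset Tile := S.image q with hU
  have hsub2 : (S.image fun s => ((k (q s), ix (-k (q s)) s.c, η (q s)) : TTop)) ⊆ U.biUnion P := by
    intro t ht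
    obtain ⟨s, hs, rfl⟩ := Finset.mem_image.1 ht
    refine Finset.mem_biUnion.2 ⟨q s, Finset.mem_image_of_mem _ hs, ?_⟩
    refine Finset.mem_image.2 ⟨_, ?_, rfl⟩
    obtain ⟨x, hx, hx'⟩ := (hq s hs).2.1
    have h1 : |s.c - (q s).c| ≤ 2 ^ (j s + 1) * 2 ^ k (q s) := by
      have h2 := hx.2.2
      have h3 := hx'.2.2
      rw [(hqS s hs).2] at h3
      have h4 : (2 : ℝ) ^ (k s + j s) ≤ 2 ^ (k (q s) + j s) :=
        zpow_le_zpow_right₀ (by norm_num) (by have := hkk s hs; omega)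
      have h5 : (2 : ℝ) ^ (k (q s) + j s) = 2 ^ j s * 2 ^ k (q s) := by
        rw [zpow_add₀ (by norm_num), zpow_natCast, mul_comm]
      rw [h5] at h3 h4
      have := abs_sub_le s.c x (q s).c
      rw [abs_sub_comm s.c x] at this
      rw [pow_succ]; linarith
    have h6 := ix_abs_sub_lt (k := -k (q s)) (x := s.c) (y := (q s).c)
    have h7 : |s.c - (q s).c| * 2 ^ (-k (q s)) ≤ 2 ^ (j s + 1) := by
      rw [zpow_neg, ← div_eq_mul_inv, div_le_iff₀ (by positivity)]; exact h1
    have h8 : |(ix (-k (q s)) s.c : ℝ) - ix (-k (q s)) (q s).c| < 2 ^ (j s + 1) + 1 := by linarith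
    have h9 : |ix (-k (q s)) s.c - ix (-k (q s)) (q s).c| < 2 ^ (j s + 1) + 1 := by exact_mod_cast h8
    rw [Int.lt_add_one_iff, abs_le] at h9
    rw [Finset.mem_Icc, (hqS s hs).2]
    constructor <;> omega
  have hUS : ∀ p ∈ U, p ∈ S ∧ p ∈ u (j p) := by
    intro p hp
    obtain ⟨s, hs, rfl⟩ := Finset.mem_image.1 hp
    exact ⟨(hqS s hs).1, by rw [(hqS s hs).2]; exact (hq s hs).1⟩
  have hlevel : ∀ i : ℕ, ∑ p ∈ U with j p = i, (2 : ℝ) ^ k p ≤ δ⁻¹ * (1 / 4) ^ i * volume.real E := by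
    intro i
    have h1 : ∑ p ∈ U with j p = i, δ * 4 ^ i * (2 : ℝ) ^ k p ≤ volume.real E := by
      calc _ ≤ ∑ p ∈ U with j p = i, volume.real (A p) := by
            refine Finset.sum_le_sum fun p hp => ?_
            have hp2 := Finset.mem_filter.1 hp
            rw [← hp2.2]
            exact (hj p (hUS p hp2.1).1).le
        _ = volume.real (⋃ p ∈ U.filter fun p => j p = i, A p) := by
            refine (measureReal_biUnion_finset ?_ (fun p _ => hAm p)
              (fun p _ => ne_top_of_le_ne_top hEf (measure_mono (hAE p)))).symm
            intro p hp p' hp' hpp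
            simp only [Finset.coe_filter, mem_ofPred_eq] at hp hp'
            exact hud i (by rw [← hp.2]; exact (hUS p hp.1).2)
              (by rw [← hp'.2]; exact (hUS p' hp'.1).2) hpp
        _ ≤ volume.real E := measureReal_mono (Set.iUnion₂_subset fun p _ => hAE p) hEf
    rw [← Finset.mul_sum] at h1
    have h4 : (δ * 4 ^ i)⁻¹ = δ⁻¹ * (1 / 4) ^ i := by rw [mul_inv, one_div, inv_pow]
    rw [← h4, ← div_eq_inv_mul, le_div_iff₀ (by positivity), mul_comm]
    exact h1
  calc _ ≤ ∑ t ∈ U.biUnion P, (2 : ℝ) ^ t.K :=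
        Finset.sum_le_sum_of_subset_of_nonneg hsub2 fun t _ _ => by positivity
    _ ≤ ∑ p ∈ U, ∑ t ∈ P p, (2 : ℝ) ^ t.K := by
        have : U.biUnion P = (U.sigma P).image fun x => x.2 := by ext t; simp
        rw [this, Finset.sum_sigma']
        exact sum_image_le_sum_of_nonneg _ _ (fun t : TTop => (2 : ℝ) ^ t.K) (fun t => by positivity)
    _ ≤ ∑ p ∈ U, 8 * 2 ^ j p * 2 ^ k p := Finset.sum_le_sum fun p _ => hPsum p
    _ = ∑ i ∈ U.image j, ∑ p ∈ U with j p = i, 8 * 2 ^ j p * 2 ^ k p :=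
        (Finset.sum_fiberwise_of_maps_to (fun p hp => Finset.mem_image_of_mem j hp) _).symm
    _ = ∑ i ∈ U.image j, 8 * 2 ^ i * ∑ p ∈ U with j p = i, (2 : ℝ) ^ k p := by
        refine Finset.sum_congr rfl fun i _ => ?_
        rw [Finset.mul_sum]
        refine Finset.sum_congr rfl fun p hp => ?_
        rw [(Finset.mem_filter.1 hp).2]
    _ ≤ ∑ i ∈ U.image j, 8 * 2 ^ i * (δ⁻¹ * (1 / 4) ^ i * volume.real E) := by
        gcongr with i _
        exact hlevel i
    _ = 8 * δ⁻¹ * volume.real E * ∑ i ∈ U.image j, (1 / 2 : ℝ) ^ i := by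
        rw [Finset.mul_sum]
        refine Finset.sum_congr rfl fun i _ => ?_
        have : (1 / 2 : ℝ) ^ i = 2 ^ i * (1 / 4) ^ i := by rw [← mul_pow]; norm_num
        rw [this]; ring
    _ ≤ 8 * δ⁻¹ * volume.real E * 2 := by
        gcongr
        calc _ ≤ ∑' d : ℕ, (1 / 2 : ℝ) ^ d :=
              Summable.sum_le_tsum _ (fun _ _ => by positivity) summable_geometric_two
          _ = 2 := tsum_geometric_two
    _ = _ := by ring

/-! ### Size selection -/

lemma UnderR.zero_one_iff {s : Tile} {t : TTop} : (0 ≤ s.n - ix s.k t.ξ ∧ s.n - ix s.k t.ξ ≤ 1) ↔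
    s.n - 1 ≤ 2 ^ s.k * t.ξ ∧ 2 ^ s.k * t.ξ < s.n + 1 := by
  have h1 : (0 ≤ s.n - ix s.k t.ξ ∧ s.n - ix s.k t.ξ ≤ 1) ↔ (s.n - 1 ≤ ix s.k t.ξ ∧ ix s.k t.ξ < s.n + 1) := by
    constructor <;> rintro ⟨a, b⟩ <;> constructor <;> omega
  rw [h1, ix, Int.le_floor, Int.floor_lt, mul_comm (t.ξ)]
  push_cast
  rfl

lemma ix_c (s : Tile) : ix (-s.k) s.c = s.m := by
  rw [ix_eq_iff, neg_neg, Tile.c]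
  have : (0 : ℝ) < 2 ^ s.k := by positivity
  constructor <;> nlinarith

lemma ix_top_of_mem {s : Tile} {K : ℤ} (h : s.k ≤ K) {y : ℝ} (hy : y ∈ s.I) :
    ix (-K) y = ix (-K) s.c :=
  ix_congr (neg_le_neg h) ((show ix (-s.k) y = s.m from hy).trans (ix_c s).symm)

lemma outside_sum (T : Finset Tile) (t : TTop) (hT : ∀ s ∈ T, UnderR 0 10 s t) :
    ∑ s ∈ T, ∫ y in t.Iᶜ, wt (2 ^ (-s.k) * (y - s.c)) ^ 4 ≤ 2816 * 2 ^ t.K := by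
  classical
  set L : ℝ := t.M * 2 ^ t.K with hL
  set R : ℝ := (t.M + 1) * 2 ^ t.K with hR
  have hI : ∀ y, y ∉ t.I → y < L ∨ R ≤ y := by
    intro y hy
    rw [TTop.I, dy_eq, mem_Ico, not_and_or, not_le, not_lt] at hy
    exact hy
  have hc : ∀ s ∈ T, L ≤ s.c ∧ s.c < R := by
    intro s hs
    have := ix_eq_iff.1 (hT s hs).2.1
    rwa [neg_neg] at this
  have hpos : ∀ k : ℤ, (0 : ℝ) < 2 ^ (-k) := fun k => by positivity
  have hint : ∀ (k : ℤ) (c : ℝ) (N : ℕ), 2 ≤ N → Integrable fun y => wt (2 ^ (-k) * (y - c)) ^ N :=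
    fun k c N hN => integrable_wt_pow hN (hpos k) c
  have hscale : ∀ k : ℤ, ∑ s ∈ T with s.k = k, ∫ y in t.Iᶜ, wt (2 ^ (-s.k) * (y - s.c)) ^ 4
      ≤ 1408 * 2 ^ k := by
    intro k
    have hg : Integrable fun y =>
        176 * (wt (2 ^ (-k) * (y - L)) ^ 2 + wt (2 ^ (-k) * (y - R)) ^ 2) :=
      ((hint k L 2 le_rfl).add (hint k R 2 le_rfl)).const_mul _
    have hswap : ∑ s ∈ T with s.k = k, ∫ y in t.Iᶜ, wt (2 ^ (-s.k) * (y - s.c)) ^ 4 =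
        ∫ y in t.Iᶜ, ∑ s ∈ T with s.k = k, wt (2 ^ (-s.k) * (y - s.c)) ^ 4 :=
      (integral_finsetSum _ fun s _ => Integrable.restrict (hint s.k s.c 4 (by norm_num))).symm
    rw [hswap]
    calc ∫ y in t.Iᶜ, ∑ s ∈ T with s.k = k, wt (2 ^ (-s.k) * (y - s.c)) ^ 4
        ≤ ∫ y in t.Iᶜ, 176 * (wt (2 ^ (-k) * (y - L)) ^ 2 + wt (2 ^ (-k) * (y - R)) ^ 2) := by
          refine setIntegral_mono_on
            (integrable_finsetSum _ fun s _ => hint s.k s.c 4 (by norm_num)).integrableOn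
            hg.integrableOn (measurableSet_dy _ _).compl fun y hy => ?_
          have h2 : ∑ s ∈ T with s.k = k, wt (2 ^ (-k) * (y - s.m * 2 ^ k)) ^ 2 ≤ 176 := by
            refine (sum_tiles_le _ k (Finset.Icc (ix k t.ξ) (ix k t.ξ + 10))
              (fun m => wt (2 ^ (-k) * (y - m * 2 ^ k)) ^ 2) (fun m => by positivity)
              (sum_wt_dy_le le_rfl k y) ?_).trans ?_
            · intro s hs
              obtain ⟨hs1, rfl⟩ := Finset.mem_filter.1 hs
              refine ⟨rfl, Finset.mem_Icc.2 ?_⟩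
              have := (hT s hs1).2.2
              omega
            · rw [Int.card_Icc, show (ix k t.ξ + 10 + 1 - ix k t.ξ) = (11 : ℕ) by push_cast; ring,
                Int.toNat_natCast]
              norm_num
          calc _ ≤ ∑ s ∈ T with s.k = k, wt (2 ^ (-k) * (y - s.m * 2 ^ k)) ^ 2 *
                (wt (2 ^ (-k) * (y - L)) ^ 2 + wt (2 ^ (-k) * (y - R)) ^ 2) := by
                refine Finset.sum_le_sum fun s hs => ?_
                obtain ⟨hs1, rfl⟩ := Finset.mem_filter.1 hs
                rw [show (4 : ℕ) = 2 + 2 from rfl, pow_add]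
                refine mul_le_mul_of_nonneg_left ?_ (by positivity)
                have hcs := hc s hs1
                have hmono : ∀ z : ℝ, |y - z| ≤ |y - s.c| → wt (2 ^ (-s.k) * (y - s.c)) ^ 2 ≤
                    wt (2 ^ (-s.k) * (y - z)) ^ 2 := by
                  intro z hz
                  refine pow_le_pow_left₀ (wt_nonneg _) (wt_abs_anti ?_) 2
                  rw [abs_mul, abs_mul]
                  gcongr
                rcases hI y hy with h | h
                · refine (hmono L ?_).trans (le_add_of_nonneg_right (by positivity))
                  rw [abs_of_neg (by linarith), abs_of_neg (by linarith)]; linarith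
                · refine (hmono R ?_).trans (le_add_of_nonneg_left (by positivity))
                  rw [abs_of_nonneg (by linarith), abs_of_nonneg (by linarith)]; linarith
            _ ≤ _ := by
                rw [← Finset.sum_mul]
                exact mul_le_mul_of_nonneg_right h2 (by positivity)
      _ ≤ ∫ y, 176 * (wt (2 ^ (-k) * (y - L)) ^ 2 + wt (2 ^ (-k) * (y - R)) ^ 2) :=
          setIntegral_le_integral hg (Filter.Eventually.of_forall fun y => by positivity)
      _ ≤ 176 * (4 / 2 ^ (-k) + 4 / 2 ^ (-k)) := by
          rw [integral_const_mul, integral_add (hint k L 2 le_rfl) (hint k R 2 le_rfl)]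
          gcongr <;> exact integral_wt_pow_le le_rfl (hpos k) _
      _ = _ := by rw [zpow_neg, div_inv_eq_mul]; ring
  calc _ = ∑ k ∈ T.image (fun s => s.k), ∑ s ∈ T with s.k = k,
        ∫ y in t.Iᶜ, wt (2 ^ (-s.k) * (y - s.c)) ^ 4 :=
        (Finset.sum_fiberwise_of_maps_to (fun s hs => Finset.mem_image_of_mem _ hs) _).symm
    _ ≤ ∑ k ∈ T.image (fun s => s.k), 1408 * (2 : ℝ) ^ k := Finset.sum_le_sum fun k _ => hscale k
    _ ≤ 1408 * (2 * 2 ^ t.K) := by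
        rw [← Finset.mul_sum]
        gcongr
        refine sum_zpow_le _ _ fun k hk => ?_
        obtain ⟨s, hs, rfl⟩ := Finset.mem_image.1 hk
        exact (hT s hs).1
    _ = _ := by ring

/-- A top violating the size bound. -/
def Viol (f : ℝ → ℂ) (S : Finset Tile) (σ : ℝ) (t : TTop) : Prop :=
  ∃ T ⊆ S, (∀ s ∈ T, UnderR 0 1 s t) ∧ σ ^ 2 * 2 ^ t.K < ∑ s ∈ T, en f s

lemma exists_min_viol {f : ℝ → ℂ} {S : Finset Tile} {σ : ℝ} (h : ¬ SizeLe f S σ) :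
    ∃ t, Viol f S σ t ∧ ∀ t', Viol f S σ t' → t.ξ ≤ t'.ξ := by
  classical
  set g : Tile → ℝ := fun s => (s.n - 1) * 2 ^ (-s.k) with hg
  have hnorm : ∀ t, Viol f S σ t → ∃ ξ ∈ S.image g, ξ ≤ t.ξ ∧ Viol f S σ (t.K, t.M, ξ) := by
    rintro t ⟨T, hTS, hT, hlt⟩
    have hne : T.Nonempty := by
      rw [Finset.nonempty_iff_ne_empty]
      rintro rfl
      rw [Finset.sum_empty] at hlt
      have : 0 ≤ σ ^ 2 * (2 : ℝ) ^ t.K := by positivity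
      linarith
    obtain ⟨s0, hs0, hmax⟩ := T.exists_max_image g hne
    have key : ∀ s : Tile, ∀ ξ : ℝ, (s.n - 1 ≤ 2 ^ s.k * ξ ↔ g s ≤ ξ) := by
      intro s ξ
      have : (0 : ℝ) < 2 ^ s.k := by positivity
      simp only [hg, zpow_neg, ← div_eq_mul_inv]
      rw [div_le_iff₀ this, mul_comm]
    have hle : g s0 ≤ t.ξ := (key _ _).1 (UnderR.zero_one_iff.1 (hT s0 hs0).2.2).1
    refine ⟨g s0, Finset.mem_image_of_mem _ (hTS hs0), hle, T, hTS, fun s hs => ⟨(hT s hs).1, (hT s hs).2.1, ?_⟩, hlt⟩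
    refine UnderR.zero_one_iff.2 ⟨(key _ _).2 (hmax s hs), lt_of_le_of_lt ?_ (UnderR.zero_one_iff.1 (hT s hs).2.2).2⟩
    exact mul_le_mul_of_nonneg_left hle (by positivity)
  have hex : ∃ t, Viol f S σ t := by
    unfold SizeLe at h
    push Not at h
    obtain ⟨t, T, h1, h2, h3⟩ := h
    exact ⟨t, T, h1, h2, h3⟩
  set X := (S.image g).filter fun ξ => ∃ K M, Viol f S σ (K, M, ξ) with hX
  have hXne : X.Nonempty := by
    obtain ⟨t, ht⟩ := hex
    obtain ⟨ξ, h1, -, h3⟩ := hnorm t ht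
    exact ⟨ξ, Finset.mem_filter.2 ⟨h1, _, _, h3⟩⟩
  obtain ⟨ξ, hξ, hmin⟩ := X.exists_min_image id hXne
  obtain ⟨-, K, M, hV⟩ := Finset.mem_filter.1 hξ
  refine ⟨(K, M, ξ), hV, fun t' ht' => ?_⟩
  obtain ⟨ξ', h1, h2, h3⟩ := hnorm t' ht'
  exact (hmin ξ' (Finset.mem_filter.2 ⟨h1, _, _, h3⟩)).trans h2

/-- Frequency proximity of tiles. -/
def FP (s' s'' : Tile) : Prop := ∃ ζ' ζ'' : ℝ, (-10 < 2 ^ s'.k * ζ' - s'.n ∧ 2 ^ s'.k * ζ' - s'.n < -2) ∧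
  (-10 < 2 ^ s''.k * ζ'' - s''.n ∧ 2 ^ s''.k * ζ'' - s''.n < -2) ∧ 2 ^ s'.k * |ζ' - ζ''| ≤ 1 / 2

lemma FP.contra {s' s'' : Tile} {t' t'' : TTop} (h : FP s' s'') (hk : s''.k + 4 ≤ s'.k)
    (h' : UnderR 0 1 s' t') (h'' : UnderR 0 1 s'' t'') (ht : t''.ξ ≤ t'.ξ) : False := by
  obtain ⟨ζ', ζ'', ⟨h1, h2⟩, ⟨h3, h4⟩, h5⟩ := h
  have a := UnderR.zero_one_iff.1 h'.2.2
  have b := UnderR.zero_one_iff.1 h''.2.2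
  have hp : (0 : ℝ) < 2 ^ s'.k := by positivity
  have hp' : (0 : ℝ) < 2 ^ s''.k := by positivity
  have hpp : (16 : ℝ) * 2 ^ s''.k ≤ 2 ^ s'.k := by
    have : (2 : ℝ) ^ (s''.k + 4) ≤ 2 ^ s'.k := zpow_le_zpow_right₀ (by norm_num) hk
    rw [zpow_add₀ (by norm_num)] at this
    norm_num at this; linarith
  have h6 : (2 : ℝ) ^ s'.k * (ζ' - ζ'') ≤ 1 / 2 :=
    (mul_le_mul_of_nonneg_left (le_abs_self _) hp.le).trans h5
  -- frequencies measured in units of the coarse tile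
  have h7 : (1 : ℝ) < 2 ^ s''.k * (t''.ξ - ζ'') := by linarith
  have h8 : (0 : ℝ) < t''.ξ - ζ'' := by
    by_contra hh
    push Not at hh
    nlinarith
  have h9 : (16 : ℝ) < 2 ^ s'.k * (t''.ξ - ζ'') := by nlinarith
  have h10 : (2 : ℝ) ^ s'.k * t''.ξ ≤ 2 ^ s'.k * t'.ξ := mul_le_mul_of_nonneg_left ht hp.le
  linarith

lemma FP.under {s' s'' : Tile} {t : TTop} (h : FP s' s'') (hk : s''.k + 4 ≤ s'.k)
    (h' : UnderR 0 1 s' t) (hI : ix (-t.K) s''.c = t.M) : UnderR 0 10 s'' t := by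
  obtain ⟨ζ', ζ'', ⟨h1, h2⟩, ⟨h3, h4⟩, h5⟩ := h
  have a := UnderR.zero_one_iff.1 h'.2.2
  have hp : (0 : ℝ) < 2 ^ s'.k := by positivity
  have hp' : (0 : ℝ) < 2 ^ s''.k := by positivity
  have hpp : (16 : ℝ) * 2 ^ s''.k ≤ 2 ^ s'.k := by
    have : (2 : ℝ) ^ (s''.k + 4) ≤ 2 ^ s'.k := zpow_le_zpow_right₀ (by norm_num) hk
    rw [zpow_add₀ (by norm_num)] at this
    norm_num at this; linarith
  have h6 : (2 : ℝ) ^ s'.k * (ζ' - ζ'') ≤ 1 / 2 :=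
    (mul_le_mul_of_nonneg_left (le_abs_self _) hp.le).trans h5
  have h6' : -(1 / 2) ≤ (2 : ℝ) ^ s'.k * (ζ' - ζ'') := by
    have := (mul_le_mul_of_nonneg_left (neg_le_abs (ζ' - ζ'')) hp.le).trans h5
    linarith
  have h7 : 0 < (2 : ℝ) ^ s'.k * (t.ξ - ζ'') := by linarith
  have h8 : (2 : ℝ) ^ s'.k * (t.ξ - ζ'') < 12 := by linarith
  have h9 : 0 < t.ξ - ζ'' := pos_of_mul_pos_right h7 hp.le
  have h10 : (2 : ℝ) ^ s''.k * (t.ξ - ζ'') < 1 := by nlinarith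
  have h11 : 0 < (2 : ℝ) ^ s''.k * (t.ξ - ζ'') := by positivity
  refine ⟨by have := h'.1; omega, hI, ?_⟩
  have h12 : ix s''.k t.ξ < s''.n := by
    rw [ix, Int.floor_lt, mul_comm]; linarith
  have h13 : s''.n - 10 ≤ ix s''.k t.ξ := by
    rw [ix, Int.le_floor, mul_comm]; push_cast; linarith
  constructor <;> omega

lemma size_select (f : ℝ → ℂ) (σ : ℝ) (S : Finset Tile) :
    ∃ S' ⊆ S, SizeLe f S' σ ∧ ∃ (𝒯 : Finset TTop) (T : Finset Tile) (τ : Tile → TTop), T ⊆ S ∧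
      (∀ s ∈ T, τ s ∈ 𝒯 ∧ UnderR 0 1 s (τ s)) ∧
      (∀ t ∈ 𝒯, Viol f S σ t ∧ σ ^ 2 * 2 ^ t.K ≤ ∑ s ∈ T with τ s = t, en f s) ∧
      (∀ s ∈ S, s ∉ S' → ∃ t ∈ 𝒯, UnderR 0 10 s t) ∧
      ∀ s' ∈ T, ∀ s'' ∈ T, s''.k + 4 ≤ s'.k → FP s' s'' → ix (-(τ s').K) s''.c ≠ (τ s').M := by
  classical
  induction S using Finset.strongInduction with
  | H S ih =>
  by_cases hsz : SizeLe f S σ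
  · exact ⟨S, subset_rfl, hsz, ∅, ∅, fun _ => (0, 0, 0), by simp, by simp, by simp,
      fun s hs hs' => absurd hs hs', by simp⟩
  obtain ⟨t, ⟨T0, hT0S, hT0, hlt⟩, hmin⟩ := exists_min_viol hsz
  have hne : T0.Nonempty := by
    rw [Finset.nonempty_iff_ne_empty]
    rintro rfl
    rw [Finset.sum_empty] at hlt
    have : 0 ≤ σ ^ 2 * (2 : ℝ) ^ t.K := by positivity
    linarith
  set S1 := S.filter fun s => ¬ UnderR 0 10 s t with hS1
  have hS1S : S1 ⊆ S := Finset.filter_subset _ _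
  have hT0not : ∀ s ∈ T0, s ∉ S1 := fun s hs hs1 =>
    (Finset.mem_filter.1 hs1).2 ((hT0 s hs).mono le_rfl (by norm_num))
  have hss : S1 ⊂ S := by
    refine (Finset.ssubset_iff_of_subset hS1S).2 ?_
    obtain ⟨s, hs⟩ := hne
    exact ⟨s, hT0S hs, hT0not s hs⟩
  obtain ⟨S', hS'S1, hS'sz, 𝒯, T, τ, hTS, hTτ, h𝒯, hcov, hstar⟩ := ih S1 hss
  have hTn : ∀ s ∈ T, s ∉ T0 := fun s hs hs0 => hT0not s hs0 (hTS hs)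
  set τ' : Tile → TTop := fun s => if s ∈ T0 then t else τ s with hτ'
  have e0 : ∀ s ∈ T0, τ' s = t := fun s hs => if_pos hs
  have e1 : ∀ s ∈ T, τ' s = τ s := fun s hs => if_neg (hTn s hs)
  have hmono : ∀ t', Viol f S1 σ t' → Viol f S σ t' := fun t' ⟨A, hA, hA'⟩ => ⟨A, hA.trans hS1S, hA'⟩
  refine ⟨S', hS'S1.trans hS1S, hS'sz, insert t 𝒯, T0 ∪ T, τ',
    Finset.union_subset hT0S (hTS.trans hS1S), ?_, ?_, ?_, ?_⟩
  · intro s hs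
    rcases Finset.mem_union.1 hs with hs | hs
    · rw [e0 s hs]; exact ⟨Finset.mem_insert_self _ _, hT0 s hs⟩
    · rw [e1 s hs]; exact ⟨Finset.mem_insert_of_mem (hTτ s hs).1, (hTτ s hs).2⟩
  · intro t' ht'
    rcases Finset.mem_insert.1 ht' with rfl | ht'
    · refine ⟨⟨T0, hT0S, hT0, hlt⟩, hlt.le.trans ?_⟩
      refine Finset.sum_le_sum_of_subset_of_nonneg ?_ fun s _ _ => en_nonneg f s
      exact fun s hs => Finset.mem_filter.2 ⟨Finset.mem_union_left _ hs, e0 s hs⟩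
    · refine ⟨hmono _ (h𝒯 t' ht').1, (h𝒯 t' ht').2.trans ?_⟩
      refine Finset.sum_le_sum_of_subset_of_nonneg ?_ fun s _ _ => en_nonneg f s
      intro s hs
      obtain ⟨hs, hst⟩ := Finset.mem_filter.1 hs
      exact Finset.mem_filter.2 ⟨Finset.mem_union_right _ hs, (e1 s hs).trans hst⟩
  · intro s hs hs'
    by_cases hu : UnderR 0 10 s t
    · exact ⟨t, Finset.mem_insert_self _ _, hu⟩
    · obtain ⟨t', ht', hu'⟩ := hcov s (Finset.mem_filter.2 ⟨hs, hu⟩) hs'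
      exact ⟨t', Finset.mem_insert_of_mem ht', hu'⟩
  · intro s' hs' s'' hs'' hk hFP
    rcases Finset.mem_union.1 hs' with hs' | hs' <;> rcases Finset.mem_union.1 hs'' with hs'' | hs''
    · exact (hFP.contra hk (hT0 s' hs') (hT0 s'' hs'') le_rfl).elim
    · rw [e0 s' hs']
      intro hI
      exact (Finset.mem_filter.1 (hTS hs'')).2 (hFP.under hk (hT0 s' hs') hI)
    · exact (hFP.contra hk (hTτ s' hs').2 (hT0 s'' hs'')
        (hmin _ (hmono _ (h𝒯 _ (hTτ s' hs').1).1))).elim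
    · rw [e1 s' hs']
      exact hstar s' hs' s'' hs'' hk hFP

/-- Scales of distinct size differ by at least four. -/
def SEP (S : Finset Tile) : Prop := ∀ s ∈ S, ∀ s' ∈ S, s'.k < s.k → s'.k + 4 ≤ s.k

lemma SizeLe.en_le {f : ℝ → ℂ} {S : Finset Tile} {σ : ℝ} (h : SizeLe f S σ) {s : Tile} (hs : s ∈ S) :
    en f s ≤ σ ^ 2 * 2 ^ s.k := by
  have := h (s.k, s.m, s.n * 2 ^ (-s.k)) {s} (by simpa using hs) (by
    intro s' hs'
    rw [Finset.mem_singleton.1 hs']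
    have h1 : ix s.k (s.n * 2 ^ (-s.k)) = s.n := by
      rw [ix_eq_iff]
      have : (0 : ℝ) < 2 ^ (-s.k) := by positivity
      constructor <;> nlinarith
    refine ⟨le_rfl, ix_c s, ?_⟩
    simp only [TTop.ξ, h1]
    constructor <;> omega)
  simpa using this

lemma SizeLe.integral_as_le {f : ℝ → ℂ} (hf : BI f) {S : Finset Tile} {σ : ℝ} (hσ : 0 ≤ σ)
    (h : SizeLe f S σ) {s : Tile} (hs : s ∈ S) : ∫ y, ‖as f s y‖ ≤ σ * 2 ^ s.k := by
  have hp : (0 : ℝ) < 2 ^ s.k := by positivity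
  refine abs_le_of_sq_le_sq' ?_ (by positivity) |>.2
  calc _ ≤ _ := integral_as_sq_le hf s
    _ ≤ 2 ^ s.k * (σ ^ 2 * 2 ^ s.k) := by gcongr; exact h.en_le hs
    _ = _ := by ring

lemma card_freq (s : Tile) (S : Finset Tile) (k' m' : ℤ) (hk : k' + 4 ≤ s.k)
    (h : ∀ s' ∈ S, ¬ FD s s' ∧ s'.k = k' ∧ s'.m = m') : S.card ≤ 10 := by
  classical
  set z : ℝ := 2 ^ (k' - s.k) * s.n with hz
  have hsub : S ⊆ (Finset.Icc (⌊z⌋ + 1) (⌊z⌋ + 10)).image fun n => ((k', m', n) : Tile) := by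
    rintro ⟨k, m, n⟩ hs'
    obtain ⟨hF, hk', hm'⟩ := h _ hs'
    simp only [Tile.k, Tile.m] at hk' hm'
    subst hk' hm'
    obtain ⟨ζ, ⟨h1, h2⟩, h3, h4⟩ := not_FD hF
    simp only [Tile.k, Tile.n] at h1 h2 h3 h4
    refine Finset.mem_image.2 ⟨n, ?_, rfl⟩
    have hp : (0 : ℝ) < 2 ^ (k - s.k) := by positivity
    have hp2 : (2 : ℝ) ^ (k - s.k) ≤ 1 / 16 := by
      have : (2 : ℝ) ^ (k - s.k) ≤ 2 ^ (-4 : ℤ) := zpow_le_zpow_right₀ (by norm_num) (by simp only [Tile.k] at hk ⊢; omega)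
      norm_num at this ⊢; exact this
    have e : (2 : ℝ) ^ k * ζ = 2 ^ (k - s.k) * (2 ^ s.k * ζ) := by
      rw [← mul_assoc, ← zpow_add₀ (by norm_num)]; congr 2; ring
    have h5 : (2 : ℝ) ^ k * ζ < z := by
      rw [e, hz]; apply mul_lt_mul_of_pos_left _ hp; simp only [Tile.k, Tile.n] at *; linarith
    have h6 : z - 1 < (2 : ℝ) ^ k * ζ := by
      rw [e, hz]; simp only [Tile.k, Tile.n] at *; nlinarith
    have h7 := Int.floor_le z
    have h8 := Int.lt_floor_add_one z
    rw [Finset.mem_Icc]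
    constructor
    · have : (⌊z⌋ : ℝ) < n := by linarith
      have : ⌊z⌋ < n := by exact_mod_cast this
      omega
    · have : (n : ℝ) < ⌊z⌋ + 1 + 10 := by linarith
      have : n < ⌊z⌋ + 1 + 10 := by exact_mod_cast this
      omega
  refine (Finset.card_le_card hsub).trans (Finset.card_image_le.trans ?_)
  simp

/-- Constant in the size lemma. -/
noncomputable def szC : ℝ := 240 * prC 2 + 3604480 * prC 4

lemma szC_pos : 0 < szC := by
  have := prC_pos 2; have := prC_pos 4; unfold szC; positivity

lemma pr_fine_le {f : ℝ → ℂ} (hf : BI f) {S : Finset Tile} {σ : ℝ} (hσ : 0 ≤ σ)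
    (h : SizeLe f S σ) {s s' : Tile} (hs : s ∈ S) (hs' : s' ∈ S) (hk : s'.k ≤ s.k) :
    pr f s s' ≤ prC 4 * σ ^ 2 * (2 ^ s'.k * wt (2 ^ (-s.k) * (s'.c - s.c)) ^ 4) := by
  have hC := prC_pos 4
  have h2 : (2 : ℝ) ^ s.k * 2 ^ (-s.k) = 1 := by rw [← zpow_add₀ (by norm_num)]; simp
  have e : wt (2 ^ (-s.k) * (s.c - s'.c)) = wt (2 ^ (-s.k) * (s'.c - s.c)) := by
    rw [← wt_neg]; congr 1; ring
  calc _ ≤ _ := pr_le hf 4 hk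
    _ ≤ prC 4 * (σ * 2 ^ s.k) * (σ * 2 ^ s'.k) *
      (2 ^ (-s.k) * wt (2 ^ (-s.k) * (s.c - s'.c)) ^ 4) := by
        have := wt_nonneg (2 ^ (-s.k) * (s.c - s'.c))
        gcongr
        · exact h.integral_as_le hf hσ hs
        · exact h.integral_as_le hf hσ hs'
    _ = prC 4 * σ ^ 2 * (2 ^ s'.k * wt (2 ^ (-s.k) * (s.c - s'.c)) ^ 4) * (2 ^ s.k * 2 ^ (-s.k)) := by ring
    _ = _ := by rw [h2, mul_one, e]

/-- Fine tiles meeting the frequency of a coarse tile. -/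
lemma sum_pr_fine {f : ℝ → ℂ} (hf : BI f) {S : Finset Tile} (hS : SEP S) {σ : ℝ} (hσ : 0 ≤ σ)
    (hsz : SizeLe f S σ) {T : Finset Tile} (hTS : T ⊆ S) {τ : Tile → TTop}
    (hτ : ∀ s ∈ T, UnderR 0 1 s (τ s))
    (hstar : ∀ s' ∈ T, ∀ s'' ∈ T, s''.k + 4 ≤ s'.k → FP s' s'' → ix (-(τ s').K) s''.c ≠ (τ s').M)
    {s : Tile} (hs : s ∈ T) :
    ∑ s' ∈ T with s'.k < s.k, pr f s s' ≤
      prC 4 * σ ^ 2 * 160 * ∫ y in (τ s).Iᶜ, wt (2 ^ (-s.k) * (y - s.c)) ^ 4 := by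
  classical
  have hC := prC_pos 4
  have hq : (0 : ℝ) < 2 ^ (-s.k) := by positivity
  set P := T.filter fun s' => s'.k < s.k ∧ ¬ FD s s' with hP
  have hPmem : ∀ s' ∈ P, s' ∈ T ∧ s'.k + 4 ≤ s.k ∧ ¬ FD s s' := fun s' h => by
    obtain ⟨h1, h2, h3⟩ := Finset.mem_filter.1 h
    exact ⟨h1, hS s (hTS hs) s' (hTS h1) h2, h3⟩
  set g : ℤ × ℤ → ℝ := fun q => 2 ^ q.1 * wt (2 ^ (-s.k) * (q.2 * 2 ^ q.1 - s.c)) ^ 4 with hg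
  set π : Tile → ℤ × ℤ := fun s' => (s'.k, s'.m) with hπ
  have hg0 : ∀ q, 0 ≤ g q := fun q => by simp only [hg]; positivity
  have hFPs : ∀ s' ∈ P, FP s s' := by
    intro s' hs'
    obtain ⟨ζ, h1, h2⟩ := not_FD (hPmem s' hs').2.2
    exact ⟨ζ, ζ, h1, h2, by simp⟩
  have hFP : ∀ s' ∈ P, ∀ s'' ∈ P, FP s' s'' := by
    intro s' hs' s'' hs''
    obtain ⟨ζ', h1, h2⟩ := not_FD (hPmem s' hs').2.2
    obtain ⟨ζ'', h3, h4⟩ := not_FD (hPmem s'' hs'').2.2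
    refine ⟨ζ', ζ'', h2, h4, ?_⟩
    have h5 : (16 : ℝ) * 2 ^ s'.k ≤ 2 ^ s.k := by
      have : (2 : ℝ) ^ (s'.k + 4) ≤ 2 ^ s.k := zpow_le_zpow_right₀ (by norm_num) (hPmem s' hs').2.1
      rw [zpow_add₀ (by norm_num)] at this
      norm_num at this; linarith
    have h6 : (2 : ℝ) ^ s.k * |ζ' - ζ''| ≤ 8 := by
      have : (0 : ℝ) < 2 ^ s.k := by positivity
      have e : (2 : ℝ) ^ s.k * |ζ' - ζ''| = |2 ^ s.k * (ζ' - ζ'')| := by rw [abs_mul, abs_of_pos this]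
      rw [e, abs_le]
      constructor <;> linarith [h1.1, h1.2, h3.1, h3.2]
    have := abs_nonneg (ζ' - ζ'')
    nlinarith
  have hdisj : ((P.image π : Finset (ℤ × ℤ)) : Set (ℤ × ℤ)).PairwiseDisjoint fun q => dy q.1 q.2 := by
    have aux : ∀ s' ∈ P, ∀ s'' ∈ P, s''.k < s'.k → Disjoint (dy s'.k s'.m) (dy s''.k s''.m) := by
      intro s' hs' s'' hs'' hk
      rw [Set.disjoint_left]
      intro y hy hy'
      have h1 := hPmem s' hs'
      have h2 := hPmem s'' hs''
      have hu := hτ s' h1.1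
      have h3 := hstar s' h1.1 s'' h2.1 (hS s' (hTS h1.1) s'' (hTS h2.1) hk) (hFP s' hs' s'' hs'')
      rw [← ix_top_of_mem (by have := hu.1; omega) (show y ∈ s''.I from hy'),
        ix_top_of_mem hu.1 (show y ∈ s'.I from hy)] at h3
      exact h3 hu.2.1
    intro q hq q' hq' hne
    obtain ⟨s', hs', rfl⟩ := Finset.mem_image.1 hq
    obtain ⟨s'', hs'', rfl⟩ := Finset.mem_image.1 hq'
    rcases lt_trichotomy s'.k s''.k with h | h | h
    · exact (aux s'' hs'' s' hs' h).symm
    · simp only [Function.onFun, hπ, h]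
      exact disjoint_dy fun hm => hne (by simp only [hπ]; rw [h, hm])
    · exact aux s' hs' s'' hs'' h
  have hcard : ∀ q ∈ P.image π, ((P.filter fun s' => π s' = q).card : ℝ) ≤ 10 := by
    intro q hq
    obtain ⟨s', hs', rfl⟩ := Finset.mem_image.1 hq
    have := card_freq s (P.filter fun s'' => π s'' = π s') s'.k s'.m (hPmem s' hs').2.1 (by
      intro s'' h
      obtain ⟨h1, h2⟩ := Finset.mem_filter.1 h
      simp only [hπ, Prod.mk.injEq] at h2
      exact ⟨(hPmem s'' h1).2.2, h2⟩)
    exact_mod_cast this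
  have hint : Integrable fun y => (τ s).Iᶜ.indicator (fun y => 16 * wt (2 ^ (-s.k) * (y - s.c)) ^ 4) y :=
    ((integrable_wt_pow (by norm_num) hq _).const_mul _).indicator (measurableSet_dy _ _).compl
  calc ∑ s' ∈ T with s'.k < s.k, pr f s s' = ∑ s' ∈ P, pr f s s' := by
        symm
        apply Finset.sum_subset_zero_on_sdiff
        · exact fun s' h => Finset.mem_filter.2 ⟨(Finset.mem_filter.1 h).1, (Finset.mem_filter.1 h).2.1⟩
        · intro s' h
          simp only [hP, Finset.mem_sdiff, Finset.mem_filter, not_and, not_not] at h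
          exact pr_eq_zero hf (h.2 h.1.1 h.1.2)
        · exact fun _ _ => rfl
    _ ≤ ∑ s' ∈ P, prC 4 * σ ^ 2 * g (π s') := by
        refine Finset.sum_le_sum fun s' hs' => ?_
        exact pr_fine_le hf hσ hsz (hTS hs) (hTS (hPmem s' hs').1) (by have := (hPmem s' hs').2.1; omega)
    _ = prC 4 * σ ^ 2 * ∑ q ∈ P.image π, ∑ s' ∈ P with π s' = q, g q := by
        rw [← Finset.mul_sum]
        congr 1
        rw [← Finset.sum_fiberwise_of_maps_to (fun s' hs' => Finset.mem_image_of_mem π hs')]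
        refine Finset.sum_congr rfl fun q _ => Finset.sum_congr rfl fun s' hs' => ?_
        rw [(Finset.mem_filter.1 hs').2]
    _ ≤ prC 4 * σ ^ 2 * ∑ q ∈ P.image π, 10 * g q := by
        gcongr with q hq
        rw [Finset.sum_const, nsmul_eq_mul]
        exact mul_le_mul_of_nonneg_right (hcard q hq) (hg0 q)
    _ ≤ prC 4 * σ ^ 2 * (10 * ∫ y, (τ s).Iᶜ.indicator (fun y => 16 * wt (2 ^ (-s.k) * (y - s.c)) ^ 4) y) := by
        rw [← Finset.mul_sum]
        gcongr
        have := sum_le_integral (P.image π) (fun q => dy q.1 q.2) (fun _ _ => measurableSet_dy _ _) hdisj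
          _ hint (fun y => Set.indicator_nonneg (fun y _ => by positivity) y)
          (fun q => wt (2 ^ (-s.k) * (q.2 * 2 ^ q.1 - s.c)) ^ 4) ?_ (fun q _ => by rw [volume_dy]; exact ENNReal.ofReal_ne_top)
        · simpa only [volume_real_dy] using this
        intro q hqm y hy
        obtain ⟨s', hs', rfl⟩ := Finset.mem_image.1 hqm
        have h1 := hPmem s' hs'
        have hyI : y ∈ (τ s).Iᶜ := by
          intro hyI
          refine hstar s hs s' h1.1 h1.2.1 (hFPs s' hs') ?_
          rw [← ix_top_of_mem (by have := (hτ s hs).1; omega) (show y ∈ s'.I from hy)]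
          exact hyI
        rw [indicator_of_mem hyI]
        have h3 : wt (2 ^ (-s.k) * ((π s').2 * 2 ^ (π s').1 - s.c)) ≤ (1 + 1) * wt (2 ^ (-s.k) * (y - s.c)) := by
          apply wt_le_mul_wt
          rw [← mul_sub, abs_mul, abs_of_pos hq, sub_sub_sub_cancel_right, abs_sub_comm]
          have h4 := abs_sub_le_of_mem_dy hy
          calc _ ≤ (2 : ℝ) ^ (-s.k) * 2 ^ s'.k := by gcongr
            _ = 2 ^ (-s.k + s'.k) := by rw [← zpow_add₀ (by norm_num)]
            _ ≤ 1 := zpow_le_one_of_nonpos₀ (by norm_num) (by omega)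
        calc _ ≤ ((1 + 1) * wt (2 ^ (-s.k) * (y - s.c))) ^ 4 := pow_le_pow_left₀ (wt_nonneg _) h3 4
          _ = _ := by rw [mul_pow]; norm_num
    _ = _ := by
        rw [integral_indicator (show MeasurableSet (τ s).Iᶜ from (measurableSet_dy _ _).compl), integral_const_mul]
        ring

/-- Size selection: a collection of size `σ` splits into one of size `σ / 2` and one which is covered
by trees of controlled total length. -/
lemma size_split {f : ℝ → ℂ} (hf : BI f) {S : Finset Tile} (hS : SEP S) {σ : ℝ} (hσ : 0 < σ)
    (hsz : SizeLe f S σ) : ∃ S' ⊆ S, SizeLe f S' (σ / 2) ∧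
      Cov (S \ S') (4 * szC * (σ ^ 2)⁻¹ * ∫ x, ‖f x‖ ^ 2) := by
  classical
  have hC2 := prC_pos 2
  have hC4 := prC_pos 4
  obtain ⟨S', hS'S, hS'sz, 𝒯, T, τ, hTS, hTτ, h𝒯, hcov, hstar⟩ := size_select f (σ / 2) S
  refine ⟨S', hS'S, hS'sz, 𝒯, fun s hs => hcov s (Finset.mem_sdiff.1 hs).1 (Finset.mem_sdiff.1 hs).2, ?_⟩
  have hlen : (σ / 2) ^ 2 * ∑ t ∈ 𝒯, (2 : ℝ) ^ t.K ≤ ∑ s ∈ T, en f s := by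
    rw [Finset.mul_sum, ← Finset.sum_fiberwise_of_maps_to (fun s hs => (hTτ s hs).1)]
    exact Finset.sum_le_sum fun t ht => (h𝒯 t ht).2
  have hfine : ∑ s ∈ T, ∑ s' ∈ T with s'.k < s.k, pr f s s' ≤ 1802240 * prC 4 * ∑ s ∈ T, en f s := by
    calc _ ≤ ∑ s ∈ T, prC 4 * σ ^ 2 * 160 * ∫ y in (τ s).Iᶜ, wt (2 ^ (-s.k) * (y - s.c)) ^ 4 :=
          Finset.sum_le_sum fun s hs => sum_pr_fine hf hS hσ.le hsz hTS (fun s hs => (hTτ s hs).2) hstar hs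
      _ = prC 4 * σ ^ 2 * 160 * ∑ t ∈ 𝒯, ∑ s ∈ T with τ s = t, ∫ y in t.Iᶜ, wt (2 ^ (-s.k) * (y - s.c)) ^ 4 := by
          rw [← Finset.mul_sum, ← Finset.sum_fiberwise_of_maps_to (fun s hs => (hTτ s hs).1)]
          congr 1
          refine Finset.sum_congr rfl fun t _ => Finset.sum_congr rfl fun s hs => ?_
          rw [(Finset.mem_filter.1 hs).2]
      _ ≤ prC 4 * σ ^ 2 * 160 * ∑ t ∈ 𝒯, 2816 * (2 : ℝ) ^ t.K := by
          gcongr with t ht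
          refine outside_sum _ t fun s hs => ?_
          obtain ⟨h1, rfl⟩ := Finset.mem_filter.1 hs
          exact (hTτ s h1).2.mono le_rfl (by norm_num)
      _ = prC 4 * 160 * 2816 * 4 * ((σ / 2) ^ 2 * ∑ t ∈ 𝒯, (2 : ℝ) ^ t.K) := by rw [← Finset.mul_sum]; ring
      _ ≤ prC 4 * 160 * 2816 * 4 * ∑ s ∈ T, en f s := by gcongr
      _ = _ := by ring
  have hcoarse : ∑ s ∈ T, ∑ s' ∈ T with s.k < s'.k, pr f s s' = ∑ s ∈ T, ∑ s' ∈ T with s'.k < s.k, pr f s s' := by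
    simp only [Finset.sum_filter]
    rw [Finset.sum_comm]
    refine Finset.sum_congr rfl fun s _ => Finset.sum_congr rfl fun s' _ => ?_
    rw [pr_comm]
  have hpairs : ∑ s ∈ T, ∑ s' ∈ T, pr f s s' ≤ szC * ∑ s ∈ T, en f s := by
    have : ∑ s ∈ T, ∑ s' ∈ T, pr f s s' = ∑ s ∈ T, ∑ s' ∈ T with s'.k = s.k, pr f s s' +
        ∑ s ∈ T, ∑ s' ∈ T with s'.k < s.k, pr f s s' + ∑ s ∈ T, ∑ s' ∈ T with s.k < s'.k, pr f s s' := by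
      rw [← Finset.sum_add_distrib, ← Finset.sum_add_distrib]
      refine Finset.sum_congr rfl fun s _ => ?_
      simp only [Finset.sum_filter]
      rw [← Finset.sum_add_distrib, ← Finset.sum_add_distrib]
      refine Finset.sum_congr rfl fun s' _ => ?_
      rcases lt_trichotomy s'.k s.k with h | h | h
      · simp [h, h.ne, h.not_gt]
      · simp [h]
      · simp [h, h.ne', h.not_gt]
    rw [this, hcoarse]
    have h1 := sum_pr_same_scale hf T
    have : szC * ∑ s ∈ T, en f s = 240 * prC 2 * ∑ s ∈ T, en f s + 2 * (1802240 * prC 4 * ∑ s ∈ T, en f s) := by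
      unfold szC; ring
    linarith
  have := sum_en_le_of_pairs hf T szC_pos hpairs
  have h2 := hlen.trans this
  rw [← le_div_iff₀' (by positivity)] at h2
  refine h2.trans (le_of_eq ?_)
  field_simp
  ring

/-! ### Shell decompositions and weighted sums -/

lemma shell_lintegral {μ : Measure ℝ} {c : ℝ} {k : ℤ} {B : ℝ} (hB : 0 ≤ B)
    (hvol : ∀ j : ℕ, μ {x | |x - c| ≤ 2 ^ (k + j)} ≤ ENNReal.ofReal (B * 4 ^ j)) :
    ∫⁻ x, ENNReal.ofReal (wt (2 ^ (-k) * (x - c)) ^ 4) ∂μ ≤ ENNReal.ofReal (32 * B) := by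
  have hp : (0 : ℝ) < 2 ^ (-k) := by positivity
  have hab : Measurable fun x : ℝ => |x - c| := by fun_prop
  have hm : ∀ j : ℕ, MeasurableSet {x : ℝ | |x - c| ≤ 2 ^ (k + j)} := fun j => hab measurableSet_Iic
  have hpt : ∀ x, ENNReal.ofReal (wt (2 ^ (-k) * (x - c)) ^ 4) ≤
      ∑' j : ℕ, {x : ℝ | |x - c| ≤ 2 ^ (k + j)}.indicator (fun _ => ENNReal.ofReal (16 * (1 / 16) ^ j)) x := by
    intro x
    have hex : ∃ j : ℕ, |x - c| ≤ 2 ^ (k + j) := by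
      obtain ⟨j, hj⟩ := pow_unbounded_of_one_lt (2 ^ (-k) * |x - c|) (by norm_num : (1 : ℝ) < 2)
      refine ⟨j, ?_⟩
      rw [zpow_add₀ (by norm_num), zpow_natCast]
      rw [zpow_neg, ← div_eq_inv_mul, div_lt_iff₀ (by positivity)] at hj
      linarith
    classical
    set j := Nat.find hex with hj
    have h1 : |x - c| ≤ 2 ^ (k + j) := Nat.find_spec hex
    refine le_trans ?_ (ENNReal.le_tsum j)
    rw [indicator_of_mem (show x ∈ {x : ℝ | |x - c| ≤ 2 ^ (k + j)} from h1)]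
    apply ENNReal.ofReal_le_ofReal
    rcases Nat.eq_zero_or_pos j with h0 | h0
    · rw [h0]
      have := pow_le_one₀ (n := 4) (wt_nonneg (2 ^ (-k) * (x - c))) (wt_le_one _)
      linarith
    · obtain ⟨i, hi⟩ := Nat.exists_eq_succ_of_ne_zero h0.ne'
      have h2 : ¬ |x - c| ≤ 2 ^ (k + i) := Nat.find_min hex (by omega)
      push Not at h2
      have h3 : wt (2 ^ (-k) * (x - c)) ≤ ((2 : ℝ) ^ i)⁻¹ := by
        apply wt_le_inv (by positivity)
        rw [abs_mul, abs_of_pos hp]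
        rw [zpow_add₀ (by norm_num), zpow_natCast] at h2
        rw [zpow_neg, ← div_eq_inv_mul, le_div_iff₀ (by positivity)]
        linarith
      calc _ ≤ (((2 : ℝ) ^ i)⁻¹) ^ 4 := pow_le_pow_left₀ (wt_nonneg _) h3 4
        _ = (1 / 16) ^ i := by
            rw [← inv_pow, ← pow_mul, mul_comm, pow_mul]; norm_num
        _ = 16 * (1 / 16) ^ j := by rw [hi, Nat.succ_eq_add_one, pow_succ]; ring
  calc _ ≤ ∫⁻ x, ∑' j : ℕ, {x : ℝ | |x - c| ≤ 2 ^ (k + j)}.indicator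
          (fun _ => ENNReal.ofReal (16 * (1 / 16) ^ j)) x ∂μ := lintegral_mono hpt
    _ = ∑' j : ℕ, ∫⁻ x, {x : ℝ | |x - c| ≤ 2 ^ (k + j)}.indicator
          (fun _ => ENNReal.ofReal (16 * (1 / 16) ^ j)) x ∂μ :=
        lintegral_tsum fun j => (measurable_const.indicator (hm j)).aemeasurable
    _ ≤ ∑' j : ℕ, ENNReal.ofReal (16 * B * (1 / 4) ^ j) := by
        refine ENNReal.tsum_le_tsum fun j => ?_
        rw [lintegral_indicator_const (hm j)]
        calc _ ≤ ENNReal.ofReal (16 * (1 / 16) ^ j) * ENNReal.ofReal (B * 4 ^ j) := by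
              gcongr; exact hvol j
          _ = _ := by
              rw [← ENNReal.ofReal_mul (by positivity)]
              congr 1
              have : (1 / 4 : ℝ) ^ j = (1 / 16) ^ j * 4 ^ j := by rw [← mul_pow]; norm_num
              rw [this]; ring
    _ = ENNReal.ofReal (∑' j : ℕ, 16 * B * (1 / 4) ^ j) := by
        rw [ENNReal.ofReal_tsum_of_nonneg (fun j => by positivity)]
        exact (summable_geometric_of_lt_one (by norm_num) (by norm_num)).mul_left _
    _ ≤ _ := by
        apply ENNReal.ofReal_le_ofReal
        rw [tsum_mul_left, tsum_geometric_of_lt_one (by norm_num) (by norm_num)]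
        linarith

lemma shell_bound {G : Set ℝ} {c : ℝ} {k : ℤ} {B : ℝ} (hB : 0 ≤ B)
    (h : ∀ j : ℕ, volume.real (G ∩ {x | |x - c| ≤ 2 ^ (k + j)}) ≤ B * 4 ^ j) :
    ∫ x in G, wt (2 ^ (-k) * (x - c)) ^ 4 ≤ 32 * B := by
  have hp : (0 : ℝ) < 2 ^ (-k) := by positivity
  have hab : Measurable fun x : ℝ => |x - c| := by fun_prop
  have hint : Integrable (fun x => wt (2 ^ (-k) * (x - c)) ^ 4) (volume.restrict G) :=
    (integrable_wt_pow (by norm_num) hp c).restrict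
  rw [integral_eq_lintegral_of_nonneg_ae (Filter.Eventually.of_forall fun x => by positivity)
    hint.aestronglyMeasurable]
  refine ENNReal.toReal_le_of_le_ofReal (by positivity) (shell_lintegral hB fun j => ?_)
  have hm : MeasurableSet {x : ℝ | |x - c| ≤ 2 ^ (k + j)} := hab measurableSet_Iic
  rw [Measure.restrict_apply hm, inter_comm]
  have hfin : volume (G ∩ {x | |x - c| ≤ 2 ^ (k + j)}) ≠ ⊤ := by
    refine ne_top_of_le_ne_top ?_ (measure_mono inter_subset_right)
    have : {x : ℝ | |x - c| ≤ 2 ^ (k + j)} = Metric.closedBall c (2 ^ (k + j)) := by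
      ext x; simp [Real.dist_eq]
    rw [this]
    exact measure_closedBall_lt_top.ne
  rw [← ENNReal.ofReal_toReal hfin]
  exact ENNReal.ofReal_le_ofReal (h j)

lemma shell_bound_fun {f : ℝ → ℂ} (hf : Integrable f) {c : ℝ} {k : ℤ} {B : ℝ} (hB : 0 ≤ B)
    (h : ∀ j : ℕ, ∫ x in {x | |x - c| ≤ 2 ^ (k + j)}, ‖f x‖ ≤ B * 4 ^ j) :
    ∫ x, wt (2 ^ (-k) * (x - c)) ^ 4 * ‖f x‖ ≤ 32 * B := by
  have hab : Measurable fun x : ℝ => |x - c| := by fun_prop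
  have hwm : Measurable fun x => ENNReal.ofReal (wt (2 ^ (-k) * (x - c)) ^ 4) := by
    have := continuous_wt.measurable
    fun_prop
  have hms : AEStronglyMeasurable (fun x => wt (2 ^ (-k) * (x - c)) ^ 4 * ‖f x‖) volume := by
    have := continuous_wt
    exact (by fun_prop : Continuous fun x => wt (2 ^ (-k) * (x - c)) ^ 4).aestronglyMeasurable.mul
      hf.norm.aestronglyMeasurable
  have key := shell_lintegral (μ := volume.withDensity fun x => ‖f x‖ₑ) (c := c) (k := k) hB (fun j => by
    have hm : MeasurableSet {x : ℝ | |x - c| ≤ 2 ^ (k + j)} := hab measurableSet_Iic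
    rw [withDensity_apply _ hm, ← ofReal_integral_norm_eq_lintegral_enorm hf.restrict]
    exact ENNReal.ofReal_le_ofReal (h j))
  rw [lintegral_withDensity_eq_lintegral_mul₀ hf.aestronglyMeasurable.enorm hwm.aemeasurable] at key
  rw [integral_eq_lintegral_of_nonneg_ae (Filter.Eventually.of_forall fun x => by have := wt_nonneg (2 ^ (-k) * (x - c)); positivity) hms]
  refine ENNReal.toReal_le_of_le_ofReal (by positivity) (le_trans (lintegral_mono fun x => ?_) key)
  rw [ENNReal.ofReal_mul (by have := wt_nonneg (2 ^ (-k) * (x - c)); positivity), mul_comm,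
    ofReal_norm]
  rfl

/-- Interaction of scales. -/
noncomputable def Eo (k j : ℤ) : ℝ := if j ≤ k then (2 ^ (j - k)) ^ 2 else 2 ^ (k - j)

lemma Eo_nonneg (k j : ℤ) : 0 ≤ Eo k j := by unfold Eo; split_ifs <;> positivity

lemma sum_wt_fine (k j : ℤ) (h : j ≤ k) (x : ℝ) (s : Finset ℤ) :
    ∑ m ∈ s, wt (2 ^ (-k) * (x - m * 2 ^ j)) ^ 2 ≤ 16 * 2 ^ (k - j) := by
  have hq : (0 : ℝ) < 2 ^ (-k) := by positivity
  have key := sum_le_integral s (dy j) (fun m _ => measurableSet_dy j m)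
    (fun m _ m' _ h => disjoint_dy h) (fun y => 4 * wt (2 ^ (-k) * (y - x)) ^ 2)
    ((integrable_wt_pow le_rfl hq x).const_mul 4) (fun y => by positivity)
    (fun m => wt (2 ^ (-k) * (x - m * 2 ^ j)) ^ 2) (fun m _ y hy => by
      have h3 : wt (2 ^ (-k) * (m * 2 ^ j - x)) ≤ (1 + 1) * wt (2 ^ (-k) * (y - x)) := by
        apply wt_le_mul_wt
        rw [← mul_sub, abs_mul, abs_of_pos hq, sub_sub_sub_cancel_right, abs_sub_comm]
        calc _ ≤ (2 : ℝ) ^ (-k) * 2 ^ j := by gcongr; exact abs_sub_le_of_mem_dy hy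
          _ = 2 ^ (-k + j) := by rw [← zpow_add₀ (by norm_num)]
          _ ≤ 1 := zpow_le_one_of_nonpos₀ (by norm_num) (by omega)
      have e : wt (2 ^ (-k) * (x - m * 2 ^ j)) = wt (2 ^ (-k) * (m * 2 ^ j - x)) := by
        rw [← wt_neg]; congr 1; ring
      rw [e]
      calc _ ≤ ((1 + 1) * wt (2 ^ (-k) * (y - x))) ^ 2 := pow_le_pow_left₀ (wt_nonneg _) h3 2
        _ = _ := by rw [mul_pow]; norm_num)
    (fun m _ => by rw [volume_dy]; exact ENNReal.ofReal_ne_top)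
  simp only [volume_real_dy, ← Finset.mul_sum] at key
  rw [integral_const_mul] at key
  have h2 := integral_wt_pow_le (N := 2) le_rfl hq x
  have h3 : (4 : ℝ) / 2 ^ (-k) = 4 * 2 ^ k := by rw [zpow_neg, div_inv_eq_mul]
  rw [h3] at h2
  have h4 : 2 ^ j * ∑ m ∈ s, wt (2 ^ (-k) * (x - m * 2 ^ j)) ^ 2 ≤ 16 * 2 ^ k := by linarith
  rw [← le_div_iff₀' (by positivity)] at h4
  rw [zpow_sub₀ (by norm_num)]
  linarith [mul_div_assoc (16 : ℝ) (2 ^ k) (2 ^ j)]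

/-- Summing the scale interaction over a set of dyadic intervals. -/
lemma sum_Eo_dy (k : ℤ) (x : ℝ) (P : Finset (ℤ × ℤ)) :
    ∑ q ∈ P, Eo k q.1 * wt (2 ^ (-k) * (x - q.2 * 2 ^ q.1)) ^ 2 ≤ 64 := by
  classical
  have hscale : ∀ j, ∑ q ∈ P with q.1 = j, wt (2 ^ (-k) * (x - q.2 * 2 ^ q.1)) ^ 2 ≤
      if j ≤ k then 16 * 2 ^ (k - j) else 16 := by
    intro j
    have e : ∑ q ∈ P with q.1 = j, wt (2 ^ (-k) * (x - q.2 * 2 ^ q.1)) ^ 2 =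
        ∑ m ∈ (P.filter fun q => q.1 = j).image Prod.snd, wt (2 ^ (-k) * (x - m * 2 ^ j)) ^ 2 := by
      rw [Finset.sum_image]
      · refine Finset.sum_congr rfl fun q hq => ?_
        rw [(Finset.mem_filter.1 hq).2]
      · intro q hq q' hq' h
        simp only [Finset.coe_filter, mem_ofPred_eq] at hq hq'
        exact Prod.ext (hq.2.trans hq'.2.symm) h
    rw [e]
    split_ifs with hj
    · exact sum_wt_fine k j hj x _
    · refine le_trans (Finset.sum_le_sum fun m _ => ?_) (sum_wt_dy_le (N := 2) le_rfl j x _)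
      refine pow_le_pow_left₀ (wt_nonneg _) (wt_abs_anti ?_) 2
      rw [abs_mul, abs_mul, abs_of_pos (by positivity : (0 : ℝ) < 2 ^ (-k)),
        abs_of_pos (by positivity : (0 : ℝ) < 2 ^ (-j))]
      gcongr
      · norm_num
      · omega
  have h2 : ∀ j, ∑ q ∈ P with q.1 = j, Eo k q.1 * wt (2 ^ (-k) * (x - q.2 * 2 ^ q.1)) ^ 2 ≤
      (if j ≤ k then 16 * 2 ^ (j - k) else 16 * 2 ^ (k - j) : ℝ) := by
    intro j
    have e : ∑ q ∈ P with q.1 = j, Eo k q.1 * wt (2 ^ (-k) * (x - q.2 * 2 ^ q.1)) ^ 2 =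
        Eo k j * ∑ q ∈ P with q.1 = j, wt (2 ^ (-k) * (x - q.2 * 2 ^ q.1)) ^ 2 := by
      rw [Finset.mul_sum]
      refine Finset.sum_congr rfl fun q hq => ?_
      rw [(Finset.mem_filter.1 hq).2]
    rw [e]
    refine (mul_le_mul_of_nonneg_left (hscale j) (Eo_nonneg k j)).trans (le_of_eq ?_)
    unfold Eo
    split_ifs with hj
    · have : (2 : ℝ) ^ (j - k) * 2 ^ (k - j) = 1 := by rw [← zpow_add₀ (by norm_num)]; simp
      linear_combination (16 * 2 ^ (j - k)) * this
    · ring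
  calc _ = ∑ j ∈ P.image Prod.fst, ∑ q ∈ P with q.1 = j,
        Eo k q.1 * wt (2 ^ (-k) * (x - q.2 * 2 ^ q.1)) ^ 2 :=
        (Finset.sum_fiberwise_of_maps_to (fun q hq => Finset.mem_image_of_mem _ hq) _).symm
    _ ≤ ∑ j ∈ P.image Prod.fst, (if j ≤ k then 16 * 2 ^ (j - k) else 16 * 2 ^ (k - j) : ℝ) :=
        Finset.sum_le_sum fun j _ => h2 j
    _ = 16 * 2 ^ (-k) * ∑ j ∈ P.image Prod.fst with j ≤ k, (2 : ℝ) ^ j +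
        16 * 2 ^ k * ∑ j ∈ P.image Prod.fst with ¬ j ≤ k, (2 : ℝ) ^ (-j) := by
        rw [Finset.sum_ite, Finset.mul_sum, Finset.mul_sum]
        congr 1 <;> refine Finset.sum_congr rfl fun j _ => ?_ <;>
          rw [mul_assoc, ← zpow_add₀ (by norm_num)] <;> congr 2 <;> ring
    _ ≤ 16 * 2 ^ (-k) * (2 * 2 ^ k) + 16 * 2 ^ k * (2 * 2 ^ (-k)) := by
        gcongr
        · exact sum_zpow_le _ _ fun j hj => (Finset.mem_filter.1 hj).2
        · exact sum_zpow_neg_le _ _ fun j hj => by have := (Finset.mem_filter.1 hj).2; omega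
    _ = _ := by
        have : (2 : ℝ) ^ (-k) * 2 ^ k = 1 := by rw [← zpow_add₀ (by norm_num)]; simp
        linear_combination 64 * this

/-- Summing the scale interaction over the tiles of a tree. -/
lemma sum_Eo_tree (T : Finset Tile) (t : TTop) {a : ℤ} (hT : ∀ s ∈ T, UnderR a (a + 1) s t) (j : ℤ) (x : ℝ) :
    ∑ s ∈ T, 2 ^ s.k * (Eo s.k j * wt (2 ^ (-s.k) * (x - s.c)) ^ 2) ≤ 128 * 2 ^ j := by
  classical
  have hscale : ∀ k, ∑ s ∈ T with s.k = k, wt (2 ^ (-s.k) * (x - s.c)) ^ 2 ≤ 32 := by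
    intro k
    have h1 := sum_tiles_le (T.filter fun s => s.k = k) k (Finset.Icc (ix k t.ξ + a) (ix k t.ξ + a + 1))
        (fun m => wt (2 ^ (-k) * (x - m * 2 ^ k)) ^ 2) (fun m => by positivity)
        (sum_wt_dy_le le_rfl k x) (by
          intro s hs
          obtain ⟨hs1, rfl⟩ := Finset.mem_filter.1 hs
          refine ⟨rfl, Finset.mem_Icc.2 ?_⟩
          have := (hT s hs1).2.2
          omega)
    rw [Int.card_Icc, show (ix k t.ξ + a + 1 + 1 - (ix k t.ξ + a)) = (2 : ℕ) by push_cast; ring,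
      Int.toNat_natCast] at h1
    refine le_trans (le_of_eq (Finset.sum_congr rfl fun s hs => ?_)) (h1.trans (by norm_num))
    rw [Tile.c, (Finset.mem_filter.1 hs).2]
  calc _ = ∑ k ∈ T.image (fun s => s.k), ∑ s ∈ T with s.k = k,
        2 ^ s.k * (Eo s.k j * wt (2 ^ (-s.k) * (x - s.c)) ^ 2) :=
        (Finset.sum_fiberwise_of_maps_to (fun s hs => Finset.mem_image_of_mem _ hs) _).symm
    _ = ∑ k ∈ T.image (fun s => s.k), 2 ^ k * Eo k j * ∑ s ∈ T with s.k = k, wt (2 ^ (-s.k) * (x - s.c)) ^ 2 := by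
        refine Finset.sum_congr rfl fun k _ => ?_
        rw [Finset.mul_sum]
        refine Finset.sum_congr rfl fun s hs => ?_
        rw [(Finset.mem_filter.1 hs).2]; ring
    _ ≤ ∑ k ∈ T.image (fun s => s.k), 2 ^ k * Eo k j * 32 := by
        gcongr with k _
        · have := Eo_nonneg k j; positivity
        · exact hscale k
    _ ≤ ∑ k ∈ T.image (fun s => s.k), (if j ≤ k then 32 * (2 ^ j * 2 ^ j) * 2 ^ (-k) else 32 * 2 ^ k : ℝ) := by
        refine Finset.sum_le_sum fun k hk => ?_
        have hk : (2 : ℝ) ^ k ≠ 0 := by positivity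
        have hj : (2 : ℝ) ^ j ≠ 0 := by positivity
        unfold Eo
        split_ifs with h
        · rw [zpow_sub₀ (by norm_num), zpow_neg]; apply le_of_eq; field_simp
        · have h1 : (2 : ℝ) ^ (k - j) ≤ 1 := zpow_le_one_of_nonpos₀ (by norm_num) (by omega)
          have h2 : (2 : ℝ) ^ k * 2 ^ (k - j) ≤ 2 ^ k * 1 := by gcongr
          linarith
    _ = 32 * (2 ^ j * 2 ^ j) * ∑ k ∈ T.image (fun s => s.k) with j ≤ k, (2 : ℝ) ^ (-k) +
        32 * ∑ k ∈ T.image (fun s => s.k) with ¬ j ≤ k, (2 : ℝ) ^ k := by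
        rw [Finset.sum_ite, Finset.mul_sum, Finset.mul_sum]
    _ ≤ 32 * (2 ^ j * 2 ^ j) * (2 * 2 ^ (-j)) + 32 * (2 * 2 ^ j) := by
        gcongr
        · exact sum_zpow_neg_le _ _ fun j hj => (Finset.mem_filter.1 hj).2
        · exact sum_zpow_le _ _ fun j hj => by have := (Finset.mem_filter.1 hj).2; omega
    _ = _ := by
        have : (2 : ℝ) ^ (-j) * 2 ^ j = 1 := by rw [← zpow_add₀ (by norm_num)]; simp
        linear_combination 64 * (2 : ℝ) ^ j * this

/-! ### A dyadic partition adapted to a finite tree -/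

/-- At scale `j`, the point `x` is adjacent to a tile of `T` of scale at most `j`. -/
def Adj (T : Finset Tile) (j : ℤ) (x : ℝ) : Prop :=
  ∃ s ∈ T, s.k ≤ j ∧ |ix (-j) s.c - ix (-j) x| ≤ 1

lemma Adj.mono {T : Finset Tile} {j j' : ℤ} {x : ℝ} (h : Adj T j x) (hj : j ≤ j') : Adj T j' x := by
  obtain ⟨s, hs, h1, h2⟩ := h
  exact ⟨s, hs, h1.trans hj, (ix_abs_sub_le (neg_le_neg hj) x s.c).trans h2⟩

lemma Adj.congr {T : Finset Tile} {j : ℤ} {x y : ℝ} (h : Adj T j x) (hxy : ix (-j) x = ix (-j) y) :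
    Adj T j y := by
  unfold Adj at *
  rwa [← hxy]

structure JPart (T : Finset Tile) (K M : ℤ) (P : Finset (ℤ × ℤ)) : Prop where
  disj : ∀ q ∈ P, ∀ q' ∈ P, q ≠ q' → Disjoint (dy q.1 q.2) (dy q'.1 q'.2)
  cover : ∀ x, |ix (-K) x - M| ≤ 1 → ∃ q ∈ P, x ∈ dy q.1 q.2
  lt : ∀ q ∈ P, q.1 < K
  sub : ∀ q ∈ P, ∀ x ∈ dy q.1 q.2, |ix (-K) x - M| ≤ 1
  far : ∀ q ∈ P, ∀ x ∈ dy q.1 q.2, ∀ s ∈ T, s.k ≤ q.1 → ∀ y, ix (-s.k) y = s.m → 2 ^ q.1 ≤ |x - y|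
  near : ∀ q ∈ P, ∃ s ∈ T, s.k ≤ q.1 + 1 ∧ ∀ x ∈ dy q.1 q.2,
    |ix (-(q.1 + 1)) s.c - ix (-(q.1 + 1)) x| ≤ 1

lemma exists_jpart (T : Finset Tile) (hne : T.Nonempty) (K M : ℤ)
    (hT : ∀ s ∈ T, s.k ≤ K ∧ ix (-K) s.c = M) : ∃ P, JPart T K M P := by
  classical
  obtain ⟨s0, hs0, hmin⟩ := T.exists_min_image (fun s => s.k) hne
  let P : Finset (ℤ × ℤ) := ((Finset.Icc (s0.k - 1) (K - 1)).biUnion fun j =>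
    (Finset.Icc (ix (-j) ((M - 1) * 2 ^ K)) (ix (-j) ((M + 2) * 2 ^ K))).image fun m => (j, m)).filter
    fun q => ∃ x ∈ dy q.1 q.2, ¬ Adj T q.1 x ∧ Adj T (q.1 + 1) x
  have hP : ∀ q ∈ P, q.1 < K ∧ ∀ x ∈ dy q.1 q.2, ¬ Adj T q.1 x ∧ Adj T (q.1 + 1) x := by
    intro q hq
    obtain ⟨h1, y, hy, h2, h3⟩ := Finset.mem_filter.1 hq
    obtain ⟨j, hj, h4⟩ := Finset.mem_biUnion.1 h1
    obtain ⟨m, hm, rfl⟩ := Finset.mem_image.1 h4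
    refine ⟨by have := (Finset.mem_Icc.1 hj).2; dsimp only; omega, fun x hx => ?_⟩
    have e : ix (-j) x = ix (-j) y := Eq.trans hx (Eq.symm hy)
    exact ⟨fun h => h2 (h.congr e), h3.congr (ix_congr (by dsimp only; omega) e.symm)⟩
  refine ⟨P, ?_, ?_, fun q hq => (hP q hq).1, ?_, ?_, ?_⟩
  · intro q hq q' hq' hne
    rw [Set.disjoint_left]
    intro x hx hx'
    have h1 := (hP q hq).2 x hx
    have h2 := (hP q' hq').2 x hx'
    rcases lt_trichotomy q.1 q'.1 with h | h | h
    · exact h2.1 (h1.2.mono (by omega))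
    · refine hne (Prod.ext h ?_)
      have e1 : ix (-q.1) x = q.2 := hx
      have e2 : ix (-q'.1) x = q'.2 := hx'
      rw [← e1, ← e2, h]
    · exact h1.1 (h2.2.mono (by omega))
  · intro x hx
    have hK : Adj T K x := by
      refine ⟨s0, hs0, (hT s0 hs0).1, ?_⟩
      rw [(hT s0 hs0).2, abs_sub_comm]; exact hx
    have hlow : ∀ j, Adj T j x → s0.k ≤ j := fun j ⟨s, hs, h, _⟩ => (hmin s hs).trans h
    obtain ⟨j, hj, hj'⟩ := Int.exists_least_of_bdd (P := fun j => Adj T j x) ⟨s0.k, hlow⟩ ⟨K, hK⟩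
    have hnot : ¬ Adj T (j - 1) x := fun h => by have := hj' _ h; omega
    have hjK : j ≤ K := hj' _ hK
    refine ⟨(j - 1, ix (-(j - 1)) x), Finset.mem_filter.2 ⟨?_, x, rfl, hnot, by simpa using hj⟩, rfl⟩
    refine Finset.mem_biUnion.2 ⟨j - 1, Finset.mem_Icc.2 ⟨?_, by omega⟩,
      Finset.mem_image.2 ⟨_, Finset.mem_Icc.2 ⟨?_, ?_⟩, rfl⟩⟩
    · have := hlow _ hj; omega
    · apply ix_mono
      have h1 := ix_le (-K) x
      rw [neg_neg] at h1
      refine le_trans ?_ h1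
      have : (M - 1 : ℝ) ≤ ix (-K) x := by
        have := (abs_le.1 hx).1
        exact_mod_cast (show M - 1 ≤ ix (-K) x by omega)
      gcongr
    · apply ix_mono
      have h1 := (lt_ix (-K) x).le
      rw [neg_neg] at h1
      refine h1.trans ?_
      have : (ix (-K) x + 1 : ℝ) ≤ M + 2 := by
        have := (abs_le.1 hx).2
        exact_mod_cast (show ix (-K) x + 1 ≤ M + 2 by omega)
      gcongr
  · intro q hq x hx
    obtain ⟨h1, h2⟩ := hP q hq
    obtain ⟨s, hs, h3, h4⟩ := (h2 x hx).2.mono (show q.1 + 1 ≤ K by omega)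
    rwa [(hT s hs).2, abs_sub_comm] at h4
  · intro q hq x hx s hs hk y hy
    have h1 := ((hP q hq).2 x hx).1
    have e : ix (-q.1) y = ix (-q.1) s.c := ix_congr (by omega) (hy.trans (ix_c s).symm)
    have h2 : (2 : ℤ) ≤ |ix (-q.1) y - ix (-q.1) x| := by
      by_contra h
      exact h1 ⟨s, hs, hk, by rw [← e]; omega⟩
    have h3 := ix_abs_sub_lt (k := -q.1) (x := y) (y := x)
    have h4 : (2 : ℝ) ≤ |(ix (-q.1) y : ℝ) - ix (-q.1) x| := by exact_mod_cast h2
    rw [zpow_neg, ← div_eq_mul_inv] at h3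
    have h5 : 1 < |y - x| / 2 ^ q.1 := by linarith
    rw [lt_div_iff₀ (by positivity), one_mul] at h5
    rw [abs_sub_comm]; exact h5.le
  · intro q hq
    obtain ⟨h1, h2⟩ := hP q hq
    obtain ⟨y, hy⟩ : (dy q.1 q.2).Nonempty := by
      obtain ⟨-, y, hy, -⟩ := Finset.mem_filter.1 hq
      exact ⟨y, hy⟩
    obtain ⟨s, hs, h3, h4⟩ := (h2 y hy).2
    refine ⟨s, hs, h3, fun x hx => ?_⟩
    have e : ix (-(q.1 + 1)) x = ix (-(q.1 + 1)) y :=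
      ix_congr (k := -q.1) (by omega) (Eq.trans hx (Eq.symm hy))
    rwa [e]

/-! ### Energy estimate -/

lemma norm_eChar_sub_le (t x y : ℝ) : ‖eChar t x - eChar t y‖ ≤ 7 * |t| * |x - y| := by
  have : eChar t x - eChar t y = eChar t y * (eChar t (x - y) - 1) := by
    rw [mul_sub, ← eChar_add_right]; simp
  rw [this, norm_mul, norm_eChar, one_mul]
  exact norm_eChar_sub_one_le t (x - y)

lemma tk_cancel {φ : ℝ → ℝ} (h : Symb φ) {k n : ℤ} {ξ y z z' : ℝ} (hθ : |2 ^ k * ξ - n| ≤ 1)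
    (hz : |z - z'| ≤ 2 ^ k) :
    ‖tk φ k n (y - z) * eChar ξ z - tk φ k n (y - z') * eChar ξ z'‖ ≤
      8 * kC φ 2 * 2 ^ (-k) * (2 ^ (-k) * |z - z'|) * wt (2 ^ (-k) * (y - z')) ^ 2 := by
  set u : ℝ := 2 ^ (-k) with hu
  have hup : 0 < u := by positivity
  have huk : u * 2 ^ k = 1 := by rw [hu, ← zpow_add₀ (by norm_num)]; simp
  have hτ : |ξ - n * u| ≤ u := by
    have : ξ - n * u = u * (2 ^ k * ξ - n) := by linear_combination -ξ * huk
    rw [this, abs_mul, abs_of_pos hup]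
    nlinarith
  have hform : ∀ w, tk φ k n (y - w) * eChar ξ w =
      ((u : ℝ) : ℂ) * (eChar (n * u) y * (eChar (ξ - n * u) w * ker φ (u * (y - w)))) := by
    intro w
    have e : eChar (n * u) (y - w) * eChar ξ w = eChar (n * u) y * eChar (ξ - n * u) w := by
      rw [sub_eq_add_neg y w, eChar_add_right, sub_eq_add_neg ξ, eChar_add_left, eChar_neg_left]
      ring
    rw [tk_eq]
    linear_combination ((u : ℝ) : ℂ) * ker φ (u * (y - w)) * e
  rw [hform, hform, ← mul_sub, ← mul_sub, norm_mul, norm_mul, norm_eChar, one_mul,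
    Complex.norm_real, Real.norm_of_nonneg hup.le]
  have hsmall : u * |z - z'| ≤ 1 := by nlinarith
  have hd : |u * (y - z) - u * (y - z')| = u * |z - z'| := by
    rw [← mul_sub, abs_mul, abs_of_pos hup, abs_sub_comm z z']; congr 2; ring
  have h1 := norm_ker_sub_le h 2 (t := u * (y - z)) (t' := u * (y - z')) (by rw [hd]; exact hsmall)
  rw [hd] at h1
  have h2 := norm_eChar_sub_le (ξ - n * u) z z'
  have h3 := norm_ker_le h 2 (u * (y - z'))
  have hC := kC_pos h 2
  have hw := wt_nonneg (u * (y - z'))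
  have h4 : eChar (ξ - n * u) z * ker φ (u * (y - z)) - eChar (ξ - n * u) z' * ker φ (u * (y - z')) =
      eChar (ξ - n * u) z * (ker φ (u * (y - z)) - ker φ (u * (y - z'))) +
      (eChar (ξ - n * u) z - eChar (ξ - n * u) z') * ker φ (u * (y - z')) := by ring
  have h5 : ‖eChar (ξ - n * u) z * ker φ (u * (y - z)) -
      eChar (ξ - n * u) z' * ker φ (u * (y - z'))‖ ≤
      kC φ 2 * (u * |z - z'|) * wt (u * (y - z')) ^ 2 +
        7 * u * |z - z'| * (kC φ 2 * wt (u * (y - z')) ^ 2) := by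
    rw [h4]
    refine (norm_add_le _ _).trans (add_le_add ?_ ?_)
    · rw [norm_mul, norm_eChar, one_mul]; exact h1
    · rw [norm_mul]
      refine mul_le_mul (h2.trans ?_) h3 (norm_nonneg _) (by positivity)
      gcongr
  calc _ ≤ u * (kC φ 2 * (u * |z - z'|) * wt (u * (y - z')) ^ 2 +
        7 * u * |z - z'| * (kC φ 2 * wt (u * (y - z')) ^ 2)) := by gcongr
    _ = _ := by ring

/-- Size of the kernel acting on a function with mean zero (after demodulation) on a short
interval. -/
lemma cv_cancel {φ : ℝ → ℝ} (h : Symb φ) {s : Tile} {ξ y z' : ℝ} (hθ : |2 ^ s.k * ξ - s.n| ≤ 1)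
    {b : ℝ → ℂ} (hb : Integrable b) (hb0 : ∫ z, b z * eChar (-ξ) z = 0) {l : ℝ} (hl : l ≤ 2 ^ s.k)
    (hsupp : ∀ z, b z ≠ 0 → |z - z'| ≤ l) :
    ‖cv (s.sy φ) b y‖ ≤ 8 * kC φ 2 * 2 ^ (-s.k) * (2 ^ (-s.k) * l) *
      wt (2 ^ (-s.k) * (y - z')) ^ 2 * ∫ z, ‖b z‖ := by
  have hi : Integrable fun z => b z * eChar (-ξ) z :=
    hb.mul_bdd (c := 1) (continuous_eChar_right _).aestronglyMeasurable (ae_of_all _ (by simp))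
  have e1 : cv (s.sy φ) b y =
      ∫ z, (tk φ s.k s.n (y - z) * eChar ξ z - tk φ s.k s.n (y - z') * eChar ξ z') *
        (b z * eChar (-ξ) z) := by
    have e2 : ∫ z, tk φ s.k s.n (y - z') * eChar ξ z' * (b z * eChar (-ξ) z) = 0 := by
      rw [integral_const_mul, hb0, mul_zero]
    have e3 : ∀ z, ker (s.sy φ) (y - z) * b z =
        tk φ s.k s.n (y - z) * eChar ξ z * (b z * eChar (-ξ) z) := by
      intro z
      have := eChar_mul_neg ξ z
      rw [show ker (s.sy φ) = tk φ s.k s.n from rfl]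
      linear_combination (-(tk φ s.k s.n (y - z) * b z)) * this
    simp_rw [sub_mul]
    rw [integral_sub ?_ (hi.const_mul _), e2, sub_zero, cv]
    · exact integral_congr_ae (ae_of_all _ e3)
    · simp_rw [← e3]
      exact cv_integrand_integrable (h.sy s) hb y
  rw [e1, ← integral_const_mul]
  refine norm_integral_le_of_norm_le (hb.norm.const_mul _) (ae_of_all _ fun z => ?_)
  by_cases hz : b z = 0
  · simp [hz]
  · rw [norm_mul, norm_mul, norm_eChar, mul_one]
    refine mul_le_mul_of_nonneg_right ?_ (norm_nonneg _)
    refine (tk_cancel h hθ ((hsupp z hz).trans hl)).trans ?_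
    have := kC_pos h 2
    have := wt_nonneg (2 ^ (-s.k) * (y - z'))
    have := hsupp z hz
    gcongr

/-- Size of the kernel acting on a function supported at distance at least `d`. -/
lemma cv_far {φ : ℝ → ℝ} (h : Symb φ) (a N : ℕ) {s : Tile} {y d : ℝ} (hd : 0 < d)
    {b : ℝ → ℂ} (hb : Integrable b) (hsupp : ∀ z, b z ≠ 0 → d ≤ |y - z|) :
    ‖cv (s.sy φ) b y‖ ≤ kC φ (a + N) * 2 ^ (-s.k) * (2 ^ s.k * d⁻¹) ^ a *
      ∫ z, wt (2 ^ (-s.k) * (y - z)) ^ N * ‖b z‖ := by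
  have hup : (0 : ℝ) < 2 ^ (-s.k) := by positivity
  have hb' : Integrable fun z => wt (2 ^ (-s.k) * (y - z)) ^ N * ‖b z‖ := by
    refine hb.norm.bdd_mul (c := 1) ?_ (ae_of_all _ fun z => ?_)
    · have := continuous_wt
      exact (by fun_prop : Continuous fun z => wt (2 ^ (-s.k) * (y - z)) ^ N).aestronglyMeasurable
    · rw [Real.norm_of_nonneg (pow_nonneg (wt_nonneg _) _)]
      exact pow_le_one₀ (wt_nonneg _) (wt_le_one _)
  rw [← integral_const_mul]
  refine norm_integral_le_of_norm_le (hb'.const_mul _) (ae_of_all _ fun z => ?_)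
  by_cases hz : b z = 0
  · simp [hz]
  · rw [norm_mul, ← mul_assoc]
    refine mul_le_mul_of_nonneg_right ?_ (norm_nonneg _)
    refine (norm_ker_sy_le h (a + N) s (y - z)).trans ?_
    have h1 : wt (2 ^ (-s.k) * (y - z)) ≤ 2 ^ s.k * d⁻¹ := by
      have := wt_le_inv (x := 2 ^ (-s.k) * (y - z)) (r := 2 ^ (-s.k) * d) (by positivity) (by
        rw [abs_mul, abs_of_pos hup]; gcongr; exact hsupp z hz)
      rwa [mul_inv, ← zpow_neg, neg_neg] at this
    have h2 := pow_le_pow_left₀ (wt_nonneg _) h1 a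
    have := kC_pos h (a + N)
    have := wt_nonneg (2 ^ (-s.k) * (y - z))
    rw [pow_add]
    calc _ = kC φ (a + N) * 2 ^ (-s.k) * wt (2 ^ (-s.k) * (y - z)) ^ a * wt (2 ^ (-s.k) * (y - z)) ^ N := by ring
      _ ≤ _ := by gcongr

/-- Local averages of `f` around the tiles of `T` are bounded by `A`. -/
def AvgLe (f : ℝ → ℂ) (T : Finset Tile) (A : ℝ) : Prop :=
  ∀ s ∈ T, ∀ r : ℝ, 2 ^ s.k ≤ r → ∫ x in {x | |x - s.c| ≤ r}, ‖f x‖ ≤ A * r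

noncomputable def avJ (f : ℝ → ℂ) (ξ : ℝ) (q : ℤ × ℤ) : ℂ :=
  ((2 ^ (-q.1) : ℝ) : ℂ) * ∫ z in dy q.1 q.2, f z * eChar (-ξ) z

noncomputable def gdJ (f : ℝ → ℂ) (ξ : ℝ) (q : ℤ × ℤ) : ℝ → ℂ :=
  (dy q.1 q.2).indicator fun x => avJ f ξ q * eChar ξ x

noncomputable def bdJ (f : ℝ → ℂ) (ξ : ℝ) (q : ℤ × ℤ) (x : ℝ) : ℂ :=
  (dy q.1 q.2).indicator f x - gdJ f ξ q x

lemma norm_avJ_le (f : ℝ → ℂ) (ξ : ℝ) (q : ℤ × ℤ) :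
    ‖avJ f ξ q‖ ≤ 2 ^ (-q.1) * ∫ z in dy q.1 q.2, ‖f z‖ := by
  rw [avJ, norm_mul, Complex.norm_real, Real.norm_of_nonneg (by positivity)]
  gcongr
  refine (norm_integral_le_integral_norm _).trans (le_of_eq ?_)
  simp

lemma BI_gdJ (f : ℝ → ℂ) (ξ : ℝ) (q : ℤ × ℤ) : BI (gdJ f ξ q) := by
  refine ⟨?_, ‖avJ f ξ q‖, fun x => ?_⟩
  · rw [gdJ, integrable_indicator_iff (measurableSet_dy _ _)]
    refine Measure.integrableOn_of_bounded (M := ‖avJ f ξ q‖) ?_ ?_ (ae_of_all _ fun x => by simp)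
    · rw [volume_dy]; exact ENNReal.ofReal_ne_top
    · exact (continuous_const.mul (continuous_eChar_right ξ)).aestronglyMeasurable
  · refine (norm_indicator_le_norm_self _ x).trans ?_
    simp

lemma BI_bdJ {f : ℝ → ℂ} (hf : BI f) (ξ : ℝ) (q : ℤ × ℤ) : BI (bdJ f ξ q) :=
  (hf.indicator (measurableSet_dy _ _)).sub (BI_gdJ f ξ q)

lemma bdJ_supp {f : ℝ → ℂ} {ξ : ℝ} {q : ℤ × ℤ} {z : ℝ} (h : bdJ f ξ q z ≠ 0) : z ∈ dy q.1 q.2 := by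
  by_contra hz
  simp [bdJ, gdJ, hz] at h

lemma integral_bdJ {f : ℝ → ℂ} (hf : BI f) (ξ : ℝ) (q : ℤ × ℤ) :
    ∫ z, bdJ f ξ q z * eChar (-ξ) z = 0 := by
  have e : ∀ z, bdJ f ξ q z * eChar (-ξ) z =
      (dy q.1 q.2).indicator (fun z => f z * eChar (-ξ) z - avJ f ξ q) z := by
    intro z
    by_cases hz : z ∈ dy q.1 q.2
    · simp only [bdJ, gdJ, indicator_of_mem hz]
      linear_combination (-avJ f ξ q) * eChar_mul_neg ξ z
    · simp [bdJ, gdJ, hz]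
  simp_rw [e]
  have hp : (2 : ℝ) ^ q.1 * 2 ^ (-q.1) = 1 := by rw [← zpow_add₀ (by norm_num)]; simp
  rw [integral_indicator (measurableSet_dy _ _), integral_sub, setIntegral_const, volume_real_dy, avJ,
    Complex.real_smul, ← mul_assoc, ← Complex.ofReal_mul, hp]
  · simp
  · exact (hf.int.mul_bdd (c := 1) (continuous_eChar_right _).aestronglyMeasurable
      (ae_of_all _ (by simp))).integrableOn
  · refine integrableOn_const ?_
    rw [volume_dy]; exact ENNReal.ofReal_ne_top

lemma integral_norm_bdJ_le {f : ℝ → ℂ} (hf : BI f) (ξ : ℝ) (q : ℤ × ℤ) :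
    ∫ z, ‖bdJ f ξ q z‖ ≤ 2 * ∫ z in dy q.1 q.2, ‖f z‖ := by
  have hp : (2 : ℝ) ^ q.1 * 2 ^ (-q.1) = 1 := by rw [← zpow_add₀ (by norm_num)]; simp
  have h1 : ∫ z, ‖bdJ f ξ q z‖ ≤ ∫ z, (dy q.1 q.2).indicator (fun z => ‖f z‖ + ‖avJ f ξ q‖) z := by
    have hi : Integrable ((dy q.1 q.2).indicator fun z => ‖f z‖ + ‖avJ f ξ q‖) := by
      rw [integrable_indicator_iff (measurableSet_dy _ _)]
      refine hf.int.norm.integrableOn.add (integrableOn_const ?_)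
      rw [volume_dy]; exact ENNReal.ofReal_ne_top
    refine integral_mono (BI_bdJ hf ξ q).int.norm hi fun z => ?_
    by_cases hz : z ∈ dy q.1 q.2
    · simp only [bdJ, gdJ, indicator_of_mem hz]
      refine (norm_sub_le _ _).trans ?_
      simp
    · simp [bdJ, gdJ, hz]
  rw [integral_indicator (measurableSet_dy _ _), integral_add hf.int.norm.integrableOn (integrableOn_const (by
    rw [volume_dy]; exact ENNReal.ofReal_ne_top)), setIntegral_const_real, volume_real_dy] at h1
  have h2 := norm_avJ_le f ξ q
  have h3 : (2 : ℝ) ^ q.1 * ‖avJ f ξ q‖ ≤ 2 ^ q.1 * (2 ^ (-q.1) * ∫ z in dy q.1 q.2, ‖f z‖) := by gcongr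
  rw [← mul_assoc, hp] at h3
  linarith

lemma AvgLe.jint {f : ℝ → ℂ} (hf : BI f) {T : Finset Tile} {A : ℝ} (h : AvgLe f T A) {K M : ℤ}
    {P : Finset (ℤ × ℤ)} (hP : JPart T K M P) {q : ℤ × ℤ} (hq : q ∈ P) :
    ∫ z in dy q.1 q.2, ‖f z‖ ≤ 4 * A * 2 ^ q.1 := by
  obtain ⟨s, hs, hk, hx⟩ := hP.near q hq
  have hle : (2 : ℝ) ^ s.k ≤ 2 ^ (q.1 + 2) := zpow_le_zpow_right₀ (by norm_num) (by omega)
  have h1 := h s hs _ hle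
  have e : (2 : ℝ) ^ (q.1 + 2) = 4 * 2 ^ q.1 := by rw [zpow_add₀ (by norm_num)]; norm_num; ring
  rw [e] at h1
  refine le_trans (setIntegral_mono_set hf.int.norm.integrableOn (ae_of_all _ fun _ => norm_nonneg _)
    (LE.le.eventuallyLE fun x hxq => ?_)) (h1.trans (le_of_eq (by ring)))
  have h2 := hx x hxq
  have h3 := abs_sub_lt_of_ix (k := -(q.1 + 1)) (x := s.c) (y := x)
  have h4 : ((|ix (-(q.1 + 1)) s.c - ix (-(q.1 + 1)) x| + 1 : ℤ) : ℝ) ≤ 2 := by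
    exact_mod_cast (show |ix (-(q.1 + 1)) s.c - ix (-(q.1 + 1)) x| + 1 ≤ 2 by omega)
  rw [neg_neg] at h3
  rw [abs_sub_comm] at h3
  have h5 : (2 : ℝ) ^ (q.1 + 1) = 2 * 2 ^ q.1 := by rw [zpow_add₀ (by norm_num)]; norm_num; ring
  rw [h5] at h3
  have h6 : (0 : ℝ) < 2 ^ q.1 := by positivity
  show |x - s.c| ≤ _
  nlinarith

noncomputable def eC : ℝ := 288 * (kC rho 2 + kC rho 4)

lemma eC_pos : 0 < eC := by
  have := kC_pos symb_rho 2
  have := kC_pos symb_rho 4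
  unfold eC; positivity

lemma Tile.abs_sub_c_le {s : Tile} {y : ℝ} (hy : y ∈ s.I) : |y - s.c| ≤ 2 ^ s.k :=
  abs_sub_le_of_mem_dy hy

lemma norm_Fs_bdJ_le {f : ℝ → ℂ} (hf : BI f) {T : Finset Tile} {A : ℝ} (hA : 0 ≤ A) (h : AvgLe f T A)
    {t : TTop} {P : Finset (ℤ × ℤ)} (hP : JPart T t.K t.M P) {q : ℤ × ℤ} (hq : q ∈ P) {s : Tile}
    (hs : s ∈ T) (hst : UnderR 0 1 s t) {y : ℝ} (hy : y ∈ s.I) :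
    ‖Fs (bdJ f t.ξ q) s y‖ ≤ eC * A * (Eo s.k q.1 * wt (2 ^ (-s.k) * (s.c - q.2 * 2 ^ q.1)) ^ 2) := by
  set u : ℝ := 2 ^ (-s.k) with hu
  set z' : ℝ := q.2 * 2 ^ q.1 with hz'
  have hup : 0 < u := by positivity
  have huk : u * 2 ^ s.k = 1 := by rw [hu, ← zpow_add₀ (by norm_num)]; simp
  have hyc := Tile.abs_sub_c_le hy
  have hC2 := kC_pos symb_rho 2
  have hC4 := kC_pos symb_rho 4
  have hb : ∫ z, ‖bdJ f t.ξ q z‖ ≤ 8 * A * 2 ^ q.1 := by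
    have h1 := integral_norm_bdJ_le hf t.ξ q
    have h2 := h.jint hf hP hq
    linarith
  have hb0 : 0 ≤ ∫ z, ‖bdJ f t.ξ q z‖ := integral_nonneg fun _ => norm_nonneg _
  have hsupp : ∀ z, bdJ f t.ξ q z ≠ 0 → |z - z'| ≤ 2 ^ q.1 := fun z hz =>
    abs_sub_le_of_mem_dy (bdJ_supp hz)
  have hw := wt_nonneg (u * (s.c - z'))
  by_cases hlt : q.1 < s.k
  · have hθ : |2 ^ s.k * t.ξ - s.n| ≤ 1 := by
      have := UnderR.zero_one_iff.1 hst.2.2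
      rw [abs_le]; constructor <;> linarith [this.1, this.2]
    have h1 := cv_cancel symb_rho (y := y) hθ (BI_bdJ hf t.ξ q).int (integral_bdJ hf t.ξ q)
      (zpow_le_zpow_right₀ (by norm_num) hlt.le) hsupp
    have h2 : wt (u * (y - z')) ≤ (1 + 1) * wt (u * (s.c - z')) := by
      apply wt_le_mul_wt
      rw [← mul_sub, abs_mul, abs_of_pos hup, sub_sub_sub_cancel_right, ← huk]
      gcongr
    have h3 := pow_le_pow_left₀ (wt_nonneg _) h2 2
    have hE : Eo s.k q.1 = (2 ^ (q.1 - s.k)) ^ 2 := if_pos hlt.le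
    have e2 : (2 : ℝ) ^ (q.1 - s.k) = u * 2 ^ q.1 := by rw [hu, ← zpow_add₀ (by norm_num)]; congr 1; ring
    rw [hE, e2]
    refine h1.trans ?_
    calc _ ≤ 8 * kC rho 2 * u * (u * 2 ^ q.1) * ((1 + 1) * wt (u * (s.c - z'))) ^ 2 * (8 * A * 2 ^ q.1) := by
          gcongr
      _ = 256 * kC rho 2 * A * ((u * 2 ^ q.1) ^ 2 * wt (u * (s.c - z')) ^ 2) := by ring
      _ ≤ _ := by
          gcongr
          unfold eC; linarith
  · have hkq : s.k ≤ q.1 := by omega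
    have hd : ∀ z, bdJ f t.ξ q z ≠ 0 → (2 : ℝ) ^ q.1 ≤ |y - z| := fun z hz => by
      rw [abs_sub_comm]; exact hP.far q hq z (bdJ_supp hz) s hs hkq y hy
    have h1 := cv_far symb_rho 2 2 (s := s) (y := y) (d := 2 ^ q.1) (by positivity) (BI_bdJ hf t.ξ q).int hd
    have h2 : ∫ z, wt (u * (y - z)) ^ 2 * ‖bdJ f t.ξ q z‖ ≤ 9 * wt (u * (s.c - z')) ^ 2 * (8 * A * 2 ^ q.1) := by
      refine le_trans ?_ (mul_le_mul_of_nonneg_left hb (by positivity))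
      rw [← integral_const_mul]
      refine integral_mono_of_nonneg (ae_of_all _ fun z => ?_)
        ((BI_bdJ hf t.ξ q).int.norm.const_mul _) (ae_of_all _ fun z => ?_)
      · have := wt_nonneg (u * (y - z)); positivity
      · by_cases hz : bdJ f t.ξ q z = 0
        · simp [hz]
        · dsimp only
          gcongr
          have h3 : wt (u * (y - z)) ≤ 3 * wt (u * (s.c - z')) := by
            unfold wt
            rw [← div_eq_mul_inv, inv_eq_one_div, div_le_div_iff₀ (by positivity) (by positivity)]
            have h4 := hd z hz
            have h5 := hsupp z hz
            have h6 : |s.c - z'| ≤ 3 * |y - z| := by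
              have : s.c - z' = -(y - s.c) + (y - z) + (z - z') := by ring
              have h7 : (2 : ℝ) ^ s.k ≤ 2 ^ q.1 := zpow_le_zpow_right₀ (by norm_num) hkq
              rw [this]
              refine (abs_add_three _ _ _).trans ?_
              rw [abs_neg]; linarith
            rw [abs_mul, abs_mul, abs_of_pos hup]
            nlinarith
          calc _ ≤ (3 * wt (u * (s.c - z'))) ^ 2 := pow_le_pow_left₀ (wt_nonneg _) h3 2
            _ = _ := by ring
    have hE : Eo s.k q.1 = 2 ^ (s.k - q.1) := by
      unfold Eo
      split_ifs with h
      · have : q.1 = s.k := le_antisymm h hkq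
        simp [this]
      · rfl
    have e2 : (2 : ℝ) ^ (s.k - q.1) = 2 ^ s.k * (2 ^ q.1)⁻¹ := by rw [zpow_sub₀ (by norm_num), div_eq_mul_inv]
    rw [hE]
    refine h1.trans ?_
    have e3 : (2 : ℝ) ^ q.1 * (2 ^ q.1)⁻¹ = 1 := mul_inv_cancel₀ (by positivity)
    calc _ ≤ kC rho (2 + 2) * u * (2 ^ s.k * (2 ^ q.1)⁻¹) ^ 2 * (9 * wt (u * (s.c - z')) ^ 2 * (8 * A * 2 ^ q.1)) := by
          gcongr
      _ = (u * 2 ^ s.k) * (2 ^ q.1 * (2 ^ q.1)⁻¹) * (72 * kC rho 4 * A * (2 ^ s.k * (2 ^ q.1)⁻¹ * wt (u * (s.c - z')) ^ 2)) := by ring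
      _ = 72 * kC rho 4 * A * (2 ^ (s.k - q.1) * wt (u * (s.c - z')) ^ 2) := by rw [huk, e3, e2]; ring
      _ ≤ _ := by
          gcongr
          unfold eC; linarith

lemma norm_Fs_far_le {f : ℝ → ℂ} (hf : BI f) {T : Finset Tile} {A : ℝ} (hA : 0 ≤ A) (h : AvgLe f T A)
    {s : Tile} (hs : s ∈ T) {K : ℤ} {f' : ℝ → ℂ} (hf' : BI f') (hle : ∀ x, ‖f' x‖ ≤ ‖f x‖)
    {y : ℝ} (hy : y ∈ s.I) (hsupp : ∀ z, f' z ≠ 0 → 2 ^ K ≤ |y - z|) :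
    ‖Fs f' s y‖ ≤ 512 * kC rho 6 * A * (2 ^ (s.k - K)) ^ 2 := by
  set u : ℝ := 2 ^ (-s.k) with hu
  have hup : 0 < u := by positivity
  have huk : u * 2 ^ s.k = 1 := by rw [hu, ← zpow_add₀ (by norm_num)]; simp
  have hC := kC_pos symb_rho 6
  have h1 := cv_far symb_rho 2 4 (s := s) (by positivity) hf'.int hsupp
  have h2 : ∫ z, wt (u * (z - s.c)) ^ 4 * ‖f z‖ ≤ 32 * (A * 2 ^ s.k) := by
    refine shell_bound_fun hf.int (by positivity) fun j => ?_
    have h3 := h s hs (2 ^ (s.k + j)) (zpow_le_zpow_right₀ (by norm_num) (by omega))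
    refine h3.trans ?_
    rw [zpow_add₀ (by norm_num), zpow_natCast, mul_assoc]
    have : (2 : ℝ) ^ j ≤ 4 ^ j := pow_le_pow_left₀ (by norm_num) (by norm_num) j
    gcongr
  have hint : Integrable fun z => wt (u * (z - s.c)) ^ 4 * ‖f z‖ := by
    refine hf.int.norm.bdd_mul (c := 1) ?_ (ae_of_all _ fun z => ?_)
    · have := continuous_wt
      exact (by fun_prop : Continuous fun z => wt (u * (z - s.c)) ^ 4).aestronglyMeasurable
    · rw [Real.norm_of_nonneg (pow_nonneg (wt_nonneg _) _)]
      exact pow_le_one₀ (wt_nonneg _) (wt_le_one _)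
  have h4 : ∫ z, wt (u * (y - z)) ^ 4 * ‖f' z‖ ≤ 16 * ∫ z, wt (u * (z - s.c)) ^ 4 * ‖f z‖ := by
    rw [← integral_const_mul]
    refine integral_mono_of_nonneg (ae_of_all _ fun z => ?_) (hint.const_mul _) (ae_of_all _ fun z => ?_)
    · have := wt_nonneg (u * (y - z)); positivity
    · have h5 : wt (u * (y - z)) ≤ (1 + 1) * wt (u * (s.c - z)) := by
        apply wt_le_mul_wt
        rw [← mul_sub, abs_mul, abs_of_pos hup, sub_sub_sub_cancel_right, ← huk]
        gcongr
        exact Tile.abs_sub_c_le hy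
      have e : wt (u * (s.c - z)) = wt (u * (z - s.c)) := by rw [← wt_neg]; congr 1; ring
      rw [e] at h5
      have h6 := pow_le_pow_left₀ (wt_nonneg _) h5 4
      have hw := wt_nonneg (u * (z - s.c))
      dsimp only
      calc _ ≤ ((1 + 1) * wt (u * (z - s.c))) ^ 4 * ‖f z‖ := by gcongr; exact hle z
        _ = _ := by ring
  refine h1.trans ?_
  have e2 : (2 : ℝ) ^ (s.k - K) = 2 ^ s.k * (2 ^ K)⁻¹ := by rw [zpow_sub₀ (by norm_num), div_eq_mul_inv]
  rw [e2]
  calc _ ≤ kC rho (2 + 4) * u * (2 ^ s.k * (2 ^ K)⁻¹) ^ 2 * (16 * (32 * (A * 2 ^ s.k))) := by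
        gcongr; exact h4.trans (by gcongr)
    _ = (u * 2 ^ s.k) * (512 * kC rho 6 * A * (2 ^ s.k * (2 ^ K)⁻¹) ^ 2) := by ring
    _ = _ := by rw [huk, one_mul]

lemma en_le_of_norm_le {f : ℝ → ℂ} {s : Tile} {D : ℝ} (h : ∀ y ∈ s.I, ‖Fs f s y‖ ≤ D) :
    en f s ≤ D ^ 2 * 2 ^ s.k := by
  have h1 : en f s ≤ ∫ x, s.I.indicator (fun _ => D ^ 2) x := by
    refine integral_mono_of_nonneg (ae_of_all _ fun x => by positivity) ?_ (ae_of_all _ fun x => ?_)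
    · rw [integrable_indicator_iff s.measurableSet_I]
      refine integrableOn_const ?_
      rw [Tile.I, volume_dy]; exact ENNReal.ofReal_ne_top
    · by_cases hx : x ∈ s.I
      · simp only [as, indicator_of_mem hx]
        exact pow_le_pow_left₀ (norm_nonneg _) (h x hx) 2
      · simp [as, hx]
  refine h1.trans (le_of_eq ?_)
  rw [integral_indicator s.measurableSet_I, setIntegral_const_real, Tile.I, volume_real_dy, mul_comm]

lemma en_add3_le {f g b e : ℝ → ℂ} (hg : BI g) (hb : BI b) (he : BI e)
    (hf : f = fun x => g x + b x + e x) (s : Tile) :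
    en f s ≤ 3 * (en g s + en b s + en e s) := by
  have hlin : ∀ x, as f s x = as g s x + as b s x + as e s x := by
    intro x
    by_cases hx : x ∈ s.I
    · simp only [as, indicator_of_mem hx, Fs, hf]
      rw [cv_add (symb_rho.sy s) (hg.add hb).int he.int, cv_add (symb_rho.sy s) hg.int hb.int]
    · simp [as, hx]
  have h12 : Integrable fun x => ‖as g s x‖ ^ 2 + ‖as b s x‖ ^ 2 := (BI_as hg s).sq_int.add (BI_as hb s).sq_int
  have e1 : en g s + en b s + en e s = ∫ x, (‖as g s x‖ ^ 2 + ‖as b s x‖ ^ 2 + ‖as e s x‖ ^ 2) := by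
    rw [integral_add h12 (BI_as he s).sq_int, integral_add (BI_as hg s).sq_int (BI_as hb s).sq_int]
    rfl
  rw [e1, ← integral_const_mul]
  unfold en
  refine integral_mono_of_nonneg (ae_of_all _ fun x => by positivity)
    ((h12.add (BI_as he s).sq_int).const_mul _)
    (ae_of_all _ fun x => ?_)
  simp only [hlin]
  have h1 := norm_add₃_le (a := as g s x) (b := as b s x) (c := as e s x)
  have h2 := pow_le_pow_left₀ (norm_nonneg _) h1 2
  nlinarith [sq_nonneg (‖as g s x‖ - ‖as b s x‖), sq_nonneg (‖as g s x‖ - ‖as e s x‖), sq_nonneg (‖as b s x‖ - ‖as e s x‖)]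

lemma JPart.sum_le {T : Finset Tile} {K M : ℤ} {P : Finset (ℤ × ℤ)} (hP : JPart T K M P) :
    ∑ q ∈ P, (2 : ℝ) ^ q.1 ≤ 3 * 2 ^ K := by
  have hp : (0 : ℝ) < 2 ^ K := by positivity
  have key := sum_le_integral P (fun q => dy q.1 q.2) (fun q _ => measurableSet_dy _ _)
    (fun q hq q' hq' h => hP.disj q hq q' hq' h)
    ((Ico (((M - 1 : ℝ)) * 2 ^ K) ((M + 2) * 2 ^ K)).indicator fun _ => (1 : ℝ))
    ((integrable_indicator_iff measurableSet_Ico).2 (integrableOn_const (by simp)))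
    (fun y => indicator_nonneg (fun _ _ => zero_le_one) y) (fun _ => 1) (fun q hq y hy => by
      rw [indicator_of_mem]
      have h1 := abs_le.1 (hP.sub q hq y hy)
      have h2 := ix_le (-K) y
      have h3 := lt_ix (-K) y
      rw [neg_neg] at h2 h3
      have h4 : (M - 1 : ℝ) ≤ ix (-K) y := by exact_mod_cast (show M - 1 ≤ ix (-K) y by omega)
      have h5 : (ix (-K) y + 1 : ℝ) ≤ M + 2 := by exact_mod_cast (show ix (-K) y + 1 ≤ M + 2 by omega)
      constructor <;> nlinarith) (fun q _ => by rw [volume_dy]; exact ENNReal.ofReal_ne_top)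
  simp only [volume_real_dy, mul_one] at key
  rw [integral_indicator measurableSet_Ico, setIntegral_const_real, Real.volume_real_Ico_of_le (by nlinarith)] at key
  linarith

lemma UnderR.dist_wt {a b : ℤ} {s : Tile} {t : TTop} (h : UnderR a b s t) :
    (2 : ℝ) ^ (s.k - t.K) ≤ 2 * wt (2 ^ (-s.k) * (t.M * 2 ^ t.K - s.c)) := by
  have h1 : |s.c - t.M * 2 ^ t.K| ≤ 2 ^ t.K := abs_sub_le_of_mem_dy (show s.c ∈ dy t.K t.M from h.2.1)
  have hup : (0 : ℝ) < 2 ^ (-s.k) := by positivity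
  have h2 : (2 : ℝ) ^ (-s.k) * 2 ^ t.K = 2 ^ (t.K - s.k) := by rw [← zpow_add₀ (by norm_num)]; congr 1; ring
  have h3 : (1 : ℝ) ≤ 2 ^ (t.K - s.k) := one_le_zpow₀ (by norm_num) (by have := h.1; omega)
  have h4 : (2 : ℝ) ^ (s.k - t.K) = (2 ^ (t.K - s.k))⁻¹ := by rw [← zpow_neg]; congr 1; ring
  rw [h4, wt, abs_mul, abs_of_pos hup, abs_sub_comm, ← div_eq_mul_inv, inv_eq_one_div,
    div_le_div_iff₀ (by positivity) (by positivity)]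
  have h5 : (2 : ℝ) ^ (-s.k) * |s.c - t.M * 2 ^ t.K| ≤ 2 ^ (-s.k) * 2 ^ t.K := by gcongr
  rw [h2] at h5
  linarith

noncomputable def enC : ℝ := 1 + (34560 * prC 2 + 73728 * eC ^ 2 + 1536 * (512 * kC rho 6) ^ 2)

lemma enC_pos : 1 ≤ enC := by
  have := prC_pos 2
  unfold enC
  have : 0 ≤ (34560 * prC 2 + 73728 * eC ^ 2 + 1536 * (512 * kC rho 6) ^ 2) := by positivity
  linarith

lemma energy_tree {f : ℝ → ℂ} (hf : BI f) {T : Finset Tile} {A : ℝ} (hA : 0 ≤ A) (h : AvgLe f T A)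
    (hS : SEP T) {t : TTop} (hT : ∀ s ∈ T, UnderR 0 1 s t) :
    ∑ s ∈ T, en f s ≤ enC * A ^ 2 * 2 ^ t.K := by
  classical
  rcases T.eq_empty_or_nonempty with rfl | hne
  · have := enC_pos
    simp; positivity
  obtain ⟨P, hP⟩ := exists_jpart T hne t.K t.M fun s hs => ⟨(hT s hs).1, (hT s hs).2.1⟩
  have hPs := hP.sum_le
  set U : Set ℝ := ⋃ q ∈ P, dy q.1 q.2 with hU
  have hUm : MeasurableSet U := Finset.measurableSet_biUnion _ fun q _ => measurableSet_dy _ _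
  set G : ℝ → ℂ := fun x => ∑ q ∈ P, gdJ f t.ξ q x with hG
  set B : ℝ → ℂ := fun x => ∑ q ∈ P, bdJ f t.ξ q x with hB
  set e : ℝ → ℂ := Uᶜ.indicator f with he
  have hGB : BI G := BI.sum P fun q _ => BI_gdJ f t.ξ q
  have hBB : BI B := BI.sum P fun q _ => BI_bdJ hf t.ξ q
  have heB : BI e := hf.indicator hUm.compl
  have hpt : ∀ (v : ℤ × ℤ → ℝ → ℂ) (q) (hq : q ∈ P) (x) (hx : x ∈ dy q.1 q.2),
      (∀ q x, x ∉ dy q.1 q.2 → v q x = 0) → ∑ q ∈ P, v q x = v q x := by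
    intro v q hq x hx hv
    refine Finset.sum_eq_single_of_mem q hq fun q' hq' hne => hv q' x fun hx' => ?_
    exact Set.disjoint_left.1 (hP.disj q' hq' q hq hne) hx' hx
  have hdec : f = fun x => G x + B x + e x := by
    ext x
    by_cases hx : x ∈ U
    · obtain ⟨q, hq, hxq⟩ : ∃ q ∈ P, x ∈ dy q.1 q.2 := by simpa [hU] using hx
      have h1 : G x = gdJ f t.ξ q x := hpt _ q hq x hxq fun q x hx => by simp [gdJ, hx]
      have h2 : B x = bdJ f t.ξ q x := hpt _ q hq x hxq fun q x hx => by simp [bdJ, gdJ, hx]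
      simp [h1, h2, he, hx, bdJ, hxq]
    · have hx' : ∀ q ∈ P, x ∉ dy q.1 q.2 := fun q hq hxq => hx (mem_biUnion hq hxq)
      have h1 : G x = 0 := Finset.sum_eq_zero fun q hq => by simp [gdJ, hx' q hq]
      have h2 : B x = 0 := Finset.sum_eq_zero fun q hq => by simp [bdJ, gdJ, hx' q hq]
      simp [h1, h2, he, hx]
  -- the good part
  have hav : ∀ q ∈ P, ‖avJ f t.ξ q‖ ≤ 4 * A := by
    intro q hq
    have h1 := norm_avJ_le f t.ξ q
    have h2 := h.jint hf hP hq
    have hp : (2 : ℝ) ^ (-q.1) * 2 ^ q.1 = 1 := by rw [← zpow_add₀ (by norm_num)]; simp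
    calc _ ≤ (2 : ℝ) ^ (-q.1) * (4 * A * 2 ^ q.1) := h1.trans (by gcongr)
      _ = _ := by linear_combination 4 * A * hp
  have hG2 : ∫ x, ‖G x‖ ^ 2 ≤ 48 * A ^ 2 * 2 ^ t.K := by
    have h1 : ∀ x, ‖G x‖ ^ 2 ≤ ∑ q ∈ P, (dy q.1 q.2).indicator (fun _ => (4 * A) ^ 2) x := by
      intro x
      by_cases hx : x ∈ U
      · obtain ⟨q, hq, hxq⟩ : ∃ q ∈ P, x ∈ dy q.1 q.2 := by simpa [hU] using hx
        have h1 : G x = gdJ f t.ξ q x := hpt _ q hq x hxq fun q x hx => by simp [gdJ, hx]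
        refine le_trans ?_ (Finset.single_le_sum (f := fun q : ℤ × ℤ => (dy q.1 q.2).indicator (fun _ => (4 * A) ^ 2) x)
          (fun q _ => indicator_nonneg (fun _ _ => by positivity) x) hq)
        rw [h1, gdJ, indicator_of_mem hxq, indicator_of_mem hxq, norm_mul, norm_eChar, mul_one]
        exact pow_le_pow_left₀ (norm_nonneg _) (hav q hq) 2
      · have hx' : ∀ q ∈ P, x ∉ dy q.1 q.2 := fun q hq hxq => hx (mem_biUnion hq hxq)
        have h1 : G x = 0 := Finset.sum_eq_zero fun q hq => by simp [gdJ, hx' q hq]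
        rw [h1]
        simpa using Finset.sum_nonneg fun (q : ℤ × ℤ) (_ : q ∈ P) => indicator_nonneg (fun _ _ => by positivity) x
    have hi : ∀ q ∈ P, Integrable ((dy q.1 q.2).indicator fun _ : ℝ => (4 * A) ^ 2) := fun q _ => by
      rw [integrable_indicator_iff (measurableSet_dy _ _)]
      refine integrableOn_const ?_
      rw [volume_dy]; exact ENNReal.ofReal_ne_top
    calc _ ≤ ∫ x, ∑ q ∈ P, (dy q.1 q.2).indicator (fun _ => (4 * A) ^ 2) x :=
          integral_mono hGB.sq_int (integrable_finsetSum _ hi) h1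
      _ = ∑ q ∈ P, 2 ^ q.1 * (4 * A) ^ 2 := by
          rw [integral_finsetSum _ hi]
          refine Finset.sum_congr rfl fun q _ => ?_
          rw [integral_indicator (measurableSet_dy _ _), setIntegral_const_real, volume_real_dy]
      _ ≤ 3 * 2 ^ t.K * (4 * A) ^ 2 := by rw [← Finset.sum_mul]; gcongr
      _ = _ := by ring
  have hFD : ∀ s ∈ T, ∀ s' ∈ T, s'.k ≠ s.k → FD s s' := by
    intro s hs s' hs' hne
    by_contra hcon
    obtain ⟨ζ, h1, h2⟩ := not_FD hcon
    rcases lt_or_gt_of_ne hne with hlt | hlt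
    · exact FP.contra ⟨ζ, ζ, h1, h2, by simp⟩ (hS s hs s' hs' hlt) (hT s hs) (hT s' hs') le_rfl
    · exact FP.contra ⟨ζ, ζ, h2, h1, by simp⟩ (hS s' hs' s hs hlt) (hT s' hs') (hT s hs) le_rfl
  have hgood : ∑ s ∈ T, en G s ≤ 240 * prC 2 * (48 * A ^ 2 * 2 ^ t.K) := by
    refine (bessel hGB T hFD).trans ?_
    have := prC_pos 2
    gcongr
  -- the bad part
  have hbad : ∑ s ∈ T, en B s ≤ 64 * (eC * A) ^ 2 * (128 * (3 * 2 ^ t.K)) := by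
    have heC := eC_pos
    have h1 : ∀ s ∈ T, en B s ≤ 64 * (eC * A) ^ 2 * ∑ q ∈ P, 2 ^ s.k *
        (Eo s.k q.1 * wt (2 ^ (-s.k) * (q.2 * 2 ^ q.1 - s.c)) ^ 2) := by
      intro s hs
      set W := ∑ q ∈ P, Eo s.k q.1 * wt (2 ^ (-s.k) * (s.c - q.2 * 2 ^ q.1)) ^ 2 with hW
      have hW0 : 0 ≤ W := Finset.sum_nonneg fun q _ => by
        have := Eo_nonneg s.k q.1; positivity
      have hW1 : W ≤ 64 := sum_Eo_dy s.k s.c P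
      have h2 : en B s ≤ (eC * A * W) ^ 2 * 2 ^ s.k := by
        refine en_le_of_norm_le fun y hy => ?_
        rw [Fs, hB, cv_sum (symb_rho.sy s) P (fun q _ => (BI_bdJ hf t.ξ q).int), hW, Finset.mul_sum]
        refine (norm_sum_le _ _).trans (Finset.sum_le_sum fun q hq => ?_)
        exact norm_Fs_bdJ_le hf hA h hP hq hs (hT s hs) hy
      have h3 : ∑ q ∈ P, 2 ^ s.k * (Eo s.k q.1 * wt (2 ^ (-s.k) * (q.2 * 2 ^ q.1 - s.c)) ^ 2) = 2 ^ s.k * W := by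
        rw [hW, Finset.mul_sum]
        refine Finset.sum_congr rfl fun q _ => ?_
        congr 3
        rw [← wt_neg]; congr 1; ring
      rw [h3]
      refine h2.trans ?_
      calc _ = (eC * A) ^ 2 * (W * W) * 2 ^ s.k := by ring
        _ ≤ (eC * A) ^ 2 * (64 * W) * 2 ^ s.k := by gcongr
        _ = _ := by ring
    calc _ ≤ ∑ s ∈ T, 64 * (eC * A) ^ 2 * ∑ q ∈ P, 2 ^ s.k *
        (Eo s.k q.1 * wt (2 ^ (-s.k) * (q.2 * 2 ^ q.1 - s.c)) ^ 2) := Finset.sum_le_sum h1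
      _ = 64 * (eC * A) ^ 2 * ∑ q ∈ P, ∑ s ∈ T, 2 ^ s.k *
        (Eo s.k q.1 * wt (2 ^ (-s.k) * (q.2 * 2 ^ q.1 - s.c)) ^ 2) := by
          rw [← Finset.mul_sum, Finset.sum_comm]
      _ ≤ 64 * (eC * A) ^ 2 * ∑ q ∈ P, 128 * 2 ^ q.1 := by
          gcongr with q _
          exact sum_Eo_tree T t (a := 0) hT q.1 _
      _ ≤ _ := by rw [← Finset.mul_sum]; gcongr
  -- the far part
  have hfar : ∑ s ∈ T, en e s ≤ 4 * (512 * kC rho 6 * A) ^ 2 * (128 * 2 ^ t.K) := by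
    have h1 : ∀ s ∈ T, en e s ≤ 4 * (512 * kC rho 6 * A) ^ 2 *
        (2 ^ s.k * (Eo s.k t.K * wt (2 ^ (-s.k) * (t.M * 2 ^ t.K - s.c)) ^ 2)) := by
      intro s hs
      have hk := (hT s hs).1
      have h2 : en e s ≤ (512 * kC rho 6 * A * (2 ^ (s.k - t.K)) ^ 2) ^ 2 * 2 ^ s.k := by
        refine en_le_of_norm_le fun y hy => ?_
        refine norm_Fs_far_le hf hA h hs heB (fun x => norm_indicator_le_norm_self _ _) hy fun z hz => ?_
        have hzU : z ∉ U := fun hzU => hz (by simp [he, hzU])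
        have h3 : ¬ |ix (-t.K) z - t.M| ≤ 1 := fun h => by
          obtain ⟨q, hq, hzq⟩ := hP.cover z h
          exact hzU (mem_biUnion hq hzq)
        have h4 : ix (-t.K) y = t.M := (ix_top_of_mem hk hy).trans (hT s hs).2.1
        rw [← h4] at h3
        have h5 := ix_abs_sub_lt (k := -t.K) (x := z) (y := y)
        have h6 : (2 : ℝ) ≤ |(ix (-t.K) z : ℝ) - ix (-t.K) y| := by
          exact_mod_cast (show (2 : ℤ) ≤ |ix (-t.K) z - ix (-t.K) y| by omega)
        rw [zpow_neg, ← div_eq_mul_inv] at h5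
        have h7 : 1 < |z - y| / 2 ^ t.K := by linarith
        rw [lt_div_iff₀ (by positivity), one_mul, abs_sub_comm] at h7
        exact h7.le
      refine h2.trans ?_
      have hE : (2 : ℝ) ^ (s.k - t.K) ≤ Eo s.k t.K := by
        unfold Eo
        split_ifs with hh
        · have : t.K = s.k := le_antisymm hh hk
          simp [this]
        · rfl
      have hw := UnderR.dist_wt (hT s hs)
      set r : ℝ := 2 ^ (s.k - t.K) with hr
      have hr0 : 0 < r := by positivity
      have hr1 : r ≤ 1 := zpow_le_one_of_nonpos₀ (by norm_num) (by omega)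
      set w := wt (2 ^ (-s.k) * (t.M * 2 ^ t.K - s.c)) with hw'
      have hw0 : 0 ≤ w := wt_nonneg _
      have h8 : (r ^ 2) ^ 2 ≤ 4 * (Eo s.k t.K * w ^ 2) := by
        calc (r ^ 2) ^ 2 = r * r * r ^ 2 := by ring
          _ ≤ 1 * Eo s.k t.K * (2 * w) ^ 2 := by
              have := Eo_nonneg s.k t.K
              gcongr
          _ = _ := by ring
      calc _ = (512 * kC rho 6 * A) ^ 2 * 2 ^ s.k * (r ^ 2) ^ 2 := by ring
        _ ≤ (512 * kC rho 6 * A) ^ 2 * 2 ^ s.k * (4 * (Eo s.k t.K * w ^ 2)) := by gcongr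
        _ = _ := by ring
    refine (Finset.sum_le_sum h1).trans ?_
    rw [← Finset.mul_sum]
    gcongr
    exact sum_Eo_tree T t (a := 0) hT t.K _
  calc _ ≤ ∑ s ∈ T, 3 * (en G s + en B s + en e s) :=
        Finset.sum_le_sum fun s _ => en_add3_le hGB hBB heB hdec s
    _ = 3 * (∑ s ∈ T, en G s + ∑ s ∈ T, en B s + ∑ s ∈ T, en e s) := by
        rw [← Finset.mul_sum, Finset.sum_add_distrib, Finset.sum_add_distrib]
    _ ≤ 3 * (240 * prC 2 * (48 * A ^ 2 * 2 ^ t.K) + 64 * (eC * A) ^ 2 * (128 * (3 * 2 ^ t.K)) +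
        4 * (512 * kC rho 6 * A) ^ 2 * (128 * 2 ^ t.K)) := by gcongr
    _ = (34560 * prC 2 + 73728 * eC ^ 2 + 1536 * (512 * kC rho 6) ^ 2) * A ^ 2 * 2 ^ t.K := by ring
    _ ≤ _ := by
        have : 34560 * prC 2 + 73728 * eC ^ 2 + 1536 * (512 * kC rho 6) ^ 2 ≤ enC := by unfold enC; linarith
        exact mul_le_mul_of_nonneg_right (mul_le_mul_of_nonneg_right this (by positivity)) (by positivity)

/-- The energy estimate. -/
lemma sizeLe_of_avgLe {f : ℝ → ℂ} (hf : BI f) {S : Finset Tile} {A : ℝ} (hA : 0 ≤ A)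
    (h : AvgLe f S A) (hS : SEP S) : SizeLe f S (enC * A) := by
  intro t T hTS hT
  refine (energy_tree hf hA (fun s hs => h s (hTS hs))
    (fun s hs s' hs' => hS s (hTS hs) s' (hTS hs')) hT).trans ?_
  have h1 := enC_pos
  rw [mul_pow]
  have : enC ≤ enC ^ 2 := by nlinarith
  gcongr

/-! ### Model pieces and single tile estimates -/

/-- Synthesizing symbols: supported in `[-9, -3]`. -/
structure SynSymb (θ : ℝ → ℝ) : Prop where
  symb : Symb θ
  supp : ∀ x, θ x ≠ 0 → -9 ≤ x ∧ x ≤ -3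

/-- The model piece attached to a tile. -/
noncomputable def hs (θ : ℝ → ℝ) (f : ℝ → ℂ) (s : Tile) : ℝ → ℂ := cv (s.sy θ) (as f s)

lemma BI_hs {θ : ℝ → ℝ} (hθ : Symb θ) {f : ℝ → ℂ} (hf : BI f) (s : Tile) : BI (hs θ f s) :=
  BI.cv (hθ.sy s) (BI_as hf s).int

lemma ix_mul_zpow (k n : ℤ) : ix k (n * 2 ^ (-k)) = n := by
  rw [ix_eq_iff]
  have : (0 : ℝ) < 2 ^ (-k) := by positivity
  constructor <;> nlinarith

lemma norm_hs_le {θ : ℝ → ℝ} (hθ : Symb θ) {f : ℝ → ℂ} (hf : BI f) (N : ℕ) {s : Tile} {σ : ℝ}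
    (h : ∫ y, ‖as f s y‖ ≤ σ * 2 ^ s.k) (x : ℝ) :
    ‖hs θ f s x‖ ≤ 2 ^ N * kC θ N * σ * wt (2 ^ (-s.k) * (x - s.c)) ^ N := by
  have h1 := norm_cv_sy_le hθ N s (BI_as hf s).int (as_of_notMem f s) x
  have hC := kC_pos hθ N
  have hk : (2 : ℝ) ^ s.k * 2 ^ (-s.k) = 1 := by rw [← zpow_add₀ (by norm_num)]; simp
  have hw := wt_nonneg (2 ^ (-s.k) * (x - s.c))
  refine h1.trans ?_
  calc _ ≤ 2 ^ N * kC θ N * (σ * 2 ^ s.k) * (2 ^ (-s.k) * wt (2 ^ (-s.k) * (x - s.c)) ^ N) := by gcongr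
    _ = _ := by linear_combination 2 ^ N * kC θ N * σ * wt (2 ^ (-s.k) * (x - s.c)) ^ N * hk

/-- The part of `E` where the linearizing function lies in the frequency interval of a tile. -/
def vset (N : ℝ → ℝ) (E : Set ℝ) (s : Tile) : Set ℝ := {x | x ∈ E ∧ ix s.k (N x) = s.n}

lemma measurableSet_vset {N : ℝ → ℝ} (hN : Measurable N) {E : Set ℝ} (hE : MeasurableSet E)
    (s : Tile) : MeasurableSet (vset N E s) :=
  hE.inter ((measurable_ix s.k).comp hN (measurableSet_singleton s.n))

lemma DensLe.integral_wt_le {N : ℝ → ℝ} {E : Set ℝ} {S : Finset Tile} {δ : ℝ} (hδ : 0 ≤ δ)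
    (h : DensLe N E S δ) {s : Tile} (hs : s ∈ S) :
    ∫ x in vset N E s, wt (2 ^ (-s.k) * (x - s.c)) ^ 4 ≤ 32 * (δ * 2 ^ s.k) := by
  refine shell_bound (by positivity) fun j => ?_
  have h1 := h s hs s.k le_rfl (s.n * 2 ^ (-s.k)) (by rw [ix_mul_zpow]; omega)
    (by rw [ix_mul_zpow]; omega) j
  refine le_trans (le_of_eq ?_) (h1.trans (le_of_eq (by ring)))
  congr 1
  ext x
  simp only [dset, vset, ix_mul_zpow, mem_inter_iff, mem_ofPred_eq, and_assoc]

lemma integrable_wt_center (k : ℤ) (c : ℝ) {n : ℕ} (hn : 2 ≤ n) :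
    Integrable fun x => wt (2 ^ (-k) * (x - c)) ^ n :=
  integrable_wt_pow hn (by positivity) c

/-- Contribution of a tile on a set where its weight is small. -/
lemma integral_hs_far_le {θ : ℝ → ℝ} (hθ : Symb θ) {f : ℝ → ℂ} (hf : BI f) {N : ℝ → ℝ}
    (hN : Measurable N) {E : Set ℝ} (hE : MeasurableSet E) {S : Finset Tile} {δ σ : ℝ}
    (hδ : 0 ≤ δ) (hσ : 0 ≤ σ) (hd : DensLe N E S δ) (hsz : SizeLe f S σ) {s : Tile} (hs' : s ∈ S)
    {G : Set ℝ} (hGm : MeasurableSet G) {b : ℝ} (hb0 : 0 ≤ b)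
    (hb : ∀ x ∈ G, wt (2 ^ (-s.k) * (x - s.c)) ^ 3 ≤ b) :
    ∫ x in G ∩ vset N E s, ‖hs θ f s x‖ ≤ 2 ^ 12 * kC θ 7 * σ * δ * (2 ^ s.k * b) := by
  have hC := kC_pos hθ 7
  have hV := measurableSet_vset hN hE s
  have hi := integrable_wt_center s.k s.c (n := 4) (by norm_num)
  calc _ ≤ ∫ x in G ∩ vset N E s, 2 ^ 7 * kC θ 7 * σ * b * wt (2 ^ (-s.k) * (x - s.c)) ^ 4 := by
        refine setIntegral_mono_on (BI_hs hθ hf s).int.norm.integrableOn (hi.const_mul _).integrableOn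
          (hGm.inter hV) fun x hx => ?_
        refine (norm_hs_le hθ hf 7 (hsz.integral_as_le hf hσ hs') x).trans ?_
        have h1 := hb x hx.1
        have hw := wt_nonneg (2 ^ (-s.k) * (x - s.c))
        calc _ = 2 ^ 7 * kC θ 7 * σ * wt (2 ^ (-s.k) * (x - s.c)) ^ 3 * wt (2 ^ (-s.k) * (x - s.c)) ^ 4 := by ring
          _ ≤ _ := by gcongr
    _ ≤ ∫ x in vset N E s, 2 ^ 7 * kC θ 7 * σ * b * wt (2 ^ (-s.k) * (x - s.c)) ^ 4 := by
        refine setIntegral_mono_set (hi.const_mul _).integrableOn (ae_of_all _ fun x => ?_) 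
          (inter_subset_right.eventuallyLE)
        have hw := wt_nonneg (2 ^ (-s.k) * (x - s.c))
        simp only [Pi.zero_apply]; positivity
    _ ≤ 2 ^ 7 * kC θ 7 * σ * b * (32 * (δ * 2 ^ s.k)) := by
        rw [integral_const_mul]
        gcongr
        exact hd.integral_wt_le hδ hs'
    _ = _ := by ring

/-- Sums of the pieces over tiles of one scale and one frequency. -/
lemma sum_norm_hs_le {θ : ℝ → ℝ} (hθ : Symb θ) {f : ℝ → ℂ} (hf : BI f) {S : Finset Tile} {σ : ℝ}
    (hσ : 0 ≤ σ) (hsz : SizeLe f S σ) {k n : ℤ} {T : Finset Tile} (hTS : T ⊆ S)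
    (hT : ∀ s ∈ T, s.k = k ∧ s.n = n) (x : ℝ) :
    ∑ s ∈ T, ‖hs θ f s x‖ ≤ 2 ^ 6 * kC θ 2 * σ := by
  have hC := kC_pos hθ 2
  have h1 := sum_tiles_le T k {n} (fun m => wt (2 ^ (-k) * (x - m * 2 ^ k)) ^ 2)
    (fun m => by positivity) (sum_wt_dy_le le_rfl k x) (fun s hs => by simpa using hT s hs)
  calc _ ≤ ∑ s ∈ T, 2 ^ 2 * kC θ 2 * σ * wt (2 ^ (-k) * (x - s.m * 2 ^ k)) ^ 2 := by
        refine Finset.sum_le_sum fun s hs => ?_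
        have := norm_hs_le hθ hf 2 (hsz.integral_as_le hf hσ (hTS hs)) x
        rwa [Tile.c, (hT s hs).1] at this
    _ ≤ 2 ^ 2 * kC θ 2 * σ * 16 := by
        rw [← Finset.mul_sum]
        gcongr
        simpa using h1
    _ = _ := by ring

/-! ### A discrete maximal inequality -/

lemma wt_pair_integral_le {a a' : ℤ} (h : a' ≤ a) (z z' : ℝ) :
    ∫ y, 2 ^ (-a) * wt (2 ^ (-a) * (y - z)) ^ 4 * (2 ^ (-a') * wt (2 ^ (-a') * (y - z')) ^ 4) ≤
      4 * (2 ^ (-a) * wt (2 ^ (-a) * (z - z')) ^ 2) := by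
  have hp : (0 : ℝ) < 2 ^ (-a) := by positivity
  have hp' : (0 : ℝ) < 2 ^ (-a') := by positivity
  have hpp : (2 : ℝ) ^ (-a) ≤ 2 ^ (-a') := zpow_le_zpow_right₀ (by norm_num) (by omega)
  have hi := integrable_wt_center a' z' (n := 2) le_rfl
  calc _ ≤ ∫ y, 2 ^ (-a) * wt (2 ^ (-a) * (z - z')) ^ 2 * (2 ^ (-a') * wt (2 ^ (-a') * (y - z')) ^ 2) := by
        refine integral_mono_of_nonneg (ae_of_all _ fun y => ?_) ((hi.const_mul _).const_mul _)
          (ae_of_all _ fun y => ?_)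
        · have := wt_nonneg (2 ^ (-a) * (y - z)); have := wt_nonneg (2 ^ (-a') * (y - z'))
          simp only [Pi.zero_apply]; positivity
        · set w := wt (2 ^ (-a) * (y - z)) with hw
          set w' := wt (2 ^ (-a') * (y - z')) with hw'
          have h0 : 0 ≤ w := wt_nonneg _
          have h0' : 0 ≤ w' := wt_nonneg _
          have h1 : w ≤ 1 := wt_le_one _
          have h2 : w' ≤ wt (2 ^ (-a) * (y - z')) := by
            apply wt_abs_anti
            rw [abs_mul, abs_mul, abs_of_pos hp, abs_of_pos hp']
            gcongr
          have h3 : w * w' ≤ wt (2 ^ (-a) * (z - z')) := by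
            have e : (2 : ℝ) ^ (-a) * (z - z') = 2 ^ (-a) * (z - y) + 2 ^ (-a) * (y - z') := by ring
            rw [e]
            refine le_trans ?_ (wt_mul_le _ _)
            have e2 : w = wt (2 ^ (-a) * (z - y)) := by rw [hw, ← wt_neg]; congr 1; ring
            rw [← e2]; gcongr
          dsimp only
          calc _ = 2 ^ (-a) * 2 ^ (-a') * (w ^ 2 * ((w * w') ^ 2 * w' ^ 2)) := by ring
            _ ≤ 2 ^ (-a) * 2 ^ (-a') * (1 * (wt (2 ^ (-a) * (z - z')) ^ 2 * w' ^ 2)) := by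
                gcongr
                exact pow_le_one₀ h0 h1
            _ = _ := by ring
    _ ≤ 2 ^ (-a) * wt (2 ^ (-a) * (z - z')) ^ 2 * (2 ^ (-a') * (4 / 2 ^ (-a'))) := by
        rw [integral_const_mul, integral_const_mul]
        gcongr
        exact integral_wt_pow_le le_rfl hp' z'
    _ = _ := by rw [mul_div_cancel₀ _ hp'.ne']; ring

/-- Disjoint dyadic intervals tested against a kernel at a coarser scale. -/
lemma sum_dy_wt_coarse_le (P : Finset (ℤ × ℤ))
    (hd : ∀ q ∈ P, ∀ q' ∈ P, q ≠ q' → Disjoint (dy q.1 q.2) (dy q'.1 q'.2)) (a : ℤ)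
    (ha : ∀ q ∈ P, q.1 ≤ a) (z : ℝ) :
    ∑ q ∈ P, 2 ^ q.1 * (2 ^ (-a) * wt (2 ^ (-a) * (z - q.2 * 2 ^ q.1)) ^ 2) ≤ 16 := by
  have hp : (0 : ℝ) < 2 ^ (-a) := by positivity
  have key := sum_le_integral P (fun q => dy q.1 q.2) (fun q _ => measurableSet_dy _ _)
    (fun q hq q' hq' h => hd q hq q' hq' h)
    (fun y => 2 ^ (-a) * (4 * wt (2 ^ (-a) * (y - z)) ^ 2))
    (((integrable_wt_center a z le_rfl).const_mul 4).const_mul _) (fun y => by positivity)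
    (fun q => 2 ^ (-a) * wt (2 ^ (-a) * (z - q.2 * 2 ^ q.1)) ^ 2) (fun q hq y hy => by
      have h3 : wt (2 ^ (-a) * (q.2 * 2 ^ q.1 - z)) ≤ (1 + 1) * wt (2 ^ (-a) * (y - z)) := by
        apply wt_le_mul_wt
        rw [← mul_sub, abs_mul, abs_of_pos hp, sub_sub_sub_cancel_right, abs_sub_comm]
        calc _ ≤ (2 : ℝ) ^ (-a) * 2 ^ q.1 := by gcongr; exact abs_sub_le_of_mem_dy hy
          _ = 2 ^ (-a + q.1) := by rw [← zpow_add₀ (by norm_num)]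
          _ ≤ 1 := zpow_le_one_of_nonpos₀ (by norm_num) (by have := ha q hq; omega)
      have e : wt (2 ^ (-a) * (z - q.2 * 2 ^ q.1)) = wt (2 ^ (-a) * (q.2 * 2 ^ q.1 - z)) := by
        rw [← wt_neg]; congr 1; ring
      rw [e]
      gcongr
      have := pow_le_pow_left₀ (wt_nonneg _) h3 2
      nlinarith) (fun q _ => by rw [volume_dy]; exact ENNReal.ofReal_ne_top)
  simp only [volume_real_dy] at key
  refine key.trans ?_
  rw [integral_const_mul, integral_const_mul]
  have := integral_wt_pow_le (N := 2) le_rfl hp z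
  calc _ ≤ (2 : ℝ) ^ (-a) * (4 * (4 / 2 ^ (-a))) := by gcongr
    _ = 16 := by field_simp; norm_num

/-- A linearized `L²` maximal inequality over disjoint dyadic intervals. -/
lemma sum_maximal_le (P : Finset (ℤ × ℤ))
    (hd : ∀ q ∈ P, ∀ q' ∈ P, q ≠ q' → Disjoint (dy q.1 q.2) (dy q'.1 q'.2)) (a : ℤ × ℤ → ℤ)
    (ha : ∀ q ∈ P, q.1 ≤ a q) {g : ℝ → ℂ} (hg : BI g) {t : ℝ} (ht : 0 < t) :
    ∑ q ∈ P, 2 ^ q.1 * ∫ y, 2 ^ (-a q) * wt (2 ^ (-a q) * (y - q.2 * 2 ^ q.1)) ^ 4 * ‖g y‖ ≤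
      t * (128 * ∑ q ∈ P, 2 ^ q.1) + t⁻¹ * ∫ y, ‖g y‖ ^ 2 := by
  classical
  set φ : ℤ × ℤ → ℝ → ℝ := fun q y => 2 ^ (-a q) * wt (2 ^ (-a q) * (y - q.2 * 2 ^ q.1)) ^ 4 with hφ
  have hφ0 : ∀ q y, 0 ≤ φ q y := fun q y => by
    have := wt_nonneg (2 ^ (-a q) * (y - q.2 * 2 ^ q.1)); simp only [hφ]; positivity
  have hφi : ∀ q, Integrable (φ q) := fun q => (integrable_wt_center _ _ (by norm_num)).const_mul _
  have hφB : ∀ q, BI fun y => (φ q y : ℂ) := fun q => ⟨(hφi q).ofReal, 2 ^ (-a q), fun y => by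
    rw [Complex.norm_real, Real.norm_of_nonneg (hφ0 q y)]
    have h1 : wt (2 ^ (-a q) * (y - q.2 * 2 ^ q.1)) ^ 4 ≤ 1 := pow_le_one₀ (wt_nonneg _) (wt_le_one _)
    simp only [hφ]
    exact mul_le_of_le_one_right (by positivity) h1⟩
  set Φ : ℝ → ℝ := fun y => ∑ q ∈ P, 2 ^ q.1 * φ q y with hΦ
  have hpair : ∀ q q', Integrable fun y => φ q y * φ q' y := fun q q' => by
    refine ((hφB q').norm_mul_int (hφB q)).congr (ae_of_all _ fun y => ?_)
    simp [abs_of_nonneg (hφ0 q y), abs_of_nonneg (hφ0 q' y)]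
  have hΦ2i : Integrable fun y => Φ y ^ 2 := by
    have : (fun y => Φ y ^ 2) = fun y => ∑ q ∈ P, ∑ q' ∈ P, 2 ^ q.1 * 2 ^ q'.1 * (φ q y * φ q' y) := by
      ext y
      simp only [hΦ, sq, Finset.sum_mul_sum]
      exact Finset.sum_congr rfl fun q _ => Finset.sum_congr rfl fun q' _ => by ring
    rw [this]
    exact integrable_finsetSum _ fun q _ => integrable_finsetSum _ fun q' _ => (hpair q q').const_mul _
  have hΦ2 : ∫ y, Φ y ^ 2 ≤ 128 * ∑ q ∈ P, 2 ^ q.1 := by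
    have e : ∫ y, Φ y ^ 2 = ∑ q ∈ P, ∑ q' ∈ P, 2 ^ q.1 * 2 ^ q'.1 * ∫ y, φ q y * φ q' y := by
      have : (fun y => Φ y ^ 2) = fun y => ∑ q ∈ P, ∑ q' ∈ P, 2 ^ q.1 * 2 ^ q'.1 * (φ q y * φ q' y) := by
        ext y
        simp only [hΦ, sq, Finset.sum_mul_sum]
        exact Finset.sum_congr rfl fun q _ => Finset.sum_congr rfl fun q' _ => by ring
      rw [this, integral_finsetSum _ fun q _ => integrable_finsetSum _ fun q' _ => (hpair q q').const_mul _]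
      refine Finset.sum_congr rfl fun q _ => ?_
      rw [integral_finsetSum _ fun q' _ => (hpair q q').const_mul _]
      exact Finset.sum_congr rfl fun q' _ => integral_const_mul _ _
    rw [e]
    set w : ℤ × ℤ → ℤ × ℤ → ℝ := fun q q' => if a q' ≤ a q then
      2 ^ q.1 * 2 ^ q'.1 * (4 * (2 ^ (-a q) * wt (2 ^ (-a q) * (q.2 * 2 ^ q.1 - q'.2 * 2 ^ q'.1)) ^ 2)) else 0 with hw
    have hw0 : ∀ q q', 0 ≤ w q q' := fun q q' => by
      simp only [hw]; split_ifs
      · positivity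
      · exact le_rfl
    have h1 : ∀ q ∈ P, ∀ q' ∈ P, 2 ^ q.1 * 2 ^ q'.1 * ∫ y, φ q y * φ q' y ≤ w q q' + w q' q := by
      intro q _ q' _
      rcases le_total (a q') (a q) with h | h
      · have h2 := wt_pair_integral_le h (q.2 * 2 ^ q.1) (q'.2 * 2 ^ q'.1)
        have h3 := hw0 q' q
        have h4 : 2 ^ q.1 * 2 ^ q'.1 * ∫ y, φ q y * φ q' y ≤ w q q' := by
          simp only [hw, if_pos h]; gcongr
        linarith
      · have h2 := wt_pair_integral_le h (q'.2 * 2 ^ q'.1) (q.2 * 2 ^ q.1)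
        have h3 := hw0 q q'
        have h4 : 2 ^ q.1 * 2 ^ q'.1 * ∫ y, φ q y * φ q' y ≤ w q' q := by
          simp only [hw, if_pos h, mul_comm (φ q _)]
          rw [mul_comm ((2 : ℝ) ^ q.1)]
          gcongr
        linarith
    have h2 : ∑ q ∈ P, ∑ q' ∈ P, w q q' ≤ 64 * ∑ q ∈ P, 2 ^ q.1 := by
      rw [Finset.mul_sum]
      refine Finset.sum_le_sum fun q _ => ?_
      have h3 := sum_dy_wt_coarse_le (P.filter fun q' => a q' ≤ a q)
        (fun q1 h1 q2 h2 => hd q1 (Finset.mem_filter.1 h1).1 q2 (Finset.mem_filter.1 h2).1) (a q)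
        (fun q' hq' => (ha q' (Finset.mem_filter.1 hq').1).trans (Finset.mem_filter.1 hq').2) (q.2 * 2 ^ q.1)
      calc ∑ q' ∈ P, w q q' = 4 * 2 ^ q.1 * ∑ q' ∈ P with a q' ≤ a q, 2 ^ q'.1 *
            (2 ^ (-a q) * wt (2 ^ (-a q) * (q.2 * 2 ^ q.1 - q'.2 * 2 ^ q'.1)) ^ 2) := by
            simp only [hw]
            rw [← Finset.sum_filter, Finset.mul_sum]
            exact Finset.sum_congr rfl fun q' _ => by ring
        _ ≤ 4 * 2 ^ q.1 * 16 := by gcongr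
        _ = _ := by ring
    calc _ ≤ ∑ q ∈ P, ∑ q' ∈ P, (w q q' + w q' q) :=
          Finset.sum_le_sum fun q hq => Finset.sum_le_sum fun q' hq' => h1 q hq q' hq'
      _ = ∑ q ∈ P, ∑ q' ∈ P, w q q' + ∑ q ∈ P, ∑ q' ∈ P, w q' q := by
          simp_rw [Finset.sum_add_distrib]
      _ = ∑ q ∈ P, ∑ q' ∈ P, w q q' + ∑ q ∈ P, ∑ q' ∈ P, w q q' := by
          congr 1; rw [Finset.sum_comm]
      _ ≤ _ := by linarith
  have hφg : ∀ q, Integrable fun y => φ q y * ‖g y‖ := fun q => by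
    refine (hg.norm_mul_int (hφB q)).congr (ae_of_all _ fun y => ?_)
    simp [abs_of_nonneg (hφ0 q y)]
  calc _ = ∫ y, ∑ q ∈ P, 2 ^ q.1 * (φ q y * ‖g y‖) := by
        rw [integral_finsetSum _ fun q _ => (hφg q).const_mul _]
        exact Finset.sum_congr rfl fun q _ => (integral_const_mul _ _).symm
    _ ≤ ∫ y, (t * Φ y ^ 2 + t⁻¹ * ‖g y‖ ^ 2) := by
        refine integral_mono (integrable_finsetSum _ fun q _ => (hφg q).const_mul _)
          ((hΦ2i.const_mul _).add (hg.sq_int.const_mul _)) fun y => ?_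
        have e : ∑ q ∈ P, 2 ^ q.1 * (φ q y * ‖g y‖) = Φ y * ‖g y‖ := by
          simp only [hΦ, Finset.sum_mul]; exact Finset.sum_congr rfl fun q _ => by ring
        dsimp only
        rw [e]
        have h1 : t * t⁻¹ = 1 := mul_inv_cancel₀ ht.ne'
        have hti : 0 < t⁻¹ := by positivity
        have h2 : 0 ≤ t⁻¹ * (t * Φ y - ‖g y‖) ^ 2 := by positivity
        have h3 : t⁻¹ * (t * Φ y - ‖g y‖) ^ 2 = t * Φ y ^ 2 - 2 * (Φ y * ‖g y‖) + t⁻¹ * ‖g y‖ ^ 2 := by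
          linear_combination (t * Φ y ^ 2 - 2 * Φ y * ‖g y‖) * h1
        have h4 : 0 ≤ t * Φ y ^ 2 := by positivity
        have h5 : 0 ≤ t⁻¹ * ‖g y‖ ^ 2 := by positivity
        nlinarith
    _ = (t * ∫ y, Φ y ^ 2) + t⁻¹ * ∫ y, ‖g y‖ ^ 2 := by
        rw [integral_add (hΦ2i.const_mul _) (hg.sq_int.const_mul _), integral_const_mul, integral_const_mul]
    _ ≤ _ := by gcongr

/-! ### The tree estimate: tiles far from the point -/

lemma wt_far_le {s : Tile} {x : ℝ} {j : ℤ} (h : 2 ^ j ≤ |x - s.c|) :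
    wt (2 ^ (-s.k) * (x - s.c)) ≤ 2 ^ (s.k - j) := by
  have h1 : (2 : ℝ) ^ (s.k - j) = (2 ^ (j - s.k))⁻¹ := by rw [← zpow_neg]; congr 1; ring
  rw [h1]
  refine wt_le_inv (by positivity) ?_
  rw [abs_mul, abs_of_pos (by positivity)]
  calc (2 : ℝ) ^ (j - s.k) = 2 ^ (-s.k) * 2 ^ j := by rw [← zpow_add₀ (by norm_num)]; congr 1; ring
    _ ≤ _ := by gcongr

lemma zpow_sub_le_Eo {k j : ℤ} (h : k ≤ j) : (2 : ℝ) ^ (k - j) ≤ Eo k j := by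
  unfold Eo
  split_ifs with hh
  · have : j = k := le_antisymm hh h
    simp [this]
  · rfl

lemma wt_le_two_mul_wt {u c x z r : ℝ} (hu : 0 ≤ u) (h : r ≤ |x - c|) (hz : |x - z| ≤ r) :
    wt (u * (x - c)) ≤ 2 * wt (u * (z - c)) := by
  have h1 : |z - c| ≤ 2 * |x - c| := by
    have : |z - c| ≤ |z - x| + |x - c| := abs_sub_le z x c
    rw [abs_sub_comm z x] at this
    linarith
  rw [wt, wt, ← div_eq_mul_inv, inv_eq_one_div, div_le_div_iff₀ (by positivity) (by positivity),
    abs_mul, abs_mul, abs_of_nonneg hu]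
  have := mul_le_mul_of_nonneg_left h1 hu
  linarith

lemma tree_outside {θ : ℝ → ℝ} (hθ : Symb θ) {f : ℝ → ℂ} (hf : BI f) {N : ℝ → ℝ}
    (hN : Measurable N) {E : Set ℝ} (hE : MeasurableSet E) {T : Finset Tile} {δ σ : ℝ}
    (hδ : 0 ≤ δ) (hσ : 0 ≤ σ) (hd : DensLe N E T δ) (hsz : SizeLe f T σ) {t : TTop} {i : ℤ}
    (hT : ∀ s ∈ T, UnderR i i s t) {P : Finset (ℤ × ℤ)} (hP : JPart T t.K t.M P) :
    ∑ s ∈ T, ∫ x in (⋃ q ∈ P, dy q.1 q.2)ᶜ ∩ vset N E s, ‖hs θ f s x‖ ≤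
      2 ^ 22 * kC θ 7 * σ * δ * 2 ^ t.K := by
  set U : Set ℝ := ⋃ q ∈ P, dy q.1 q.2 with hU
  have hUm : MeasurableSet U := Finset.measurableSet_biUnion _ fun q _ => measurableSet_dy _ _
  have hC := kC_pos hθ 7
  have h1 : ∀ s ∈ T, ∫ x in Uᶜ ∩ vset N E s, ‖hs θ f s x‖ ≤ 2 ^ 12 * kC θ 7 * σ * δ *
      (4 * (2 ^ s.k * (Eo s.k t.K * wt (2 ^ (-s.k) * (t.M * 2 ^ t.K - s.c)) ^ 2))) := by
    intro s hs
    have hk := (hT s hs).1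
    refine (integral_hs_far_le hθ hf hN hE hδ hσ hd hsz hs hUm.compl
      (b := (2 ^ (s.k - t.K)) ^ 3) (by positivity) fun x hx => ?_).trans ?_
    · refine pow_le_pow_left₀ (wt_nonneg _) (wt_far_le ?_) 3
      have h3 : ¬ |ix (-t.K) x - t.M| ≤ 1 := fun h => by
        obtain ⟨q, hq, hzq⟩ := hP.cover x h
        exact hx (mem_biUnion hq hzq)
      rw [← (hT s hs).2.1] at h3
      have h5 := ix_abs_sub_lt (k := -t.K) (x := x) (y := s.c)
      have h6 : (2 : ℝ) ≤ |(ix (-t.K) x : ℝ) - ix (-t.K) s.c| := by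
        exact_mod_cast (show (2 : ℤ) ≤ |ix (-t.K) x - ix (-t.K) s.c| by omega)
      rw [zpow_neg, ← div_eq_mul_inv] at h5
      have h7 : 1 < |x - s.c| / 2 ^ t.K := by linarith
      rw [lt_div_iff₀ (by positivity), one_mul] at h7
      exact h7.le
    · have hw := UnderR.dist_wt (hT s hs)
      have hE := zpow_sub_le_Eo hk
      set r : ℝ := 2 ^ (s.k - t.K) with hr
      have hr0 : 0 < r := by positivity
      set w := wt (2 ^ (-s.k) * (t.M * 2 ^ t.K - s.c)) with hw'
      have hw0 : 0 ≤ w := wt_nonneg _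
      have h8 : r ^ 3 ≤ 4 * (Eo s.k t.K * w ^ 2) := by
        calc r ^ 3 = r * r ^ 2 := by ring
          _ ≤ Eo s.k t.K * (2 * w) ^ 2 := by
              have := Eo_nonneg s.k t.K
              gcongr
          _ = _ := by ring
      calc _ ≤ 2 ^ 12 * kC θ 7 * σ * δ * (2 ^ s.k * (4 * (Eo s.k t.K * w ^ 2))) := by gcongr
        _ = _ := by ring
  refine (Finset.sum_le_sum h1).trans ?_
  rw [← Finset.mul_sum, ← Finset.mul_sum]
  have := sum_Eo_tree T t (fun s hs => (hT s hs).mono le_rfl (by omega)) t.K (t.M * 2 ^ t.K)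
  calc _ ≤ 2 ^ 12 * kC θ 7 * σ * δ * (4 * (128 * 2 ^ t.K)) := by gcongr
    _ = 2 ^ 21 * kC θ 7 * σ * δ * 2 ^ t.K := by ring
    _ ≤ _ := by gcongr <;> norm_num

lemma tree_small {θ : ℝ → ℝ} (hθ : Symb θ) {f : ℝ → ℂ} (hf : BI f) {N : ℝ → ℝ}
    (hN : Measurable N) {E : Set ℝ} (hE : MeasurableSet E) {T : Finset Tile} {δ σ : ℝ}
    (hδ : 0 ≤ δ) (hσ : 0 ≤ σ) (hd : DensLe N E T δ) (hsz : SizeLe f T σ) {t : TTop} {i : ℤ}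
    (hT : ∀ s ∈ T, UnderR i i s t) {P : Finset (ℤ × ℤ)} (hP : JPart T t.K t.M P) {q : ℤ × ℤ}
    (hq : q ∈ P) :
    ∑ s ∈ T with s.k ≤ q.1, ∫ x in dy q.1 q.2 ∩ vset N E s, ‖hs θ f s x‖ ≤
      2 ^ 21 * kC θ 7 * σ * δ * 2 ^ q.1 := by
  have hC := kC_pos hθ 7
  have h1 : ∀ s ∈ T.filter (fun s => s.k ≤ q.1), ∫ x in dy q.1 q.2 ∩ vset N E s, ‖hs θ f s x‖ ≤
      2 ^ 12 * kC θ 7 * σ * δ *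
      (4 * (2 ^ s.k * (Eo s.k q.1 * wt (2 ^ (-s.k) * (q.2 * 2 ^ q.1 - s.c)) ^ 2))) := by
    intro s hs
    obtain ⟨hs, hk⟩ := Finset.mem_filter.1 hs
    set w := wt (2 ^ (-s.k) * (q.2 * 2 ^ q.1 - s.c)) with hw'
    have hw0 : 0 ≤ w := wt_nonneg _
    have hE0 := Eo_nonneg s.k q.1
    refine (integral_hs_far_le hθ hf hN hE hδ hσ hd hsz hs (measurableSet_dy _ _)
      (b := 4 * (Eo s.k q.1 * w ^ 2)) (by positivity) fun x hx => ?_).trans (le_of_eq (by ring))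
    have hfar := hP.far q hq x hx s hs hk s.c (ix_c s)
    have h2 := wt_far_le hfar
    have h3 : wt (2 ^ (-s.k) * (x - s.c)) ≤ 2 * w :=
      wt_le_two_mul_wt (by positivity) hfar (abs_sub_le_of_mem_dy hx)
    have h4 := zpow_sub_le_Eo hk
    set v := wt (2 ^ (-s.k) * (x - s.c)) with hv
    have hv0 : 0 ≤ v := wt_nonneg _
    calc v ^ 3 = v * v ^ 2 := by ring
      _ ≤ Eo s.k q.1 * (2 * w) ^ 2 := by gcongr; exact h2.trans h4
      _ = _ := by ring
  refine (Finset.sum_le_sum h1).trans ?_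
  rw [← Finset.mul_sum, ← Finset.mul_sum]
  have := sum_Eo_tree (T.filter fun s => s.k ≤ q.1) t (fun s hs =>
    (hT s (Finset.mem_filter.1 hs).1).mono le_rfl (by omega)) q.1 (q.2 * 2 ^ q.1)
  calc _ ≤ 2 ^ 12 * kC θ 7 * σ * δ * (4 * (128 * 2 ^ q.1)) := by gcongr
    _ = _ := by ring

/-! ### The tree estimate: density near the point -/

/-- Points of a dyadic interval seen by a coarse tile of the tree. -/
def gset (N : ℝ → ℝ) (E : Set ℝ) (T : Finset Tile) (q : ℤ × ℤ) : Set ℝ :=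
  dy q.1 q.2 ∩ ⋃ s ∈ T.filter fun s => q.1 < s.k, vset N E s

lemma measurableSet_gset {N : ℝ → ℝ} (hN : Measurable N) {E : Set ℝ} (hE : MeasurableSet E)
    (T : Finset Tile) (q : ℤ × ℤ) : MeasurableSet (gset N E T q) :=
  (measurableSet_dy _ _).inter (Finset.measurableSet_biUnion _ fun s _ => measurableSet_vset hN hE s)

lemma volume_gset_le {N : ℝ → ℝ} {E : Set ℝ} {T : Finset Tile} {δ : ℝ}
    (hd : DensLe N E T δ) {t : TTop} {i : ℤ} (hi0 : 0 ≤ i) (hi : i ≤ 10)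
    (hT : ∀ s ∈ T, UnderR i i s t) {P : Finset (ℤ × ℤ)} (hP : JPart T t.K t.M P) {q : ℤ × ℤ}
    (hq : q ∈ P) : volume.real (gset N E T q) ≤ 88 * δ * 2 ^ q.1 := by
  obtain ⟨s0, hs0, hk0, hnear⟩ := hP.near q hq
  set k := q.1 + 1 with hk
  have hsub : gset N E T q ⊆ ⋃ i' ∈ Finset.Icc 0 (10 : ℤ),
      dset N E s0.c k (((ix k t.ξ + min i i' : ℤ) : ℝ) * 2 ^ (-k)) 1 := by
    rintro x ⟨hxq, hx⟩
    simp only [mem_iUnion, Finset.mem_filter] at hx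
    obtain ⟨s, ⟨hs, hks⟩, hxE, hxn⟩ := hx
    have h1 := (hT s hs).2.2
    have h2 : ix s.k (N x) - ix s.k t.ξ = i := by omega
    have h3 := ix_sub_le (k := s.k) (k' := k) (by omega) (x := t.ξ) (y := N x) (by omega)
    have h4 : ix k (N x) - ix k t.ξ ≤ i := by omega
    simp only [mem_iUnion]
    refine ⟨ix k (N x) - ix k t.ξ, Finset.mem_Icc.2 ⟨by omega, by omega⟩, hxE, ?_, ?_⟩
    · rw [ix_mul_zpow]; omega
    · have h5 := hnear x hxq
      have h6 := abs_sub_lt_of_ix (k := -k) (x := s0.c) (y := x)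
      rw [neg_neg] at h6
      rw [abs_sub_comm]
      refine h6.le.trans ?_
      have h7 : ((|ix (-k) s0.c - ix (-k) x| + 1 : ℤ) : ℝ) ≤ 2 := by exact_mod_cast (by omega)
      calc _ ≤ 2 * (2 : ℝ) ^ k := mul_le_mul_of_nonneg_right h7 (by positivity)
        _ = _ := by rw [zpow_add₀ two_ne_zero k]; norm_num; ring
  have hm : ∀ i' ∈ Finset.Icc 0 (10 : ℤ),
      volume.real (dset N E s0.c k (((ix k t.ξ + min i i' : ℤ) : ℝ) * 2 ^ (-k)) 1) ≤ 8 * δ * 2 ^ q.1 := by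
    intro i' hi'
    have hi' := Finset.mem_Icc.1 hi'
    set η : ℝ := ((ix k t.ξ + min i i' : ℤ) : ℝ) * 2 ^ (-k) with hη
    have e : ix k η = ix k t.ξ + min i i' := ix_mul_zpow k _
    have h1 := (hT s0 hs0).2.2
    have h3 := ix_sub_le (k := k) (k' := s0.k) hk0 (x := t.ξ) (y := η) (by omega)
    refine (hd s0 hs0 k hk0 η (by omega) (by omega) 1).trans (le_of_eq ?_)
    rw [hk, zpow_add₀ (by norm_num)]; norm_num; ring
  have hfin : ∀ i', volume (dset N E s0.c k (((ix k t.ξ + min i i' : ℤ) : ℝ) * 2 ^ (-k)) 1) ≠ ⊤ := by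
    intro i'
    refine ((measure_mono (t := Metric.closedBall s0.c (2 ^ (k + (1 : ℕ)))) ?_).trans_lt
      (by rw [Real.volume_closedBall]; exact ENNReal.ofReal_lt_top)).ne
    rintro x ⟨-, -, h⟩
    simpa [Real.dist_eq] using h
  calc _ ≤ volume.real (⋃ i' ∈ Finset.Icc 0 (10 : ℤ),
      dset N E s0.c k (((ix k t.ξ + min i i' : ℤ) : ℝ) * 2 ^ (-k)) 1) :=
        measureReal_mono hsub ((measure_biUnion_finset_le _ _).trans_lt
          (ENNReal.sum_lt_top.2 fun i' _ => (hfin i').lt_top)).ne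
    _ ≤ ∑ i' ∈ Finset.Icc 0 (10 : ℤ),
      volume.real (dset N E s0.c k (((ix k t.ξ + min i i' : ℤ) : ℝ) * 2 ^ (-k)) 1) :=
        measureReal_biUnion_finset_le _ _
    _ ≤ ∑ i' ∈ Finset.Icc 0 (10 : ℤ), 8 * δ * 2 ^ q.1 := Finset.sum_le_sum hm
    _ = _ := by simp; ring

/-! ### The tree estimate: square integral of the synthesized tree -/

lemma sum_wt_same_scale (T : Finset Tile) (t : TTop) (hT : ∀ s ∈ T, UnderR 0 1 s t) (s : Tile) :
    ∑ s' ∈ T with s'.k = s.k, wt (2 ^ (-s.k) * (s.c - s'.c)) ^ 2 ≤ 32 := by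
  classical
  have h1 := sum_tiles_le (T.filter fun s' => s'.k = s.k) s.k (Finset.Icc (ix s.k t.ξ) (ix s.k t.ξ + 1))
    (fun m => wt (2 ^ (-s.k) * (s.c - m * 2 ^ s.k)) ^ 2) (fun m => by positivity)
    (sum_wt_dy_le le_rfl s.k s.c) (by
      intro s' hs'
      obtain ⟨h2, h3⟩ := Finset.mem_filter.1 hs'
      have := (hT s' h2).2.2
      rw [h3] at this
      exact ⟨h3, Finset.mem_Icc.2 ⟨by omega, by omega⟩⟩)
  have e : ∑ s' ∈ T with s'.k = s.k, wt (2 ^ (-s.k) * (s.c - s'.c)) ^ 2 =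
      ∑ s' ∈ T with s'.k = s.k, wt (2 ^ (-s.k) * (s.c - s'.m * 2 ^ s.k)) ^ 2 :=
    Finset.sum_congr rfl fun s' hs' => by rw [show s'.c = s'.m * 2 ^ s'.k from rfl, (Finset.mem_filter.1 hs').2]
  rw [e]
  refine h1.trans ?_
  rw [Int.card_Icc, show (ix s.k t.ξ + 1 + 1 - ix s.k t.ξ) = (2 : ℕ) by push_cast; ring, Int.toNat_natCast]
  norm_num

lemma hs_orthogonal {θ : ℝ → ℝ} (hθ : SynSymb θ) {f : ℝ → ℂ} (hf : BI f) {T : Finset Tile}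
    (hS : SEP T) {t : TTop} (hT : ∀ s ∈ T, UnderR 0 1 s t) {s s' : Tile} (hsT : s ∈ T)
    (hsT' : s' ∈ T) (hne : s'.k ≠ s.k) : ∫ x, hs θ f s x * (starRingEnd ℂ) (hs θ f s' x) = 0 := by
  refine cv_orthogonal (hθ.symb.sy s) (hθ.symb.sy s') (fun ζ => ?_) (BI_as hf s).int (BI_as hf s').int
  by_contra hcon
  have h1 := hθ.supp _ (left_ne_zero_of_mul hcon)
  have h2 := hθ.supp _ (right_ne_zero_of_mul hcon)
  have h1' : -10 < 2 ^ s.k * ζ - s.n ∧ 2 ^ s.k * ζ - s.n < -2 := ⟨by linarith, by linarith⟩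
  have h2' : -10 < 2 ^ s'.k * ζ - s'.n ∧ 2 ^ s'.k * ζ - s'.n < -2 := ⟨by linarith, by linarith⟩
  rcases lt_or_gt_of_ne hne with hlt | hlt
  · exact FP.contra ⟨ζ, ζ, h1', h2', by simp⟩ (hS s hsT s' hsT' hlt) (hT s hsT) (hT s' hsT') le_rfl
  · exact FP.contra ⟨ζ, ζ, h2', h1', by simp⟩ (hS s' hsT' s hsT hlt) (hT s' hsT') (hT s hsT) le_rfl

lemma hs_pair_le {θ : ℝ → ℝ} (hθ : Symb θ) {f : ℝ → ℂ} (hf : BI f) {s s' : Tile} (hk : s'.k = s.k) :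
    ‖∫ x, hs θ f s x * (starRingEnd ℂ) (hs θ f s' x)‖ ≤
      2 ^ 9 * kC θ 4 ^ 2 * ((en f s + en f s') * wt (2 ^ (-s.k) * (s.c - s'.c)) ^ 2) := by
  have hC := kC_pos hθ 4
  set A := ∫ y, ‖as f s y‖ with hA
  set A' := ∫ y, ‖as f s' y‖ with hA'
  have hA0 : 0 ≤ A := integral_nonneg fun _ => norm_nonneg _
  have hA0' : 0 ≤ A' := integral_nonneg fun _ => norm_nonneg _
  have h1 : ‖∫ x, hs θ f s x * (starRingEnd ℂ) (hs θ f s' x)‖ ≤ ∫ x, (2 ^ 4 * kC θ 4 * A) * (2 ^ 4 * kC θ 4 * A') *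
      (2 ^ (-s.k) * wt (2 ^ (-s.k) * (x - s.c)) ^ 4 * (2 ^ (-s.k) * wt (2 ^ (-s.k) * (x - s'.c)) ^ 4)) := by
    refine norm_integral_le_of_norm_le (Integrable.const_mul ?_ _) (ae_of_all _ fun x => ?_)
    · refine ((integrable_wt_center s.k s.c (n := 4) (by norm_num)).const_mul
        ((2 : ℝ) ^ (-s.k) * 2 ^ (-s.k))).mono' (by
          have := continuous_wt
          exact Continuous.aestronglyMeasurable (by fun_prop)) (ae_of_all _ fun x => ?_)
      have hw := wt_nonneg (2 ^ (-s.k) * (x - s.c))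
      have hw' := wt_nonneg (2 ^ (-s.k) * (x - s'.c))
      rw [Real.norm_of_nonneg (by positivity)]
      have : wt (2 ^ (-s.k) * (x - s'.c)) ^ 4 ≤ 1 := pow_le_one₀ hw' (wt_le_one _)
      calc _ = (2 : ℝ) ^ (-s.k) * 2 ^ (-s.k) * wt (2 ^ (-s.k) * (x - s.c)) ^ 4 * wt (2 ^ (-s.k) * (x - s'.c)) ^ 4 := by ring
        _ ≤ (2 : ℝ) ^ (-s.k) * 2 ^ (-s.k) * wt (2 ^ (-s.k) * (x - s.c)) ^ 4 * 1 := by gcongr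
        _ = _ := by ring
    · rw [norm_mul, RCLike.norm_conj]
      have h2 := norm_cv_sy_le hθ 4 s (BI_as hf s).int (as_of_notMem f s) x
      have h3 := norm_cv_sy_le hθ 4 s' (BI_as hf s').int (as_of_notMem f s') x
      rw [hk] at h3
      refine (mul_le_mul h2 h3 (norm_nonneg _) ((norm_nonneg _).trans h2)).trans (le_of_eq ?_)
      ring
  rw [integral_const_mul] at h1
  have h2 := wt_pair_integral_le (le_refl s.k) s.c s'.c
  have h3 := integral_as_sq_le hf s
  have h4 := integral_as_sq_le hf s'
  rw [hk] at h4
  set w := wt (2 ^ (-s.k) * (s.c - s'.c)) ^ 2 with hw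
  have hw0 : 0 ≤ w := by positivity
  have hAA : A * A' ≤ 2 ^ s.k * (en f s + en f s') / 2 := by nlinarith [sq_nonneg (A - A')]
  refine h1.trans ?_
  calc _ ≤ (2 ^ 4 * kC θ 4 * A) * (2 ^ 4 * kC θ 4 * A') * (4 * (2 ^ (-s.k) * w)) := by gcongr
    _ = 2 ^ 10 * kC θ 4 ^ 2 * 2 ^ (-s.k) * w * (A * A') := by ring
    _ ≤ 2 ^ 10 * kC θ 4 ^ 2 * 2 ^ (-s.k) * w * (2 ^ s.k * (en f s + en f s') / 2) := by gcongr
    _ = 2 ^ 9 * kC θ 4 ^ 2 * ((en f s + en f s') * w) * (2 ^ (-s.k) * 2 ^ s.k) := by ring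
    _ = _ := by rw [← zpow_add₀ (by norm_num)]; simp

lemma tree_sq_le {θ : ℝ → ℝ} (hθ : SynSymb θ) {f : ℝ → ℂ} (hf : BI f) {T : Finset Tile} {σ : ℝ}
    (hS : SEP T) (hsz : SizeLe f T σ) {t : TTop} (hT : ∀ s ∈ T, UnderR 0 1 s t) :
    ∫ x, ‖∑ s ∈ T, hs θ f s x‖ ^ 2 ≤ 2 ^ 15 * kC θ 4 ^ 2 * σ ^ 2 * 2 ^ t.K := by
  classical
  have hC := kC_pos hθ.symb 4
  refine (integral_norm_sum_sq_le T fun s _ => BI_hs hθ.symb hf s).trans ?_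
  have h1 : ∀ s ∈ T, ∀ s' ∈ T, ‖∫ x, hs θ f s x * (starRingEnd ℂ) (hs θ f s' x)‖ ≤
      2 ^ 9 * kC θ 4 ^ 2 * (if s'.k = s.k then en f s * wt (2 ^ (-s.k) * (s.c - s'.c)) ^ 2 else 0) +
      2 ^ 9 * kC θ 4 ^ 2 * (if s.k = s'.k then en f s' * wt (2 ^ (-s'.k) * (s'.c - s.c)) ^ 2 else 0) := by
    intro s hs s' hs'
    by_cases hk : s'.k = s.k
    · rw [if_pos hk, if_pos hk.symm, hk]
      refine (hs_pair_le hθ.symb hf hk).trans (le_of_eq ?_)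
      have : wt (2 ^ (-s.k) * (s'.c - s.c)) = wt (2 ^ (-s.k) * (s.c - s'.c)) := by
        rw [← wt_neg]; congr 1; ring
      rw [this]; ring
    · rw [if_neg hk, if_neg (Ne.symm hk), hs_orthogonal hθ hf hS hT hs hs' hk]
      simp
  have h2 : ∑ s ∈ T, ∑ s' ∈ T, 2 ^ 9 * kC θ 4 ^ 2 *
      (if s'.k = s.k then en f s * wt (2 ^ (-s.k) * (s.c - s'.c)) ^ 2 else 0) ≤
      2 ^ 14 * kC θ 4 ^ 2 * (σ ^ 2 * 2 ^ t.K) := by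
    have h3 : ∀ s ∈ T, ∑ s' ∈ T, 2 ^ 9 * kC θ 4 ^ 2 *
        (if s'.k = s.k then en f s * wt (2 ^ (-s.k) * (s.c - s'.c)) ^ 2 else 0) ≤
        2 ^ 14 * kC θ 4 ^ 2 * en f s := by
      intro s hs
      rw [← Finset.mul_sum, ← Finset.sum_filter, ← Finset.mul_sum]
      have h4 := sum_wt_same_scale T t hT s
      have h5 := en_nonneg f s
      calc _ ≤ 2 ^ 9 * kC θ 4 ^ 2 * (en f s * 32) := by gcongr
        _ = _ := by ring
    refine (Finset.sum_le_sum h3).trans ?_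
    rw [← Finset.mul_sum]
    have := hsz t T subset_rfl hT
    gcongr
  refine (Finset.sum_le_sum fun s hs => Finset.sum_le_sum (h1 s hs)).trans ?_
  simp only [Finset.sum_add_distrib]
  have h3 : ∑ s ∈ T, ∑ s' ∈ T, 2 ^ 9 * kC θ 4 ^ 2 *
      (if s.k = s'.k then en f s' * wt (2 ^ (-s'.k) * (s'.c - s.c)) ^ 2 else 0) ≤
      2 ^ 14 * kC θ 4 ^ 2 * (σ ^ 2 * 2 ^ t.K) := by
    rw [Finset.sum_comm]; exact h2
  calc _ ≤ 2 ^ 14 * kC θ 4 ^ 2 * (σ ^ 2 * 2 ^ t.K) + 2 ^ 14 * kC θ 4 ^ 2 * (σ ^ 2 * 2 ^ t.K) := add_le_add h2 h3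
    _ = _ := by ring

/-! ### The tree estimate: truncations in scale -/

noncomputable def psiBump : ContDiffBump (0 : ℝ) := ⟨10, 30, by norm_num, by norm_num⟩

/-- A smooth cutoff to frequencies of size about one. -/
noncomputable def psi (x : ℝ) : ℝ := psiBump x

lemma symb_psi : Symb psi := ⟨psiBump.contDiff, psiBump.hasCompactSupport⟩

lemma psi_eq_one {x : ℝ} (h : |x| ≤ 10) : psi x = 1 := by
  apply psiBump.one_of_mem_closedBall
  rw [Metric.mem_closedBall, Real.dist_eq, sub_zero]
  exact h

lemma psi_eq_zero {x : ℝ} (h : 30 ≤ |x|) : psi x = 0 := by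
  apply psiBump.zero_of_le_dist
  rw [Real.dist_eq, sub_zero]
  exact h

/-- The cutoff to frequencies within about `2^{-a}` of `ξ`. -/
noncomputable def mol (a : ℤ) (ξ ζ : ℝ) : ℝ := psi (2 ^ a * ζ - 2 ^ a * ξ)

lemma symb_mol (a : ℤ) (ξ : ℝ) : Symb (mol a ξ) := symb_psi.scale (by positivity) _

lemma norm_ker_mol_le (a : ℤ) (ξ t : ℝ) :
    ‖ker (mol a ξ) t‖ ≤ kC psi 4 * (2 ^ (-a) * wt (2 ^ (-a) * t) ^ 4) := by
  have h := ker_scale psi (c := (2 : ℝ) ^ a) (by positivity) (2 ^ a * ξ) t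
  rw [show mol a ξ = fun ζ => psi (2 ^ a * ζ - 2 ^ a * ξ) from rfl, h, norm_mul, norm_mul, norm_eChar,
    one_mul, Complex.norm_real, Real.norm_of_nonneg (by positivity), ← zpow_neg]
  have := norm_ker_le symb_psi 4 (2 ^ (-a) * t)
  calc _ ≤ (2 : ℝ) ^ (-a) * (kC psi 4 * wt (2 ^ (-a) * t) ^ 4) := by gcongr
    _ = _ := by ring

/-- An average of `‖g‖` at scale `2^a`. -/
noncomputable def avg (g : ℝ → ℂ) (a : ℤ) (z : ℝ) : ℝ :=
  ∫ y, 2 ^ (-a) * wt (2 ^ (-a) * (y - z)) ^ 4 * ‖g y‖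

lemma avg_nonneg (g : ℝ → ℂ) (a : ℤ) (z : ℝ) : 0 ≤ avg g a z :=
  integral_nonneg fun y => by have := wt_nonneg (2 ^ (-a) * (y - z)); positivity

lemma norm_cv_mol_le {g : ℝ → ℂ} (hg : BI g) (a : ℤ) (ξ : ℝ) {x z : ℝ} (h : |x - z| ≤ 2 ^ a) :
    ‖cv (mol a ξ) g x‖ ≤ 16 * kC psi 4 * avg g a z := by
  have hC := kC_pos symb_psi 4
  rw [avg, ← integral_const_mul]
  refine norm_integral_le_of_norm_le (Integrable.const_mul ?_ _) (ae_of_all _ fun y => ?_)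
  · refine (hg.int.norm.const_mul ((2 : ℝ) ^ (-a))).mono' (by
      have h1 := continuous_wt
      exact (Continuous.aestronglyMeasurable (by fun_prop)).mul hg.int.norm.aestronglyMeasurable)
      (ae_of_all _ fun y => ?_)
    have hw := wt_nonneg (2 ^ (-a) * (y - z))
    rw [Real.norm_of_nonneg (by positivity)]
    have h2 : wt (2 ^ (-a) * (y - z)) ^ 4 ≤ 1 := pow_le_one₀ hw (wt_le_one _)
    calc _ ≤ (2 : ℝ) ^ (-a) * 1 * ‖g y‖ := by gcongr
      _ = _ := by ring
  · rw [norm_mul]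
    have h1 := norm_ker_mol_le a ξ (x - y)
    have h2 : wt (2 ^ (-a) * (x - y)) ≤ (1 + 1) * wt (2 ^ (-a) * (z - y)) := by
      refine wt_le_mul_wt ?_
      rw [show (2 : ℝ) ^ (-a) * (x - y) - 2 ^ (-a) * (z - y) = 2 ^ (-a) * (x - z) by ring, abs_mul,
        abs_of_pos (by positivity)]
      calc _ ≤ (2 : ℝ) ^ (-a) * 2 ^ a := by gcongr
        _ = 1 := by rw [← zpow_add₀ (by norm_num)]; simp
    have h3 : wt (2 ^ (-a) * (z - y)) = wt (2 ^ (-a) * (y - z)) := by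
      rw [← wt_neg]; congr 1; ring
    rw [h3] at h2
    have hw := wt_nonneg (2 ^ (-a) * (x - y))
    have hw' := wt_nonneg (2 ^ (-a) * (y - z))
    calc _ ≤ kC psi 4 * (2 ^ (-a) * ((1 + 1) * wt (2 ^ (-a) * (y - z))) ^ 4) * ‖g y‖ := by
          gcongr; exact h1.trans (by gcongr)
      _ = _ := by ring

lemma cv_mol_coarse {θ : ℝ → ℝ} (hθ : SynSymb θ) {f : ℝ → ℂ} (hf : BI f) {s : Tile} {t : TTop}
    (hs1 : UnderR 0 1 s t) {a : ℤ} (ha : a ≤ s.k) : cv (mol a t.ξ) (hs θ f s) = hs θ f s := by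
  rw [hs, cv_cv (symb_mol a t.ξ) (hθ.symb.sy s) (BI_as hf s).int]
  congr 1
  ext ζ
  by_cases h0 : s.sy θ ζ = 0
  · rw [h0, mul_zero]
  have h1 := hθ.supp _ h0
  have h2 := UnderR.zero_one_iff.1 hs1.2.2
  have h3 : (2 : ℝ) ^ s.k * |ζ - t.ξ| ≤ 10 := by
    rw [← abs_of_pos (show (0 : ℝ) < 2 ^ s.k by positivity), ← abs_mul, abs_le]
    constructor <;> nlinarith
  have h4 : (2 : ℝ) ^ a ≤ 2 ^ s.k := zpow_le_zpow_right₀ (by norm_num) ha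
  rw [mol, psi_eq_one, one_mul]
  rw [← mul_sub, abs_mul, abs_of_pos (by positivity)]
  exact (mul_le_mul_of_nonneg_right h4 (abs_nonneg _)).trans h3

lemma cv_mol_fine {θ : ℝ → ℝ} (hθ : SynSymb θ) {f : ℝ → ℂ} (hf : BI f) {s : Tile} {t : TTop}
    (hs1 : UnderR 0 1 s t) {a : ℤ} (ha : s.k + 4 ≤ a) (x : ℝ) : cv (mol a t.ξ) (hs θ f s) x = 0 := by
  rw [hs, cv_cv (symb_mol a t.ξ) (hθ.symb.sy s) (BI_as hf s).int]
  refine cv_zero _ (fun ζ => ?_) x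
  by_cases h0 : s.sy θ ζ = 0
  · rw [h0, mul_zero]
  have h1 := hθ.supp _ h0
  have h2 := UnderR.zero_one_iff.1 hs1.2.2
  have h3 : 2 ≤ (2 : ℝ) ^ s.k * |ζ - t.ξ| := by
    rw [← abs_of_pos (show (0 : ℝ) < 2 ^ s.k by positivity), ← abs_mul, le_abs]
    right; nlinarith
  have h4 : (2 : ℝ) ^ (s.k + 4) ≤ 2 ^ a := zpow_le_zpow_right₀ (by norm_num) ha
  rw [zpow_add₀ two_ne_zero] at h4
  norm_num at h4
  rw [mol, psi_eq_zero, zero_mul]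
  rw [← mul_sub, abs_mul, abs_of_pos (by positivity)]
  nlinarith [mul_le_mul_of_nonneg_right h4 (abs_nonneg (ζ - t.ξ))]

lemma sum_coarse_eq {θ : ℝ → ℝ} (hθ : SynSymb θ) {f : ℝ → ℂ} (hf : BI f) {T : Finset Tile} {t : TTop}
    (hT : ∀ s ∈ T, UnderR 0 1 s t) {a : ℤ} (ha : ∀ s ∈ T, a ≤ s.k ∨ s.k + 4 ≤ a) (x : ℝ) :
    ∑ s ∈ T with a ≤ s.k, hs θ f s x = cv (mol a t.ξ) (fun y => ∑ s ∈ T, hs θ f s y) x := by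
  rw [cv_sum (symb_mol a t.ξ) T (fun s _ => (BI_hs hθ.symb hf s).int), Finset.sum_filter]
  refine Finset.sum_congr rfl fun s hs' => ?_
  split_ifs with h
  · rw [cv_mol_coarse hθ hf (hT s hs') h]
  · rw [cv_mol_fine hθ hf (hT s hs') ((ha s hs').resolve_left h)]

/-- The scales at which the truncated sums are controlled. -/
noncomputable def scl (T : Finset Tile) (j : ℤ) : Finset ℤ :=
  ((T.filter fun s => j < s.k).image fun s => s.k) ∪ ((T.filter fun s => j < s.k).image fun s => s.k + 4)

lemma near_le {θ : ℝ → ℝ} (hθ : SynSymb θ) {f : ℝ → ℂ} (hf : BI f) {T : Finset Tile} (hS : SEP T)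
    {t : TTop} {i : ℤ} (hi0 : 0 ≤ i) (hi : i ≤ 1) (hT : ∀ s ∈ T, UnderR i i s t) {q : ℤ × ℤ}
    {x : ℝ} (hx : x ∈ dy q.1 q.2) (ν : ℝ) {B : ℝ} (hB0 : 0 ≤ B)
    (hB : ∀ a ∈ scl T q.1, avg (fun y => ∑ s ∈ T, hs θ f s y) a (q.2 * 2 ^ q.1) ≤ B) :
    ‖∑ s ∈ T with q.1 < s.k ∧ ix s.k ν = s.n, hs θ f s x‖ ≤ 32 * kC psi 4 * B := by
  classical
  have hC := kC_pos symb_psi 4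
  have hT1 : ∀ s ∈ T, UnderR 0 1 s t := fun s hs => (hT s hs).mono hi0 hi
  have hgB : BI (fun y => ∑ s ∈ T, hs θ f s y) := BI.sum T fun s _ => BI_hs hθ.symb hf s
  set R := T.filter fun s => q.1 < s.k ∧ ix s.k ν = s.n with hR
  rcases R.eq_empty_or_nonempty with h0 | hne
  · rw [h0]; simp; positivity
  obtain ⟨s0, hs0, hmin⟩ := R.exists_min_image (fun s => s.k) hne
  obtain ⟨s1, hs1, hmax⟩ := R.exists_max_image (fun s => s.k) hne
  obtain ⟨hs0T, hk0, hn0⟩ := Finset.mem_filter.1 hs0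
  obtain ⟨hs1T, hk1, hn1⟩ := Finset.mem_filter.1 hs1
  have hle : ∀ {a : ℤ}, (∀ s ∈ T, a ≤ s.k ∨ s.k + 4 ≤ a) → a ∈ scl T q.1 → q.1 ≤ a →
      ‖∑ s ∈ T with a ≤ s.k, hs θ f s x‖ ≤ 16 * kC psi 4 * B := by
    intro a h1 h2 h3
    rw [sum_coarse_eq hθ hf hT1 h1]
    refine (norm_cv_mol_le hgB a t.ξ (z := q.2 * 2 ^ q.1)
      ((abs_sub_le_of_mem_dy hx).trans (zpow_le_zpow_right₀ (by norm_num) h3))).trans ?_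
    have := hB a h2
    gcongr
  have hA := hle (a := s0.k) (fun s hs => by
      by_cases h : s0.k ≤ s.k
      · exact Or.inl h
      · exact Or.inr (hS s0 hs0T s hs (by omega)))
    (Finset.mem_union_left _ (Finset.mem_image.2 ⟨s0, Finset.mem_filter.2 ⟨hs0T, hk0⟩, rfl⟩)) hk0.le
  have hA' := hle (a := s1.k + 4) (fun s hs => by
      by_cases h : s1.k < s.k
      · exact Or.inl (hS s hs s1 hs1T h)
      · exact Or.inr (by omega))
    (Finset.mem_union_right _ (Finset.mem_image.2 ⟨s1, Finset.mem_filter.2 ⟨hs1T, hk1⟩, rfl⟩)) (by omega)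
  have hsplit : ∑ s ∈ T with s0.k ≤ s.k, hs θ f s x =
      ∑ s ∈ R, hs θ f s x + ∑ s ∈ T with s1.k + 4 ≤ s.k, hs θ f s x := by
    rw [← Finset.sum_union]
    · refine Finset.sum_congr ?_ fun _ _ => rfl
      ext s
      simp only [Finset.mem_union, Finset.mem_filter, hR]
      constructor
      · rintro ⟨hs, hk⟩
        by_cases h : s1.k < s.k
        · exact Or.inr ⟨hs, hS s hs s1 hs1T h⟩
        · refine Or.inl ⟨hs, by omega, ?_⟩
          have e0 := (hT s0 hs0T).2.2
          have e1 := (hT s1 hs1T).2.2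
          have e := (hT s hs).2.2
          have h3 := ix_sub_le (k := s1.k) (k' := s.k) (by omega) (x := t.ξ) (y := ν) (by omega)
          have h4 := ix_sub_le (k := s.k) (k' := s0.k) (by omega) (x := t.ξ) (y := ν) (by omega)
          omega
      · rintro (⟨hs, hk, hn⟩ | ⟨hs, hk⟩)
        · exact ⟨hs, hmin s (Finset.mem_filter.2 ⟨hs, hk, hn⟩)⟩
        · have := hmin s1 hs1
          exact ⟨hs, by omega⟩
    · rw [Finset.disjoint_left]
      intro s h1 h2
      have := hmax s h1
      have := (Finset.mem_filter.1 h2).2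
      omega
  have e : ∑ s ∈ R, hs θ f s x = ∑ s ∈ T with s0.k ≤ s.k, hs θ f s x -
      ∑ s ∈ T with s1.k + 4 ≤ s.k, hs θ f s x := by rw [hsplit]; ring
  rw [e]
  calc _ ≤ 16 * kC psi 4 * B + 16 * kC psi 4 * B := (norm_sub_le _ _).trans (add_le_add hA hA')
    _ = _ := by ring

lemma near_single_le {θ : ℝ → ℝ} (hθ : Symb θ) {f : ℝ → ℂ} (hf : BI f) {T : Finset Tile} (hS : SEP T)
    {σ : ℝ} (hσ : 0 ≤ σ) (hsz : SizeLe f T σ)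
    {t : TTop} {i : ℤ} (hi2 : 2 ≤ i) (hi : i ≤ 10) (hT : ∀ s ∈ T, UnderR i i s t) (j : ℤ)
    (x ν : ℝ) :
    ‖∑ s ∈ T with j < s.k ∧ ix s.k ν = s.n, hs θ f s x‖ ≤ 2 ^ 6 * kC θ 2 * σ := by
  have hC := kC_pos hθ 2
  set R := T.filter fun s => j < s.k ∧ ix s.k ν = s.n with hR
  rcases R.eq_empty_or_nonempty with h0 | ⟨s0, hs0⟩
  · rw [h0]; simp; positivity
  have hRT : R ⊆ T := Finset.filter_subset _ _
  have key : ∀ s ∈ R, ∀ s' ∈ R, ¬ s'.k < s.k := by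
    intro s hs s' hs' hlt
    have h4 := hS s (hRT hs) s' (hRT hs') hlt
    have e := (hT s (hRT hs)).2.2
    have e' := (hT s' (hRT hs')).2.2
    have n := (Finset.mem_filter.1 hs).2.2
    have n' := (Finset.mem_filter.1 hs').2.2
    have h5 := ix_sub_le (k := s.k - 4) (k' := s'.k) (by omega) (x := t.ξ) (y := ν)
      (sub_nonneg.1 (ix_sub_le (k := s.k) (k' := s.k - 4) (by omega) (x := t.ξ) (y := ν) (by omega)).1)
    rw [ix_coarse' (show s.k - 4 ≤ s.k by omega), ix_coarse' (show s.k - 4 ≤ s.k by omega),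
      show s.k - (s.k - 4) = (4 : ℕ) by push_cast; ring, Int.toNat_natCast] at h5
    omega
  refine (norm_sum_le _ _).trans (sum_norm_hs_le hθ hf hσ hsz hRT (k := s0.k) (n := s0.n)
    (fun s hs => ?_) x)
  have h1 : s.k = s0.k := le_antisymm (not_lt.1 (key s hs s0 hs0)) (not_lt.1 (key s0 hs0 s hs))
  refine ⟨h1, ?_⟩
  rw [← (Finset.mem_filter.1 hs).2.2, ← (Finset.mem_filter.1 hs0).2.2, h1]

/-! ### The tree estimate -/

/-- The model operator of a collection of tiles, restricted to `E`. -/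
noncomputable def TS (θ : ℝ → ℝ) (f : ℝ → ℂ) (N : ℝ → ℝ) (E : Set ℝ) (S : Finset Tile) (x : ℝ) : ℂ :=
  ∑ s ∈ S, (vset N E s).indicator (hs θ f s) x

lemma integrable_TS {θ : ℝ → ℝ} (hθ : Symb θ) {f : ℝ → ℂ} (hf : BI f) {N : ℝ → ℝ}
    (hN : Measurable N) {E : Set ℝ} (hE : MeasurableSet E) (S : Finset Tile) :
    Integrable (TS θ f N E S) :=
  integrable_finsetSum _ fun s _ => (BI_hs hθ hf s).int.indicator (measurableSet_vset hN hE s)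

noncomputable def nearC (θ : ℝ → ℝ) : ℝ :=
  192 * kC θ 2 + 32 * kC psi 4 * (384 + 2 ^ 15 * kC θ 4 ^ 2)

lemma nearC_pos {θ : ℝ → ℝ} (hθ : Symb θ) : 0 < nearC θ := by
  have h1 := kC_pos hθ 2
  have h2 := kC_pos symb_psi 4
  unfold nearC; positivity

lemma exists_near_bound {θ : ℝ → ℝ} (hθ : SynSymb θ) {f : ℝ → ℂ} (hf : BI f) {T : Finset Tile}
    (hS : SEP T) {σ : ℝ} (hσ : 0 < σ) (hsz : SizeLe f T σ) {t : TTop} {i : ℤ} (hi0 : 0 ≤ i)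
    (hi : i ≤ 10) (hT : ∀ s ∈ T, UnderR i i s t) {P : Finset (ℤ × ℤ)} (hP : JPart T t.K t.M P) :
    ∃ b : ℤ × ℤ → ℝ, (∀ q ∈ P, 0 ≤ b q ∧ ∀ x ∈ dy q.1 q.2, ∀ ν,
      ‖∑ s ∈ T with q.1 < s.k ∧ ix s.k ν = s.n, hs θ f s x‖ ≤ b q) ∧
      ∑ q ∈ P, 2 ^ q.1 * b q ≤ nearC θ * σ * 2 ^ t.K := by
  have h2 := kC_pos hθ.symb 2
  have h4 := kC_pos symb_psi 4
  have hPs := hP.sum_le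
  by_cases hi1 : i ≤ 1
  · have hT1 : ∀ s ∈ T, UnderR 0 1 s t := fun s hs => (hT s hs).mono hi0 hi1
    set g : ℝ → ℂ := fun y => ∑ s ∈ T, hs θ f s y with hg
    have hgB : BI g := BI.sum T fun s _ => BI_hs hθ.symb hf s
    have hmax : ∀ q : ℤ × ℤ, ∃ a : ℤ, q.1 ≤ a ∧ ∀ a' ∈ scl T q.1,
        avg g a' (q.2 * 2 ^ q.1) ≤ avg g a (q.2 * 2 ^ q.1) := by
      intro q
      obtain ⟨a, ha, hmax⟩ := (insert q.1 (scl T q.1)).exists_max_image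
        (fun a => avg g a (q.2 * 2 ^ q.1)) (Finset.insert_nonempty _ _)
      refine ⟨a, ?_, fun a' ha' => hmax a' (Finset.mem_insert_of_mem ha')⟩
      simp only [scl, Finset.mem_insert, Finset.mem_union, Finset.mem_image, Finset.mem_filter] at ha
      rcases ha with rfl | ⟨s, ⟨-, hs⟩, rfl⟩ | ⟨s, ⟨-, hs⟩, rfl⟩ <;> omega
    choose a ha hmax using hmax
    refine ⟨fun q => 32 * kC psi 4 * avg g (a q) (q.2 * 2 ^ q.1), fun q _ => ⟨?_, fun x hx ν => ?_⟩, ?_⟩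
    · have := avg_nonneg g (a q) (q.2 * 2 ^ q.1)
      positivity
    · exact near_le hθ hf hS hi0 hi1 hT hx ν (avg_nonneg _ _ _) (hmax q)
    · have h1 := sum_maximal_le P hP.disj a (fun q _ => ha q) hgB hσ
      have h3 := tree_sq_le hθ hf hS hsz hT1
      have e : ∑ q ∈ P, 2 ^ q.1 * (32 * kC psi 4 * avg g (a q) (q.2 * 2 ^ q.1)) =
          32 * kC psi 4 * ∑ q ∈ P, 2 ^ q.1 * avg g (a q) (q.2 * 2 ^ q.1) := by
        rw [Finset.mul_sum]; exact Finset.sum_congr rfl fun q _ => by ring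
      rw [e]
      have hs1 : σ⁻¹ * σ = 1 := inv_mul_cancel₀ hσ.ne'
      have hsi : 0 < σ⁻¹ := by positivity
      calc _ ≤ 32 * kC psi 4 * (σ * (128 * (3 * 2 ^ t.K)) +
            σ⁻¹ * (2 ^ 15 * kC θ 4 ^ 2 * σ ^ 2 * 2 ^ t.K)) := by
            refine mul_le_mul_of_nonneg_left (h1.trans ?_) (by positivity)
            gcongr
        _ = 32 * kC psi 4 * (384 + 2 ^ 15 * kC θ 4 ^ 2) * σ * 2 ^ t.K := by
            linear_combination 32 * kC psi 4 * 2 ^ 15 * kC θ 4 ^ 2 * σ * 2 ^ t.K * hs1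
        _ ≤ _ := by unfold nearC; gcongr; linarith
  · refine ⟨fun _ => 2 ^ 6 * kC θ 2 * σ, fun q _ => ⟨by positivity, fun x _ ν =>
      near_single_le hθ.symb hf hS hσ.le hsz (by omega) hi hT q.1 x ν⟩, ?_⟩
    rw [← Finset.sum_mul]
    calc _ ≤ 3 * 2 ^ t.K * (2 ^ 6 * kC θ 2 * σ) := by gcongr
      _ = 192 * kC θ 2 * σ * 2 ^ t.K := by ring
      _ ≤ _ := by
        unfold nearC
        have : 0 ≤ 32 * kC psi 4 * (384 + 2 ^ 15 * kC θ 4 ^ 2) := by positivity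
        gcongr; linarith

noncomputable def treeC (θ : ℝ → ℝ) : ℝ := 2 ^ 24 * kC θ 7 + 88 * nearC θ

lemma treeC_pos {θ : ℝ → ℝ} (hθ : Symb θ) : 0 < treeC θ := by
  have h1 := kC_pos hθ 7
  have h2 := nearC_pos hθ
  unfold treeC; positivity

lemma tree_class {θ : ℝ → ℝ} (hθ : SynSymb θ) {f : ℝ → ℂ} (hf : BI f) {N : ℝ → ℝ}
    (hN : Measurable N) {E : Set ℝ} (hE : MeasurableSet E) {T : Finset Tile} {δ σ : ℝ}
    (hδ : 0 ≤ δ) (hσ : 0 < σ) (hS : SEP T) (hd : DensLe N E T δ) (hsz : SizeLe f T σ) {t : TTop}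
    {i : ℤ} (hi0 : 0 ≤ i) (hi : i ≤ 10) (hT : ∀ s ∈ T, UnderR i i s t) :
    ∫ x, ‖TS θ f N E T x‖ ≤ treeC θ * σ * δ * 2 ^ t.K := by
  classical
  have hC7 := kC_pos hθ.symb 7
  have hnC := nearC_pos hθ.symb
  rcases T.eq_empty_or_nonempty with rfl | hne
  · have := treeC_pos hθ.symb
    simp [TS]; positivity
  obtain ⟨P, hP⟩ := exists_jpart T hne t.K t.M fun s hs => ⟨(hT s hs).1, (hT s hs).2.1⟩
  obtain ⟨b, hb, hbs⟩ := exists_near_bound hθ hf hS hσ hsz hi0 hi hT hP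
  have hPs := hP.sum_le
  set U : Set ℝ := ⋃ q ∈ P, dy q.1 q.2 with hU
  have hUm : MeasurableSet U := Finset.measurableSet_biUnion _ fun q _ => measurableSet_dy _ _
  set F : ℝ → ℝ := fun x => ∑ s ∈ T, (Uᶜ ∩ vset N E s).indicator (fun x => ‖hs θ f s x‖) x with hF
  set G : ℤ × ℤ → ℝ → ℝ := fun q x => ∑ s ∈ T with s.k ≤ q.1,
    (dy q.1 q.2 ∩ vset N E s).indicator (fun x => ‖hs θ f s x‖) x with hG
  set L : ℤ × ℤ → ℝ → ℝ := fun q => (gset N E T q).indicator fun _ => b q with hL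
  have hind : ∀ {A : Set ℝ} (_ : MeasurableSet A) (s : Tile),
      Integrable ((A ∩ vset N E s).indicator fun x => ‖hs θ f s x‖) := fun hA s =>
    (BI_hs hθ.symb hf s).int.norm.indicator (hA.inter (measurableSet_vset hN hE s))
  have hind0 : ∀ (A : Set ℝ) (s : Tile) (x), 0 ≤ (A ∩ vset N E s).indicator (fun x => ‖hs θ f s x‖) x :=
    fun A s x => indicator_nonneg (fun _ _ => norm_nonneg _) x
  have hFi : Integrable F := integrable_finsetSum _ fun s _ => hind hUm.compl s
  have hGi : ∀ q, Integrable (G q) := fun q => integrable_finsetSum _ fun s _ => hind (measurableSet_dy _ _) s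
  have hLi : ∀ q, Integrable (L q) := fun q => by
    rw [hL, integrable_indicator_iff (measurableSet_gset hN hE T q)]
    refine integrableOn_const ?_
    refine ((measure_mono (μ := volume) (inter_subset_left : gset N E T q ⊆ dy q.1 q.2)).trans_lt ?_).ne
    rw [volume_dy]; exact ENNReal.ofReal_lt_top
  have hF0 : ∀ x, 0 ≤ F x := fun x => Finset.sum_nonneg fun s _ => hind0 _ s x
  have hG0 : ∀ q x, 0 ≤ G q x := fun q x => Finset.sum_nonneg fun s _ => hind0 _ s x
  have hL0 : ∀ q ∈ P, ∀ x, 0 ≤ L q x := fun q hq x => indicator_nonneg (fun _ _ => (hb q hq).1) x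
  have hpt : ∀ x, ‖TS θ f N E T x‖ ≤ F x + ∑ q ∈ P, (G q x + L q x) := by
    intro x
    have hsum0 : 0 ≤ ∑ q ∈ P, (G q x + L q x) :=
      Finset.sum_nonneg fun q hq => add_nonneg (hG0 q x) (hL0 q hq x)
    by_cases hx : x ∈ U
    · obtain ⟨q, hq, hxq⟩ : ∃ q ∈ P, x ∈ dy q.1 q.2 := by simpa [hU] using hx
      have h1 : G q x + L q x ≤ ∑ q ∈ P, (G q x + L q x) :=
        Finset.single_le_sum (f := fun q => G q x + L q x)
          (fun q hq => add_nonneg (hG0 q x) (hL0 q hq x)) hq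
      suffices h2 : ‖TS θ f N E T x‖ ≤ G q x + L q x by linarith [hF0 x]
      have h3 : TS θ f N E T x = ∑ s ∈ T with s.k ≤ q.1, (vset N E s).indicator (hs θ f s) x +
          ∑ s ∈ T with ¬ s.k ≤ q.1, (vset N E s).indicator (hs θ f s) x :=
        (Finset.sum_filter_add_sum_filter_not _ _ _).symm
      rw [h3]
      refine (norm_add_le _ _).trans (add_le_add ?_ ?_)
      · refine (norm_sum_le _ _).trans (Finset.sum_le_sum fun s _ => ?_)
        rw [norm_indicator_eq_indicator_norm]
        by_cases hv : x ∈ vset N E s <;> simp [hv, hxq]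
      · by_cases hg : x ∈ gset N E T q
        · rw [show L q x = b q from indicator_of_mem hg _]
          obtain ⟨-, hg2⟩ := hg
          simp only [mem_iUnion] at hg2
          obtain ⟨s0, -, hxE, -⟩ := hg2
          refine le_trans (le_of_eq ?_) ((hb q hq).2 x hxq (N x))
          congr 1
          rw [← Finset.filter_filter, Finset.sum_filter (fun s : Tile => ix s.k (N x) = s.n)]
          simp only [not_le]
          refine Finset.sum_congr rfl fun s _ => ?_
          simp only [indicator, vset, mem_ofPred_eq, hxE, true_and]
        · rw [Finset.sum_eq_zero, norm_zero]
          · exact hL0 q hq x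
          · intro s hs'
            refine indicator_of_notMem (fun hv => hg ⟨hxq, ?_⟩) _
            exact mem_biUnion (x := s) (by simpa using hs') hv
    · suffices h2 : ‖TS θ f N E T x‖ ≤ F x by linarith
      refine (norm_sum_le _ _).trans (Finset.sum_le_sum fun s _ => ?_)
      rw [norm_indicator_eq_indicator_norm]
      by_cases hv : x ∈ vset N E s <;> simp [hv, hx]
  have hGL : ∀ q ∈ P, ∫ x, (G q x + L q x) ≤ 2 ^ 21 * kC θ 7 * σ * δ * 2 ^ q.1 + 88 * δ * (2 ^ q.1 * b q) := by
    intro q hq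
    rw [integral_add (hGi q) (hLi q)]
    refine add_le_add ?_ ?_
    · rw [hG, integral_finsetSum _ fun s _ => hind (measurableSet_dy _ _) s]
      refine le_trans (le_of_eq (Finset.sum_congr rfl fun s _ => ?_))
        (tree_small hθ.symb hf hN hE hδ hσ.le hd hsz hT hP hq)
      rw [integral_indicator ((measurableSet_dy _ _).inter (measurableSet_vset hN hE s))]
    · rw [hL, integral_indicator (measurableSet_gset hN hE T q), setIntegral_const_real]
      have h1 := volume_gset_le (N := N) (E := E) hd hi0 hi hT hP hq
      calc _ ≤ 88 * δ * 2 ^ q.1 * b q := mul_le_mul_of_nonneg_right h1 (hb q hq).1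
        _ = _ := by ring
  have hFle : ∫ x, F x ≤ 2 ^ 22 * kC θ 7 * σ * δ * 2 ^ t.K := by
    rw [hF, integral_finsetSum _ fun s _ => hind hUm.compl s]
    refine le_trans (le_of_eq (Finset.sum_congr rfl fun s _ => ?_))
      (tree_outside hθ.symb hf hN hE hδ hσ.le hd hsz hT hP)
    rw [integral_indicator (hUm.compl.inter (measurableSet_vset hN hE s))]
  have hGLi : ∀ q ∈ P, Integrable fun x => G q x + L q x := fun q _ => (hGi q).add (hLi q)
  calc ∫ x, ‖TS θ f N E T x‖ ≤ ∫ x, (F x + ∑ q ∈ P, (G q x + L q x)) :=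
        integral_mono (integrable_TS hθ.symb hf hN hE T).norm
          (hFi.add (integrable_finsetSum _ hGLi)) hpt
    _ = (∫ x, F x) + ∑ q ∈ P, ∫ x, (G q x + L q x) := by
        rw [integral_add hFi (integrable_finsetSum _ hGLi), integral_finsetSum _ hGLi]
    _ ≤ 2 ^ 22 * kC θ 7 * σ * δ * 2 ^ t.K +
        ∑ q ∈ P, (2 ^ 21 * kC θ 7 * σ * δ * 2 ^ q.1 + 88 * δ * (2 ^ q.1 * b q)) :=
        add_le_add hFle (Finset.sum_le_sum hGL)
    _ = 2 ^ 22 * kC θ 7 * σ * δ * 2 ^ t.K +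
        (2 ^ 21 * kC θ 7 * σ * δ * ∑ q ∈ P, 2 ^ q.1 + 88 * δ * ∑ q ∈ P, 2 ^ q.1 * b q) := by
        rw [Finset.sum_add_distrib, ← Finset.mul_sum, ← Finset.mul_sum]
    _ ≤ 2 ^ 22 * kC θ 7 * σ * δ * 2 ^ t.K +
        (2 ^ 21 * kC θ 7 * σ * δ * (3 * 2 ^ t.K) + 88 * δ * (nearC θ * σ * 2 ^ t.K)) := by gcongr
    _ ≤ 2 ^ 24 * kC θ 7 * σ * δ * 2 ^ t.K + 88 * δ * (nearC θ * σ * 2 ^ t.K) := by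
        have : 0 ≤ kC θ 7 * σ * δ * 2 ^ t.K := by positivity
        linarith
    _ = _ := by unfold treeC; ring

lemma SizeLe.mono {f : ℝ → ℂ} {S S' : Finset Tile} {σ : ℝ} (h : SizeLe f S σ) (hs : S' ⊆ S) :
    SizeLe f S' σ := fun t T hT => h t T (hT.trans hs)

lemma DensLe.mono {N : ℝ → ℝ} {E : Set ℝ} {S S' : Finset Tile} {δ : ℝ} (h : DensLe N E S δ)
    (hs : S' ⊆ S) : DensLe N E S' δ := fun s hs' => h s (hs hs')

lemma SEP.mono {S S' : Finset Tile} (h : SEP S) (hs : S' ⊆ S) : SEP S' :=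
  fun s h1 s' h2 => h s (hs h1) s' (hs h2)

/-- The tree estimate. -/
lemma tree_le {θ : ℝ → ℝ} (hθ : SynSymb θ) {f : ℝ → ℂ} (hf : BI f) {N : ℝ → ℝ}
    (hN : Measurable N) {E : Set ℝ} (hE : MeasurableSet E) {T : Finset Tile} {δ σ : ℝ}
    (hδ : 0 ≤ δ) (hσ : 0 < σ) (hS : SEP T) (hd : DensLe N E T δ) (hsz : SizeLe f T σ) {t : TTop}
    (hT : ∀ s ∈ T, UnderR 0 10 s t) :
    ∫ x, ‖TS θ f N E T x‖ ≤ 11 * treeC θ * σ * δ * 2 ^ t.K := by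
  classical
  set Ti : ℤ → Finset Tile := fun i => T.filter fun s => s.n - ix s.k t.ξ = i with hTi
  have h1 : ∀ x, ‖TS θ f N E T x‖ ≤ ∑ i ∈ Finset.Icc (0 : ℤ) 10, ‖TS θ f N E (Ti i) x‖ := by
    intro x
    have : TS θ f N E T x = ∑ i ∈ Finset.Icc (0 : ℤ) 10, TS θ f N E (Ti i) x :=
      (Finset.sum_fiberwise_of_maps_to (fun s hs => by
        have := (hT s hs).2.2; exact Finset.mem_Icc.2 this) _).symm
    rw [this]
    exact norm_sum_le _ _
  have hi : ∀ i ∈ Finset.Icc (0 : ℤ) 10, Integrable fun x => ‖TS θ f N E (Ti i) x‖ :=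
    fun i _ => (integrable_TS hθ.symb hf hN hE _).norm
  calc _ ≤ ∫ x, ∑ i ∈ Finset.Icc (0 : ℤ) 10, ‖TS θ f N E (Ti i) x‖ :=
        integral_mono (integrable_TS hθ.symb hf hN hE T).norm (integrable_finsetSum _ hi) h1
    _ = ∑ i ∈ Finset.Icc (0 : ℤ) 10, ∫ x, ‖TS θ f N E (Ti i) x‖ := integral_finsetSum _ hi
    _ ≤ ∑ i ∈ Finset.Icc (0 : ℤ) 10, treeC θ * σ * δ * 2 ^ t.K := by
        refine Finset.sum_le_sum fun i hi' => ?_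
        have hi' := Finset.mem_Icc.1 hi'
        have hsub : Ti i ⊆ T := Finset.filter_subset _ _
        refine tree_class hθ hf hN hE hδ hσ (hS.mono hsub) (hd.mono hsub) (hsz.mono hsub) hi'.1 hi'.2 fun s hs' => ?_
        have h2 := (Finset.mem_filter.1 hs').2
        have h3 := hT s (hsub hs')
        exact ⟨h3.1, h3.2.1, h2.ge, h2.le⟩
    _ = _ := by simp; ring

/-! ### Summation over trees -/

lemma Cov.mono {S S' : Finset Tile} {B : ℝ} (h : Cov S B) (hs : S' ⊆ S) : Cov S' B :=
  let ⟨𝒯, h1, h2⟩ := h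
  ⟨𝒯, fun s hs' => h1 s (hs hs'), h2⟩

lemma Cov.nonneg {S : Finset Tile} {B : ℝ} (h : Cov S B) : 0 ≤ B :=
  let ⟨_, _, h2⟩ := h
  (Finset.sum_nonneg fun _ _ => by positivity).trans h2

lemma exists_cov (S : Finset Tile) : ∃ B, Cov S B := by
  classical
  refine ⟨_, S.image fun s => (s.k, s.m, s.n * 2 ^ (-s.k)), fun s hs =>
    ⟨_, Finset.mem_image_of_mem _ hs, le_rfl, ix_c s, ?_⟩, le_rfl⟩
  simp only [TTop.ξ, ix_mul_zpow]
  omega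

section

variable {θ : ℝ → ℝ} {f : ℝ → ℂ} {N : ℝ → ℝ} {E : Set ℝ}

lemma integral_TS_le_add [DecidableEq Tile] (hθ : Symb θ) (hf : BI f) (hN : Measurable N)
    (hE : MeasurableSet E) {S S' : Finset Tile} (h : S' ⊆ S) :
    ∫ x, ‖TS θ f N E S x‖ ≤ (∫ x, ‖TS θ f N E (S \ S') x‖) + ∫ x, ‖TS θ f N E S' x‖ := by
  rw [← integral_add (integrable_TS hθ hf hN hE _).norm (integrable_TS hθ hf hN hE _).norm]
  refine integral_mono (integrable_TS hθ hf hN hE _).norm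
    ((integrable_TS hθ hf hN hE _).norm.add (integrable_TS hθ hf hN hE _).norm) fun x => ?_
  have : TS θ f N E S x = TS θ f N E (S \ S') x + TS θ f N E S' x :=
    (Finset.sum_sdiff h).symm
  rw [this]
  exact norm_add_le _ _

lemma cov_le (hθ : SynSymb θ) (hf : BI f) (hN : Measurable N) (hE : MeasurableSet E)
    {S : Finset Tile} {δ σ B : ℝ} (hδ : 0 ≤ δ) (hσ : 0 < σ) (hS : SEP S) (hd : DensLe N E S δ)
    (hsz : SizeLe f S σ) (hB : Cov S B) :
    ∫ x, ‖TS θ f N E S x‖ ≤ 11 * treeC θ * (σ * δ * B) := by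
  classical
  obtain ⟨𝒯, h1, h2⟩ := hB
  choose! t ht hst using h1
  have hC := treeC_pos hθ.symb
  have hp : ∀ x, ‖TS θ f N E S x‖ ≤ ∑ τ ∈ 𝒯, ‖TS θ f N E (S.filter fun s => t s = τ) x‖ := by
    intro x
    have : TS θ f N E S x = ∑ τ ∈ 𝒯, TS θ f N E (S.filter fun s => t s = τ) x :=
      (Finset.sum_fiberwise_of_maps_to ht _).symm
    rw [this]
    exact norm_sum_le _ _
  calc _ ≤ ∫ x, ∑ τ ∈ 𝒯, ‖TS θ f N E (S.filter fun s => t s = τ) x‖ :=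
        integral_mono (integrable_TS hθ.symb hf hN hE _).norm
          (integrable_finsetSum _ fun _ _ => (integrable_TS hθ.symb hf hN hE _).norm) hp
    _ = ∑ τ ∈ 𝒯, ∫ x, ‖TS θ f N E (S.filter fun s => t s = τ) x‖ :=
        integral_finsetSum _ fun _ _ => (integrable_TS hθ.symb hf hN hE _).norm
    _ ≤ ∑ τ ∈ 𝒯, 11 * treeC θ * σ * δ * 2 ^ τ.K := Finset.sum_le_sum fun τ _ => by
        have hsub := Finset.filter_subset (fun s => t s = τ) S
        refine tree_le hθ hf hN hE hδ hσ (hS.mono hsub) (hd.mono hsub) (hsz.mono hsub) fun s hsT => ?_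
        obtain ⟨h3, h4⟩ := Finset.mem_filter.1 hsT
        exact h4 ▸ hst s h3
    _ = 11 * treeC θ * σ * δ * ∑ τ ∈ 𝒯, 2 ^ τ.K := by rw [Finset.mul_sum]
    _ ≤ 11 * treeC θ * σ * δ * B := by gcongr
    _ = _ := by ring

lemma min_le_rpow {X Y t : ℝ} (hX : 0 ≤ X) (hY : 0 ≤ Y) (h0 : 0 < t) (h1 : t < 1) :
    min X Y ≤ X ^ (1 - t) * Y ^ t := by
  have h2 : 0 ≤ min X Y := le_min hX hY
  calc min X Y = min X Y ^ (1 - t) * min X Y ^ t := by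
        rw [← Real.rpow_add_of_nonneg h2 (by linarith) h0.le]; simp
    _ ≤ _ := by
        exact mul_le_mul (Real.rpow_le_rpow h2 (min_le_left _ _) (by linarith))
          (Real.rpow_le_rpow h2 (min_le_right _ _) h0.le) (by positivity) (by positivity)

lemma one_sub_two_rpow_pos {u : ℝ} (hu : 0 < u) : 0 < 1 - (2 : ℝ) ^ (-u) :=
  sub_pos.2 (Real.rpow_lt_one_of_one_lt_of_neg one_lt_two (by linarith))

lemma size_layers (hθ : SynSymb θ) (hf : BI f) (hN : Measurable N) (hE : MeasurableSet E)
    {δ B t : ℝ} (hδ : 0 ≤ δ) (ht0 : 0 < t) (ht : t < 1 / 2) (J : ℕ) :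
    ∀ {S : Finset Tile} {σ : ℝ}, 0 < σ → SEP S → DensLe N E S δ → SizeLe f S σ → Cov S B →
    ∫ x, ‖TS θ f N E S x‖ ≤ 11 * treeC θ * δ * (σ ^ (1 - 2 * t) *
      (B ^ (1 - t) * (4 * szC * ∫ x, ‖f x‖ ^ 2) ^ t / (1 - 2 ^ (-(1 - 2 * t)))) +
        σ * (2 ^ J)⁻¹ * B) := by
  classical
  have hC := treeC_pos hθ.symb
  have hsC := szC_pos
  have hr := one_sub_two_rpow_pos (u := 1 - 2 * t) (by linarith)
  have hF : 0 ≤ ∫ x, ‖f x‖ ^ 2 := integral_nonneg fun x => by positivity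
  induction J with
  | zero =>
    intro S σ hσ hS hd hsz hB
    have hB0 := hB.nonneg
    have h1 := cov_le hθ hf hN hE hδ hσ hS hd hsz hB
    refine h1.trans ?_
    have : 0 ≤ 11 * treeC θ * δ * (σ ^ (1 - 2 * t) *
      (B ^ (1 - t) * (4 * szC * ∫ x, ‖f x‖ ^ 2) ^ t / (1 - 2 ^ (-(1 - 2 * t))))) := by positivity
    simp only [pow_zero, inv_one, mul_one]
    linarith
  | succ J ih =>
    intro S σ hσ hS hd hsz hB
    have hB0 := hB.nonneg
    obtain ⟨S', hS', hsz', hcov⟩ := size_split hf hS hσ hsz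
    have h1 := ih (half_pos hσ) (hS.mono hS') (hd.mono hS') hsz' (hB.mono hS')
    have hsub : S \ S' ⊆ S := Finset.sdiff_subset
    have h2 := cov_le hθ hf hN hE hδ hσ (hS.mono hsub) (hd.mono hsub) (hsz.mono hsub) (hB.mono hsub)
    have h3 := cov_le hθ hf hN hE hδ hσ (hS.mono hsub) (hd.mono hsub) (hsz.mono hsub) hcov
    set F := ∫ x, ‖f x‖ ^ 2
    set D := B ^ (1 - t) * (4 * szC * F) ^ t with hD
    set r : ℝ := 2 ^ (-(1 - 2 * t)) with hrd
    have h4 : ∫ x, ‖TS θ f N E (S \ S') x‖ ≤ 11 * treeC θ * (σ * δ *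
        min B (4 * szC * (σ ^ 2)⁻¹ * F)) := by
      rcases min_choice B (4 * szC * (σ ^ 2)⁻¹ * F) with h | h <;> rw [h] <;> assumption
    have h5 : σ * min B (4 * szC * (σ ^ 2)⁻¹ * F) ≤ σ ^ (1 - 2 * t) * D := by
      refine (mul_le_mul_of_nonneg_left (min_le_rpow hB0 (by positivity) ht0 (by linarith)) hσ.le).trans_eq ?_
      rw [show 4 * szC * (σ ^ 2)⁻¹ * F = (4 * szC * F) * (σ ^ 2)⁻¹ by ring,
        Real.mul_rpow (by positivity) (by positivity), Real.inv_rpow (by positivity),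
        ← Real.rpow_natCast σ 2, ← Real.rpow_mul hσ.le, Real.rpow_sub hσ, Real.rpow_one, hD]
      push_cast
      field_simp
    have h6 : (σ / 2) ^ (1 - 2 * t) = σ ^ (1 - 2 * t) * r := by
      rw [Real.div_rpow hσ.le (by norm_num), hrd, Real.rpow_neg (by norm_num), div_eq_mul_inv]
    have h7 : r * (D / (1 - r)) + D = D / (1 - r) := by field_simp; ring
    have h8 : σ / 2 * (2 ^ J)⁻¹ = σ * (2 ^ (J + 1))⁻¹ := by rw [pow_succ]; field_simp
    rw [h6, h8] at h1
    have h9 := integral_TS_le_add hθ.symb hf hN hE hS'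
    have h10 : 11 * treeC θ * (σ * δ * min B (4 * szC * (σ ^ 2)⁻¹ * F)) ≤
        11 * treeC θ * δ * (σ ^ (1 - 2 * t) * D) := by
      rw [show 11 * treeC θ * (σ * δ * min B (4 * szC * (σ ^ 2)⁻¹ * F)) =
        11 * treeC θ * δ * (σ * min B (4 * szC * (σ ^ 2)⁻¹ * F)) by ring]
      gcongr
    have e : 11 * treeC θ * δ * (σ ^ (1 - 2 * t) * (D / (1 - r)) + σ * (2 ^ (J + 1))⁻¹ * B) =
      11 * treeC θ * δ * (σ ^ (1 - 2 * t) * D) + 11 * treeC θ * δ * (σ ^ (1 - 2 * t) * r * (D / (1 - r)) +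
        σ * (2 ^ (J + 1))⁻¹ * B) := by
      linear_combination (-(11 * treeC θ * δ * σ ^ (1 - 2 * t))) * h7
    rw [e]
    linarith

lemma tendsto_inv_two_pow : Filter.Tendsto (fun J : ℕ => ((2 : ℝ) ^ J)⁻¹) Filter.atTop (nhds 0) :=
  tendsto_inv_atTop_zero.comp (tendsto_pow_atTop_atTop_of_one_lt one_lt_two)

lemma size_layer (hθ : SynSymb θ) (hf : BI f) (hN : Measurable N) (hE : MeasurableSet E)
    {δ B t : ℝ} (hδ : 0 ≤ δ) (ht0 : 0 < t) (ht : t < 1 / 2)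
    {S : Finset Tile} {σ : ℝ} (hσ : 0 < σ) (hS : SEP S) (hd : DensLe N E S δ) (hsz : SizeLe f S σ)
    (hB : Cov S B) :
    ∫ x, ‖TS θ f N E S x‖ ≤ 11 * treeC θ * δ * (σ ^ (1 - 2 * t) *
      (B ^ (1 - t) * (4 * szC * ∫ x, ‖f x‖ ^ 2) ^ t / (1 - 2 ^ (-(1 - 2 * t))))) := by
  refine ge_of_tendsto' (x := Filter.atTop (α := ℕ)) ?_ fun J => size_layers hθ hf hN hE hδ ht0 ht J hσ hS hd hsz hB
  have := ((tendsto_inv_two_pow.const_mul σ).mul_const B).const_add (σ ^ (1 - 2 * t) *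
      (B ^ (1 - t) * (4 * szC * ∫ x, ‖f x‖ ^ 2) ^ t / (1 - 2 ^ (-(1 - 2 * t)))))
  simpa using this.const_mul (11 * treeC θ * δ)

lemma dens_layers (hθ : SynSymb θ) (hf : BI f) (hN : Measurable N) (hE : MeasurableSet E)
    (hEf : volume E ≠ ⊤) {σ B t : ℝ} (hσ : 0 < σ) (ht0 : 0 < t) (ht : t < 1 / 2) (n : ℕ) :
    ∀ {S : Finset Tile} {δ : ℝ}, 0 < δ → SEP S → DensLe N E S δ → SizeLe f S σ → Cov S B →
    ∫ x, ‖TS θ f N E S x‖ ≤ 11 * treeC θ * (δ ^ t * (σ ^ (1 - 2 * t) *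
      ((32 * volume.real E) ^ (1 - t) * (4 * szC * ∫ x, ‖f x‖ ^ 2) ^ t /
        (1 - 2 ^ (-(1 - 2 * t)))) / (1 - 2 ^ (-t))) + σ * (δ * (2 ^ n)⁻¹) * B) := by
  classical
  have hC := treeC_pos hθ.symb
  have hsC := szC_pos
  have hr := one_sub_two_rpow_pos (u := 1 - 2 * t) (by linarith)
  have hrt := one_sub_two_rpow_pos ht0
  have hF : 0 ≤ ∫ x, ‖f x‖ ^ 2 := integral_nonneg fun x => by positivity
  have hE0 : 0 ≤ volume.real E := measureReal_nonneg
  induction n with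
  | zero =>
    intro S δ hδ hS hd hsz hB
    have hB0 := hB.nonneg
    refine (cov_le hθ hf hN hE hδ.le hσ hS hd hsz hB).trans ?_
    gcongr
    rw [pow_zero, inv_one, mul_one]
    refine le_add_of_nonneg_left ?_
    positivity
  | succ n ih =>
    intro S δ hδ hS hd hsz hB
    have hB0 := hB.nonneg
    set S' := S.filter fun s => ∀ k, s.k ≤ k → ∀ η, 0 ≤ s.n - ix s.k η → s.n - ix s.k η ≤ 10 →
      ∀ j : ℕ, volume.real (dset N E s.c k η j) ≤ δ / 2 * 4 ^ j * 2 ^ k with hS'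
    have hsub : S' ⊆ S := Finset.filter_subset _ _
    have hsub2 : S \ S' ⊆ S := Finset.sdiff_subset
    have hd' : DensLe N E S' (δ / 2) := fun s hsT => (Finset.mem_filter.1 hsT).2
    have hcov : Cov (S \ S') (16 * (δ / 2)⁻¹ * volume.real E) := by
      refine density_cov hN hE hEf (half_pos hδ) fun s hsT => ?_
      obtain ⟨h1, h2⟩ := Finset.mem_sdiff.1 hsT
      by_contra! h3
      exact h2 (Finset.mem_filter.2 ⟨h1, fun k hk η h4 h5 j => h3 k hk η h4 h5 j⟩)
    have h1 := ih (half_pos hδ) (hS.mono hsub) hd' (hsz.mono hsub) (hB.mono hsub)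
    have h2 := size_layer hθ hf hN hE hδ.le ht0 ht hσ (hS.mono hsub2) (hd.mono hsub2)
      (hsz.mono hsub2) hcov
    have h9 := integral_TS_le_add hθ.symb hf hN hE hsub
    set F := (4 * szC * ∫ x, ‖f x‖ ^ 2) ^ t
    set q := 1 - (2 : ℝ) ^ (-(1 - 2 * t))
    set r : ℝ := 2 ^ (-t) with hrd
    set L := σ ^ (1 - 2 * t) * ((32 * volume.real E) ^ (1 - t) * F / q) with hL
    have e1 : δ * (σ ^ (1 - 2 * t) * ((16 * (δ / 2)⁻¹ * volume.real E) ^ (1 - t) * F / q)) = δ ^ t * L := by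
      rw [show 16 * (δ / 2)⁻¹ * volume.real E = δ⁻¹ * (32 * volume.real E) by field_simp; ring,
        Real.mul_rpow (by positivity) (by positivity), Real.inv_rpow hδ.le, hL,
        Real.rpow_sub hδ, Real.rpow_one]
      field_simp
    have h6 : (δ / 2) ^ t = δ ^ t * r := by
      rw [Real.div_rpow hδ.le (by norm_num), hrd, Real.rpow_neg (by norm_num), div_eq_mul_inv]
    have h7 : r * (L / (1 - r)) + L = L / (1 - r) := by field_simp; ring
    have h8 : δ / 2 * (2 ^ n)⁻¹ = δ * (2 ^ (n + 1))⁻¹ := by rw [pow_succ]; field_simp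
    rw [h6, h8] at h1
    rw [mul_assoc, e1] at h2
    have e : 11 * treeC θ * (δ ^ t * (L / (1 - r)) + σ * (δ * (2 ^ (n + 1))⁻¹) * B) =
      11 * treeC θ * (δ ^ t * L) + 11 * treeC θ * (δ ^ t * r * (L / (1 - r)) +
        σ * (δ * (2 ^ (n + 1))⁻¹) * B) := by
      linear_combination (-(11 * treeC θ * δ ^ t)) * h7
    rw [e]
    linarith

lemma densLe_two (N : ℝ → ℝ) (E : Set ℝ) (S : Finset Tile) : DensLe N E S 2 := by
  intro s _ k _ η _ _ j
  have h1 : dset N E s.c k η j ⊆ Icc (s.c - 2 ^ (k + j)) (s.c + 2 ^ (k + j)) := fun x hx => by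
    have := abs_le.1 hx.2.2
    constructor <;> linarith [this.1, this.2]
  have h2 : (0 : ℝ) < 2 ^ (k + j) := by positivity
  have h3 := measureReal_mono (μ := volume) h1 (by simp)
  rw [Real.volume_real_Icc_of_le (by linarith)] at h3
  refine h3.trans ?_
  have h4 : (2 : ℝ) ^ (k + (j : ℤ)) = 2 ^ j * 2 ^ k := by
    rw [zpow_add₀ two_ne_zero, zpow_natCast, mul_comm]
  have h5 : (2 : ℝ) ^ j ≤ 4 ^ j := pow_le_pow_left₀ (by norm_num) (by norm_num) j
  have h6 : (0 : ℝ) < 2 ^ k := by positivity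
  rw [h4]
  nlinarith

noncomputable def formC (θ : ℝ → ℝ) (t : ℝ) : ℝ :=
  11 * treeC θ * (2 ^ t * (enC ^ (1 - 2 * t) * (32 ^ (1 - t) * (4 * szC) ^ t /
    (1 - 2 ^ (-(1 - 2 * t)))) / (1 - 2 ^ (-t))))

lemma formC_pos (hθ : Symb θ) {t : ℝ} (ht0 : 0 < t) (ht : t < 1 / 2) : 0 < formC θ t := by
  have hC := treeC_pos hθ
  have hsC := szC_pos
  have he := enC_pos
  have hr := one_sub_two_rpow_pos (u := 1 - 2 * t) (by linarith)
  have hrt := one_sub_two_rpow_pos ht0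
  unfold formC
  positivity

/-- The model form estimate. -/
theorem form_le (hθ : SynSymb θ) (hf : BI f) (hN : Measurable N) (hE : MeasurableSet E)
    (hEf : volume E ≠ ⊤) {A t : ℝ} (hA : 0 < A) (ht0 : 0 < t) (ht : t < 1 / 2)
    {S : Finset Tile} (hS : SEP S) (hav : AvgLe f S A) :
    ∫ x, ‖TS θ f N E S x‖ ≤ formC θ t * (A ^ (1 - 2 * t) * (∫ x, ‖f x‖ ^ 2) ^ t *
      volume.real E ^ (1 - t)) := by
  obtain ⟨B, hB⟩ := exists_cov S
  have he := enC_pos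
  have hsC := szC_pos
  have hsz := sizeLe_of_avgLe hf hA.le hav hS
  have hF : 0 ≤ ∫ x, ‖f x‖ ^ 2 := integral_nonneg fun x => by positivity
  have hE0 : 0 ≤ volume.real E := measureReal_nonneg
  have hσ : 0 < enC * A := by positivity
  refine ge_of_tendsto' (x := Filter.atTop (α := ℕ)) ?_ fun n => dens_layers hθ hf hN hE hEf hσ ht0 ht n two_pos hS
    (densLe_two N E S) hsz hB
  have := (((tendsto_inv_two_pow.const_mul 2).const_mul (enC * A)).mul_const B).const_add
    (2 ^ t * ((enC * A) ^ (1 - 2 * t) *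
      ((32 * volume.real E) ^ (1 - t) * (4 * szC * ∫ x, ‖f x‖ ^ 2) ^ t /
        (1 - 2 ^ (-(1 - 2 * t)))) / (1 - 2 ^ (-t))))
  have := this.const_mul (11 * treeC θ)
  simp only [mul_zero, zero_mul, add_zero] at this
  convert this using 2
  rw [Real.mul_rpow (by positivity) hA.le, Real.mul_rpow (by positivity) hE0,
    Real.mul_rpow (by positivity) hF, formC]
  ring

end

/-! ### Tiles on which the averages are large -/

lemma exists_max_avg {f : ℝ → ℂ} (hf : Integrable f) {A c r : ℝ} {k : ℤ} (hA : 0 < A)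
    (hr : 2 ^ k ≤ r) (h : 2 * A * r < ∫ x in {x | |x - c| ≤ r}, ‖f x‖) :
    ∃ K, k ≤ K ∧ A * 2 ^ K < ∫ x in {x | |x - c| ≤ 2 ^ K}, ‖f x‖ ∧
      ∀ K' > K, ∫ x in {x | |x - c| ≤ 2 ^ K'}, ‖f x‖ ≤ A * 2 ^ K' := by
  have hk : (0 : ℝ) < 2 ^ k := by positivity
  have hr0 : 0 < r := hk.trans_le hr
  have hmono : ∀ {r r' : ℝ}, r ≤ r' →
      ∫ x in {x | |x - c| ≤ r}, ‖f x‖ ≤ ∫ x in {x | |x - c| ≤ r'}, ‖f x‖ := fun hrr =>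
    setIntegral_mono_set hf.norm.integrableOn (ae_of_all _ fun x => norm_nonneg _)
      (Filter.Eventually.of_forall fun x (hx : |x - c| ≤ _) => hx.trans hrr)
  obtain ⟨K₀, hK1, hK2⟩ := exists_mem_Ioc_zpow hr0 one_lt_two
  have hK3 : (2 : ℝ) ^ (K₀ + 1) = 2 * 2 ^ K₀ := by rw [zpow_add₀ two_ne_zero, zpow_one, mul_comm]
  have hkK : k ≤ K₀ + 1 := (zpow_le_zpow_iff_right₀ one_lt_two).1 (hr.trans hK2)
  have hP : A * 2 ^ (K₀ + 1) < ∫ x in {x | |x - c| ≤ 2 ^ (K₀ + 1)}, ‖f x‖ := by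
    refine lt_of_lt_of_le ?_ (hmono hK2)
    rw [hK3]; nlinarith
  obtain ⟨M, hM⟩ := exists_nat_gt ((∫ x, ‖f x‖) / A)
  have hbd : ∀ K : ℤ, (k ≤ K ∧ A * 2 ^ K < ∫ x in {x | |x - c| ≤ 2 ^ K}, ‖f x‖) → K ≤ M := by
    rintro K ⟨-, hK⟩
    by_contra! hKM
    have h1 : ∫ x in {x | |x - c| ≤ 2 ^ K}, ‖f x‖ ≤ ∫ x, ‖f x‖ :=
      setIntegral_le_integral hf.norm (ae_of_all _ fun x => norm_nonneg _)
    have h2 : (2 : ℝ) ^ (M : ℤ) ≤ 2 ^ K := zpow_le_zpow_right₀ one_le_two hKM.le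
    have h3 : (M : ℝ) < 2 ^ (M : ℤ) := by exact_mod_cast Nat.lt_two_pow_self
    rw [div_lt_iff₀ hA] at hM
    nlinarith
  obtain ⟨K, ⟨h1, h2⟩, h3⟩ := Int.exists_greatest_of_bdd (P := fun K => k ≤ K ∧
    A * 2 ^ K < ∫ x in {x | |x - c| ≤ 2 ^ K}, ‖f x‖) ⟨M, hbd⟩ ⟨K₀ + 1, hkK, hP⟩
  refine ⟨K, h1, h2, fun K' hK' => ?_⟩
  by_contra! h4
  exact absurd (h3 K' ⟨by omega, h4⟩) (by omega)

lemma integral_as_le_of_max {f : ℝ → ℂ} (hf : BI f) {A : ℝ} {s : Tile} {K : ℤ} (hA : 0 ≤ A)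
    (hK : s.k ≤ K) (h : ∀ K' > K, ∫ x in {x | |x - s.c| ≤ 2 ^ K'}, ‖f x‖ ≤ A * 2 ^ K') :
    ∫ y, ‖as f s y‖ ≤ (1024 * kC rho 4 * A * 2 ^ (K - s.k)) * 2 ^ s.k := by
  have hC := kC_pos symb_rho 4
  set u : ℝ := 2 ^ (-s.k) with hu
  have hu0 : 0 < u := by positivity
  have huk : u * 2 ^ s.k = 1 := by rw [hu, ← zpow_add₀ (by norm_num)]; simp
  have h1 : ∫ x, wt (2 ^ (-K) * (x - s.c)) ^ 4 * ‖f x‖ ≤ 32 * (2 * A * 2 ^ K) := by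
    refine shell_bound_fun hf.int (by positivity) fun j => ?_
    have hj : (2 : ℝ) ^ (K + (j : ℤ)) = 2 ^ K * 2 ^ j := by
      rw [zpow_add₀ two_ne_zero, zpow_natCast]
    have hj1 : (2 : ℝ) ^ (K + (j : ℤ) + 1) = 2 ^ K * 2 ^ j * 2 := by
      rw [zpow_add₀ two_ne_zero, hj, zpow_one]
    have h2 : (2 : ℝ) ^ j ≤ 4 ^ j := pow_le_pow_left₀ (by norm_num) (by norm_num) j
    have h3 := h (K + j + 1) (by omega)
    rw [hj1] at h3
    calc _ ≤ ∫ x in {x | |x - s.c| ≤ 2 ^ (K + (j : ℤ) + 1)}, ‖f x‖ :=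
          setIntegral_mono_set hf.int.norm.integrableOn (ae_of_all _ fun x => norm_nonneg _)
            (Filter.Eventually.of_forall fun x (hx : |x - s.c| ≤ _) =>
              hx.trans (by rw [hj1, hj]; linarith [show (0 : ℝ) < 2 ^ K * 2 ^ j by positivity]))
      _ ≤ A * (2 ^ K * 2 ^ j * 2) := by rw [hj1]; exact h3
      _ = 2 * A * 2 ^ K * 2 ^ j := by ring
      _ ≤ _ := by gcongr
  have hint : Integrable fun x => wt (2 ^ (-K) * (x - s.c)) ^ 4 * ‖f x‖ := by
    have hc : Continuous fun x => wt (2 ^ (-K) * (x - s.c)) ^ 4 := by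
      have := continuous_wt
      fun_prop
    refine hf.int.norm.bdd_mul (c := 1) hc.aestronglyMeasurable (ae_of_all _ fun x => ?_)
    rw [Real.norm_of_nonneg (pow_nonneg (wt_nonneg _) _)]
    exact pow_le_one₀ (wt_nonneg _) (wt_le_one _)
  have h2 : ∀ y ∈ s.I, ‖Fs f s y‖ ≤ 1024 * kC rho 4 * A * 2 ^ (K - s.k) := by
    intro y hy
    have hy' : |y - s.c| ≤ 2 ^ s.k := abs_sub_le_of_mem_dy hy
    have hp : ∀ z, ‖ker (s.sy rho) (y - z) * f z‖ ≤
        16 * kC rho 4 * u * (wt (2 ^ (-K) * (z - s.c)) ^ 4 * ‖f z‖) := by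
      intro z
      have h3 := norm_ker_sy_le symb_rho 4 s (y - z)
      have h4 : wt (u * (y - z)) ≤ 2 * wt (2 ^ (-K) * (z - s.c)) := by
        have h5 : |u * (y - z) - u * (s.c - z)| ≤ 1 := by
          rw [← mul_sub, abs_mul, abs_of_pos hu0, sub_sub_sub_cancel_right]
          calc u * |y - s.c| ≤ u * 2 ^ s.k := by gcongr
            _ = 1 := huk
        refine (wt_le_mul_wt h5).trans ?_
        have h6 : wt (u * (s.c - z)) ≤ wt (2 ^ (-K) * (z - s.c)) := by
          refine wt_abs_anti ?_
          rw [abs_mul, abs_mul, abs_sub_comm, abs_of_pos hu0, abs_of_pos (by positivity)]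
          gcongr
          exact zpow_le_zpow_right₀ one_le_two (by omega)
        linarith
      have hw := wt_nonneg (u * (y - z))
      rw [norm_mul]
      calc _ ≤ kC rho 4 * (u * (2 * wt (2 ^ (-K) * (z - s.c))) ^ 4) * ‖f z‖ := by
            gcongr
            refine h3.trans ?_
            gcongr
        _ = _ := by ring
    have h7 : ‖Fs f s y‖ ≤ ∫ z, 16 * kC rho 4 * u * (wt (2 ^ (-K) * (z - s.c)) ^ 4 * ‖f z‖) :=
      norm_integral_le_of_norm_le (hint.const_mul _) (ae_of_all _ hp)
    rw [integral_const_mul] at h7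
    refine h7.trans ?_
    calc _ ≤ 16 * kC rho 4 * u * (32 * (2 * A * 2 ^ K)) := by gcongr
      _ = 1024 * kC rho 4 * A * (2 ^ K * u) := by ring
      _ = _ := by rw [hu, ← zpow_add₀ (two_ne_zero' ℝ), sub_eq_add_neg]
  have h3 : ∀ y, ‖as f s y‖ ≤ s.I.indicator (fun _ => 1024 * kC rho 4 * A * 2 ^ (K - s.k)) y := by
    intro y
    by_cases hy : y ∈ s.I
    · simpa [as, hy] using h2 y hy
    · simp [as, hy]
  have hfin : volume s.I ≠ ⊤ := by rw [show s.I = dy s.k s.m from rfl, volume_dy]; exact ENNReal.ofReal_ne_top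
  calc _ ≤ ∫ y, s.I.indicator (fun _ => 1024 * kC rho 4 * A * 2 ^ (K - s.k)) y :=
        integral_mono (BI_as hf s).int.norm
          ((integrable_indicator_iff s.measurableSet_I).2 (integrableOn_const hfin)) h3
    _ = _ := by
        rw [integral_indicator s.measurableSet_I, setIntegral_const_real,
          show s.I = dy s.k s.m from rfl, volume_real_dy, mul_comm]

/-- Measure of the union of the enlarged balls with large averages. -/
lemma volume_large_avg_le {ι : Type*} {f : ℝ → ℂ} (hf : Integrable f) {A : ℝ} (hA : 0 < A) (S : Finset ι)
    (c : ι → ℝ) (K : ι → ℤ) (h : ∀ s ∈ S, A * 2 ^ K s < ∫ x in {x | |x - c s| ≤ 2 ^ K s}, ‖f x‖) :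
    volume (⋃ s ∈ S, Metric.closedBall (c s) (4 * 2 ^ K s)) ≤ ENNReal.ofReal (40 * A⁻¹ * ∫ x, ‖f x‖) := by
  classical
  rcases S.eq_empty_or_nonempty with rfl | hne
  · simp
  obtain ⟨u, huS, hdis, hcov⟩ := Vitali.exists_disjoint_subfamily_covering_enlargement_closedBall
    (S : Set ι) c (fun s => 4 * 2 ^ K s) (∑ s ∈ S, 4 * 2 ^ K s)
    (fun s hs => Finset.single_le_sum (f := fun s => (4 : ℝ) * 2 ^ K s) (fun s _ => by positivity) hs)
    5 (by norm_num)
  have hufin : u.Finite := S.finite_toSet.subset huS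
  set U := hufin.toFinset
  have hU : ∀ {s}, s ∈ U ↔ s ∈ u := by simp [U]
  have hle : ∑ s ∈ U, A * 2 ^ K s ≤ ∫ x, ‖f x‖ := by
    have hm : ∀ s, MeasurableSet {x : ℝ | |x - c s| ≤ 2 ^ K s} := fun s =>
      (by fun_prop : Measurable fun x : ℝ => |x - c s|) measurableSet_Iic
    calc _ ≤ ∑ s ∈ U, ∫ x in {x | |x - c s| ≤ 2 ^ K s}, ‖f x‖ :=
          Finset.sum_le_sum fun s hs => (h s (huS (hU.1 hs))).le
      _ = ∫ x in ⋃ s ∈ U, {x | |x - c s| ≤ 2 ^ K s}, ‖f x‖ := by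
          rw [integral_biUnion_finset U (fun s _ => hm s) ?_ fun s _ => hf.norm.integrableOn]
          intro s hs s' hs' hss
          refine (hdis (hU.1 hs) (hU.1 hs') hss).mono ?_ ?_ <;>
          · intro x (hx : |x - _| ≤ _)
            rw [Metric.mem_closedBall, Real.dist_eq]
            refine hx.trans (le_mul_of_one_le_left (by positivity) (by norm_num))
      _ ≤ _ := setIntegral_le_integral hf.norm (ae_of_all _ fun x => norm_nonneg _)
  calc _ ≤ volume (⋃ s ∈ U, Metric.closedBall (c s) (5 * (4 * 2 ^ K s))) := by
        refine measure_mono (iUnion₂_subset fun s hs => ?_)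
        obtain ⟨b, hb, hsub⟩ := hcov s hs
        exact hsub.trans (subset_iUnion₂_of_subset b (hU.2 hb) subset_rfl)
    _ ≤ ∑ s ∈ U, volume (Metric.closedBall (c s) (5 * (4 * 2 ^ K s))) := measure_biUnion_finset_le _ _
    _ = ENNReal.ofReal (∑ s ∈ U, 40 * 2 ^ K s) := by
        rw [ENNReal.ofReal_sum_of_nonneg fun s _ => by positivity]
        refine Finset.sum_congr rfl fun s _ => ?_
        rw [Real.volume_closedBall]
        congr 1; ring
    _ ≤ _ := by
        refine ENNReal.ofReal_le_ofReal ?_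
        rw [← Finset.mul_sum] at hle ⊢
        have h3 : ∑ s ∈ U, (2 : ℝ) ^ K s = A⁻¹ * (A * ∑ s ∈ U, 2 ^ K s) := by
          rw [inv_mul_cancel_left₀ hA.ne']
        rw [h3, mul_assoc]
        gcongr

/-- Dyadic intervals well inside an open-ended set, summed with distance decay. -/
lemma sum_dist_decay_le {Ω : Set ℝ} (hΩ : MeasurableSet Ω) (hfin : volume Ω ≠ ⊤) (P : Finset (ℤ × ℤ))
    (hP : ∀ q ∈ P, 4 * 2 ^ q.1 ≤ Metric.infDist ((q.2 : ℝ) * 2 ^ q.1) Ωᶜ) :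
    ∑ q ∈ P, (2 : ℝ) ^ q.1 * (2 ^ q.1 / Metric.infDist ((q.2 : ℝ) * 2 ^ q.1) Ωᶜ) ≤ 5 * volume.real Ω := by
  classical
  have hne : (Ωᶜ).Nonempty := by
    by_contra h
    rw [not_nonempty_iff_eq_empty, compl_empty_iff] at h
    simp [h] at hfin
  set d : ℝ → ℝ := fun y => Metric.infDist y Ωᶜ with hd
  have hLip : ∀ x y, d x ≤ d y + |x - y| := fun x y => Metric.infDist_le_infDist_add_dist
  have hsub : ∀ q ∈ P, ∀ y ∈ dy q.1 q.2, 0 < d y ∧ 2 ^ q.1 ≤ d y ∧ d y ≤ 5 / 4 * d (q.2 * 2 ^ q.1) := by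
    intro q hq y hy
    have h1 := abs_sub_le_of_mem_dy hy
    have h2 := hLip y (q.2 * 2 ^ q.1)
    have h3 := hLip (q.2 * 2 ^ q.1) y
    have h4 := hP q hq
    rw [abs_sub_comm] at h3
    have h5 : (0 : ℝ) < 2 ^ q.1 := by positivity
    change 4 * 2 ^ q.1 ≤ d _ at h4
    refine ⟨by linarith, by linarith, by linarith⟩
  have hmem : ∀ q ∈ P, ∀ y ∈ dy q.1 q.2, y ∈ Ω := by
    intro q hq y hy
    by_contra hn
    have := (hsub q hq y hy).1
    rw [hd] at this
    simp only [Metric.infDist_zero_of_mem (show y ∈ Ωᶜ from hn)] at this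
    exact lt_irrefl _ this
  set g : ℝ → ℝ := fun y => ∑ q ∈ P, (dy q.1 q.2).indicator (fun _ => 2 ^ q.1 / d (q.2 * 2 ^ q.1)) y
  have hvol : ∀ q : ℤ × ℤ, volume (dy q.1 q.2) ≠ ⊤ := fun q => by
    rw [volume_dy]; exact ENNReal.ofReal_ne_top
  have hi : ∀ q : ℤ × ℤ, Integrable ((dy q.1 q.2).indicator fun _ : ℝ => 2 ^ q.1 / d (q.2 * 2 ^ q.1)) :=
    fun q => (integrable_indicator_iff (measurableSet_dy _ _)).2 (integrableOn_const (hvol q))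
  have hg : ∀ y, g y ≤ Ω.indicator (fun _ => 5) y := by
    intro y
    set Py := P.filter fun q => y ∈ dy q.1 q.2 with hPy
    have e : g y = ∑ q ∈ Py, 2 ^ q.1 / d (q.2 * 2 ^ q.1) := by
      rw [hPy, Finset.sum_filter]
      exact Finset.sum_congr rfl fun q _ => by simp [indicator]
    rw [e]
    rcases Py.eq_empty_or_nonempty with h0 | hne
    · rw [h0, Finset.sum_empty]; exact indicator_nonneg (fun _ _ => by norm_num) _
    obtain ⟨q₀, hq₀, hmax⟩ := Finset.exists_max_image Py (fun q => q.1) hne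
    have hmemP : ∀ {q}, q ∈ Py → q ∈ P ∧ y ∈ dy q.1 q.2 := fun h => Finset.mem_filter.1 h
    have hq₀' := hsub _ (hmemP hq₀).1 y (hmemP hq₀).2
    rw [indicator_of_mem (hmem _ (hmemP hq₀).1 y (hmemP hq₀).2)]
    have h1 : ∑ q ∈ Py, (2 : ℝ) ^ q.1 ≤ 2 * 2 ^ q₀.1 := by
      rw [← Finset.sum_image (f := fun k => (2 : ℝ) ^ k) (g := fun q : ℤ × ℤ => q.1)]
      · refine sum_zpow_le _ _ fun k hk => ?_
        obtain ⟨q, hq, rfl⟩ := Finset.mem_image.1 hk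
        exact hmax q hq
      · intro q hq q' hq' hqq
        have h2 : ix (-q.1) y = q.2 := (hmemP hq).2
        have h3 : ix (-q'.1) y = q'.2 := (hmemP hq').2
        refine Prod.ext hqq ?_
        rw [← h2, ← h3]
        simp only at hqq
        rw [hqq]
    calc _ ≤ ∑ q ∈ Py, 2 ^ q.1 * (5 / 4 / d y) := Finset.sum_le_sum fun q hq => by
          obtain ⟨h3, h4, h5⟩ := hsub _ (hmemP hq).1 y (hmemP hq).2
          have h6 : 0 < d (q.2 * 2 ^ q.1) := by linarith
          rw [div_eq_mul_inv]
          gcongr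
          rw [inv_eq_one_div, div_le_div_iff₀ h6 h3]
          linarith
      _ = (5 / 4 / d y) * ∑ q ∈ Py, 2 ^ q.1 := by rw [← Finset.sum_mul, mul_comm]
      _ ≤ (5 / 4 / d y) * (2 * d y) := by
          have := hq₀'.1
          gcongr
          linarith [hq₀'.2.1]
      _ ≤ 5 := by
          have := hq₀'.1
          field_simp; norm_num
  calc _ = ∫ y, g y := by
        rw [integral_finsetSum _ fun q _ => hi q]
        refine Finset.sum_congr rfl fun q _ => ?_
        rw [integral_indicator (measurableSet_dy _ _), setIntegral_const_real, volume_real_dy]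
    _ ≤ ∫ y, Ω.indicator (fun _ => (5 : ℝ)) y :=
        integral_mono (integrable_finsetSum _ fun q _ => hi q)
          ((integrable_indicator_iff hΩ).2 (integrableOn_const hfin)) hg
    _ = _ := by rw [integral_indicator hΩ, setIntegral_const_real, mul_comm]

section

variable {θ : ℝ → ℝ} {f : ℝ → ℂ} {N : ℝ → ℝ} {E : Set ℝ}

lemma outside_tiles_le (hθ : Symb θ) (hf : BI f) (hN : Measurable N) (hE : MeasurableSet E)
    {Ω : Set ℝ} (hΩ : MeasurableSet Ω) (hfin : volume Ω ≠ ⊤) (hEΩ : Disjoint E Ω) {S : Finset Tile}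
    {D : ℝ} (hD : 0 ≤ D) (hS : ∀ s ∈ S, 4 * 2 ^ s.k ≤ Metric.infDist s.c Ωᶜ)
    (hsD : ∀ s ∈ S, ∫ y, ‖as f s y‖ ≤ D * Metric.infDist s.c Ωᶜ) :
    ∫ x, ‖TS θ f N E S x‖ ≤ 320 * kC θ 4 * D * volume.real Ω := by
  classical
  have hC := kC_pos hθ 4
  set d : ℝ → ℝ := fun y => Metric.infDist y Ωᶜ with hd
  set P : Finset (ℤ × ℤ) := S.image fun s => (s.k, s.m) with hPdef
  have hP : ∀ q ∈ P, 4 * 2 ^ q.1 ≤ d ((q.2 : ℝ) * 2 ^ q.1) := by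
    intro q hq
    obtain ⟨s, hsT, rfl⟩ := Finset.mem_image.1 hq
    exact hS s hsT
  set w : ℤ × ℤ → ℝ → ℝ := fun q x => 16 * kC θ 4 * D * (2 ^ q.1 / d ((q.2 : ℝ) * 2 ^ q.1)) *
    wt (2 ^ (-q.1) * (x - q.2 * 2 ^ q.1)) ^ 2 with hw
  have hw0 : ∀ q x, 0 ≤ w q x := fun q x => by
    have : 0 ≤ d ((q.2 : ℝ) * 2 ^ q.1) := Metric.infDist_nonneg
    simp only [hw]; positivity
  have hwi : ∀ q, Integrable (w q) := fun q => (integrable_wt_center q.1 _ le_rfl).const_mul _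
  have hhs : ∀ s ∈ S, ∀ x ∉ Ω, ‖hs θ f s x‖ ≤ w (s.k, s.m) x := by
    intro s hsT x hx
    have h2k : (0 : ℝ) < 2 ^ s.k := by positivity
    have h1 := hS s hsT
    have hd0 : 0 < d s.c := by change 4 * 2 ^ s.k ≤ d s.c at h1; linarith
    have h2 := norm_hs_le hθ hf 4 (σ := D * d s.c / 2 ^ s.k) (s := s)
      (by rw [div_mul_cancel₀ _ h2k.ne']; exact hsD s hsT) x
    have h3 : wt (2 ^ (-s.k) * (x - s.c)) ≤ 2 ^ s.k / d s.c := by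
      have h4 : d s.c ≤ |x - s.c| := by
        rw [abs_sub_comm]
        exact Metric.infDist_le_dist_of_mem (show x ∈ Ωᶜ from hx)
      rw [← inv_div]
      refine wt_le_inv (by positivity) ?_
      rw [abs_mul, abs_of_pos (by positivity), zpow_neg, div_eq_inv_mul]
      gcongr
    have hw := wt_nonneg (2 ^ (-s.k) * (x - s.c))
    refine h2.trans ?_
    calc 2 ^ 4 * kC θ 4 * (D * d s.c / 2 ^ s.k) * wt (2 ^ (-s.k) * (x - s.c)) ^ 4
        = 16 * kC θ 4 * D * (d s.c / 2 ^ s.k) * wt (2 ^ (-s.k) * (x - s.c)) ^ 2 *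
          wt (2 ^ (-s.k) * (x - s.c)) ^ 2 := by ring
      _ ≤ 16 * kC θ 4 * D * (d s.c / 2 ^ s.k) * (2 ^ s.k / d s.c) ^ 2 *
          wt (2 ^ (-s.k) * (x - s.c)) ^ 2 := by gcongr
      _ = 16 * kC θ 4 * D * (2 ^ s.k / d s.c) * wt (2 ^ (-s.k) * (x - s.c)) ^ 2 := by
          field_simp
      _ = _ := rfl
  have hpt : ∀ x, ‖TS θ f N E S x‖ ≤ ∑ q ∈ P, w q x := by
    intro x
    by_cases hxE : x ∈ E
    swap
    · have : TS θ f N E S x = 0 := Finset.sum_eq_zero fun s _ =>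
        indicator_of_notMem (fun h => hxE h.1) _
      rw [this, norm_zero]
      exact Finset.sum_nonneg fun q _ => hw0 q x
    have hxΩ : x ∉ Ω := disjoint_left.1 hEΩ hxE
    have e : TS θ f N E S x = ∑ q ∈ P, ∑ s ∈ S with (s.k, s.m) = q, (vset N E s).indicator (hs θ f s) x :=
      (Finset.sum_fiberwise_of_maps_to (fun s hsT => Finset.mem_image_of_mem _ hsT) _).symm
    rw [e]
    refine (norm_sum_le _ _).trans (Finset.sum_le_sum fun q _ => ?_)
    by_cases hex : ∃ s ∈ S, (s.k, s.m) = q ∧ x ∈ vset N E s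
    · obtain ⟨s, hsT, rfl, hxs⟩ := hex
      have hz : ∑ s' ∈ S with (s'.k, s'.m) = (s.k, s.m), (vset N E s').indicator (hs θ f s') x =
          (vset N E s).indicator (hs θ f s) x := by
        refine Finset.sum_eq_single_of_mem s (Finset.mem_filter.2 ⟨hsT, rfl⟩) fun s' hs' hne => ?_
        refine indicator_of_notMem (fun hx' => hne ?_) _
        have h1 := (Prod.mk.inj (Finset.mem_filter.1 hs').2)
        have h2 := hx'.2
        have h3 := hxs.2
        rw [h1.1, h3] at h2
        exact Prod.ext h1.1 (Prod.ext h1.2 h2.symm)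
      rw [hz, indicator_of_mem hxs]
      exact hhs s hsT x hxΩ
    · push Not at hex
      rw [Finset.sum_eq_zero, norm_zero]
      · exact hw0 q x
      · intro s hsT
        obtain ⟨h1, h2⟩ := Finset.mem_filter.1 hsT
        exact indicator_of_notMem (hex s h1 h2) _
  calc _ ≤ ∫ x, ∑ q ∈ P, w q x := integral_mono (integrable_TS hθ hf hN hE _).norm
        (integrable_finsetSum _ fun q _ => hwi q) hpt
    _ = ∑ q ∈ P, ∫ x, w q x := integral_finsetSum _ fun q _ => hwi q
    _ ≤ ∑ q ∈ P, 64 * kC θ 4 * D * (2 ^ q.1 * (2 ^ q.1 / d ((q.2 : ℝ) * 2 ^ q.1))) := by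
        refine Finset.sum_le_sum fun q _ => ?_
        have : 0 ≤ d ((q.2 : ℝ) * 2 ^ q.1) := Metric.infDist_nonneg
        rw [integral_const_mul]
        have h1 := integral_wt_pow_le (N := 2) le_rfl (u := (2 : ℝ) ^ (-q.1)) (by positivity) (q.2 * 2 ^ q.1)
        have h2 : 4 / (2 : ℝ) ^ (-q.1) = 4 * 2 ^ q.1 := by rw [zpow_neg, div_inv_eq_mul]
        rw [h2] at h1
        calc _ ≤ 16 * kC θ 4 * D * (2 ^ q.1 / d ((q.2 : ℝ) * 2 ^ q.1)) * (4 * 2 ^ q.1) := by gcongr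
          _ = _ := by ring
    _ ≤ 64 * kC θ 4 * D * (5 * volume.real Ω) := by
        rw [← Finset.mul_sum]
        gcongr
        exact sum_dist_decay_le hΩ hfin P hP
    _ = _ := by ring

/-! ### Restricted weak-type estimates -/

/-- Restricted weak-type estimate above two. -/
theorem weak_high (hθ : SynSymb θ) (hf : BI f) (hf1 : ∀ x, ‖f x‖ ≤ 1) (hN : Measurable N)
    (hE : MeasurableSet E) (hEf : volume E ≠ ⊤) {t : ℝ} (ht0 : 0 < t) (ht : t < 1 / 2)
    {S : Finset Tile} (hS : SEP S) :
    ∫ x, ‖TS θ f N E S x‖ ≤ 2 * formC θ t * ((∫ x, ‖f x‖) ^ t * volume.real E ^ (1 - t)) := by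
  have hC := formC_pos hθ.symb ht0 ht
  have h1 : AvgLe f S 2 := by
    intro s _ r hr
    have hr0 : 0 ≤ r := le_trans (by positivity) hr
    have e : {x : ℝ | |x - s.c| ≤ r} = Metric.closedBall s.c r := by
      ext x; simp [Real.dist_eq]
    have h2 : ∫ x in Metric.closedBall s.c r, ‖f x‖ ≤ ∫ x in Metric.closedBall s.c r, (1 : ℝ) :=
      setIntegral_mono_on hf.int.norm.integrableOn
        (integrableOn_const (by rw [Real.volume_closedBall]; exact ENNReal.ofReal_ne_top))
        measurableSet_closedBall fun x _ => hf1 x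
    rw [setIntegral_const_real, measureReal_def, Real.volume_closedBall, ENNReal.toReal_ofReal (by linarith),
      mul_one] at h2
    rw [e]; exact h2
  have h3 := form_le hθ hf hN hE hEf two_pos ht0 ht hS h1
  have h4 : ∫ x, ‖f x‖ ^ 2 ≤ ∫ x, ‖f x‖ := integral_mono hf.sq_int hf.int.norm fun x => by
    have := norm_nonneg (f x); have := hf1 x
    show ‖f x‖ ^ 2 ≤ ‖f x‖
    nlinarith
  have h5 : 0 ≤ ∫ x, ‖f x‖ ^ 2 := integral_nonneg fun x => by positivity
  have h6 : (2 : ℝ) ^ (1 - 2 * t) ≤ 2 := by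
    conv_rhs => rw [← Real.rpow_one 2]
    exact Real.rpow_le_rpow_of_exponent_le one_le_two (by linarith)
  have h7 : 0 ≤ volume.real E := measureReal_nonneg
  calc _ ≤ formC θ t * (2 ^ (1 - 2 * t) * (∫ x, ‖f x‖ ^ 2) ^ t * volume.real E ^ (1 - t)) := h3
    _ ≤ formC θ t * (2 * (∫ x, ‖f x‖) ^ t * volume.real E ^ (1 - t)) := by gcongr
    _ = _ := by ring

noncomputable def lowC (θ : ℝ → ℝ) (t : ℝ) : ℝ :=
  320 * formC θ t + 320 * kC θ 4 * (256 * kC rho 4) * 40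

lemma lowC_pos (hθ : Symb θ) {t : ℝ} (ht0 : 0 < t) (ht : t < 1 / 2) : 0 < lowC θ t := by
  have h1 := formC_pos hθ ht0 ht
  have h2 := kC_pos hθ 4
  have h3 := kC_pos symb_rho 4
  unfold lowC; positivity

/-- Restricted weak-type estimate below two, off an exceptional set. -/
theorem weak_low (hθ : SynSymb θ) (hf : BI f) (hf1 : ∀ x, ‖f x‖ ≤ 1) (hN : Measurable N)
    (hE : MeasurableSet E) (hEf : volume E ≠ ⊤) (hE0 : 0 < volume.real E) {t : ℝ} (ht0 : 0 < t)
    (ht : t < 1 / 2) {S : Finset Tile} (hS : SEP S) :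
    ∃ E' ⊆ E, MeasurableSet E' ∧ volume.real E ≤ 2 * volume.real E' ∧
      ∫ x, ‖TS θ f N E' S x‖ ≤ lowC θ t * ((∫ x, ‖f x‖) ^ (1 - t) * volume.real E ^ t +
        ∫ x, ‖f x‖) := by
  classical
  have hC := formC_pos hθ.symb ht0 ht
  have hk4 := kC_pos hθ.symb 4
  have hr4 := kC_pos symb_rho 4
  set F := ∫ x, ‖f x‖ with hF
  have hF0 : 0 ≤ F := integral_nonneg fun x => norm_nonneg _
  rcases hF0.eq_or_lt with hF0' | hF0
  · refine ⟨E, subset_rfl, hE, by linarith, ?_⟩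
    have h1 := weak_high hθ hf hf1 hN hE hEf ht0 ht hS
    rw [← hF, ← hF0', Real.zero_rpow ht0.ne', zero_mul, mul_zero] at h1
    refine h1.trans ?_
    have := lowC_pos hθ.symb ht0 ht
    rw [← hF0', add_zero]
    have h7 : 0 ≤ volume.real E := measureReal_nonneg
    positivity
  set A := 80 * F / volume.real E with hA
  have hA0 : 0 < A := by positivity
  set G := S.filter fun s => ∀ r : ℝ, 2 ^ s.k ≤ r → ∫ x in {x | |x - s.c| ≤ r}, ‖f x‖ ≤ 2 * A * r with hG
  have hGS : G ⊆ S := Finset.filter_subset _ _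
  have hGav : AvgLe f G (2 * A) := fun s hsT => (Finset.mem_filter.1 hsT).2
  have hbad : ∀ s ∈ S \ G, ∃ K, s.k ≤ K ∧ A * 2 ^ K < ∫ x in {x | |x - s.c| ≤ 2 ^ K}, ‖f x‖ ∧
      ∀ K' > K, ∫ x in {x | |x - s.c| ≤ 2 ^ K'}, ‖f x‖ ≤ A * 2 ^ K' := by
    intro s hsT
    obtain ⟨h1, h2⟩ := Finset.mem_sdiff.1 hsT
    have h3 : ∃ r : ℝ, 2 ^ s.k ≤ r ∧ 2 * A * r < ∫ x in {x | |x - s.c| ≤ r}, ‖f x‖ := by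
      by_contra! h
      exact h2 (Finset.mem_filter.2 ⟨h1, h⟩)
    obtain ⟨r, hr, h4⟩ := h3
    exact exists_max_avg hf.int hA0 hr h4
  choose! K hK hKl hKm using hbad
  set Ω : Set ℝ := ⋃ s ∈ S \ G, Metric.closedBall s.c (4 * 2 ^ K s) with hΩ
  have hΩm : MeasurableSet Ω := Finset.measurableSet_biUnion _ fun s _ => measurableSet_closedBall
  have hvol : volume Ω ≤ ENNReal.ofReal (40 * A⁻¹ * F) :=
    volume_large_avg_le hf.int hA0 (S \ G) Tile.c K hKl
  have hvolr : volume.real Ω ≤ 40 * A⁻¹ * F := ENNReal.toReal_le_of_le_ofReal (by positivity) hvol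
  have hfin : volume Ω ≠ ⊤ := (hvol.trans_lt ENNReal.ofReal_lt_top).ne
  have hhalf : 40 * A⁻¹ * F = volume.real E / 2 := by
    rw [hA]; field_simp; norm_num
  have hne : (Ωᶜ).Nonempty := by
    by_contra h
    rw [not_nonempty_iff_eq_empty, compl_empty_iff] at h
    simp [h] at hfin
  have hdist : ∀ s ∈ S \ G, 4 * 2 ^ K s ≤ Metric.infDist s.c Ωᶜ := by
    intro s hsT
    rw [Metric.le_infDist hne]
    intro y hy
    by_contra! h
    exact hy (mem_iUnion₂.2 ⟨s, hsT, by rw [Metric.mem_closedBall, dist_comm]; exact h.le⟩)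
  have hEm : MeasurableSet (E \ Ω) := hE.diff hΩm
  have hE'f : volume (E \ Ω) ≠ ⊤ := ne_top_of_le_ne_top hEf (measure_mono sdiff_subset)
  have hE'le : volume.real (E \ Ω) ≤ volume.real E := measureReal_mono sdiff_subset hEf
  refine ⟨E \ Ω, sdiff_subset, hEm, ?_, ?_⟩
  · have h1 : volume.real E ≤ volume.real (E \ Ω) + volume.real Ω :=
      (measureReal_mono (by rw [sdiff_union_self]; exact subset_union_left)
        (measure_union_ne_top hE'f hfin)).trans (measureReal_union_le _ _)
    linarith
  have h1 := integral_TS_le_add (N := N) (E := E \ Ω) hθ.symb hf hN hEm hGS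
  have h2 := form_le hθ hf hN hEm hE'f (by positivity : 0 < 2 * A) ht0 ht (hS.mono hGS) hGav
  have h3 := outside_tiles_le (D := 256 * kC rho 4 * A) hθ.symb hf hN hEm hΩm hfin disjoint_sdiff_left
    (S := S \ G) (by positivity)
    (fun s hsT => le_trans (by gcongr <;> [norm_num; exact hK s hsT]) (hdist s hsT)) (fun s hsT => by
      refine (integral_as_le_of_max hf hA0.le (hK s hsT) (hKm s hsT)).trans ?_
      have h4 : (2 : ℝ) ^ (K s - s.k) * 2 ^ s.k = 2 ^ K s := by
        rw [← zpow_add₀ two_ne_zero]; congr 1; ring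
      calc _ = 1024 * kC rho 4 * A * (2 ^ (K s - s.k) * 2 ^ s.k) := by ring
        _ = 256 * kC rho 4 * A * (4 * 2 ^ K s) := by rw [h4]; ring
        _ ≤ _ := by gcongr; exact hdist s hsT)
  have h5 : ∫ x, ‖f x‖ ^ 2 ≤ F := integral_mono hf.sq_int hf.int.norm fun x => by
    have := norm_nonneg (f x); have := hf1 x
    show ‖f x‖ ^ 2 ≤ ‖f x‖
    nlinarith
  have h6 : 0 ≤ ∫ x, ‖f x‖ ^ 2 := integral_nonneg fun x => by positivity
  have h7 : 0 ≤ volume.real (E \ Ω) := measureReal_nonneg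
  have h8 : (2 * A) ^ (1 - 2 * t) * F ^ t * volume.real E ^ (1 - t) ≤
      160 * (F ^ (1 - t) * volume.real E ^ t) := by
    have e1 : 2 * A = 160 * (F / volume.real E) := by rw [hA]; ring
    have e2 : (160 : ℝ) ^ (1 - 2 * t) ≤ 160 := by
      conv_rhs => rw [← Real.rpow_one 160]
      exact Real.rpow_le_rpow_of_exponent_le (by norm_num) (by linarith)
    rw [e1, Real.mul_rpow (by norm_num) (by positivity), Real.div_rpow hF0.le hE0.le]
    have e3 : F ^ (1 - t) = F ^ (1 - 2 * t) * F ^ t := by rw [← Real.rpow_add hF0]; congr 1; ring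
    have e4 : volume.real E ^ (1 - t) = volume.real E ^ (1 - 2 * t) * volume.real E ^ t := by
      rw [← Real.rpow_add hE0]; congr 1; ring
    have e5 : 0 < volume.real E ^ (1 - 2 * t) := by positivity
    rw [e3, e4]
    calc _ = 160 ^ (1 - 2 * t) * (F ^ (1 - 2 * t) * F ^ t * volume.real E ^ t) := by field_simp
      _ ≤ _ := by gcongr
  have h9 : 320 * kC θ 4 * (256 * kC rho 4 * A) * volume.real Ω ≤
      320 * kC θ 4 * (256 * kC rho 4) * 40 * F := by
    calc _ ≤ 320 * kC θ 4 * (256 * kC rho 4 * A) * (40 * A⁻¹ * F) := by gcongr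
      _ = _ := by field_simp
  have h10 : ∫ x, ‖TS θ f N (E \ Ω) G x‖ ≤ formC θ t * (160 * (F ^ (1 - t) * volume.real E ^ t)) := by
    refine h2.trans ?_
    refine mul_le_mul_of_nonneg_left (le_trans ?_ h8) hC.le
    gcongr
    linarith
  have h11 : 0 ≤ F ^ (1 - t) * volume.real E ^ t := by positivity
  unfold lowC
  have h12 : 0 ≤ formC θ t * (F ^ (1 - t) * volume.real E ^ t) := by positivity
  have h13 : 0 ≤ formC θ t * F := by positivity
  have h14 : 0 ≤ 320 * kC θ 4 * (256 * kC rho 4) * 40 * (F ^ (1 - t) * volume.real E ^ t) := by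
    positivity
  nlinarith

end

lemma summable_exp_decay {ε : ℝ} (hε : 0 < ε) : Summable fun m : ℤ => (2 : ℝ) ^ (-ε * |(m : ℝ)|) := by
  have h0 : (0 : ℝ) ≤ 2 ^ (-ε) := by positivity
  have h1 : (2 : ℝ) ^ (-ε) < 1 := Real.rpow_lt_one_of_one_lt_of_neg one_lt_two (by linarith)
  have h2 := summable_geometric_of_lt_one h0 h1
  have h3 : ∀ n : ℕ, (2 : ℝ) ^ (-ε * (n : ℝ)) = (2 ^ (-ε)) ^ n := fun n => by
    rw [Real.rpow_mul two_pos.le, Real.rpow_natCast]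
  refine Summable.of_nat_of_neg ?_ ?_
  · refine h2.congr fun n => ?_
    rw [← h3]; simp
  · refine h2.congr fun n => ?_
    rw [← h3]; simp

lemma sum_exp_decay_le {ε : ℝ} (hε : 0 < ε) (P : Finset ℤ) (l : ℤ) :
    ∑ k ∈ P, (2 : ℝ) ^ (-ε * |((k - l : ℤ) : ℝ)|) ≤ ∑' m : ℤ, (2 : ℝ) ^ (-ε * |(m : ℝ)|) := by
  have h := ((Equiv.subRight l).summable_iff (f := fun m : ℤ => (2 : ℝ) ^ (-ε * |(m : ℝ)|))).2
    (summable_exp_decay hε)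
  refine (h.sum_le_tsum P fun k _ => by simp only [Function.comp_apply]; positivity).trans_eq ?_
  exact (Equiv.subRight l).tsum_eq (fun m : ℤ => (2 : ℝ) ^ (-ε * |(m : ℝ)|))

lemma tsum_exp_decay_pos {ε : ℝ} (hε : 0 < ε) : 0 < ∑' m : ℤ, (2 : ℝ) ^ (-ε * |(m : ℝ)|) :=
  (summable_exp_decay hε).tsum_pos (fun m => by positivity) 0 (by positivity)

lemma rpow_norm_le_dyadic_sum {p : ℝ} (hp : 0 < p) (v : ℝ → ℂ) (x : ℝ) :
    ‖v x‖ₑ ^ p ≤ ∑' l : ℤ, {x | (2 : ℝ) ^ l < ‖v x‖}.indicator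
      (fun _ => ENNReal.ofReal (((2 : ℝ) ^ (l + 1)) ^ p)) x := by
  by_cases hv : v x = 0
  · rw [hv]; simp [hp]
  obtain ⟨l, hl, hl'⟩ := exists_mem_Ioc_zpow (norm_pos_iff.2 hv) (one_lt_two : (1 : ℝ) < 2)
  refine le_trans ?_ (ENNReal.le_tsum l)
  rw [indicator_of_mem (by exact hl), ← ofReal_norm, ENNReal.ofReal_rpow_of_nonneg (norm_nonneg _) hp.le]
  gcongr

/-- Interpolation of two weak-type bounds along a dyadic decomposition. -/
theorem exists_dyadic_interpolation {p q0 q1 C : ℝ} (hq0 : 0 < q0) (h0 : q0 < p) (h1 : p < q1) (hC : 0 < C) :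
    ∃ K : ℝ, 0 < K ∧ ∀ (P : Finset ℤ) (u : ℤ → ℝ → ℂ) (F : ℤ → ℝ), (∀ k ∈ P, 0 ≤ F k) →
      (∀ k ∈ P, Measurable (u k)) →
      (∀ k ∈ P, ∀ c : ℝ, 0 < c → volume {x | c < ‖u k x‖} ≤ ENNReal.ofReal ((C * 2 ^ k / c) ^ q0 * F k)) →
      (∀ k ∈ P, ∀ c : ℝ, 0 < c → volume {x | c < ‖u k x‖} ≤ ENNReal.ofReal ((C * 2 ^ k / c) ^ q1 * F k)) →
      ∫⁻ x, ‖∑ k ∈ P, u k x‖ₑ ^ p ≤ ENNReal.ofReal (K * ∑ k ∈ P, ((2 : ℝ) ^ k) ^ p * F k) := by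
  have hq1 : 0 < q1 := by linarith
  have hp : 0 < p := by linarith
  set ε := min (p - q0) (q1 - p) / (1 + q1) with hεd
  have hε : 0 < ε := div_pos (lt_min (by linarith) (by linarith)) (by linarith)
  have hε1 : ε * (1 + q1) = min (p - q0) (q1 - p) := div_mul_cancel₀ _ (by linarith)
  have he0 : ε + ε * q0 ≤ p - q0 := by
    have := min_le_left (p - q0) (q1 - p); nlinarith
  have he1 : ε + ε * q1 ≤ q1 - p := by
    have := min_le_right (p - q0) (q1 - p); nlinarith
  set D := ∑' m : ℤ, (2 : ℝ) ^ (-ε * |(m : ℝ)|) with hD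
  have hD0 : 0 < D := tsum_exp_decay_pos hε
  set B := (C * D) ^ q0 + (C * D) ^ q1 with hB
  have hB0 : 0 < B := by positivity
  refine ⟨2 ^ p * B * D, by positivity, fun P u F hF hu hw0 hw1 => ?_⟩
  set v : ℝ → ℂ := fun x => ∑ k ∈ P, u k x with hv
  have hvm : Measurable v := Finset.measurable_fun_sum _ hu
  have hz : ∀ k : ℤ, (2 : ℝ) ^ k = (2 : ℝ) ^ (k : ℝ) := fun k => (Real.rpow_intCast 2 k).symm
  -- the bound for one layer at one level
  have key : ∀ l : ℤ, ∀ k ∈ P, volume {x | (2 : ℝ) ^ (-ε * |((k - l : ℤ) : ℝ)|) * D⁻¹ * 2 ^ l < ‖u k x‖} *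
      ENNReal.ofReal (((2 : ℝ) ^ (l + 1)) ^ p) ≤
      ENNReal.ofReal (2 ^ p * B * (((2 : ℝ) ^ k) ^ p * F k) * 2 ^ (-ε * |((k - l : ℤ) : ℝ)|)) := by
    intro l k hk
    have hFk := hF k hk
    set m : ℝ := ((k - l : ℤ) : ℝ) with hm
    have hlm : (l : ℝ) = k - m := by rw [hm]; push_cast; ring
    have ec : C * 2 ^ k / ((2 : ℝ) ^ (-ε * |m|) * D⁻¹ * 2 ^ l) = (C * D) * 2 ^ (m + ε * |m|) := by
      rw [hz k, hz l, hlm, Real.rpow_sub two_pos, neg_mul, Real.rpow_neg two_pos.le, Real.rpow_add two_pos]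
      field_simp
    have el : ((2 : ℝ) ^ (l + 1)) ^ p = 2 ^ p * (((2 : ℝ) ^ k) ^ p * 2 ^ (-m * p)) := by
      have e1 : ((2 : ℝ) ^ l) ^ p = ((2 : ℝ) ^ k) ^ p * 2 ^ (-m * p) := by
        rw [hz l, hz k, hlm, ← Real.rpow_mul two_pos.le, ← Real.rpow_mul two_pos.le,
          ← Real.rpow_add two_pos]
        congr 1; ring
      rw [zpow_add₀ two_ne_zero, zpow_one, Real.mul_rpow (by positivity) two_pos.le, e1, mul_comm]
    have hc : (0 : ℝ) < (2 : ℝ) ^ (-ε * |m|) * D⁻¹ * 2 ^ l := by positivity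
    have fin : ∀ q, 0 < q → (C * D) ^ q ≤ B → (m + ε * |m|) * q + -m * p ≤ -ε * |m| →
        volume {x | (2 : ℝ) ^ (-ε * |m|) * D⁻¹ * 2 ^ l < ‖u k x‖} ≤
          ENNReal.ofReal ((C * 2 ^ k / ((2 : ℝ) ^ (-ε * |m|) * D⁻¹ * 2 ^ l)) ^ q * F k) →
        volume {x | (2 : ℝ) ^ (-ε * |m|) * D⁻¹ * 2 ^ l < ‖u k x‖} * ENNReal.ofReal (((2 : ℝ) ^ (l + 1)) ^ p) ≤
        ENNReal.ofReal (2 ^ p * B * (((2 : ℝ) ^ k) ^ p * F k) * 2 ^ (-ε * |m|)) := by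
      intro q hq hqB hexp h
      rw [ec, Real.mul_rpow (by positivity) (by positivity), ← Real.rpow_mul two_pos.le] at h
      refine (mul_le_mul_left h _).trans ?_
      rw [← ENNReal.ofReal_mul (by positivity)]
      refine ENNReal.ofReal_le_ofReal ?_
      rw [el]
      calc _ = (C * D) ^ q * (2 ^ p * (((2 : ℝ) ^ k) ^ p * F k)) *
            (2 ^ ((m + ε * |m|) * q) * 2 ^ (-m * p)) := by ring
        _ = (C * D) ^ q * (2 ^ p * (((2 : ℝ) ^ k) ^ p * F k)) * 2 ^ ((m + ε * |m|) * q + -m * p) := by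
          rw [Real.rpow_add two_pos]
        _ ≤ B * (2 ^ p * (((2 : ℝ) ^ k) ^ p * F k)) * 2 ^ (-ε * |m|) := by
          gcongr
          exact one_le_two
        _ = _ := by ring
    have hB1 : 0 ≤ (C * D) ^ q0 := by positivity
    have hB2 : 0 ≤ (C * D) ^ q1 := by positivity
    rcases le_total 0 m with h | h
    · refine fin q0 hq0 (by linarith) ?_ (hw0 k hk _ hc)
      rw [abs_of_nonneg h]; nlinarith
    · refine fin q1 hq1 (by linarith) ?_ (hw1 k hk _ hc)
      rw [abs_of_nonpos h]; nlinarith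
  have hsub : ∀ l : ℤ, volume {x | (2 : ℝ) ^ l < ‖v x‖} ≤
      ∑ k ∈ P, volume {x | (2 : ℝ) ^ (-ε * |((k - l : ℤ) : ℝ)|) * D⁻¹ * 2 ^ l < ‖u k x‖} := by
    intro l
    refine le_trans (measure_mono ?_) (measure_biUnion_finset_le P _)
    intro x hx
    by_contra hcon
    simp only [mem_iUnion, mem_ofPred_eq, not_exists, not_lt] at hcon
    have h2 : ‖v x‖ ≤ 2 ^ l := calc
      ‖v x‖ ≤ ∑ k ∈ P, ‖u k x‖ := norm_sum_le _ _
      _ ≤ ∑ k ∈ P, (2 : ℝ) ^ (-ε * |((k - l : ℤ) : ℝ)|) * D⁻¹ * 2 ^ l := Finset.sum_le_sum hcon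
      _ = (∑ k ∈ P, (2 : ℝ) ^ (-ε * |((k - l : ℤ) : ℝ)|)) * D⁻¹ * 2 ^ l := by
        rw [Finset.sum_mul, Finset.sum_mul]
      _ ≤ D * D⁻¹ * 2 ^ l := by
        gcongr; exact sum_exp_decay_le hε P l
      _ = 2 ^ l := by rw [mul_inv_cancel₀ hD0.ne', one_mul]
    exact absurd hx (not_lt.2 h2)
  have hG : 0 ≤ ∑ k ∈ P, ((2 : ℝ) ^ k) ^ p * F k :=
    Finset.sum_nonneg fun k hk => mul_nonneg (by positivity) (hF k hk)
  calc ∫⁻ x, ‖v x‖ₑ ^ p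
      ≤ ∫⁻ x, ∑' l : ℤ, {x | (2 : ℝ) ^ l < ‖v x‖}.indicator
          (fun _ => ENNReal.ofReal (((2 : ℝ) ^ (l + 1)) ^ p)) x :=
        lintegral_mono fun x => rpow_norm_le_dyadic_sum hp v x
    _ = ∑' l : ℤ, volume {x | (2 : ℝ) ^ l < ‖v x‖} * ENNReal.ofReal (((2 : ℝ) ^ (l + 1)) ^ p) := by
        have hms : ∀ l : ℤ, MeasurableSet {x | (2 : ℝ) ^ l < ‖v x‖} := fun l =>
          measurableSet_lt measurable_const hvm.norm
        rw [lintegral_tsum fun l => (measurable_const.indicator (hms l)).aemeasurable]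
        congr 1; ext l
        rw [lintegral_indicator (hms l), setLIntegral_const, mul_comm]
    _ ≤ ∑' l : ℤ, ∑ k ∈ P, ENNReal.ofReal (2 ^ p * B * (((2 : ℝ) ^ k) ^ p * F k) *
          2 ^ (-ε * |((k - l : ℤ) : ℝ)|)) := by
        refine ENNReal.tsum_le_tsum fun l => ?_
        refine (mul_le_mul_left (hsub l) _).trans ?_
        rw [Finset.sum_mul]
        exact Finset.sum_le_sum fun k hk => key l k hk
    _ = ∑ k ∈ P, ∑' l : ℤ, ENNReal.ofReal (2 ^ p * B * (((2 : ℝ) ^ k) ^ p * F k) *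
          2 ^ (-ε * |((k - l : ℤ) : ℝ)|)) := Summable.tsum_finsetSum fun _ _ => ENNReal.summable
    _ = ∑ k ∈ P, ENNReal.ofReal (2 ^ p * B * (((2 : ℝ) ^ k) ^ p * F k) * D) := by
        refine Finset.sum_congr rfl fun k hk => ?_
        have hFk := hF k hk
        have e : ∀ l : ℤ, ENNReal.ofReal (2 ^ p * B * (((2 : ℝ) ^ k) ^ p * F k) *
            2 ^ (-ε * |((k - l : ℤ) : ℝ)|)) = ENNReal.ofReal (2 ^ p * B * (((2 : ℝ) ^ k) ^ p * F k)) *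
            ENNReal.ofReal (2 ^ (-ε * |((k - l : ℤ) : ℝ)|)) := fun l => ENNReal.ofReal_mul (by positivity)
        simp_rw [e]
        rw [ENNReal.tsum_mul_left,
          ENNReal.ofReal_mul (p := 2 ^ p * B * (((2 : ℝ) ^ k) ^ p * F k)) (q := D) (by positivity), hD,
          ENNReal.ofReal_tsum_of_nonneg (fun m => by positivity) (summable_exp_decay hε)]
        congr 1
        exact (Equiv.subLeft k).tsum_eq (fun m : ℤ => ENNReal.ofReal ((2 : ℝ) ^ (-ε * |(m : ℝ)|)))
    _ = _ := by
        rw [← ENNReal.ofReal_sum_of_nonneg fun k hk => by have := hF k hk; positivity]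
        congr 1
        rw [Finset.mul_sum]
        exact Finset.sum_congr rfl fun k _ => by ring

section

variable {θ : ℝ → ℝ} {f : ℝ → ℂ} {N : ℝ → ℝ} {E : Set ℝ}

lemma measurable_TS (hθ : Symb θ) (hf : BI f) (hN : Measurable N) (hE : MeasurableSet E) (S : Finset Tile) :
    Measurable (TS θ f N E S) :=
  Finset.measurable_fun_sum _ fun s _ =>
    (continuous_cv (hθ.sy s) (BI_as hf s).int).measurable.indicator (measurableSet_vset hN hE s)

lemma TS_eq_indicator (θ : ℝ → ℝ) (f : ℝ → ℂ) (N : ℝ → ℝ) (E : Set ℝ) (S : Finset Tile) :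
    TS θ f N E S = E.indicator (TS θ f N univ S) := by
  classical
  ext x
  by_cases hx : x ∈ E
  · rw [indicator_of_mem hx]
    refine Finset.sum_congr rfl fun s _ => ?_
    simp only [indicator_apply, vset, mem_ofPred_eq, hx, mem_univ, true_and]
  · rw [indicator_of_notMem hx]
    exact Finset.sum_eq_zero fun s _ => indicator_of_notMem (fun h => hx h.1) _

lemma as_sum {ι : Type*} (P : Finset ι) {g : ι → ℝ → ℂ} (hg : ∀ i ∈ P, BI (g i)) (s : Tile) :
    as (fun y => ∑ i ∈ P, g i y) s = fun y => ∑ i ∈ P, as (g i) s y := by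
  ext y
  by_cases hy : y ∈ s.I
  · simp only [as, indicator_of_mem hy, Fs]
    exact cv_sum (symb_rho.sy s) P (fun i hi => (hg i hi).int) y
  · simp [as, hy]

lemma TS_sum (hθ : Symb θ) {ι : Type*} (P : Finset ι) {g : ι → ℝ → ℂ} (hg : ∀ i ∈ P, BI (g i))
    (S : Finset Tile) (x : ℝ) :
    TS θ (fun y => ∑ i ∈ P, g i y) N E S x = ∑ i ∈ P, TS θ (g i) N E S x := by
  classical
  simp only [TS]
  rw [Finset.sum_comm]
  refine Finset.sum_congr rfl fun s _ => ?_
  by_cases hx : x ∈ vset N E s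
  · simp only [indicator_of_mem hx, hs, as_sum P hg]
    exact cv_sum (hθ.sy s) P (fun i hi => (BI_as (hg i hi) s).int) x
  · simp [hx]

lemma cv_const_mul (φ : ℝ → ℝ) (c : ℂ) (a : ℝ → ℂ) (x : ℝ) :
    cv φ (fun y => c * a y) x = c * cv φ a x := by
  simp only [cv]
  rw [← integral_const_mul]
  congr 1; ext y; ring

lemma TS_const_mul (c : ℂ) (S : Finset Tile) (x : ℝ) :
    TS θ (fun y => c * f y) N E S x = c * TS θ f N E S x := by
  classical
  simp only [TS, Finset.mul_sum]
  refine Finset.sum_congr rfl fun s _ => ?_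
  have h : as (fun y => c * f y) s = fun y => c * as f s y := by
    ext y
    by_cases hy : y ∈ s.I
    · simp only [as, indicator_of_mem hy, Fs, cv_const_mul]
    · simp [as, hy]
  by_cases hx : x ∈ vset N E s
  · simp only [indicator_of_mem hx, hs, h, cv_const_mul]
  · simp [hx]

lemma BI.const_mul (hf : BI f) (c : ℂ) : BI fun y => c * f y := by
  obtain ⟨A, hA⟩ := hf.bdd
  exact ⟨hf.int.const_mul c, ‖c‖ * A, fun x => by rw [norm_mul]; gcongr; exact hA x⟩

lemma le_of_mul_le_rpow {l X F C r : ℝ} (hl : 0 < l) (hX : 0 < X) (hF : 0 ≤ F) (hC : 0 ≤ C) (hr : 0 < r)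
    (h : l * X ≤ C * (F ^ r * X ^ (1 - r))) : X ≤ (C / l) ^ (1 / r) * F := by
  have h1 : X = X ^ r * X ^ (1 - r) := by
    rw [← Real.rpow_add hX]; simp
  have h2 : l * X ^ r ≤ C * F ^ r := by
    have h3 : 0 < X ^ (1 - r) := by positivity
    refine le_of_mul_le_mul_right ?_ h3
    calc l * X ^ r * X ^ (1 - r) = l * X := by rw [mul_assoc, ← h1]
      _ ≤ _ := h
      _ = _ := by ring
  have h3 : X ^ r ≤ C / l * F ^ r := by
    rw [div_mul_eq_mul_div, le_div_iff₀ hl]; linarith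
  calc X = (X ^ r) ^ (1 / r) := by rw [← Real.rpow_mul hX.le, mul_one_div_cancel hr.ne', Real.rpow_one]
    _ ≤ (C / l * F ^ r) ^ (1 / r) := by gcongr
    _ = _ := by
      rw [Real.mul_rpow (by positivity) (by positivity), ← Real.rpow_mul hF, mul_one_div_cancel hr.ne',
        Real.rpow_one]

/-- Restricted weak-type bounds for every exponent other than two. -/
theorem exists_restricted_weak (hθ : SynSymb θ) {q : ℝ} (hq : 1 < q) (hq2 : q ≠ 2) :
    ∃ C : ℝ, 0 < C ∧ ∀ (f : ℝ → ℂ) (N : ℝ → ℝ) (S : Finset Tile), BI f → (∀ x, ‖f x‖ ≤ 1) → Measurable N →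
      SEP S → ∀ l : ℝ, 0 < l →
        volume {x | l < ‖TS θ f N univ S x‖} ≤ ENNReal.ofReal ((C / l) ^ q * ∫ x, ‖f x‖) := by
  have hr0 : 0 < 1 / q := by positivity
  have hqr : 1 / (1 / q) = q := one_div_one_div q
  suffices H : ∃ C : ℝ, 0 < C ∧ ∀ (f : ℝ → ℂ) (N : ℝ → ℝ) (S : Finset Tile), BI f → (∀ x, ‖f x‖ ≤ 1) →
      Measurable N → SEP S → ∀ l : ℝ, 0 < l → ∀ E : Set ℝ, MeasurableSet E → volume E ≠ ⊤ →
      0 < volume.real E → (∀ E' ⊆ E, MeasurableSet E' → l * volume.real E' ≤ ∫ x, ‖TS θ f N E' S x‖) →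
      l * volume.real E ≤ C * ((∫ x, ‖f x‖) ^ (1 / q) * volume.real E ^ (1 - 1 / q)) by
    obtain ⟨C, hC, H⟩ := H
    refine ⟨C, hC, fun f N S hf hf1 hN hS l hl => ?_⟩
    set E := {x | l < ‖TS θ f N univ S x‖} with hEd
    have hE : MeasurableSet E := measurableSet_lt measurable_const
      (measurable_TS hθ.symb hf hN MeasurableSet.univ S).norm
    have hint := integrable_TS hθ.symb hf hN MeasurableSet.univ S
    have hEf : volume E ≠ ⊤ := (hint.measure_norm_gt_lt_top hl).ne
    rw [← ENNReal.ofReal_toReal hEf]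
    refine ENNReal.ofReal_le_ofReal ?_
    have hF : 0 ≤ ∫ x, ‖f x‖ := integral_nonneg fun x => norm_nonneg _
    rcases (ENNReal.toReal_nonneg (a := volume E)).eq_or_lt with h0 | h0
    · rw [← h0]; positivity
    have h1 := H f N S hf hf1 hN hS l hl E hE hEf h0 fun E' hE' hE'm => by
      have h3 : ∫ x, ‖TS θ f N E' S x‖ = ∫ x in E', ‖TS θ f N univ S x‖ := by
        rw [TS_eq_indicator, ← integral_indicator hE'm]
        congr 1; ext x; exact norm_indicator_eq_indicator_norm _ _
      rw [h3, mul_comm, ← smul_eq_mul, ← setIntegral_const]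
      refine setIntegral_mono_on (integrableOn_const (measure_ne_top_of_subset hE' hEf)) hint.norm.integrableOn
        hE'm fun x hx => (hE' hx).le
    have h2 := le_of_mul_le_rpow hl h0 hF hC.le hr0 h1
    rwa [hqr] at h2
  rcases lt_or_gt_of_ne hq2 with h2 | h2
  · set t := 1 - 1 / q with ht
    have hr : 1 / q = 1 - t := by rw [ht]; ring
    have hr1 : 1 / q < 1 := (div_lt_one (by linarith)).2 hq
    have hr2 : 1 / 2 < 1 / q := one_div_lt_one_div_of_lt (by linarith) h2
    have ht0 : 0 < t := by linarith
    have ht2 : t < 1 / 2 := by linarith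
    have hc1 := lowC_pos hθ.symb ht0 ht2
    have hc2 := formC_pos hθ.symb ht0 ht2
    refine ⟨4 * lowC θ t + 2 * formC θ t, by positivity, fun f N S hf hf1 hN hS l hl E hE hEf hE0 hl' => ?_⟩
    set F := ∫ x, ‖f x‖ with hF
    have hF0 : 0 ≤ F := integral_nonneg fun x => norm_nonneg _
    set X := volume.real E with hX
    rw [hr]
    have hnn : 0 ≤ F ^ (1 - t) * X ^ t := by positivity
    rcases le_total F X with hFX | hFX
    · obtain ⟨E', hE', hE'm, h3, h4⟩ := weak_low hθ hf hf1 hN hE hEf hE0 ht0 ht2 hS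
      have h5 := hl' E' hE' hE'm
      have h6 : F ≤ F ^ (1 - t) * X ^ t := by
        calc F = F ^ (1 - t) * F ^ t := by
              rw [← Real.rpow_add_of_nonneg hF0 (by linarith) ht0.le]; simp
          _ ≤ _ := by gcongr
      calc l * X ≤ l * (2 * volume.real E') := by gcongr
        _ = 2 * (l * volume.real E') := by ring
        _ ≤ 2 * (lowC θ t * (F ^ (1 - t) * X ^ t + F)) := by linarith
        _ ≤ 2 * (lowC θ t * (F ^ (1 - t) * X ^ t + F ^ (1 - t) * X ^ t)) := by gcongr
        _ ≤ (4 * lowC θ t + 2 * formC θ t) * (F ^ (1 - t) * X ^ t) := by nlinarith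
    · have h3 := weak_high hθ hf hf1 hN hE hEf ht0 ht2 hS
      have h5 := hl' E subset_rfl hE
      have hF0' : 0 < F := hE0.trans_le hFX
      have h6 : F ^ t * X ^ (1 - t) ≤ F ^ (1 - t) * X ^ t := by
        have e1 : X ^ (1 - t) = X ^ t * X ^ (1 - 2 * t) := by rw [← Real.rpow_add hE0]; congr 1; ring
        have e2 : F ^ (1 - t) = F ^ t * F ^ (1 - 2 * t) := by rw [← Real.rpow_add hF0']; congr 1; ring
        rw [e1, e2]
        calc F ^ t * (X ^ t * X ^ (1 - 2 * t)) ≤ F ^ t * (X ^ t * F ^ (1 - 2 * t)) := by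
              gcongr; linarith
          _ = _ := by ring
      calc l * X ≤ _ := h5
        _ ≤ _ := h3
        _ ≤ 2 * formC θ t * (F ^ (1 - t) * X ^ t) := by gcongr
        _ ≤ _ := by nlinarith
  · have ht2 : 1 / q < 1 / 2 := one_div_lt_one_div_of_lt (by linarith) h2
    have hc2 := formC_pos hθ.symb hr0 ht2
    refine ⟨2 * formC θ (1 / q), by positivity, fun f N S hf hf1 hN hS l hl E hE hEf hE0 hl' => ?_⟩
    exact (hl' E subset_rfl hE).trans (weak_high hθ hf hf1 hN hE hEf hr0 ht2 hS)

lemma restricted_weak_scaled {q C : ℝ}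
    (H : ∀ (f : ℝ → ℂ) (N : ℝ → ℝ) (S : Finset Tile), BI f → (∀ x, ‖f x‖ ≤ 1) → Measurable N →
      SEP S → ∀ l : ℝ, 0 < l →
        volume {x | l < ‖TS θ f N univ S x‖} ≤ ENNReal.ofReal ((C / l) ^ q * ∫ x, ‖f x‖))
    (hf : BI f) {k : ℤ} (hfk : ∀ x, ‖f x‖ ≤ 2 ^ k) (hN : Measurable N) {S : Finset Tile} (hS : SEP S)
    {c : ℝ} (hc : 0 < c) :
    volume {x | c < ‖TS θ f N univ S x‖} ≤
      ENNReal.ofReal ((C * 2 ^ k / c) ^ q * ((2 ^ k)⁻¹ * ∫ x, ‖f x‖)) := by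
  have hk : (0 : ℝ) < 2 ^ k := by positivity
  have hnc : ‖(((2 ^ k)⁻¹ : ℝ) : ℂ)‖ = (2 ^ k)⁻¹ := by
    rw [Complex.norm_real, Real.norm_of_nonneg (by positivity)]
  have h := H (fun y => (((2 ^ k)⁻¹ : ℝ) : ℂ) * f y) N S (hf.const_mul _) (fun x => by
    rw [norm_mul, hnc, inv_mul_le_iff₀ hk, mul_one]; exact hfk x) hN hS (c / 2 ^ k) (by positivity)
  have e1 : {x | c / 2 ^ k < ‖TS θ (fun y => (((2 ^ k)⁻¹ : ℝ) : ℂ) * f y) N univ S x‖} =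
      {x | c < ‖TS θ f N univ S x‖} := by
    ext x
    simp only [mem_ofPred_eq]
    rw [TS_const_mul, norm_mul, hnc, inv_mul_eq_div, div_lt_div_iff_of_pos_right hk]
  have e2 : ∫ x, ‖(((2 ^ k)⁻¹ : ℝ) : ℂ) * f x‖ = (2 ^ k)⁻¹ * ∫ x, ‖f x‖ := by
    rw [← integral_const_mul]
    congr 1; ext x; rw [norm_mul, hnc]
  rw [e1, e2, div_div_eq_mul_div] at h
  exact h

/-- Uniform strong-type bounds for the model sums. -/
theorem exists_TS_bound (hθ : SynSymb θ) {p : ℝ} (hp : 1 < p) :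
    ∃ C : ℝ, 0 < C ∧ ∀ (f : ℝ → ℂ) (N : ℝ → ℝ) (S : Finset Tile), BI f → Measurable f → Measurable N → SEP S →
      ∫⁻ x, ‖TS θ f N univ S x‖ₑ ^ p ≤ ENNReal.ofReal (C * ∫ x, ‖f x‖ ^ p) := by
  obtain ⟨q0, hq1, hqp, hq2⟩ : ∃ q0, 1 < q0 ∧ q0 < p ∧ q0 ≠ 2 := by
    by_cases h : (1 + p) / 2 = 2
    · exact ⟨3 / 2, by norm_num, by linarith, by norm_num⟩
    · exact ⟨(1 + p) / 2, by linarith, by linarith, h⟩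
  obtain ⟨q1, hqp1, hq21⟩ : ∃ q1, p < q1 ∧ q1 ≠ 2 := by
    by_cases h : p + 1 = 2
    · exact ⟨3, by linarith, by norm_num⟩
    · exact ⟨p + 1, by linarith, h⟩
  obtain ⟨C0, hC0, H0⟩ := exists_restricted_weak hθ hq1 hq2
  obtain ⟨C1, hC1, H1⟩ := exists_restricted_weak hθ (hp.trans hqp1) hq21
  set C := max C0 C1 with hCd
  have hC : 0 < C := lt_max_of_lt_left hC0
  obtain ⟨K, hK, HK⟩ := exists_dyadic_interpolation (by linarith : (0 : ℝ) < q0) hqp hqp1 hC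
  refine ⟨K * 2 ^ (p - 1), by positivity, fun f N S hf hfm hN hS => ?_⟩
  have hfp : Integrable fun x => ‖f x‖ ^ p := by
    obtain ⟨A, hA⟩ := hf.bdd
    have hA0 : 0 ≤ A := (norm_nonneg _).trans (hA 0)
    refine (hf.int.norm.const_mul (A ^ (p - 1))).mono'
      ((Real.continuous_rpow_const (by linarith)).comp_aestronglyMeasurable hf.int.1.norm) ?_
    refine Filter.Eventually.of_forall fun x => ?_
    rw [Real.norm_of_nonneg (by positivity)]
    calc ‖f x‖ ^ p = ‖f x‖ ^ (p - 1) * ‖f x‖ := by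
          conv_rhs => rw [← Real.rpow_one ‖f x‖, ← Real.rpow_mul (norm_nonneg _), one_mul]
          rw [← Real.rpow_add_of_nonneg (norm_nonneg _) (by linarith) zero_le_one]; simp
      _ ≤ A ^ (p - 1) * ‖f x‖ := by gcongr; exact hA x
  obtain ⟨M, hM⟩ : ∃ M : ℤ, ∀ x, ‖f x‖ ≤ 2 ^ M := by
    obtain ⟨A, hA⟩ := hf.bdd
    obtain ⟨n, hn⟩ := pow_unbounded_of_one_lt A one_lt_two
    exact ⟨n, fun x => (hA x).trans (by rw [zpow_natCast]; exact hn.le)⟩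
  have hbase : ∀ n : ℕ, ∫⁻ x, ‖TS θ f N univ S x‖ₑ ^ p ≤
      ENNReal.ofReal (K * ∫ x, (2 ^ (p - 1) * ‖f x‖ ^ p + ((2 : ℝ) ^ (M - n)) ^ (p - 1) * ‖f x‖)) := by
    intro n
    set L : ℤ := M - n with hL
    set P := Finset.Icc L M with hP
    set A : ℤ → Set ℝ := fun k => {x | ‖f x‖ ≤ 2 ^ k ∧ (k = L ∨ (2 : ℝ) ^ (k - 1) < ‖f x‖)} with hA
    have hAm : ∀ k, MeasurableSet (A k) := fun k =>
      (measurableSet_le hfm.norm measurable_const).inter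
        ((MeasurableSet.const _).union (measurableSet_lt measurable_const hfm.norm))
    set g : ℤ → ℝ → ℂ := fun k => (A k).indicator f with hg
    have hgB : ∀ k ∈ P, BI (g k) := fun k _ => hf.indicator (hAm k)
    have hle : ∀ {i j : ℤ}, (2 : ℝ) ^ i < 2 ^ j → i < j := fun h => (zpow_lt_zpow_iff_right₀ one_lt_two).1 h
    have hex : ∀ x, ∃ k ∈ P, x ∈ A k ∧ ∀ k' ∈ P, x ∈ A k' → k' = k := by
      intro x
      by_cases h : ‖f x‖ ≤ 2 ^ L
      · refine ⟨L, Finset.mem_Icc.2 ⟨le_rfl, by omega⟩, ⟨h, Or.inl rfl⟩, fun k' hk' hx => ?_⟩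
        rcases hx.2 with h1 | h1
        · exact h1
        · have := hle (h1.trans_le h)
          have := (Finset.mem_Icc.1 hk').1
          omega
      · have h0 : 0 < ‖f x‖ := by
          have : (0 : ℝ) < 2 ^ L := by positivity
          linarith
        obtain ⟨l, hl, hl'⟩ := exists_mem_Ioc_zpow h0 (one_lt_two : (1 : ℝ) < 2)
        have h1 := hle (hl.trans_le (hM x))
        have h2 := hle ((not_le.1 h).trans_le hl')
        refine ⟨l + 1, Finset.mem_Icc.2 ⟨by omega, by omega⟩, ⟨hl', Or.inr (by simpa using hl)⟩, ?_⟩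
        intro k' hk' hx
        have h3 := hle (hl.trans_le hx.1)
        rcases hx.2 with h4 | h4
        · rw [h4] at hx; exact absurd hx.1 h
        · have := hle (h4.trans_le hl')
          omega
    have hsum : ∀ x, ∃ k ∈ P, x ∈ A k ∧ ∀ k' ∈ P, k' ≠ k → g k' x = 0 := by
      intro x
      obtain ⟨k, hk, hx, hu⟩ := hex x
      exact ⟨k, hk, hx, fun k' hk' hne => indicator_of_notMem (fun h => hne (hu k' hk' h)) _⟩
    have hfsum : (fun x => ∑ k ∈ P, g k x) = f := by
      ext x
      obtain ⟨k, hk, hx, hu⟩ := hsum x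
      rw [Finset.sum_eq_single_of_mem k hk hu]
      exact indicator_of_mem hx _
    have hgk : ∀ k, ∀ x, ‖g k x‖ ≤ 2 ^ k := by
      intro k x
      by_cases hx : x ∈ A k
      · simp only [hg, indicator_of_mem hx]; exact hx.1
      · simp only [hg, indicator_of_notMem hx, norm_zero]; positivity
    have h := HK P (fun k => TS θ (g k) N univ S) (fun k => (2 ^ k)⁻¹ * ∫ x, ‖g k x‖)
      (fun k _ => mul_nonneg (by positivity) (integral_nonneg fun x => norm_nonneg _))
      (fun k hk => measurable_TS hθ.symb (hgB k hk) hN MeasurableSet.univ S)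
      (fun k hk c hc => (restricted_weak_scaled H0 (hgB k hk) (hgk k) hN hS hc).trans
        (ENNReal.ofReal_le_ofReal (by
          have : 0 ≤ ∫ x, ‖g k x‖ := integral_nonneg fun x => norm_nonneg _
          have := le_max_left C0 C1
          gcongr)))
      (fun k hk c hc => (restricted_weak_scaled H1 (hgB k hk) (hgk k) hN hS hc).trans
        (ENNReal.ofReal_le_ofReal (by
          have : 0 ≤ ∫ x, ‖g k x‖ := integral_nonneg fun x => norm_nonneg _
          have := le_max_right C0 C1
          have hq10 : 0 ≤ q1 := by linarith
          gcongr)))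
    have e1 : ∀ x, ∑ k ∈ P, TS θ (g k) N univ S x = TS θ f N univ S x := fun x => by
      rw [← TS_sum hθ.symb P hgB, hfsum]
    simp only [e1] at h
    refine h.trans (ENNReal.ofReal_le_ofReal (mul_le_mul_of_nonneg_left ?_ hK.le))
    have e2 : ∀ k : ℤ, ((2 : ℝ) ^ k) ^ p * ((2 ^ k)⁻¹ * ∫ x, ‖g k x‖) =
        ∫ x, ((2 : ℝ) ^ k) ^ (p - 1) * ‖g k x‖ := by
      intro k
      have : (0 : ℝ) < 2 ^ k := by positivity
      rw [integral_const_mul, Real.rpow_sub_one this.ne', div_eq_mul_inv, mul_assoc]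
    simp only [e2]
    rw [← integral_finsetSum P fun k hk => (hgB k hk).int.norm.const_mul _]
    refine integral_mono (integrable_finsetSum P fun k hk => (hgB k hk).int.norm.const_mul _)
      ((hfp.const_mul _).add (hf.int.norm.const_mul _)) fun x => ?_
    obtain ⟨k, hk, hx, hu⟩ := hsum x
    show ∑ k ∈ P, ((2 : ℝ) ^ k) ^ (p - 1) * ‖g k x‖ ≤
      2 ^ (p - 1) * ‖f x‖ ^ p + ((2 : ℝ) ^ L) ^ (p - 1) * ‖f x‖
    have hs1 : ∑ k ∈ P, ((2 : ℝ) ^ k) ^ (p - 1) * ‖g k x‖ = ((2 : ℝ) ^ k) ^ (p - 1) * ‖g k x‖ :=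
      Finset.sum_eq_single_of_mem k hk fun k' hk' hne => by rw [hu k' hk' hne, norm_zero, mul_zero]
    rw [hs1]
    have e3 : g k x = f x := indicator_of_mem hx _
    have hn1 := norm_nonneg (f x)
    rw [e3]
    rcases hx.2 with h1 | h1
    · rw [h1]
      have : 0 ≤ 2 ^ (p - 1) * ‖f x‖ ^ p := by positivity
      linarith
    · have h2 : (0 : ℝ) < 2 ^ (k - 1) := by positivity
      have h3 : (2 : ℝ) ^ k = 2 * 2 ^ (k - 1) := by
        rw [← zpow_one_add₀ two_ne_zero]; congr 1; ring
      have h4 : ‖f x‖ ^ p = ‖f x‖ ^ (p - 1) * ‖f x‖ := by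
        have hn2 : ‖f x‖ ≠ 0 := (h2.trans h1).ne'
        rw [Real.rpow_sub_one hn2]; field_simp
      have h5 : ((2 : ℝ) ^ k) ^ (p - 1) * ‖f x‖ ≤ 2 ^ (p - 1) * ‖f x‖ ^ p := by
        rw [h4, ← mul_assoc, ← Real.mul_rpow two_pos.le hn1, h3]
        gcongr
      have : 0 ≤ ((2 : ℝ) ^ L) ^ (p - 1) * ‖f x‖ := by positivity
      linarith
  have hlim : Filter.Tendsto (fun n : ℕ => ((2 : ℝ) ^ (M - n)) ^ (p - 1)) Filter.atTop (nhds 0) := by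
    have h1 : Filter.Tendsto (fun n : ℕ => (2 : ℝ) ^ (M - n)) Filter.atTop (nhds 0) := by
      have h2 : ∀ n : ℕ, (2 : ℝ) ^ (M - n) = 2 ^ M * (1 / 2) ^ n := fun n => by
        rw [zpow_sub₀ two_ne_zero, zpow_natCast, one_div, inv_pow, div_eq_mul_inv]
      simp only [h2]
      have := (tendsto_pow_atTop_nhds_zero_of_lt_one (r := (1 / 2 : ℝ)) (by norm_num) (by norm_num)).const_mul
        ((2 : ℝ) ^ M)
      rwa [mul_zero] at this
    have h3 := h1.rpow_const (p := p - 1) (Or.inr (by linarith))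
    rwa [Real.zero_rpow (by linarith)] at h3
  have e : ∀ n : ℕ, ∫ x, (2 ^ (p - 1) * ‖f x‖ ^ p + ((2 : ℝ) ^ (M - n)) ^ (p - 1) * ‖f x‖) =
      2 ^ (p - 1) * (∫ x, ‖f x‖ ^ p) + ((2 : ℝ) ^ (M - n)) ^ (p - 1) * ∫ x, ‖f x‖ := fun n => by
    rw [integral_add (hfp.const_mul _) (hf.int.norm.const_mul _), integral_const_mul, integral_const_mul]
  have hl := ((hlim.mul_const (∫ x, ‖f x‖)).const_add (2 ^ (p - 1) * (∫ x, ‖f x‖ ^ p))).const_mul K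
  have hl2 := (ENNReal.continuous_ofReal.tendsto _).comp hl
  have h := ge_of_tendsto' (x := Filter.atTop (α := ℕ)) hl2 fun n => by
    have := hbase n
    rw [e] at this
    exact this
  refine h.trans_eq ?_
  congr 1; ring

end

/-! ### Telescoping cutoffs -/

/-- A smooth cutoff equal to one on `(-∞, -4]` and to zero on `[-3, ∞)`. -/
noncomputable def cutChi (t : ℝ) : ℝ := Real.smoothTransition (-3 - t)

lemma cutChi_zero {t : ℝ} (h : -3 ≤ t) : cutChi t = 0 :=
  Real.smoothTransition.zero_of_nonpos (by linarith)

lemma cutChi_one {t : ℝ} (h : t ≤ -4) : cutChi t = 1 :=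
  Real.smoothTransition.one_of_one_le (by linarith)

lemma cutChi_nonneg (t : ℝ) : 0 ≤ cutChi t := Real.smoothTransition.nonneg _

lemma cutChi_le_one (t : ℝ) : cutChi t ≤ 1 := Real.smoothTransition.le_one _

lemma contDiff_cutChi : ContDiff ℝ (⊤ : ℕ∞) cutChi :=
  Real.smoothTransition.contDiff.comp (contDiff_const.sub contDiff_id)

/-- The difference of two consecutive dyadic cutoffs. -/
noncomputable def telSym (b : ℤ) (t : ℝ) : ℝ := cutChi t - cutChi ((t + b) / 2)

lemma synSymb_telSym {b : ℤ} (h0 : 0 ≤ b) (h1 : b ≤ 1) : SynSymb (telSym b) := by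
  have h0' : (0 : ℝ) ≤ b := by exact_mod_cast h0
  have h1' : (b : ℝ) ≤ 1 := by exact_mod_cast h1
  have hs : ∀ x, telSym b x ≠ 0 → -9 ≤ x ∧ x ≤ -3 := by
    intro x hx
    by_contra hcon
    apply hx
    rcases lt_or_ge x (-9) with h | h
    · rw [telSym, cutChi_one (by linarith), cutChi_one (by linarith), sub_self]
    · have h2 : -3 < x := by
        by_contra h3; exact hcon ⟨h, not_lt.1 h3⟩
      rw [telSym, cutChi_zero (by linarith), cutChi_zero (by linarith), sub_self]
  refine ⟨⟨?_, ?_⟩, hs⟩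
  · exact contDiff_cutChi.sub (contDiff_cutChi.comp ((contDiff_id.add contDiff_const).div_const 2))
  · refine HasCompactSupport.intro (isCompact_Icc (a := (-9 : ℝ)) (b := -3)) fun x hx => ?_
    by_contra h
    exact hx (hs x h)

/-- The dyadic cutoff approximating the half line below `ξ`. -/
noncomputable def dyCut (ξ : ℝ) (k : ℤ) (ζ : ℝ) : ℝ := cutChi (2 ^ k * ζ - ix k ξ)

lemma telSym_eq (ξ : ℝ) (k : ℤ) (ζ : ℝ) :
    telSym (ix k ξ % 2) (2 ^ k * ζ - ix k ξ) = dyCut ξ k ζ - dyCut ξ (k - 1) ζ := by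
  have h1 : ix (k - 1) ξ = ix k ξ / 2 := by
    have := ix_coarse k 1 ξ
    simpa using this
  have h2 : (ix k ξ : ℝ) = 2 * (ix (k - 1) ξ : ℝ) + (ix k ξ % 2 : ℤ) := by
    rw [h1]; exact_mod_cast (Int.mul_ediv_add_emod (ix k ξ) 2).symm
  have h3 : (2 : ℝ) ^ k = 2 * 2 ^ (k - 1) := by
    rw [← zpow_one_add₀ two_ne_zero]; congr 1; ring
  rw [telSym, dyCut, dyCut]
  congr 2
  rw [h3]
  linarith

lemma sum_Ioc_sub_int {M : Type*} [AddCommGroup M] (F : ℤ → M) {a b : ℤ} (h : a ≤ b) :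
    ∑ k ∈ Finset.Ioc a b, (F k - F (k - 1)) = F b - F a := by
  induction b, h using Int.leInduction with
  | base => simp
  | succ n hn ih =>
    have : Finset.Ioc a (n + 1) = insert (n + 1) (Finset.Ioc a n) := by
      ext x; simp only [Finset.mem_Ioc, Finset.mem_insert]; omega
    rw [this, Finset.sum_insert (by simp), ih]
    simp

lemma tendsto_dyCut_atTop (ξ ζ : ℝ) :
    Filter.Tendsto (fun K : ℕ => dyCut ξ (K : ℤ) ζ) Filter.atTop (nhds ((Iio ξ).indicator 1 ζ)) := by
  refine tendsto_const_nhds.congr' ?_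
  have hp : ∀ K : ℕ, (0 : ℝ) < 2 ^ (K : ℤ) := fun K => by positivity
  rcases lt_or_ge ζ ξ with h | h
  · obtain ⟨n, hn⟩ := pow_unbounded_of_one_lt (5 / (ξ - ζ)) (one_lt_two : (1 : ℝ) < 2)
    filter_upwards [Filter.eventually_ge_atTop n] with K hK
    rw [indicator_of_mem (by exact h), dyCut, cutChi_one]
    · rfl
    have h1 : (5 : ℝ) / (ξ - ζ) < 2 ^ K := hn.trans_le (pow_le_pow_right₀ one_le_two hK)
    rw [div_lt_iff₀ (by linarith)] at h1
    have h2 : ξ * 2 ^ (K : ℤ) < ix K ξ + 1 := Int.lt_floor_add_one _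
    rw [zpow_natCast] at *
    nlinarith
  · filter_upwards with K
    rw [indicator_of_notMem (by simpa using h), dyCut, cutChi_zero]
    have h2 : (ix K ξ : ℝ) ≤ ξ * 2 ^ (K : ℤ) := Int.floor_le _
    have := mul_le_mul_of_nonneg_right h (hp K).le
    linarith

lemma tendsto_dyCut_atBot (ξ ζ : ℝ) :
    Filter.Tendsto (fun K : ℕ => dyCut ξ (-(K : ℤ)) ζ) Filter.atTop (nhds 0) := by
  refine tendsto_const_nhds.congr' ?_
  obtain ⟨n, hn⟩ := pow_unbounded_of_one_lt |ζ - ξ| (one_lt_two : (1 : ℝ) < 2)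
  filter_upwards [Filter.eventually_ge_atTop n] with K hK
  rw [dyCut, cutChi_zero]
  have h1 : |ζ - ξ| < 2 ^ K := hn.trans_le (pow_le_pow_right₀ one_le_two hK)
  have h2 : (ix (-K) ξ : ℝ) ≤ ξ * 2 ^ (-(K : ℤ)) := Int.floor_le _
  have h3 : (2 : ℝ) ^ (-(K : ℤ)) = (2 ^ K)⁻¹ := by rw [zpow_neg, zpow_natCast]
  have h4 : |ζ - ξ| * (2 ^ K)⁻¹ ≤ 1 := by
    rw [mul_inv_le_iff₀ (by positivity), one_mul]; exact h1.le
  have h5 := neg_abs_le (ζ - ξ)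
  have h6 : (0 : ℝ) < (2 ^ K)⁻¹ := by positivity
  rw [h3] at h2 ⊢
  nlinarith

lemma continuous_fourierT {f : ℝ → ℂ} (hf : Integrable f) : Continuous (fourierT f) := by
  unfold fourierT
  refine continuous_of_dominated (bound := fun x => ‖f x‖) (fun ξ => ?_) (fun ξ => ?_) hf.norm ?_
  · exact hf.1.mul (continuous_eChar_right _).aestronglyMeasurable
  · exact Filter.Eventually.of_forall fun x => by simp
  · exact Filter.Eventually.of_forall fun x =>
      continuous_const.mul ((continuous_eChar_left x).comp continuous_neg)

lemma cv_eq_fourier {φ : ℝ → ℝ} (h : Symb φ) {f : ℝ → ℂ} (hf : Integrable f) (x : ℝ) :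
    cv φ f x = ∫ ζ, (φ ζ : ℂ) * fourierT f ζ * eChar ζ x := by
  have hφ : Integrable fun ζ => (φ ζ : ℂ) := h.toS.integrable
  have hint : Integrable (fun p : ℝ × ℝ => (φ p.2 : ℂ) * eChar p.2 (x - p.1) * f p.1)
      (volume.prod volume) := by
    have h1 : Integrable (fun p : ℝ × ℝ => f p.1 * (φ p.2 : ℂ)) (volume.prod volume) := hf.mul_prod hφ
    refine h1.mono ?_ (Filter.Eventually.of_forall fun p => by simp [mul_comm])
    have h2 : Continuous fun p : ℝ × ℝ => eChar p.2 (x - p.1) := continuous_eChar.comp (by fun_prop : Continuous fun p : ℝ × ℝ => (p.2, x - p.1))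
    refine (h1.1.mul h2.aestronglyMeasurable).congr (Filter.Eventually.of_forall fun p => ?_)
    simp only [Pi.mul_apply]; ring
  calc cv φ f x = ∫ y, ∫ ζ, (φ ζ : ℂ) * eChar ζ (x - y) * f y := by
        unfold cv ker
        congr 1; ext y
        rw [← integral_mul_const]
    _ = ∫ ζ, ∫ y, (φ ζ : ℂ) * eChar ζ (x - y) * f y := integral_integral_swap hint
    _ = _ := by
        congr 1; ext ζ
        rw [fourierT, ← integral_const_mul, ← integral_mul_const]
        congr 1; ext y
        rw [sub_eq_add_neg, eChar_add_right, ← eChar_neg_left]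
        ring

lemma tendsto_sum_hs {θ : ℝ → ℝ} (hθ : SynSymb θ) {f : ℝ → ℂ} (hf : BI f) (k n : ℤ) (x : ℝ) :
    Filter.Tendsto (fun M : ℕ => ∑ m ∈ Finset.Icc (-(M : ℤ)) M, hs θ f (k, m, n) x) Filter.atTop
      (nhds (cv (fun ζ => θ (2 ^ k * ζ - n)) f x)) := by
  set s : Tile := (k, 0, n) with hsd
  set g : ℝ → ℂ := fun y => ker (s.sy θ) (x - y) * Fs f s y with hg
  have hgi : Integrable g := cv_integrand_integrable (hθ.symb.sy s) (BI_Fs hf s).int x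
  have h1 : ∀ m : ℤ, hs θ f (k, m, n) x = ∫ y in dy k m, g y := by
    intro m
    rw [← integral_indicator (measurableSet_dy k m), hs, cv]
    congr 1; ext y
    by_cases hy : y ∈ dy k m
    · rw [indicator_of_mem hy, hg, as, indicator_of_mem (by exact hy)]
      rfl
    · rw [indicator_of_notMem hy, as, indicator_of_notMem (by exact hy), mul_zero]
  have hU : ⋃ m : ℤ, dy k m = univ := eq_univ_of_forall fun y => mem_iUnion.2 ⟨ix (-k) y, rfl⟩
  have h2 := hasSum_integral_iUnion (f := g) (μ := volume) (fun m => measurableSet_dy k m)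
    (fun i j hij => disjoint_dy hij) hgi.integrableOn
  rw [hU, setIntegral_univ] at h2
  have h3 : ∫ y, g y = cv (fun ζ => θ (2 ^ k * ζ - n)) f x := by
    have : ∫ y, g y = cv (s.sy θ) (cv (s.sy rho) f) x := rfl
    rw [this, cv_cv (hθ.symb.sy s) (symb_rho.sy s) hf.int]
    congr 1; ext ζ
    by_cases hz : θ (2 ^ k * ζ - n) = 0
    · show θ (2 ^ k * ζ - n) * rho (2 ^ k * ζ - n) = _
      rw [hz, zero_mul]
    · obtain ⟨h4, h5⟩ := hθ.supp _ hz
      show θ (2 ^ k * ζ - n) * rho (2 ^ k * ζ - n) = _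
      rw [rho_eq_one h4 h5, mul_one]
  rw [h3] at h2
  simp only [h1]
  refine h2.comp (Filter.tendsto_atTop_finset_of_monotone ?_ fun m => ⟨m.natAbs, ?_⟩)
  · intro a b hab
    exact Finset.Icc_subset_Icc (by omega) (by omega)
  · simp only [Finset.mem_Icc]; omega

lemma tendsto_sum_cv {f : ℝ → ℂ} (hf : Integrable f) (hf' : Integrable (fourierT f)) (ξ x : ℝ) :
    Filter.Tendsto (fun K : ℕ => ∑ k ∈ Finset.Ioc (-(K : ℤ)) K,
      cv (fun ζ => telSym (ix k ξ % 2) (2 ^ k * ζ - ix k ξ)) f x) Filter.atTop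
      (nhds (fproj (Iio ξ) f x)) := by
  have hS : ∀ k : ℤ, Symb fun ζ => telSym (ix k ξ % 2) (2 ^ k * ζ - ix k ξ) := fun k =>
    (synSymb_telSym (Int.emod_nonneg _ two_ne_zero) (by omega)).symb.tile k (ix k ξ)
  have hi : ∀ k : ℤ, Integrable fun ζ =>
      ((telSym (ix k ξ % 2) (2 ^ k * ζ - ix k ξ) : ℝ) : ℂ) * fourierT f ζ * eChar ζ x := by
    intro k
    have h1 : Integrable fun ζ => ((telSym (ix k ξ % 2) (2 ^ k * ζ - ix k ξ) : ℝ) : ℂ) := (hS k).toS.integrable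
    refine (h1.mul_bdd (c := ∫ y, ‖f y‖) (continuous_fourierT hf).aestronglyMeasurable
      (Filter.Eventually.of_forall fun ζ => ?_)).mul_bdd (c := 1)
      (continuous_eChar_left x).aestronglyMeasurable (Filter.Eventually.of_forall fun ζ => by simp)
    refine (norm_integral_le_integral_norm _).trans_eq ?_
    simp
  have h1 : ∀ K : ℕ, ∑ k ∈ Finset.Ioc (-(K : ℤ)) K,
      cv (fun ζ => telSym (ix k ξ % 2) (2 ^ k * ζ - ix k ξ)) f x =
      ∫ ζ, ((dyCut ξ K ζ - dyCut ξ (-K) ζ : ℝ) : ℂ) * (fourierT f ζ * eChar ζ x) := by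
    intro K
    rw [Finset.sum_congr rfl fun k _ => cv_eq_fourier (hS k) hf x, ← integral_finsetSum _ fun k _ => hi k]
    congr 1; ext ζ
    rw [← sum_Ioc_sub_int (fun k => dyCut ξ k ζ) (by omega : -(K : ℤ) ≤ K), Complex.ofReal_sum,
      Finset.sum_mul]
    refine Finset.sum_congr rfl fun k _ => ?_
    rw [telSym_eq]; ring
  have h2 : fproj (Iio ξ) f x =
      ∫ ζ, (((Iio ξ).indicator 1 ζ - 0 : ℝ) : ℂ) * (fourierT f ζ * eChar ζ x) := by
    rw [fproj, ← integral_indicator measurableSet_Iio]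
    congr 1; ext ζ
    by_cases hz : ζ ∈ Iio ξ <;> simp [hz]
  simp only [h1]
  rw [h2]
  have hcut : ∀ k : ℤ, Continuous (dyCut ξ k) := fun k =>
    contDiff_cutChi.continuous.comp (by fun_prop)
  refine tendsto_integral_of_dominated_convergence (fun ζ => ‖fourierT f ζ‖) (fun K => ?_) hf'.norm
    (fun K => Filter.Eventually.of_forall fun ζ => ?_) (Filter.Eventually.of_forall fun ζ => ?_)
  · exact ((Complex.continuous_ofReal.comp ((hcut _).sub (hcut _))).mul
      ((continuous_fourierT hf).mul (continuous_eChar_left x))).aestronglyMeasurable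
  · rw [norm_mul, norm_mul, norm_eChar, mul_one, Complex.norm_real]
    refine mul_le_of_le_one_left (norm_nonneg _) ?_
    rw [Real.norm_eq_abs, abs_le]
    have a1 := cutChi_nonneg (2 ^ (K : ℤ) * ζ - ix K ξ)
    have a2 := cutChi_le_one (2 ^ (K : ℤ) * ζ - ix K ξ)
    have a3 := cutChi_nonneg (2 ^ (-(K : ℤ)) * ζ - ix (-K) ξ)
    have a4 := cutChi_le_one (2 ^ (-(K : ℤ)) * ζ - ix (-K) ξ)
    simp only [dyCut]
    constructor <;> linarith
  · have h5 := (tendsto_dyCut_atTop ξ ζ).sub (tendsto_dyCut_atBot ξ ζ)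
    exact ((Complex.continuous_ofReal.tendsto _).comp h5).mul_const _

lemma lintegral_rpow_le_of_tendsto {F : ℕ → ℝ → ℂ} {G : ℝ → ℂ} (hF : ∀ n, Measurable (F n))
    (h : ∀ x, Filter.Tendsto (fun n => F n x) Filter.atTop (nhds (G x))) {p : ℝ} {A : ℝ≥0∞}
    (hA : ∀ n, ∫⁻ x, ‖F n x‖ₑ ^ p ≤ A) : ∫⁻ x, ‖G x‖ₑ ^ p ≤ A := by
  have h1 : ∀ x, ‖G x‖ₑ ^ p = Filter.liminf (fun n => ‖F n x‖ₑ ^ p) Filter.atTop := fun x =>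
    ((((ENNReal.continuous_rpow_const (y := p)).comp continuous_enorm).tendsto _).comp
      (h x)).liminf_eq.symm
  simp_rw [h1]
  refine (lintegral_liminf_le fun n => ((hF n).enorm.pow_const p)).trans ?_
  refine (Filter.liminf_le_liminf (Filter.Eventually.of_forall hA)).trans ?_
  rw [Filter.liminf_const]

lemma lintegral_sum_rpow_le {ι : Type*} (s : Finset ι) (F : ι → ℝ → ℂ)
    (hF : ∀ i ∈ s, Measurable (F i)) {p : ℝ} (hp : 1 ≤ p) {A : ℝ≥0∞}
    (hA : ∀ i ∈ s, ∫⁻ x, ‖F i x‖ₑ ^ p ≤ A) :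
    ∫⁻ x, ‖∑ i ∈ s, F i x‖ₑ ^ p ≤ (s.card : ℝ≥0∞) ^ p * A := by
  have hp0 : 0 ≤ p := by linarith
  calc ∫⁻ x, ‖∑ i ∈ s, F i x‖ₑ ^ p
      ≤ ∫⁻ x, (s.card : ℝ≥0∞) ^ (p - 1) * ∑ i ∈ s, ‖F i x‖ₑ ^ p := by
        refine lintegral_mono fun x => ?_
        refine le_trans (ENNReal.rpow_le_rpow (enorm_sum_le s _) hp0) ?_
        exact ENNReal.rpow_sum_le_const_mul_sum_rpow s _ hp
    _ = (s.card : ℝ≥0∞) ^ (p - 1) * ∑ i ∈ s, ∫⁻ x, ‖F i x‖ₑ ^ p := by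
        rw [lintegral_const_mul _ (Finset.measurable_fun_sum _ fun i hi =>
          (hF i hi).enorm.pow_const p), lintegral_finsetSum _ fun i hi =>
          (hF i hi).enorm.pow_const p]
    _ ≤ (s.card : ℝ≥0∞) ^ (p - 1) * (s.card * A) := by
        gcongr
        exact (Finset.sum_le_sum hA).trans (by simp)
    _ = (s.card : ℝ≥0∞) ^ p * A := by
        rcases s.eq_empty_or_nonempty with rfl | hs
        · simp [ENNReal.zero_rpow_of_pos (by linarith : 0 < p)]
        · have h0 : (s.card : ℝ≥0∞) ≠ 0 := by simpa using hs.ne_empty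
          rw [← mul_assoc]
          congr 1
          conv_lhs => rw [← ENNReal.rpow_one (s.card : ℝ≥0∞), ← ENNReal.rpow_mul, one_mul]
          rw [← ENNReal.rpow_add _ _ h0 (ENNReal.natCast_ne_top _)]
          congr 1; ring

/-- The tiles of scale `k ∈ (-K, K]`, position `|m| ≤ M` and frequency index in `Q`. -/
noncomputable def tileBox (K M : ℕ) (Q : Finset ℤ) : Finset Tile :=
  Finset.Ioc (-(K : ℤ)) K ×ˢ (Finset.Icc (-(M : ℤ)) M ×ˢ Q)

/-- The residue class of a tile that fixes its telescoping symbol and separates scales. -/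
def tileClass (s : Tile) : ℤ × ℤ := (s.k % 4, s.n % 2)

/-- All residue classes of tiles. -/
noncomputable def tileClasses : Finset (ℤ × ℤ) := Finset.Ico 0 4 ×ˢ Finset.Ico 0 2

lemma tileClass_mem (s : Tile) : tileClass s ∈ tileClasses := by
  simp only [tileClass, tileClasses, Finset.mem_product, Finset.mem_Ico]
  refine ⟨⟨?_, ?_⟩, ?_, ?_⟩ <;> omega

lemma SEP_filter_tileClass (S : Finset Tile) (c : ℤ × ℤ) : SEP (S.filter fun s => tileClass s = c) := by
  intro s h s' h' hk
  have h1 := (Finset.mem_filter.1 h).2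
  have h2 := (Finset.mem_filter.1 h').2
  have h3 : s.k % 4 = s'.k % 4 := by
    have := congrArg Prod.fst (h1.trans h2.symm)
    exact this
  omega

lemma sum_tileClasses_TS (f : ℝ → ℂ) (N : ℝ → ℝ) (K M : ℕ) (Q : Finset ℤ) (x : ℝ)
    (hQ : ∀ k ∈ Finset.Ioc (-(K : ℤ)) K, ix k (N x) ∈ Q) :
    ∑ c ∈ tileClasses, TS (telSym c.2) f N univ ((tileBox K M Q).filter fun s => tileClass s = c) x =
      ∑ k ∈ Finset.Ioc (-(K : ℤ)) K, ∑ m ∈ Finset.Icc (-(M : ℤ)) M,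
        hs (telSym (ix k (N x) % 2)) f (k, m, ix k (N x)) x := by
  have h1 : ∀ c ∈ tileClasses,
      TS (telSym c.2) f N univ ((tileBox K M Q).filter fun s => tileClass s = c) x =
      ∑ s ∈ (tileBox K M Q).filter fun s => tileClass s = c,
        (vset N univ s).indicator (hs (telSym (s.n % 2)) f s) x := by
    intro c _
    refine Finset.sum_congr rfl fun s h => ?_
    rw [← (Finset.mem_filter.1 h).2]
    rfl
  rw [Finset.sum_congr rfl h1, Finset.sum_fiberwise_of_maps_to fun s _ => tileClass_mem s, tileBox,
    Finset.sum_product]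
  refine Finset.sum_congr rfl fun k hk => ?_
  rw [Finset.sum_product]
  refine Finset.sum_congr rfl fun m _ => ?_
  have h2 := Finset.sum_eq_single_of_mem (s := Q) (f := fun n =>
    (vset N univ (k, m, n)).indicator (hs (telSym (Tile.n (k, m, n) % 2)) f (k, m, n)) x)
    (ix k (N x)) (hQ k hk) fun n _ hn =>
      indicator_of_notMem (fun h => hn h.2.symm) _
  exact h2.trans (indicator_of_mem (s := vset N univ (k, m, ix k (N x))) ⟨mem_univ x, rfl⟩ _)

/-- Linearised Carleson-Hunt bound for finitely valued frequency functions. -/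
theorem exists_carleson_linearised {p : ℝ} (hp : 1 < p) :
    ∃ C : ℝ, 0 < C ∧ ∀ (f : ℝ → ℂ) (N : ℝ → ℝ) (Ξ : Finset ℝ), BI f → Measurable f →
      Integrable (fourierT f) → Measurable N → (∀ x, N x ∈ Ξ) →
      ∫⁻ x, ‖fproj (Iio (N x)) f x‖ₑ ^ p ≤ ENNReal.ofReal (C * ∫ x, ‖f x‖ ^ p) := by
  obtain ⟨C0, hC0, H0⟩ := exists_TS_bound (synSymb_telSym le_rfl zero_le_one) hp
  obtain ⟨C1, hC1, H1⟩ := exists_TS_bound (synSymb_telSym zero_le_one le_rfl) hp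
  have hp0 : 0 < p := by linarith
  refine ⟨8 ^ p * (C0 + C1), by positivity, fun f N Ξ hf hfm hf' hN hΞ => ?_⟩
  have hI : 0 ≤ ∫ x, ‖f x‖ ^ p := integral_nonneg fun x => by positivity
  have hcls : ∀ c ∈ tileClasses, (c.2 = 0 ∨ c.2 = 1) := by
    intro c hc
    have := Finset.mem_Ico.1 (Finset.mem_product.1 hc).2
    omega
  have hsy : ∀ c ∈ tileClasses, SynSymb (telSym c.2) := by
    intro c hc
    rcases hcls c hc with h | h <;> rw [h]
    · exact synSymb_telSym le_rfl zero_le_one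
    · exact synSymb_telSym zero_le_one le_rfl
  have hTS : ∀ c ∈ tileClasses, ∀ S : Finset Tile, SEP S →
      ∫⁻ x, ‖TS (telSym c.2) f N univ S x‖ₑ ^ p ≤
        ENNReal.ofReal ((C0 + C1) * ∫ x, ‖f x‖ ^ p) := by
    intro c hc S hS
    rcases hcls c hc with h | h <;> rw [h]
    · refine (H0 f N S hf hfm hN hS).trans (ENNReal.ofReal_le_ofReal ?_)
      gcongr; linarith
    · refine (H1 f N S hf hfm hN hS).trans (ENNReal.ofReal_le_ofReal ?_)
      gcongr; linarith
  set A : ℝ≥0∞ := ENNReal.ofReal (8 ^ p * (C0 + C1) * ∫ x, ‖f x‖ ^ p) with hAd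
  have hA : ((tileClasses.card : ℕ) : ℝ≥0∞) ^ p * ENNReal.ofReal ((C0 + C1) * ∫ x, ‖f x‖ ^ p) = A := by
    have : tileClasses.card = 8 := by rfl
    rw [hAd, this, mul_assoc, ENNReal.ofReal_mul (p := 8 ^ p) (by positivity),
      ← ENNReal.ofReal_rpow_of_pos (by norm_num : (0 : ℝ) < 8)]
    norm_num
  set Q : ℕ → Finset ℤ := fun K =>
    (Finset.Ioc (-(K : ℤ)) K ×ˢ Ξ).image fun q => ix q.1 q.2 with hQd
  have hQ : ∀ (K : ℕ) x, ∀ k ∈ Finset.Ioc (-(K : ℤ)) K, ix k (N x) ∈ Q K := fun K x k hk =>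
    Finset.mem_image.2 ⟨(k, N x), Finset.mem_product.2 ⟨hk, hΞ x⟩, rfl⟩
  set P : ℕ → ℕ → ℝ → ℂ := fun K M x => ∑ c ∈ tileClasses,
    TS (telSym c.2) f N univ ((tileBox K M (Q K)).filter fun s => tileClass s = c) x with hPd
  have hPm : ∀ K M, Measurable (P K M) := fun K M => Finset.measurable_fun_sum _ fun c hc =>
    measurable_TS (hsy c hc).symb hf hN MeasurableSet.univ _
  have hPA : ∀ K M, ∫⁻ x, ‖P K M x‖ₑ ^ p ≤ A := by
    intro K M
    rw [← hA]
    exact lintegral_sum_rpow_le _ _ (fun c hc =>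
      measurable_TS (hsy c hc).symb hf hN MeasurableSet.univ _) hp.le fun c hc =>
      hTS c hc _ (SEP_filter_tileClass _ c)
  have hlim1 : ∀ K x, Filter.Tendsto (fun M => P K M x) Filter.atTop
      (nhds (∑ k ∈ Finset.Ioc (-(K : ℤ)) K,
        cv (fun ζ => telSym (ix k (N x) % 2) (2 ^ k * ζ - ix k (N x))) f x)) := by
    intro K x
    simp only [hPd, fun M => sum_tileClasses_TS f N K M (Q K) x (hQ K x)]
    exact tendsto_finsetSum _ fun k _ =>
      tendsto_sum_hs (synSymb_telSym (by omega) (by omega)) hf k _ x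
  refine lintegral_rpow_le_of_tendsto (fun K => measurable_of_tendsto_metrizable (hPm K)
    (tendsto_pi_nhds.2 (hlim1 K))) (fun x => tendsto_sum_cv hf.int hf' (N x) x) fun K =>
    lintegral_rpow_le_of_tendsto (hPm K) (hlim1 K) (hPA K)

lemma continuous_fproj {f : ℝ → ℂ} (hf' : Integrable (fourierT f)) (S : Set ℝ) :
    Continuous (fproj S f) := by
  refine continuous_of_dominated (bound := fun ξ => ‖fourierT f ξ‖)
    (fun x => hf'.1.restrict.mul (continuous_eChar_left x).aestronglyMeasurable)
    (fun x => Filter.Eventually.of_forall fun ξ => ?_) hf'.norm.integrableOn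
    (Filter.Eventually.of_forall fun ξ => continuous_const.mul (continuous_eChar_right ξ))
  rw [norm_mul, norm_eChar, mul_one]

lemma exists_argmax {G : ℝ → ℝ → ℂ} (hG : ∀ t, Measurable (G t)) (ξ : ℕ → ℝ) (n : ℕ) :
    ∃ N : ℝ → ℝ, Measurable N ∧ (∀ x, N x ∈ (Finset.range (n + 1)).image ξ) ∧
      Measurable (fun x => G (N x) x) ∧ ∀ i ≤ n, ∀ x, ‖G (ξ i) x‖ₑ ≤ ‖G (N x) x‖ₑ := by
  induction n with
  | zero =>
    refine ⟨fun _ => ξ 0, measurable_const, fun x => by simp, hG _, fun i hi x => ?_⟩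
    rw [Nat.le_zero.1 hi]
  | succ n ih =>
    obtain ⟨N, hN, hr, hm, hle⟩ := ih
    set D : Set ℝ := {x | ‖G (N x) x‖ₑ < ‖G (ξ (n + 1)) x‖ₑ} with hD
    have hDm : MeasurableSet D := measurableSet_lt hm.enorm (hG _).enorm
    classical
    have hval : ∀ x, (G (D.piecewise (fun _ => ξ (n + 1)) N x) x) =
        D.piecewise (G (ξ (n + 1))) (fun x => G (N x) x) x := by
      intro x
      by_cases hx : x ∈ D <;> simp [hx]
    refine ⟨D.piecewise (fun _ => ξ (n + 1)) N, measurable_const.piecewise hDm hN, fun x => ?_, ?_,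
      fun i hi x => ?_⟩
    · by_cases hx : x ∈ D
      · rw [piecewise_eq_of_mem _ _ _ hx]
        exact Finset.mem_image_of_mem _ (by simp)
      · rw [piecewise_eq_of_notMem _ _ _ hx]
        exact Finset.image_subset_image (Finset.range_mono (by omega)) (hr x)
    · simp_rw [hval]
      exact (hG _).piecewise hDm hm
    · rw [hval]
      by_cases hx : x ∈ D
      · rw [piecewise_eq_of_mem _ _ _ hx]
        rcases Nat.le_succ_iff.1 hi with h | h
        · exact (hle i h x).trans (le_of_lt hx)
        · rw [h]
      · rw [piecewise_eq_of_notMem _ _ _ hx]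
        rcases Nat.le_succ_iff.1 hi with h | h
        · exact hle i h x
        · rw [h]; exact not_lt.1 hx

/-- The Carleson-Hunt maximal inequality, for countably many frequencies. -/
theorem exists_carleson {p : ℝ} (hp : 1 < p) :
    ∃ C : ℝ, 0 < C ∧ ∀ (f : ℝ → ℂ) (ξ : ℕ → ℝ), BI f → Measurable f → Integrable (fourierT f) →
      ∫⁻ x, (⨆ i, ‖fproj (Iio (ξ i)) f x‖ₑ) ^ p ≤ ENNReal.ofReal (C * ∫ x, ‖f x‖ ^ p) := by
  obtain ⟨C, hC, H⟩ := exists_carleson_linearised hp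
  refine ⟨C, hC, fun f ξ hf hfm hf' => ?_⟩
  choose N hN hr hm hle using fun n => exists_argmax
    (G := fun t => fproj (Iio t) f) (fun t => (continuous_fproj hf' _).measurable) ξ n
  have hp0 : 0 < p := by linarith
  have h1 : ∀ x, (⨆ i, ‖fproj (Iio (ξ i)) f x‖ₑ) ^ p ≤
      Filter.liminf (fun n => ‖fproj (Iio (N n x)) f x‖ₑ ^ p) Filter.atTop := by
    intro x
    rw [← ENNReal.le_rpow_inv_iff hp0]
    refine iSup_le fun i => ?_
    rw [ENNReal.le_rpow_inv_iff hp0]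
    refine Filter.le_liminf_of_le (by isBoundedDefault) ?_
    filter_upwards [Filter.eventually_ge_atTop i] with n hn
    exact ENNReal.rpow_le_rpow (hle n i hn x) hp0.le
  refine (lintegral_mono h1).trans ((lintegral_liminf_le fun n => (hm n).enorm.pow_const p).trans ?_)
  refine (Filter.liminf_le_liminf (Filter.Eventually.of_forall fun n =>
    H f (N n) _ hf hfm hf' (hN n) (hr n))).trans ?_
  rw [Filter.liminf_const]

lemma integral_fproj_mul {f w : ℝ → ℂ} (hf' : Integrable (fourierT f)) (hw : Integrable w) (A : Set ℝ) :
    ∫ x, fproj A f x * w x = ∫ ξ in A, fourierT f ξ * ∫ x, w x * eChar ξ x := by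
  have hint : Integrable (fun q : ℝ × ℝ => fourierT f q.2 * eChar q.2 q.1 * w q.1)
      (volume.prod (volume.restrict A)) := by
    have h1 : Integrable (fun q : ℝ × ℝ => w q.1 * fourierT f q.2) (volume.prod (volume.restrict A)) :=
      hw.mul_prod hf'.integrableOn
    have h2 : Continuous fun q : ℝ × ℝ => eChar q.2 q.1 :=
      continuous_eChar.comp (by fun_prop : Continuous fun q : ℝ × ℝ => (q.2, q.1))
    refine (h1.mul_bdd (c := 1) h2.aestronglyMeasurable
      (Filter.Eventually.of_forall fun q => by rw [norm_eChar])).congr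
      (Filter.Eventually.of_forall fun q => ?_)
    ring
  calc ∫ x, fproj A f x * w x = ∫ x, ∫ ξ in A, fourierT f ξ * eChar ξ x * w x := by
        congr 1; ext x
        rw [fproj, integral_mul_const]
    _ = ∫ ξ in A, ∫ x, fourierT f ξ * eChar ξ x * w x := integral_integral_swap hint
    _ = _ := by
        congr 1; ext ξ
        rw [← integral_const_mul]
        congr 1; ext x; ring

lemma fourierT_ker {φ : ℝ → ℝ} (h : Symb φ) (t : ℝ) : fourierT (ker φ) t = φ t := by
  rw [fourierT_eq, ker_eq h, ← SchwartzMap.fourier_coe, Symb.invF, FourierTransform.fourier_fourierInv_eq]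
  rfl

lemma fproj_univ (f : SchwartzMap ℝ ℂ) (x : ℝ) : fproj univ f x = f x := by
  rw [fproj, setIntegral_univ, ← fourierInv_eq_eChar, fourierT_eq, ← SchwartzMap.fourier_coe,
    ← SchwartzMap.fourierInv_coe, FourierTransform.fourierInv_fourier_eq]

lemma SchwartzMap.integrable_fourierT (f : SchwartzMap ℝ ℂ) : Integrable (fourierT f) := by
  rw [fourierT_eq, ← SchwartzMap.fourier_coe]
  exact SchwartzMap.integrable _

lemma SchwartzMap.BI (f : SchwartzMap ℝ ℂ) : BI f := by
  obtain ⟨C, _, hC⟩ := schwartz_decay f 0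
  exact ⟨f.integrable, C, fun x => by simpa using hC x⟩

lemma norm_fproj_le {f : ℝ → ℂ} (hf' : Integrable (fourierT f)) (S : Set ℝ) (x : ℝ) :
    ‖fproj S f x‖ ≤ ∫ ξ, ‖fourierT f ξ‖ := by
  refine (norm_integral_le_integral_norm _).trans ?_
  simp only [norm_mul, norm_eChar, mul_one]
  exact setIntegral_le_integral hf'.norm (Filter.Eventually.of_forall fun ξ => norm_nonneg _)

/-! ### Frequency projections and paraproducts -/

/-- A smooth symbol supported in the unit ball. -/
noncomputable def unitBump : ContDiffBump (0 : ℝ) := ⟨1 / 2, 1, by norm_num, by norm_num⟩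

lemma symb_unitBump : Symb unitBump := ⟨unitBump.contDiff, unitBump.hasCompactSupport⟩

lemma ker_unitBump_zero : ker unitBump 0 ≠ 0 := by
  have h : ker unitBump 0 = ((∫ x, unitBump x : ℝ) : ℂ) := by
    rw [ker, ← integral_complex_ofReal]
    congr 1; ext ζ
    rw [eChar]; simp
  rw [h]
  exact_mod_cast (unitBump.integral_pos (μ := volume)).ne'

lemma integral_fproj_mul_fproj_eq_zero {f g : ℝ → ℂ} (hf' : Integrable (fourierT f))
    (hg' : Integrable (fourierT g)) {A B : Set ℝ}
    (hint : Integrable fun x => fproj A f x * fproj B g x) {ζ δ : ℝ} (hδ : 0 < δ)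
    (hsep : ∀ ξ ∈ A, ∀ η ∈ B, δ ≤ |ξ + η + ζ|) :
    ∫ x, fproj A f x * fproj B g x * eChar ζ x = 0 := by
  have hS : ∀ n : ℕ, Symb fun t => unitBump ((n + 1 : ℝ) * t - 0) := fun n =>
    symb_unitBump.scale (by positivity) 0
  have hk : ∀ (n : ℕ) x, ker (fun t => unitBump ((n + 1 : ℝ) * t - 0)) x * (n + 1) =
      ker unitBump (x / (n + 1)) := by
    intro n x
    have h0 : (0 : ℝ) < n + 1 := by positivity
    have h0' : (n + 1 : ℂ) ≠ 0 := by exact_mod_cast h0.ne'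
    rw [ker_scale _ h0]
    have : eChar 0 x = 1 := by simp [eChar]
    simp [this]
    field_simp
  have hlim : Filter.Tendsto (fun n : ℕ => ∫ x, fproj A f x * fproj B g x * eChar ζ x *
      ker unitBump (x / (n + 1))) Filter.atTop
      (nhds (∫ x, fproj A f x * fproj B g x * eChar ζ x * ker unitBump 0)) := by
    refine tendsto_integral_of_dominated_convergence
      (fun x => ‖fproj A f x * fproj B g x‖ * kC unitBump 0) (fun n => ?_) (hint.norm.mul_const _)
      (fun n => Filter.Eventually.of_forall fun x => ?_) (Filter.Eventually.of_forall fun x => ?_)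
    · exact (hint.1.mul (continuous_eChar_right ζ).aestronglyMeasurable).mul
        ((continuous_ker symb_unitBump).comp (by fun_prop)).aestronglyMeasurable
    · rw [norm_mul, norm_mul, norm_eChar, mul_one]
      exact mul_le_mul_of_nonneg_left (ker_bdd symb_unitBump _) (norm_nonneg _)
    · refine Filter.Tendsto.const_mul _ (((continuous_ker symb_unitBump).tendsto _).comp ?_)
      exact Filter.Tendsto.const_div_atTop (Filter.tendsto_atTop_add_const_right _ _
        tendsto_natCast_atTop_atTop) _
  have hzero : ∀ᶠ n : ℕ in Filter.atTop, ∫ x, fproj A f x * fproj B g x * eChar ζ x *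
      ker unitBump (x / (n + 1)) = 0 := by
    obtain ⟨n0, hn0⟩ := exists_nat_one_div_lt hδ
    filter_upwards [Filter.eventually_ge_atTop n0] with n hn
    have hn1 : (1 : ℝ) ≤ (n + 1) * δ := by
      have h1 : (1 : ℝ) ≤ (n0 + 1) * δ := by
        rw [div_lt_iff₀ (by positivity)] at hn0; linarith
      have h2 : (n0 : ℝ) ≤ n := by exact_mod_cast hn
      nlinarith
    set R : ℝ → ℂ := ker (fun t => unitBump ((n + 1 : ℝ) * t - 0)) with hR
    have hRi : Integrable R := integrable_ker (hS n)
    have hw1 : Integrable fun x => R x * eChar ζ x :=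
      hRi.mul_bdd (c := 1) (continuous_eChar_right ζ).aestronglyMeasurable
        (Filter.Eventually.of_forall fun x => by rw [norm_eChar])
    have hw2 : Integrable fun x => fproj B g x * (R x * eChar ζ x) :=
      hw1.bdd_mul (continuous_fproj hg' B).aestronglyMeasurable
        (Filter.Eventually.of_forall (norm_fproj_le hg' B))
    have e1 : ∫ x, fproj A f x * fproj B g x * eChar ζ x * ker unitBump (x / (n + 1)) =
        (n + 1) * ∫ x, fproj A f x * (fproj B g x * (R x * eChar ζ x)) := by
      rw [← integral_const_mul]
      congr 1; ext x
      rw [← hk n x]; ring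
    rw [e1, integral_fproj_mul hf' hw2, setIntegral_eq_zero_of_forall_eq_zero, mul_zero]
    intro ξ hξ
    have hw3 : Integrable fun x => R x * eChar (ζ + ξ) x :=
      hRi.mul_bdd (c := 1) (continuous_eChar_right _).aestronglyMeasurable
        (Filter.Eventually.of_forall fun x => by rw [norm_eChar])
    have e2 : ∫ x, fproj B g x * (R x * eChar ζ x) * eChar ξ x =
        ∫ x, fproj B g x * (R x * eChar (ζ + ξ) x) := by
      congr 1; ext x
      rw [eChar_add_left]; ring
    rw [e2, integral_fproj_mul hg' hw3, setIntegral_eq_zero_of_forall_eq_zero, mul_zero]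
    intro η hη
    have e3 : ∫ x, R x * eChar (ζ + ξ) x * eChar η x = fourierT R (-(ξ + η + ζ)) := by
      rw [fourierT]
      congr 1; ext x
      rw [neg_neg, mul_assoc, ← eChar_add_left]
      congr 2; ring
    rw [e3, hR, fourierT_ker (hS n)]
    have : unitBump ((n + 1 : ℝ) * -(ξ + η + ζ) - 0) = 0 := by
      refine unitBump.zero_of_le_dist ?_
      show (1 : ℝ) ≤ _
      rw [Real.dist_eq, sub_zero, sub_zero, abs_mul, abs_neg, abs_of_pos (by positivity : (0 : ℝ) < n + 1)]
      exact hn1.trans (mul_le_mul_of_nonneg_left (hsep ξ hξ η hη) (by positivity))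
    rw [this]; simp
  have h0 := tendsto_nhds_unique hlim (tendsto_const_nhds.congr' (hzero.mono fun n hn => hn.symm))
  rw [integral_mul_const] at h0
  exact (mul_eq_zero.1 h0).resolve_right ker_unitBump_zero

lemma integral_mul_eq_integral_fproj_mul (k : SchwartzMap ℝ ℂ) {u : ℝ → ℂ} (hu : Integrable u)
    {T : Set ℝ} (hT : MeasurableSet T) (h : ∀ᵐ ζ, ζ ∉ T → ∫ x, u x * eChar ζ x = 0) :
    ∫ x, k x * u x = ∫ x, fproj T k x * u x := by
  have hk := k.integrable_fourierT
  have e : ∫ x, k x * u x = ∫ x, fproj univ k x * u x := by simp_rw [fproj_univ]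
  rw [e, integral_fproj_mul hk hu, integral_fproj_mul hk hu, setIntegral_univ, ← integral_indicator hT]
  refine integral_congr_ae (h.mono fun ζ hζ => ?_)
  by_cases hz : ζ ∈ T
  · simp [hz]
  · simp [hz, hζ hz]

lemma fproj_union {f : ℝ → ℂ} (hf' : Integrable (fourierT f)) {A B : Set ℝ} (hAB : Disjoint A B)
    (hB : MeasurableSet B) (x : ℝ) : fproj (A ∪ B) f x = fproj A f x + fproj B f x := by
  have hi : Integrable fun ξ => fourierT f ξ * eChar ξ x :=
    hf'.mul_bdd (c := 1) (continuous_eChar_left x).aestronglyMeasurable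
      (Filter.Eventually.of_forall fun ξ => by rw [norm_eChar])
  exact setIntegral_union hAB hB hi.integrableOn hi.integrableOn

lemma fproj_congr {A B : Set ℝ} (h : A =ᵐ[volume] B) (f : ℝ → ℂ) (x : ℝ) :
    fproj A f x = fproj B f x := setIntegral_congr_set h

lemma fproj_Ico {f : ℝ → ℂ} (hf' : Integrable (fourierT f)) {s t : ℝ} (hst : s ≤ t) (x : ℝ) :
    fproj (Ico s t) f x = fproj (Iio t) f x - fproj (Iio s) f x := by
  rw [← Iio_union_Ico_eq_Iio hst, fproj_union hf' (by
    rw [disjoint_left]; intro y h1 h2; exact absurd h2.1 (not_le.2 h1)) measurableSet_Ico]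
  ring

lemma fproj_Ico_sum {f : ℝ → ℂ} (hf' : Integrable (fourierT f)) {a : ℕ → ℝ} (ha : Antitone a)
    (j n : ℕ) (x : ℝ) :
    fproj (Ico (a (j + n)) (a j)) f x = ∑ i ∈ Finset.range n, fproj (Ico (a (j + i + 1)) (a (j + i))) f x := by
  induction n with
  | zero => simp [fproj]
  | succ n ih =>
    rw [Finset.sum_range_succ, ← ih, fproj_Ico hf' (ha (by omega)), fproj_Ico hf' (ha (by omega)),
      fproj_Ico hf' (ha (by omega))]
    ring_nf

lemma mem_mink2_Ico {s t u v y : ℝ} (hst : s < t) (huv : u < v) (h1 : s + u ≤ y) (h2 : y < t + v) :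
    -y ∈ mink2 (Ico s t) (Ico u v) := by
  set r := (y - s - u) / ((t - s) + (v - u)) with hr
  have hD : 0 < (t - s) + (v - u) := by linarith
  have hr0 : 0 ≤ r := div_nonneg (by linarith) hD.le
  have hr1 : r < 1 := by rw [hr, div_lt_one hD]; linarith
  have hrD : r * ((t - s) + (v - u)) = y - s - u := div_mul_cancel₀ _ hD.ne'
  refine ⟨s + r * (t - s), ⟨?_, ?_⟩, u + r * (v - u), ⟨?_, ?_⟩, ?_⟩
  · nlinarith
  · nlinarith
  · nlinarith
  · nlinarith
  · simp only; linarith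

/-- Pigeonhole consequence of the finite splitting into disjoint subcollections. -/
lemma add_le_add_of_splitting {a b : ℕ → ℝ} (ha : StrictAnti a) (hb : StrictAnti b) {n : ℕ}
    {σ : ℕ → Fin n} (h : ∀ j k : ℕ, 1 ≤ j → 1 ≤ k → j ≠ k → σ j = σ k → Disjoint (Iab a b j) (Iab a b k))
    {j : ℕ} (hj : 1 ≤ j) : a (j + n) + b 0 ≤ a (j + 1) + b j := by
  obtain ⟨x, y, hxy, hσ⟩ := Fintype.exists_ne_map_eq_of_card_lt
    (fun i : Fin (n + 1) => σ (j + i)) (by simp)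
  wlog hlt : x < y generalizing x y
  · exact this y x hxy.symm hσ.symm (lt_of_le_of_ne (not_lt.1 hlt) hxy.symm)
  have hlt' : (x : ℕ) < y := hlt
  have hyn : (y : ℕ) ≤ n := Nat.lt_succ_iff.1 y.2
  set i := j + (x : ℕ)
  set l := j + (y : ℕ)
  have hil : i < l := by omega
  have hd := h i l (by omega) (by omega) (by omega) hσ
  have key : a l + b 0 ≤ a (i + 1) + b i := by
    by_contra hc
    push Not at hc
    have m1 : -(a (i + 1) + b i) ∈ Iab a b i :=
      mem_mink2_Ico (ha (Nat.lt_succ_self i)) (hb (by omega)) le_rfl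
        (add_lt_add (ha (Nat.lt_succ_self i)) (hb (by omega)))
    have m2 : -(a (i + 1) + b i) ∈ Iab a b l :=
      mem_mink2_Ico (ha (Nat.lt_succ_self l)) (hb (by omega))
        (add_le_add (ha.antitone (by omega)) (hb.antitone (by omega))) hc
    exact disjoint_left.1 hd m1 m2
  exact (add_le_add_left (ha.antitone (by omega)) _).trans
    (key.trans (add_le_add (ha.antitone (by omega)) (hb.antitone (by omega))))

lemma Ioo_mem_componentsOf {a : ℕ → ℝ} (ha : StrictAnti a) (j : ℕ) :
    Ioo (a (j + 1)) (a j) ∈ componentsOf (closure (range a))ᶜ := by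
  have hlt : a (j + 1) < a j := ha (Nat.lt_succ_self j)
  obtain ⟨x, hx⟩ := exists_between hlt
  have hdis : Disjoint (Ioo (a (j + 1)) (a j)) (range a) := by
    rw [disjoint_left]
    rintro y hy ⟨i, rfl⟩
    have h1 := ha.lt_iff_gt.1 hy.1
    have h2 := ha.lt_iff_gt.1 hy.2
    omega
  have hsub : Ioo (a (j + 1)) (a j) ⊆ (closure (range a))ᶜ :=
    (hdis.closure_right isOpen_Ioo).subset_compl_right
  refine ⟨x, hsub hx, Subset.antisymm
    (isPreconnected_Ioo.subset_connectedComponentIn hx hsub) fun y hy => ?_⟩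
  have hord : OrdConnected (connectedComponentIn (closure (range a))ᶜ x) :=
    isPreconnected_connectedComponentIn.ordConnected
  have hxm := mem_connectedComponentIn (hsub hx)
  have hno : ∀ i, a i ∉ connectedComponentIn (closure (range a))ᶜ x := fun i hi =>
    connectedComponentIn_subset _ _ hi (subset_closure (mem_range_self i))
  constructor
  · by_contra hc
    exact hno (j + 1) (hord.out hy hxm ⟨not_lt.1 hc, hx.1.le⟩)
  · by_contra hc
    exact hno j (hord.out hxm hy ⟨hx.2.le, not_lt.1 hc⟩)

lemma IsLPSeq.exists_bound {a : ℕ → ℝ} (ha : StrictAnti a) (hLP : IsLPSeq a) {p : ℝ} (hp : 1 < p) :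
    ∃ C : ℝ, 0 < C ∧ ∀ f : SchwartzMap ℝ ℂ,
      (∫⁻ x, (∑' j, ‖fproj (Ico (a (j + 1)) (a j)) f x‖ₑ ^ 2) ^ (p / 2)) ^ (1 / p) ≤
        ENNReal.ofReal C * eLpNorm f (ENNReal.ofReal p) volume := by
  obtain ⟨_, _, C, hC, h⟩ := hLP.2.2 p hp
  refine ⟨C, hC, fun f => le_trans ?_ (h f).2⟩
  refine ENNReal.rpow_le_rpow (lintegral_mono fun x => ENNReal.rpow_le_rpow ?_ (by positivity))
    (by positivity)
  set φ : ℕ → componentsOf (closure (range a))ᶜ := fun j => ⟨_, Ioo_mem_componentsOf ha j⟩ with hφ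
  have hinj : Function.Injective φ := by
    intro i j hij
    have h1 : Ioo (a (i + 1)) (a i) = Ioo (a (j + 1)) (a j) := congrArg Subtype.val hij
    have h2 := congrArg sSup h1
    rw [csSup_Ioo (ha (Nat.lt_succ_self i)), csSup_Ioo (ha (Nat.lt_succ_self j))] at h2
    exact ha.injective h2
  refine le_trans (le_of_eq ?_) (ENNReal.tsum_comp_le_tsum_of_injective hinj
    fun ω : componentsOf (closure (range a))ᶜ => (‖fproj ω f x‖₊ : ℝ≥0∞) ^ 2)
  congr 1; ext j
  rw [fproj_congr (Ioo_ae_eq_Ico (μ := volume)).symm]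
  rfl

lemma mab_of_mem {a b : ℕ → ℝ} (ha : StrictAnti a) {j : ℕ} {ξ : ℝ}
    (hξ : ξ ∈ Ico (a (j + 2)) (a (j + 1))) (η : ℝ) :
    mab a b ξ η = indC (Ico (b (j + 1)) (b 0)) η := by
  rw [mab, tsum_eq_single j]
  · rw [indC, indicator_of_mem hξ, Pi.one_apply, one_mul]
  · intro i hi
    have : ξ ∉ Ico (a (i + 2)) (a (i + 1)) := by
      intro h
      have h1 := ha.lt_iff_gt.1 (hξ.1.trans_lt h.2)
      have h2 := ha.lt_iff_gt.1 (h.1.trans_lt hξ.2)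
      omega
    rw [indC, indicator_of_notMem this, zero_mul]

lemma mab_of_notMem {a b : ℕ → ℝ} {ξ : ℝ} (hξ : ξ ∉ ⋃ j, Ico (a (j + 2)) (a (j + 1))) (η : ℝ) :
    mab a b ξ η = 0 := by
  have h : ∀ j, indC (Ico (a (j + 2)) (a (j + 1))) ξ * indC (Ico (b (j + 1)) (b 0)) η = 0 := fun j => by
    rw [indC, indicator_of_notMem (fun h => hξ (mem_iUnion.2 ⟨j, h⟩)), zero_mul]
  simp [mab, h]

lemma hasSum_Bm_mab {a b : ℕ → ℝ} (ha : StrictAnti a) {f g : ℝ → ℂ}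
    (hf' : Integrable (fourierT f)) (hg' : Integrable (fourierT g)) (x : ℝ) :
    HasSum (fun j => fproj (Ico (a (j + 2)) (a (j + 1))) f x * fproj (Ico (b (j + 1)) (b 0)) g x)
      (Bm (mab a b) f g x) := by
  set A : ℕ → Set ℝ := fun j => Ico (a (j + 2)) (a (j + 1)) with hA
  set Φ : ℝ → ℂ := fun ξ => ∫ η, mab a b ξ η * fourierT f ξ * fourierT g η * eChar (ξ + η) x with hΦ
  have h1 : ∀ j, ∀ ξ ∈ A j, Φ ξ = fourierT f ξ * eChar ξ x * fproj (Ico (b (j + 1)) (b 0)) g x := by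
    intro j ξ hξ
    rw [fproj, ← integral_indicator measurableSet_Ico, ← integral_const_mul]
    refine integral_congr_ae (Filter.Eventually.of_forall fun η => ?_)
    beta_reduce
    rw [mab_of_mem ha hξ, indC, eChar_add_left]
    by_cases hη : η ∈ Ico (b (j + 1)) (b 0)
    · rw [indicator_of_mem hη, indicator_of_mem hη, Pi.one_apply]; ring
    · rw [indicator_of_notMem hη, indicator_of_notMem hη]; ring
  have h0 : ∀ ξ, ξ ∉ ⋃ j, A j → Φ ξ = 0 := by
    intro ξ hξ
    simp only [hΦ, mab_of_notMem hξ, zero_mul, integral_zero]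
  have hm : ∀ j, MeasurableSet (A j) := fun j => measurableSet_Ico
  have hint : IntegrableOn Φ (⋃ j, A j) := by
    refine Integrable.mono' (g := fun ξ => ‖fourierT f ξ‖ * ∫ ξ, ‖fourierT g ξ‖)
      (hf'.norm.mul_const _).integrableOn ?_ ?_
    · rw [aestronglyMeasurable_iUnion_iff]
      intro j
      have : AEStronglyMeasurable (fun ξ => fourierT f ξ * eChar ξ x * fproj (Ico (b (j + 1)) (b 0)) g x)
          (volume.restrict (A j)) :=
        ((hf'.1.mul (continuous_eChar_left x).aestronglyMeasurable).mul_const _).restrict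
      exact this.congr ((ae_restrict_iff' (hm j)).2
        (Filter.Eventually.of_forall fun ξ hξ => (h1 j ξ hξ).symm))
    · refine Filter.Eventually.of_forall fun ξ => ?_
      by_cases hξ : ξ ∈ ⋃ j, A j
      · obtain ⟨j, hj⟩ := mem_iUnion.1 hξ
        rw [h1 j ξ hj, norm_mul, norm_mul, norm_eChar, mul_one]
        exact mul_le_mul_of_nonneg_left (norm_fproj_le hg' _ x) (norm_nonneg _)
      · rw [h0 ξ hξ, norm_zero]
        exact mul_nonneg (norm_nonneg _) (integral_nonneg fun _ => norm_nonneg _)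
  have hdis : Pairwise (Function.onFun Disjoint A) := by
    intro i j hij
    refine disjoint_left.2 fun ξ hi hj => ?_
    have h1 := ha.lt_iff_gt.1 (hi.1.trans_lt hj.2)
    have h2 := ha.lt_iff_gt.1 (hj.1.trans_lt hi.2)
    omega
  have h2 := hasSum_integral_iUnion hm hdis hint
  rw [setIntegral_eq_integral_of_forall_compl_eq_zero h0] at h2
  have h3 : (fun j => fproj (A j) f x * fproj (Ico (b (j + 1)) (b 0)) g x) =
      fun j => ∫ ξ in A j, Φ ξ := by
    funext j
    rw [setIntegral_congr_fun (hm j) (h1 j), integral_mul_const, fproj]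
  exact h3 ▸ h2

lemma memLp_fproj_Ico (f : SchwartzMap ℝ ℂ) {s t : ℝ} (hst : s ≤ t) {p : ℝ} (hp : 1 < p) :
    MemLp (fproj (Ico s t) f) (ENNReal.ofReal p) := by
  have hp0 : 0 < p := by linarith
  have hf' := f.integrable_fourierT
  have h : ∀ r, MemLp (fproj (Iio r) f) (ENNReal.ofReal p) := by
    intro r
    obtain ⟨C, _, hC⟩ := exists_carleson hp
    refine ⟨(continuous_fproj hf' _).aestronglyMeasurable, ?_⟩
    rw [eLpNorm_lt_top_iff_lintegral_rpow_enorm_lt_top (by simpa using hp0) ENNReal.ofReal_ne_top,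
      ENNReal.toReal_ofReal hp0.le]
    refine lt_of_le_of_lt ?_ ((hC f (fun _ => r) f.BI f.continuous.measurable hf').trans_lt
      ENNReal.ofReal_lt_top)
    exact lintegral_mono fun x => by simp
  exact ((h t).sub (h s)).ae_eq (Filter.Eventually.of_forall fun x => (fproj_Ico hf' hst x).symm)

lemma integrable_fproj_mul_fproj (f g : SchwartzMap ℝ ℂ) {s t u v : ℝ} (hst : s ≤ t) (huv : u ≤ v) :
    Integrable fun x => fproj (Ico s t) f x * fproj (Ico u v) g x := by
  have h1 := memLp_fproj_Ico f hst one_lt_two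
  have h2 := memLp_fproj_Ico g huv one_lt_two
  rw [ENNReal.ofReal_ofNat] at h1 h2
  exact MemLp.integrable_mul h1 h2

lemma BI.lintegral_rpow_ne_top {f : ℝ → ℂ} (hf : BI f) {q : ℝ} (hq : 1 < q) :
    ∫⁻ x, ‖f x‖ₑ ^ q ≠ ⊤ := by
  obtain ⟨A, hA⟩ := hf.bdd
  have hb : ∀ x, ‖f x‖ₑ ^ q ≤ ENNReal.ofReal A ^ (q - 1) * ‖f x‖ₑ := by
    intro x
    by_cases h0 : ‖f x‖ₑ = 0
    · rw [h0, ENNReal.zero_rpow_of_pos (by linarith)]; exact zero_le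
    · have h1 : ‖f x‖ₑ ^ q = ‖f x‖ₑ ^ (q - 1) * ‖f x‖ₑ := by
        conv_rhs => rw [← ENNReal.rpow_one ‖f x‖ₑ, ← ENNReal.rpow_mul, one_mul]
        rw [← ENNReal.rpow_add _ _ h0 enorm_ne_top]
        congr 1; ring
      rw [h1]
      gcongr
      rw [← ofReal_norm]; exact ENNReal.ofReal_le_ofReal (hA x)
  refine ((lintegral_mono hb).trans_lt ?_).ne
  rw [lintegral_const_mul' _ _ (ENNReal.rpow_ne_top_of_nonneg (by linarith) ENNReal.ofReal_ne_top)]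
  exact ENNReal.mul_lt_top (ENNReal.rpow_lt_top_of_nonneg (by linarith) ENNReal.ofReal_ne_top)
    hf.int.2

lemma enorm_integral_mul_le {w V : ℝ → ℂ} (hw : AEStronglyMeasurable w volume)
    (hV : AEStronglyMeasurable V volume) {q p : ℝ} (hqp : q.HolderConjugate p) :
    ‖∫ x, w x * V x‖ₑ ≤ (∫⁻ x, ‖w x‖ₑ ^ p) ^ (1 / p) * (∫⁻ x, ‖V x‖ₑ ^ q) ^ (1 / q) := by
  refine (enorm_integral_le_lintegral_enorm _).trans ?_
  simp_rw [enorm_mul]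
  exact ENNReal.lintegral_mul_le_Lp_mul_Lq volume hqp.symm hw.enorm hV.enorm

/-- Duality: an `L^q` bound follows from bounds on pairings with Schwartz functions. -/
lemma lintegral_rpow_le_of_pairing {V : ℝ → ℂ} (hV : BI V) {q p : ℝ} (hqp : q.HolderConjugate p)
    {D : ℝ≥0∞}
    (hD : ∀ k : SchwartzMap ℝ ℂ, ‖∫ x, k x * V x‖ₑ ≤ D * (∫⁻ x, ‖k x‖ₑ ^ p) ^ (1 / p)) :
    (∫⁻ x, ‖V x‖ₑ ^ q) ^ (1 / q) ≤ D := by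
  rcases eq_or_ne D ⊤ with rfl | hDt
  · exact le_top
  have hq0 := hqp.pos
  have hp0 := hqp.symm.pos
  set X := ∫⁻ x, ‖V x‖ₑ ^ q with hX
  have hXt : X ≠ ⊤ := hV.lintegral_rpow_ne_top hqp.lt
  set h : ℝ → ℂ := fun x => (starRingEnd ℂ) (V x) * ((‖V x‖ ^ (q - 2) : ℝ) : ℂ) with hh
  have hnorm : ∀ x, V x ≠ 0 → ‖h x‖ = ‖V x‖ ^ (q - 1) := by
    intro x hx
    have h0 : 0 < ‖V x‖ := norm_pos_iff.2 hx
    rw [hh, norm_mul, RCLike.norm_conj, Complex.norm_real, Real.norm_of_nonneg (by positivity)]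
    conv_lhs => rw [← Real.rpow_one ‖V x‖, ← Real.rpow_mul h0.le, one_mul]
    rw [← Real.rpow_add h0]
    congr 1; ring
  have hp : ∀ x, ‖h x‖ₑ ^ p = ‖V x‖ₑ ^ q := by
    intro x
    by_cases hx : V x = 0
    · simp [hh, hx, ENNReal.zero_rpow_of_pos hp0, ENNReal.zero_rpow_of_pos hq0]
    · have h0 : 0 < ‖V x‖ := norm_pos_iff.2 hx
      rw [← ofReal_norm, ← ofReal_norm, hnorm x hx, ← ENNReal.ofReal_rpow_of_pos h0, ← ENNReal.rpow_mul,
        hqp.sub_one_mul_conj]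
  have hmul : ∀ x, h x * V x = ((‖V x‖ ^ q : ℝ) : ℂ) := by
    intro x
    by_cases hx : V x = 0
    · simp [hx, Real.zero_rpow hq0.ne']
    · have h0 : 0 < ‖V x‖ := norm_pos_iff.2 hx
      have e : h x * V x = (V x * (starRingEnd ℂ) (V x)) * ((‖V x‖ ^ (q - 2) : ℝ) : ℂ) := by
        rw [hh]; ring
      rw [e, Complex.mul_conj, Complex.normSq_eq_norm_sq, ← Complex.ofReal_mul, ← Real.rpow_natCast,
        ← Real.rpow_add h0]
      congr 2; push_cast; ring
  have hmeas : AEStronglyMeasurable h volume :=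
    (RCLike.continuous_conj.comp_aestronglyMeasurable hV.int.1).mul
      (Complex.continuous_ofReal.comp_aestronglyMeasurable
        (hV.int.1.norm.aemeasurable.pow_const _).aestronglyMeasurable)
  have hXr : ∫⁻ x, ‖h x * V x‖ₑ = X := by
    rw [hX]
    congr 1; ext x
    rw [hmul, ← ofReal_norm, Complex.norm_real, Real.norm_of_nonneg (by positivity),
      ← ENNReal.ofReal_rpow_of_nonneg (norm_nonneg _) hq0.le, ofReal_norm]
  have hint : Integrable fun x => h x * V x := by
    refine ⟨hmeas.mul hV.int.1, ?_⟩
    rw [hasFiniteIntegral_iff_enorm, hXr]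
    exact hXt.lt_top
  have hval : ‖∫ x, h x * V x‖ₑ = X := by
    have e : ∫ x, h x * V x = ((∫ x, ‖h x * V x‖ : ℝ) : ℂ) := by
      rw [← integral_complex_ofReal]
      congr 1; ext x
      rw [hmul, Complex.norm_real, Real.norm_of_nonneg (by positivity)]
    rw [e, ← ofReal_norm, Complex.norm_real, Real.norm_of_nonneg (integral_nonneg fun _ => norm_nonneg _),
      ofReal_integral_norm_eq_lintegral_enorm hint, hXr]
  have hLp : MemLp h (ENNReal.ofReal p) := by
    refine ⟨hmeas, ?_⟩
    rw [eLpNorm_lt_top_iff_lintegral_rpow_enorm_lt_top (by simpa using hp0) ENNReal.ofReal_ne_top,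
      ENNReal.toReal_ofReal hp0.le]
    simp_rw [hp]
    exact hXt.lt_top
  have hlp : ∀ w : ℝ → ℂ, eLpNorm w (ENNReal.ofReal p) volume = (∫⁻ x, ‖w x‖ₑ ^ p) ^ (1 / p) := by
    intro w
    rw [eLpNorm_eq_lintegral_rpow_enorm_toReal (by simpa using hp0) ENNReal.ofReal_ne_top,
      ENNReal.toReal_ofReal hp0.le]
  have hstep : ∀ n : ℕ, X ≤ D * X ^ (1 / p) + ENNReal.ofReal (1 / (n + 1)) * (D + X ^ (1 / q)) := by
    intro n
    have hε : (0 : ℝ) < 1 / (n + 1) := by positivity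
    have h1p : 1 ≤ ENNReal.ofReal p := by
      rw [← ENNReal.ofReal_one]; exact ENNReal.ofReal_le_ofReal hqp.symm.lt.le
    obtain ⟨g, hg1, hg2, hg3⟩ := hLp.exist_eLpNorm_sub_le ENNReal.ofReal_ne_top h1p hε
    set k := hg1.toSchwartzMap hg2
    have hk : ∀ x, k x = g x := fun x => rfl
    have hd : (∫⁻ x, ‖h x - k x‖ₑ ^ p) ^ (1 / p) ≤ ENNReal.ofReal (1 / (n + 1)) := by
      rw [← hlp]; exact hg3
    have hkn : (∫⁻ x, ‖k x‖ₑ ^ p) ^ (1 / p) ≤ X ^ (1 / p) + ENNReal.ofReal (1 / (n + 1)) := by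
      have e1 : eLpNorm (fun x => k x) (ENNReal.ofReal p) volume ≤
          eLpNorm h (ENNReal.ofReal p) volume + eLpNorm (h - g) (ENNReal.ofReal p) volume := by
        have e2 : (fun x => k x) = h - (h - g) := by funext x; simp [hk]
        rw [e2]
        exact eLpNorm_sub_le hmeas (hmeas.sub hg2.continuous.aestronglyMeasurable) h1p
      rw [hlp, hlp h] at e1
      simp_rw [hp] at e1
      exact e1.trans (by gcongr)
    have hsplit : ∫ x, h x * V x = (∫ x, k x * V x) + ∫ x, (h x - k x) * V x := by
      have i1 : Integrable fun x => k x * V x :=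
        (k.BI.mul_int hV.int).congr (Filter.Eventually.of_forall fun x => mul_comm _ _)
      rw [← integral_add i1 ((hint.sub i1).congr (Filter.Eventually.of_forall fun x => by
        simp only [Pi.sub_apply]; ring))]
      congr 1; ext x; ring
    refine hval.symm.le.trans ?_
    rw [hsplit]
    calc _ ≤ D * (X ^ (1 / p) + ENNReal.ofReal (1 / (n + 1))) +
          ENNReal.ofReal (1 / (n + 1)) * X ^ (1 / q) := by
          refine (enorm_add_le _ _).trans (add_le_add ((hD k).trans (by gcongr)) ?_)
          refine (enorm_integral_mul_le (hmeas.sub k.continuous.aestronglyMeasurable) hV.int.1 hqp).trans ?_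
          gcongr
          exact hd
      _ = _ := by ring
  have hlim : Filter.Tendsto (fun n : ℕ => D * X ^ (1 / p) +
      ENNReal.ofReal (1 / (n + 1)) * (D + X ^ (1 / q))) Filter.atTop
      (nhds (D * X ^ (1 / p) + 0 * (D + X ^ (1 / q)))) := by
    refine Filter.Tendsto.const_add _ (ENNReal.Tendsto.mul_const ?_ (Or.inr ?_))
    · rw [← ENNReal.ofReal_zero]
      exact ENNReal.tendsto_ofReal tendsto_one_div_add_atTop_nhds_zero_nat
    · exact ENNReal.add_ne_top.2 ⟨hDt, ENNReal.rpow_ne_top_of_nonneg (by positivity) hXt⟩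
  have hfin : X ≤ D * X ^ (1 / p) := by
    have := ge_of_tendsto' (x := Filter.atTop (α := ℕ)) hlim hstep
    rwa [zero_mul, add_zero] at this
  by_cases hX0 : X = 0
  · rw [hX0, ENNReal.zero_rpow_of_pos (by positivity)]; exact zero_le
  have hY0 : X ^ (1 / p) ≠ 0 := by simp [hX0, hXt]
  have hYt : X ^ (1 / p) ≠ ⊤ := ENNReal.rpow_ne_top_of_nonneg (by positivity) hXt
  rw [← ENNReal.mul_le_mul_iff_left hY0 hYt]
  refine le_of_eq_of_le ?_ hfin
  rw [← ENNReal.rpow_add _ _ hX0 hXt, one_div, one_div, hqp.inv_add_inv_eq_one, ENNReal.rpow_one]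

lemma lintegral_trilinear_le {F G κ : ℕ → ℝ → ℝ≥0∞} (hF : ∀ j, Measurable (F j))
    (hG : ∀ j, Measurable (G j)) (hκ : ∀ j, Measurable (κ j)) {p1 p2 p3 : ℝ} (h1 : 0 < p1) (h2 : 0 < p2)
    (h3 : 0 < p3) (hsum : 1 / p1 + 1 / p2 + 1 / p3 = 1) (J n : ℕ) :
    ∫⁻ x, ∑ j ∈ Finset.range J, ∑ i ∈ Finset.range n, κ (j + 1 + i) x * (F j x * G j x) ≤
      n * ((∫⁻ x, (∑' j, F j x ^ 2) ^ (p1 / 2)) ^ (1 / p1) * (∫⁻ x, (⨆ j, G j x) ^ p2) ^ (1 / p2) *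
        (∫⁻ x, (∑' j, κ j x ^ 2) ^ (p3 / 2)) ^ (1 / p3)) := by
  set SF : ℝ → ℝ≥0∞ := fun x => ∑' j, F j x ^ 2 with hSF
  set SK : ℝ → ℝ≥0∞ := fun x => ∑' j, κ j x ^ 2 with hSK
  set MG : ℝ → ℝ≥0∞ := fun x => ⨆ j, G j x with hMG
  have mF : Measurable SF := Measurable.tsum fun j => (hF j).pow_const 2
  have mK : Measurable SK := Measurable.tsum fun j => (hκ j).pow_const 2
  have mG : Measurable MG := Measurable.iSup hG
  have hpt : ∀ x, ∑ j ∈ Finset.range J, ∑ i ∈ Finset.range n, κ (j + 1 + i) x * (F j x * G j x) ≤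
      n * (SF x ^ (1 / 2 : ℝ) * MG x * SK x ^ (1 / 2 : ℝ)) := by
    intro x
    rw [Finset.sum_comm]
    have hi : ∀ i ∈ Finset.range n, ∑ j ∈ Finset.range J, κ (j + 1 + i) x * (F j x * G j x) ≤
        SF x ^ (1 / 2 : ℝ) * MG x * SK x ^ (1 / 2 : ℝ) := by
      intro i _
      calc ∑ j ∈ Finset.range J, κ (j + 1 + i) x * (F j x * G j x)
          ≤ ∑ j ∈ Finset.range J, κ (j + 1 + i) x * (F j x * MG x) := by
            gcongr with j _
            exact le_iSup (fun j => G j x) j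
        _ = (∑ j ∈ Finset.range J, κ (j + 1 + i) x * F j x) * MG x := by
            rw [Finset.sum_mul]; simp only [mul_assoc]
        _ ≤ ((∑ j ∈ Finset.range J, κ (j + 1 + i) x ^ (2 : ℝ)) ^ (1 / 2 : ℝ) *
            (∑ j ∈ Finset.range J, F j x ^ (2 : ℝ)) ^ (1 / 2 : ℝ)) * MG x := by
            gcongr
            exact ENNReal.inner_le_Lp_mul_Lq _ _ _ Real.HolderConjugate.two_two
        _ ≤ (SK x ^ (1 / 2 : ℝ) * SF x ^ (1 / 2 : ℝ)) * MG x := by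
            simp_rw [ENNReal.rpow_two]
            have e1 : ∑ j ∈ Finset.range J, κ (j + 1 + i) x ^ 2 ≤ SK x :=
              (ENNReal.sum_le_tsum _).trans (ENNReal.tsum_comp_le_tsum_of_injective
                (fun a b h => by
                  have h' : a + 1 + i = b + 1 + i := h
                  omega : Function.Injective fun j => j + 1 + i) fun j => κ j x ^ 2)
            have e2 : ∑ j ∈ Finset.range J, F j x ^ 2 ≤ SF x := ENNReal.sum_le_tsum _
            gcongr
        _ = _ := by ring
    exact (Finset.sum_le_sum hi).trans (by simp)
  refine (lintegral_mono hpt).trans ?_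
  rw [lintegral_const_mul' _ _ (ENNReal.natCast_ne_top n)]
  gcongr
  have hol := ENNReal.lintegral_prod_norm_pow_le (μ := (volume : Measure ℝ)) Finset.univ
    (f := ![fun x => SF x ^ (p1 / 2), fun x => MG x ^ p2, fun x => SK x ^ (p3 / 2)])
    (p := ![1 / p1, 1 / p2, 1 / p3])
    (by
      intro i _
      fin_cases i
      · exact (mF.pow_const _).aemeasurable
      · exact (mG.pow_const _).aemeasurable
      · exact (mK.pow_const _).aemeasurable)
    (by simpa [Fin.sum_univ_three] using hsum)
    (by
      intro i _
      fin_cases i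
      · exact (by positivity : 0 ≤ 1 / p1)
      · exact (by positivity : 0 ≤ 1 / p2)
      · exact (by positivity : 0 ≤ 1 / p3))
  simp only [Fin.prod_univ_three] at hol
  refine le_of_eq_of_le ?_ hol
  congr 1; ext x
  show _ = (SF x ^ (p1 / 2)) ^ (1 / p1) * (MG x ^ p2) ^ (1 / p2) * (SK x ^ (p3 / 2)) ^ (1 / p3)
  rw [← ENNReal.rpow_mul, ← ENNReal.rpow_mul, ← ENNReal.rpow_mul]
  have a1 : p1 / 2 * (1 / p1) = 1 / 2 := by field_simp
  have a2 : p2 * (1 / p2) = 1 := by field_simp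
  have a3 : p3 / 2 * (1 / p3) = 1 / 2 := by field_simp
  rw [a1, a2, a3, ENNReal.rpow_one]

lemma BI_fproj_mul_fproj (f g : SchwartzMap ℝ ℂ) {s t u v : ℝ} (hst : s ≤ t) (huv : u ≤ v) (r : ℝ) :
    BI fun x => fproj (Ico s t) f (-x) * fproj (Ico u v) g (-x) * eChar r x := by
  have hb := norm_fproj_le f.integrable_fourierT (Ico s t)
  have hc := norm_fproj_le g.integrable_fourierT (Ico u v)
  refine BI.mul_char (f := fun x => fproj (Ico s t) f (-x) * fproj (Ico u v) g (-x))
    ⟨?_, (∫ ξ, ‖fourierT f ξ‖) * ∫ ξ, ‖fourierT g ξ‖, fun x => ?_⟩ r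
  · exact (integrable_fproj_mul_fproj f g hst huv).comp_neg
  · rw [norm_mul]
    exact mul_le_mul (hb _) (hc _) (norm_nonneg _) ((norm_nonneg _).trans (hb 0))

/-- Frequency localisation of the pairing of one term of the paraproduct with a test function. -/
lemma integral_mul_paraproduct_term {a b : ℕ → ℝ} (ha : StrictAnti a) (hb : StrictAnti b) {n j : ℕ}
    (h : a (j + 1 + n) + b 0 ≤ a (j + 2) + b (j + 1)) (f g k : SchwartzMap ℝ ℂ) :
    ∫ x, k x * (fproj (Ico (a (j + 2)) (a (j + 1))) f (-x) *
        fproj (Ico (b (j + 1)) (b 0)) g (-x) * eChar (b 0) x) =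
      ∫ x, (∑ i ∈ Finset.range n, fproj (Ico (a (j + 1 + i + 1)) (a (j + 1 + i))) k x) *
        (fproj (Ico (a (j + 2)) (a (j + 1))) f (-x) * fproj (Ico (b (j + 1)) (b 0)) g (-x) *
          eChar (b 0) x) := by
  have hst : a (j + 2) ≤ a (j + 1) := (ha (by omega)).le
  have huv : b (j + 1) ≤ b 0 := (hb (by omega)).le
  have hu := BI_fproj_mul_fproj f g hst huv (b 0)
  rw [integral_mul_eq_integral_fproj_mul k hu.int
    (measurableSet_Ico (a := a (j + 1 + n)) (b := a (j + 1)))]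
  · simp_rw [fproj_Ico_sum k.integrable_fourierT ha.antitone (j + 1) n]
  · have hne : ∀ᵐ ζ : ℝ, ζ ≠ a (j + 1) := by simp [ae_iff]
    filter_upwards [hne] with ζ hζ hnot
    have e : ∫ x, fproj (Ico (a (j + 2)) (a (j + 1))) f (-x) * fproj (Ico (b (j + 1)) (b 0)) g (-x) *
        eChar (b 0) x * eChar ζ x = ∫ x, fproj (Ico (a (j + 2)) (a (j + 1))) f x *
          fproj (Ico (b (j + 1)) (b 0)) g x * eChar (-(b 0) + -ζ) x := by
      rw [← integral_neg_eq_self (fun x => fproj (Ico (a (j + 2)) (a (j + 1))) f x *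
          fproj (Ico (b (j + 1)) (b 0)) g x * eChar (-(b 0) + -ζ) x)]
      refine integral_congr_ae (Filter.Eventually.of_forall fun x => ?_)
      beta_reduce
      rw [eChar_add_left, eChar_neg_left, eChar_neg_left, neg_neg, mul_assoc]
    rw [e]
    rcases lt_or_ge ζ (a (j + 1 + n)) with h1 | h1
    · refine integral_fproj_mul_fproj_eq_zero f.integrable_fourierT g.integrable_fourierT
        (integrable_fproj_mul_fproj f g hst huv) (sub_pos.2 h1) fun ξ hξ η hη => ?_
      refine le_trans ?_ (le_abs_self _)
      linarith [hξ.1, hη.1]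
    · have h2 : a (j + 1) < ζ := by
        rcases lt_or_ge ζ (a (j + 1)) with h3 | h3
        · exact absurd ⟨h1, h3⟩ hnot
        · exact lt_of_le_of_ne h3 hζ.symm
      refine integral_fproj_mul_fproj_eq_zero f.integrable_fourierT g.integrable_fourierT
        (integrable_fproj_mul_fproj f g hst huv) (sub_pos.2 h2) fun ξ hξ η hη => ?_
      refine le_trans ?_ (neg_le_abs _)
      linarith [hξ.2, hη.2]

lemma exists_iSup_fproj_bound {b : ℕ → ℝ} (hb : StrictAnti b) {p : ℝ} (hp : 1 < p) :
    ∃ C : ℝ, 0 < C ∧ ∀ g : SchwartzMap ℝ ℂ,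
      (∫⁻ x, (⨆ j, ‖fproj (Ico (b (j + 1)) (b 0)) g x‖ₑ) ^ p) ^ (1 / p) ≤
        ENNReal.ofReal C * eLpNorm g (ENNReal.ofReal p) volume := by
  obtain ⟨C, hC, H⟩ := exists_carleson hp
  have hp0 : 0 < p := by linarith
  refine ⟨2 * C ^ (1 / p), by positivity, fun g => ?_⟩
  have hg' := g.integrable_fourierT
  have hle : ∀ x, (⨆ j, ‖fproj (Ico (b (j + 1)) (b 0)) g x‖ₑ) ≤
      2 * ⨆ i, ‖fproj (Iio (b i)) g x‖ₑ := by
    intro x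
    refine iSup_le fun j => ?_
    rw [fproj_Ico hg' (hb.antitone (Nat.zero_le _)), two_mul]
    exact enorm_sub_le.trans (add_le_add (le_iSup (fun i => ‖fproj (Iio (b i)) g x‖ₑ) 0)
      (le_iSup (fun i => ‖fproj (Iio (b i)) g x‖ₑ) (j + 1)))
  have hnorm : ∫⁻ x, ‖g x‖ₑ ^ p = ENNReal.ofReal (∫ x, ‖g x‖ ^ p) := by
    rw [integral_eq_lintegral_of_nonneg_ae (Filter.Eventually.of_forall fun x => by positivity)
      (g.continuous.norm.measurable.pow_const p).aestronglyMeasurable, ENNReal.ofReal_toReal]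
    · simp_rw [← ENNReal.ofReal_rpow_of_nonneg (norm_nonneg _) hp0.le, ofReal_norm]
    · simp_rw [← ENNReal.ofReal_rpow_of_nonneg (norm_nonneg _) hp0.le, ofReal_norm]
      exact g.BI.lintegral_rpow_ne_top hp
  rw [eLpNorm_eq_lintegral_rpow_enorm_toReal (by simpa using hp0) ENNReal.ofReal_ne_top,
    ENNReal.toReal_ofReal hp0.le, hnorm]
  calc _ ≤ (∫⁻ x, (2 * ⨆ i, ‖fproj (Iio (b i)) g x‖ₑ) ^ p) ^ (1 / p) := by
        gcongr with x
        exact hle x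
    _ = (2 ^ p * ∫⁻ x, (⨆ i, ‖fproj (Iio (b i)) g x‖ₑ) ^ p) ^ (1 / p) := by
        simp_rw [ENNReal.mul_rpow_of_nonneg _ _ hp0.le]
        rw [lintegral_const_mul' _ _ (by simp)]
    _ ≤ (2 ^ p * ENNReal.ofReal (C * ∫ x, ‖g x‖ ^ p)) ^ (1 / p) := by
        gcongr
        exact H g b g.BI g.continuous.measurable hg'
    _ = _ := by
        rw [ENNReal.mul_rpow_of_nonneg _ _ (by positivity), ← ENNReal.rpow_mul,
          mul_one_div_cancel hp0.ne', ENNReal.rpow_one, ENNReal.ofReal_mul hC.le,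
          ENNReal.mul_rpow_of_nonneg _ _ (by positivity), ENNReal.ofReal_mul zero_le_two,
          ENNReal.ofReal_rpow_of_pos hC, ENNReal.ofReal_ofNat, mul_assoc]

/-- Theorem 1.1 (Hyp 1 and `a` Littlewood--Paley): the paraproduct bound extends to
`1 < p₁, p₂ < ∞`, `2 ≤ p₃ < ∞`. -/
theorem paraproduct_hyp1_LP_bound (a b : ℕ → ℝ) (ha : StrictAnti a) (hb : StrictAnti b)
    (hyp1 : ∃ n : ℕ, ∃ σ : ℕ → Fin n, ∀ j k : ℕ, 1 ≤ j → 1 ≤ k → j ≠ k → σ j = σ k →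
      Disjoint (Iab a b j) (Iab a b k))
    (hLP : IsLPSeq a)
    (p1 p2 p3 : ℝ) (hp1 : 1 < p1) (hp2 : 1 < p2) (hp3 : 2 ≤ p3)
    (hsum : 1 / p1 + 1 / p2 + 1 / p3 = 1) :
    ∃ C : ℝ, 0 < C ∧
      ∀ f g : SchwartzMap ℝ ℂ,
        eLpNorm (Bm (mab a b) (⇑f) (⇑g)) (ENNReal.ofReal (p3 / (p3 - 1))) volume ≤
          ENNReal.ofReal C * eLpNorm (⇑f) (ENNReal.ofReal p1) volume *
            eLpNorm (⇑g) (ENNReal.ofReal p2) volume := by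
  obtain ⟨n, σ, hσ⟩ := hyp1
  have hn : 0 < n := Fin.pos (σ 0)
  have hp3' : 1 < p3 := by linarith
  obtain ⟨C1, hC1, H1⟩ := hLP.exists_bound ha hp1
  obtain ⟨C2, hC2, H2⟩ := exists_iSup_fproj_bound hb hp2
  obtain ⟨C3, hC3, H3⟩ := hLP.exists_bound ha hp3'
  refine ⟨n * C1 * C2 * C3, by positivity, fun f g => ?_⟩
  set q := p3 / (p3 - 1) with hq
  have hqp : q.HolderConjugate p3 := (Real.HolderConjugate.conjExponent hp3').symm
  have hq0 := hqp.pos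
  have hp30 := hqp.symm.pos
  have hf' := f.integrable_fourierT
  have hg' := g.integrable_fourierT
  set F : ℕ → ℝ → ℂ := fun j => fproj (Ico (a (j + 2)) (a (j + 1))) f with hF
  set G : ℕ → ℝ → ℂ := fun j => fproj (Ico (b (j + 1)) (b 0)) g with hG
  set Nf := eLpNorm f (ENNReal.ofReal p1) volume
  set Ng := eLpNorm g (ENNReal.ofReal p2) volume
  have mF : ∀ j, Continuous (F j) := fun j => continuous_fproj hf' _
  have mG : ∀ j, Continuous (G j) := fun j => continuous_fproj hg' _
  have hu : ∀ j, BI fun x => F j (-x) * G j (-x) * eChar (b 0) x := fun j =>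
    BI_fproj_mul_fproj f g (ha (by omega)).le (hb (by omega)).le _
  have LF : (∫⁻ x, (∑' j, ‖F j (-x)‖ₑ ^ 2) ^ (p1 / 2)) ^ (1 / p1) ≤ ENNReal.ofReal C1 * Nf := by
    rw [lintegral_neg_eq_self (fun x => (∑' j, ‖F j x‖ₑ ^ 2) ^ (p1 / 2))]
    refine le_trans ?_ (H1 f)
    refine ENNReal.rpow_le_rpow (lintegral_mono fun x => ENNReal.rpow_le_rpow ?_ (by positivity))
      (by positivity)
    exact ENNReal.tsum_comp_le_tsum_of_injective (add_left_injective 1)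
      fun j => ‖fproj (Ico (a (j + 1)) (a j)) f x‖ₑ ^ 2
  have LG : (∫⁻ x, (⨆ j, ‖G j (-x)‖ₑ) ^ p2) ^ (1 / p2) ≤ ENNReal.ofReal C2 * Ng := by
    rw [lintegral_neg_eq_self (fun x => (⨆ j, ‖G j x‖ₑ) ^ p2)]
    exact H2 g
  have hpair : ∀ (J : ℕ) (k : SchwartzMap ℝ ℂ),
      ‖∫ x, k x * ∑ j ∈ Finset.range J, F j (-x) * G j (-x) * eChar (b 0) x‖ₑ ≤
        ENNReal.ofReal (n * C1 * C2 * C3) * Nf * Ng * (∫⁻ x, ‖k x‖ₑ ^ p3) ^ (1 / p3) := by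
    intro J k
    set κ : ℕ → ℝ → ℂ := fun j => fproj (Ico (a (j + 1)) (a j)) k with hκ
    have mκ : ∀ j, Continuous (κ j) := fun j => continuous_fproj k.integrable_fourierT _
    have e1 : ∫ x, k x * ∑ j ∈ Finset.range J, F j (-x) * G j (-x) * eChar (b 0) x =
        ∑ j ∈ Finset.range J, ∫ x, (∑ i ∈ Finset.range n, κ (j + 1 + i) x) *
          (F j (-x) * G j (-x) * eChar (b 0) x) := by
      simp_rw [Finset.mul_sum]
      rw [integral_finsetSum _ fun j _ => (hu j).mul_int k.BI.int]
      refine Finset.sum_congr rfl fun j _ => ?_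
      exact integral_mul_paraproduct_term ha hb
        (add_le_add_of_splitting ha hb hσ (Nat.le_add_left 1 j)) f g k
    have e2 : ‖∑ j ∈ Finset.range J, ∫ x, (∑ i ∈ Finset.range n, κ (j + 1 + i) x) *
          (F j (-x) * G j (-x) * eChar (b 0) x)‖ₑ ≤
        ∫⁻ x, ∑ j ∈ Finset.range J, ∑ i ∈ Finset.range n,
          ‖κ (j + 1 + i) x‖ₑ * (‖F j (-x)‖ₑ * ‖G j (-x)‖ₑ) := by
      rw [lintegral_finsetSum _ fun j _ => by
        have := mκ; have := mF; have := mG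
        fun_prop]
      refine (enorm_sum_le _ _).trans (Finset.sum_le_sum fun j _ => ?_)
      refine (enorm_integral_le_lintegral_enorm _).trans (lintegral_mono fun x => ?_)
      rw [enorm_mul, enorm_mul, enorm_mul, ← Finset.sum_mul]
      have e3 : ‖eChar (b 0) x‖ₑ = 1 := by rw [← ofReal_norm]; simp
      rw [e3, mul_one]
      gcongr
      exact enorm_sum_le _ _
    have LK := H3 k
    rw [eLpNorm_eq_lintegral_rpow_enorm_toReal (by simpa using hp30) ENNReal.ofReal_ne_top,
      ENNReal.toReal_ofReal hp30.le] at LK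
    rw [e1]
    refine e2.trans ((lintegral_trilinear_le (F := fun j x => ‖F j (-x)‖ₑ)
      (G := fun j x => ‖G j (-x)‖ₑ) (κ := fun j x => ‖κ j x‖ₑ)
      (fun j => ((mF j).comp continuous_neg).enorm.measurable)
      (fun j => ((mG j).comp continuous_neg).enorm.measurable) (fun j => (mκ j).enorm.measurable)
      (by linarith) (by linarith) hp30 hsum J n).trans ?_)
    refine (mul_le_mul' le_rfl (mul_le_mul' (mul_le_mul' LF LG) LK)).trans (le_of_eq ?_)
    rw [ENNReal.ofReal_mul (by positivity), ENNReal.ofReal_mul (by positivity),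
      ENNReal.ofReal_mul (by positivity), ENNReal.ofReal_natCast]
    ring
  have hpart : ∀ J : ℕ, ∫⁻ x, ‖∑ j ∈ Finset.range J, F j x * G j x‖ₑ ^ q ≤
      (ENNReal.ofReal (n * C1 * C2 * C3) * Nf * Ng) ^ q := by
    intro J
    have h1 := lintegral_rpow_le_of_pairing (BI.sum (Finset.range J) fun j _ => hu j) hqp (hpair J)
    rw [one_div, ENNReal.rpow_inv_le_iff hq0] at h1
    rw [← lintegral_neg_eq_self]
    refine le_of_eq_of_le (lintegral_congr fun x => ?_) h1
    rw [← Finset.sum_mul, enorm_mul]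
    have e3 : ‖eChar (b 0) x‖ₑ = 1 := by rw [← ofReal_norm]; simp
    rw [e3, mul_one]
  have hfull : ∫⁻ x, ‖Bm (mab a b) f g x‖ₑ ^ q ≤ (ENNReal.ofReal (n * C1 * C2 * C3) * Nf * Ng) ^ q :=
    lintegral_rpow_le_of_tendsto
      (fun J => (continuous_finsetSum _ fun j _ => (mF j).mul (mG j)).measurable)
      (fun x => (hasSum_Bm_mab ha hf' hg' x).tendsto_sum_nat) hpart
  rw [eLpNorm_eq_lintegral_rpow_enorm_toReal (by simpa using hq0) ENNReal.ofReal_ne_top,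
    ENNReal.toReal_ofReal hq0.le, one_div, ENNReal.rpow_inv_le_iff hq0]
  exact hfull
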